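/- Let k > 2 be a fixed real number, let C > 0 be a fixed constant, let q be a large integer such that every Dirichlet L-function modulo q satisfies the Riemann Hypothesis, let 2 ≤ y ≤ q, and set T = y/(log y)^C. Define f : ℝ_{>0} → ℝ by f(x) = 1 for 0 < x ≤ y − T, f(x) = 1 − (x − y + T)/T for y − T ≤ x ≤ y, and f(x) = 0 for x ≥ y. Then there is a constant C' depending only on k and C such that ∑_{χ ∈ X_q^*} |∑_{n ≤ y} f(n)χ(n)|^{2k} ≤ C' · y^k · φ(q) · (log y)^{(k−1)²}. -/

import Mathlib

open Complex Real Finset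

def dirichletRH {q : ℕ} [NeZero q] (χ : DirichletCharacter ℂ q) : Prop :=
  ∀ s : ℂ, 0 < s.re → s.re < 1 → DirichletCharacter.LFunction χ s = 0 → s.re = 1 / 2
section
open Complex Real Finset

lemma chi_sum_range_q {q : ℕ} [NeZero q] {χ : DirichletCharacter ℂ q} (hχ : χ ≠ 1) :
    ∑ k ∈ Finset.range q, χ (k : ZMod q) = 0 := by
  rw [← MulChar.sum_eq_zero_of_ne_one hχ]
  refine Finset.sum_bij (fun k _ => (k : ZMod q)) (fun _ _ => Finset.mem_univ _) ?_ ?_ (fun _ _ => rfl)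
  · intro a ha b hb h
    rw [Finset.mem_range] at ha hb
    have := (ZMod.natCast_eq_natCast_iff' a b q).1 h
    rwa [Nat.mod_eq_of_lt ha, Nat.mod_eq_of_lt hb] at this
  · intro b _
    exact ⟨b.val, Finset.mem_range.2 (ZMod.val_lt b), by simp⟩

lemma chi_sum_range_le {q : ℕ} [NeZero q] {χ : DirichletCharacter ℂ q} (hχ : χ ≠ 1) (n : ℕ) :
    ‖∑ k ∈ Finset.range n, χ (k : ZMod q)‖ ≤ q := by
  induction n using Nat.strong_induction_on with
  | _ n ih =>
    rcases lt_or_ge n q with h | h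
    · refine (norm_sum_le _ _).trans ?_
      refine (Finset.sum_le_sum (fun i _ => χ.norm_le_one _)).trans ?_
      simpa using h.le
    · obtain ⟨m, rfl⟩ := Nat.exists_eq_add_of_le h
      rw [Finset.sum_range_add, chi_sum_range_q hχ, zero_add]
      have := ih m (by have := NeZero.pos q; omega)
      simpa using this

/-- coefficients supported beyond N -/
noncomputable def tailc {q : ℕ} (χ : DirichletCharacter ℂ q) (N : ℕ) (n : ℕ) : ℂ :=
  if N < n then χ (n : ZMod q) else 0

lemma tailc_sum_le {q : ℕ} [NeZero q] {χ : DirichletCharacter ℂ q} (hχ : χ ≠ 1) (N n : ℕ) :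
    ‖∑ k ∈ Finset.Icc 1 n, tailc χ N k‖ ≤ 2 * q := by
  have h1 : ∑ k ∈ Finset.Icc 1 n, tailc χ N k =
      ∑ k ∈ Finset.range (max n N + 1), χ (k : ZMod q) - ∑ k ∈ Finset.range (N+1), χ (k : ZMod q) := by
    rw [eq_sub_iff_add_eq, add_comm]
    unfold tailc
    rw [← Finset.sum_filter]
    rw [← Finset.sum_union]
    · apply Finset.sum_congr _ (fun _ _ => rfl)
      ext k; simp; omega
    · rw [Finset.disjoint_left]; intro a; simp; omega
  rw [h1]
  refine (norm_sub_le _ _).trans ?_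
  have := chi_sum_range_le hχ (max n N + 1)
  have := chi_sum_range_le hχ (N + 1)
  linarith

noncomputable def tailA {q : ℕ} (χ : DirichletCharacter ℂ q) (N : ℕ) (t : ℝ) : ℂ :=
  ∑ k ∈ Finset.Icc 1 ⌊t⌋₊, tailc χ N k

lemma tailA_zero {q : ℕ} (χ : DirichletCharacter ℂ q) (N : ℕ) (t : ℝ) (ht : t < N + 1) :
    tailA χ N t = 0 := by
  unfold tailA
  apply Finset.sum_eq_zero
  intro k hk
  rw [Finset.mem_Icc] at hk
  unfold tailc
  rw [if_neg]
  intro h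
  have h0 : k ≤ ⌊t⌋₊ := hk.2
  have : (k : ℝ) ≤ t := (Nat.le_floor_iff' (by omega)).1 h0
  have h2 : (N : ℝ) + 1 ≤ k := by exact_mod_cast h
  linarith

lemma tailA_le {q : ℕ} [NeZero q] {χ : DirichletCharacter ℂ q} (hχ : χ ≠ 1) (N : ℕ) (t : ℝ) :
    ‖tailA χ N t‖ ≤ 2 * q := tailc_sum_le hχ N _

lemma tailA_meas {q : ℕ} (χ : DirichletCharacter ℂ q) (N : ℕ) : Measurable (tailA χ N) := by
  have : tailA χ N = (fun n : ℕ => ∑ k ∈ Finset.Icc 1 n, tailc χ N k) ∘ (fun t : ℝ => ⌊t⌋₊) := rfl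
  rw [this]
  exact (measurable_from_nat).comp Nat.measurable_floor

lemma tailA_mellin_diff {q : ℕ} [NeZero q] {χ : DirichletCharacter ℂ q} (hχ : χ ≠ 1) (N : ℕ)
    {s : ℂ} (hs : s.re < 0) : DifferentiableAt ℂ (mellin (tailA χ N)) s := by
  refine mellin_differentiableAt_of_isBigO_rpow (a := 0) (b := s.re - 1) ?_ ?_ hs ?_ (by linarith)
  · apply MeasureTheory.LocallyIntegrable.locallyIntegrableOn
    refine (MeasureTheory.locallyIntegrable_const (2 * (q:ℝ))).mono
      (tailA_meas χ N).aestronglyMeasurable (Filter.Eventually.of_forall fun t => ?_)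
    rw [Real.norm_of_nonneg (by positivity)]
    exact tailA_le hχ N t
  · refine Asymptotics.IsBigO.of_bound (2 * q) (Filter.Eventually.of_forall fun t => ?_)
    simpa using tailA_le hχ N t
  · refine Asymptotics.IsBigO.of_bound 1 ?_
    have : ∀ᶠ t : ℝ in nhdsWithin 0 (Set.Ioi 0), t < 1 :=
      (eventually_lt_nhds (by norm_num)).filter_mono nhdsWithin_le_nhds
    filter_upwards [this] with t ht
    rw [tailA_zero χ N t (by have : (0:ℝ) ≤ N := by positivity
                             linarith)]
    simp

lemma tailA_mellin_eq {q : ℕ} (χ : DirichletCharacter ℂ q) (N : ℕ) (s : ℂ) :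
    mellin (tailA χ N) (-s) = ∫ t in Set.Ioi (1:ℝ), tailA χ N t * (t:ℂ) ^ (-(s+1)) := by
  unfold mellin
  have h : Set.Ioi (0:ℝ) = Set.Ioc 0 1 ∪ Set.Ioi 1 := by
    rw [Set.Ioc_union_Ioi_eq_Ioi]; norm_num
  rw [← MeasureTheory.integral_indicator measurableSet_Ioi, ← MeasureTheory.integral_indicator measurableSet_Ioi]
  apply MeasureTheory.integral_congr_ae
  have h1 : ∀ᵐ t : ℝ, t ≠ 1 := by
    simp [MeasureTheory.ae_iff]
  filter_upwards [h1] with t ht1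
  by_cases h1 : 1 < t
  · rw [Set.indicator_of_mem (show t ∈ Set.Ioi (0:ℝ) by simp; linarith), Set.indicator_of_mem (show t ∈ Set.Ioi (1:ℝ) from h1)]
    rw [smul_eq_mul, mul_comm]; congr 2; ring
  · rw [Set.indicator_of_notMem (show t ∉ Set.Ioi (1:ℝ) from h1)]
    have : t < 1 := lt_of_le_of_ne (not_lt.1 h1) ht1
    rw [Set.indicator_apply]
    rw [tailA_zero χ N t (by have : (0:ℝ) ≤ N := by positivity
                             linarith)]
    simp

lemma L_tail_eq_one_lt {q : ℕ} [NeZero q] {χ : DirichletCharacter ℂ q} (hχ : χ ≠ 1) (N : ℕ)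
    {s : ℂ} (hs : 1 < s.re) :
    DirichletCharacter.LFunction χ s - ∑ n ∈ Finset.Icc 1 N, χ (n : ZMod q) * (n:ℂ)^(-s) =
      s * mellin (tailA χ N) (-s) := by
  rw [DirichletCharacter.LFunction_eq_LSeries χ hs, tailA_mellin_eq]
  have hS1 : LSeriesSummable (fun n => χ (n : ZMod q)) s := ZMod.LSeriesSummable_of_one_lt_re _ hs
  have hfin : LSeriesSummable (fun n => if n ≤ N then χ (n : ZMod q) else 0) s := by
    unfold LSeriesSummable
    apply summable_of_ne_finset_zero (s := Finset.Icc 0 N)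
    intro n hn
    have : ¬ n ≤ N := by simpa using hn
    simp [LSeries.term, this]
  have hdec : tailc χ N = (fun n : ℕ => χ (n : ZMod q)) - (fun n => if n ≤ N then χ (n : ZMod q) else 0) := by
    ext n; unfold tailc; simp only [Pi.sub_apply]
    split_ifs <;> first | omega | simp
  have hS : LSeriesSummable (tailc χ N) s := by rw [hdec]; exact hS1.sub hfin
  have key := LSeries_eq_mul_integral (tailc χ N) (r := 0) le_rfl (by linarith) hS (by
    refine Asymptotics.IsBigO.of_bound (2 * q) (Filter.Eventually.of_forall fun n => ?_)
    simpa using tailc_sum_le hχ N n)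
  have hL : LSeries (tailc χ N) s = LSeries (fun n => χ (n : ZMod q)) s - ∑ n ∈ Finset.Icc 1 N, χ (n : ZMod q) * (n:ℂ)^(-s) := by
    rw [hdec, LSeries_sub hS1 hfin]
    congr 1
    unfold LSeries
    rw [tsum_eq_sum (s := Finset.Icc 1 N)]
    · apply Finset.sum_congr rfl
      intro n hn
      rw [Finset.mem_Icc] at hn
      rw [LSeries.term_of_ne_zero (by omega), if_pos hn.2, Complex.cpow_neg, div_eq_mul_inv]
    · intro n hn
      by_cases h0 : n = 0
      · simp [h0]
      · have : ¬ n ≤ N := by simp at hn; omega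
        simp [LSeries.term, this]
  rw [← hL, key]; rfl

lemma L_tail_eq {q : ℕ} [NeZero q] {χ : DirichletCharacter ℂ q} (hχ : χ ≠ 1) (N : ℕ)
    {s : ℂ} (hs : 0 < s.re) :
    DirichletCharacter.LFunction χ s - ∑ n ∈ Finset.Icc 1 N, χ (n : ZMod q) * (n:ℂ)^(-s) =
      s * mellin (tailA χ N) (-s) := by
  have hU : IsOpen {s : ℂ | 0 < s.re} := isOpen_lt continuous_const Complex.continuous_re
  have hconv : IsPreconnected {s : ℂ | 0 < s.re} := (convex_halfSpace_re_gt 0).isPreconnected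
  have h1 : AnalyticOnNhd ℂ (fun s : ℂ => DirichletCharacter.LFunction χ s - ∑ n ∈ Finset.Icc 1 N, χ (n : ZMod q) * (n:ℂ)^(-s)) {s : ℂ | 0 < s.re} := by
    apply DifferentiableOn.analyticOnNhd _ hU
    apply Differentiable.differentiableOn
    apply (DirichletCharacter.differentiable_LFunction hχ).sub
    refine Differentiable.fun_sum fun n hn => ?_
    rw [Finset.mem_Icc] at hn
    apply Differentiable.const_mul
    intro z
    refine DifferentiableAt.const_cpow (by fun_prop) (Or.inl ?_)
    exact_mod_cast (by omega : n ≠ 0)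
  have h2 : AnalyticOnNhd ℂ (fun s : ℂ => s * mellin (tailA χ N) (-s)) {s : ℂ | 0 < s.re} := by
    apply DifferentiableOn.analyticOnNhd _ hU
    intro z hz
    apply DifferentiableAt.differentiableWithinAt
    apply differentiableAt_id.mul
    exact (tailA_mellin_diff hχ N (by simpa using hz)).comp z differentiableAt_id.neg
  refine AnalyticOnNhd.eqOn_of_preconnected_of_eventuallyEq h1 h2 hconv (z₀ := 2) (by simp) ?_ hs
  have : ∀ᶠ z : ℂ in nhds 2, 1 < z.re :=
    (isOpen_lt continuous_const Complex.continuous_re).mem_nhds (by simp)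
  filter_upwards [this] with z hz
  exact L_tail_eq_one_lt hχ N hz

lemma L_tail_le {q : ℕ} [NeZero q] {χ : DirichletCharacter ℂ q} (hχ : χ ≠ 1) (N : ℕ) (hN : 1 ≤ N)
    {s : ℂ} (hs : 0 < s.re) :
    ‖DirichletCharacter.LFunction χ s - ∑ n ∈ Finset.Icc 1 N, χ (n : ZMod q) * (n:ℂ)^(-s)‖ ≤
      2 * q * ‖s‖ * (N:ℝ)^(-s.re) / s.re := by
  have hN0 : (0:ℝ) < N := by exact_mod_cast hN
  rw [L_tail_eq hχ N hs, norm_mul, tailA_mellin_eq]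
  have h1 : ‖∫ t in Set.Ioi (1:ℝ), tailA χ N t * (t:ℂ) ^ (-(s+1))‖ ≤
      ∫ t in Set.Ioi (N:ℝ), 2 * q * t ^ (-s.re - 1) := by
    have : (∫ t in Set.Ioi (1:ℝ), tailA χ N t * (t:ℂ) ^ (-(s+1))) = ∫ t in Set.Ioi (N:ℝ), tailA χ N t * (t:ℂ) ^ (-(s+1)) := by
      apply MeasureTheory.setIntegral_eq_of_subset_of_forall_sdiff_eq_zero measurableSet_Ioi
      · apply Set.Ioi_subset_Ioi; exact_mod_cast hN
      · intro t ht
        have : t ≤ N := by simpa using ht.2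
        rw [tailA_zero χ N t (by linarith), zero_mul]
    rw [this]
    apply MeasureTheory.norm_integral_le_of_norm_le
    · exact ((integrableOn_Ioi_rpow_of_lt (by linarith) hN0)).const_mul _
    · filter_upwards [MeasureTheory.ae_restrict_mem measurableSet_Ioi] with t ht
      have ht0 : 0 < t := hN0.trans ht
      rw [norm_mul, Complex.norm_cpow_eq_rpow_re_of_pos ht0]
      have : (-(s+1)).re = -s.re - 1 := by simp; ring
      rw [this]
      exact mul_le_mul_of_nonneg_right (tailA_le hχ N t) (by positivity)
  have h2 : ∫ t in Set.Ioi (N:ℝ), 2 * q * t ^ (-s.re - 1) = 2 * q * ((N:ℝ)^(-s.re) / s.re) := by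
    rw [MeasureTheory.integral_const_mul, integral_Ioi_rpow_of_lt (by linarith) hN0]
    congr 1
    rw [show -s.re - 1 + 1 = -s.re by ring, neg_div_neg_eq]
  rw [h2] at h1
  calc _ ≤ ‖s‖ * (2 * q * ((N:ℝ)^(-s.re) / s.re)) := mul_le_mul_of_nonneg_left h1 (norm_nonneg _)
    _ = _ := by ring

lemma L_bound_lin {q : ℕ} [NeZero q] {χ : DirichletCharacter ℂ q} (hχ : χ ≠ 1)
    {s : ℂ} (hs : 0 < s.re) :
    ‖DirichletCharacter.LFunction χ s‖ ≤ 1 + 2 * q * ‖s‖ / s.re := by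
  have h := L_tail_le hχ 1 le_rfl hs
  simp only [Finset.Icc_self, Finset.sum_singleton, Nat.cast_one, map_one, one_mul, Complex.one_cpow, Real.one_rpow, mul_one] at h
  have := norm_sub_norm_le (DirichletCharacter.LFunction χ s) 1
  rw [norm_one] at this
  linarith

lemma sum_inv_sqrt_le (N : ℕ) : ∑ n ∈ Finset.Icc 1 N, (1:ℝ) / √n ≤ 2 * √N := by
  induction N with
  | zero => simp
  | succ n ih =>
    rw [Finset.sum_Icc_succ_top (by omega)]
    have h1 : √((n:ℝ)) ≤ √((n+1:ℕ):ℝ) := Real.sqrt_le_sqrt (by push_cast; linarith)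
    have hpos : 0 < √((n+1:ℕ):ℝ) := Real.sqrt_pos.2 (by positivity)
    have h2 := Real.sq_sqrt (show (0:ℝ) ≤ n by positivity)
    have h3 := Real.sq_sqrt (show (0:ℝ) ≤ ((n+1:ℕ):ℝ) by positivity)
    push_cast at h3
    have : 1 / √((n+1:ℕ):ℝ) ≤ 2 * (√((n+1:ℕ):ℝ) - √(n:ℝ)) := by
      rw [div_le_iff₀ hpos]
      have h0 := Real.sqrt_nonneg (n:ℝ)
      push_cast at *
      nlinarith [sq_nonneg (√((n:ℝ)+1) - √(n:ℝ))]
    linarith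

lemma L_bound_sqrt {q : ℕ} [NeZero q] {χ : DirichletCharacter ℂ q} (hχ : χ ≠ 1)
    {s : ℂ} (hs : 1/2 ≤ s.re) :
    ‖DirichletCharacter.LFunction χ s‖ ≤ 8 * √(q * ‖s‖) := by
  have hq : (1:ℝ) ≤ q := by exact_mod_cast NeZero.pos q
  have hs2 : 1/2 ≤ ‖s‖ := hs.trans ((le_abs_self _).trans (Complex.abs_re_le_norm s))
  set X := (q:ℝ) * ‖s‖ with hX
  have hX2 : 1/2 ≤ X := by nlinarith
  set N := ⌈X⌉₊
  have hN1 : 1 ≤ N := Nat.ceil_pos.2 (by linarith)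
  have hNle : X ≤ N := Nat.le_ceil _
  have hNlt : (N:ℝ) < X + 1 := Nat.ceil_lt_add_one (by linarith)
  have h := L_tail_le hχ N hN1 (by linarith : 0 < s.re)
  have hN0 : (1:ℝ) ≤ N := by exact_mod_cast hN1
  have hrp : ∀ n : ℕ, 1 ≤ n → (n:ℝ)^(-s.re) ≤ 1 / √n := by
    intro n hn
    have hn1 : (1:ℝ) ≤ n := by exact_mod_cast hn
    rw [Real.sqrt_eq_rpow, one_div, ← Real.rpow_neg (by linarith)]
    exact Real.rpow_le_rpow_of_exponent_le hn1 (by linarith)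
  have hsum : ‖∑ n ∈ Finset.Icc 1 N, χ (n : ZMod q) * (n:ℂ)^(-s)‖ ≤ 2 * √N := by
    refine (norm_sum_le _ _).trans (le_trans (Finset.sum_le_sum fun n hn => ?_) (sum_inv_sqrt_le N))
    rw [Finset.mem_Icc] at hn
    rw [norm_mul, Complex.norm_natCast_cpow_of_pos (by omega)]
    calc _ ≤ 1 * (n:ℝ)^(-s).re := mul_le_mul_of_nonneg_right (χ.norm_le_one _) (by positivity)
      _ ≤ _ := by rw [one_mul, Complex.neg_re]; exact hrp n hn.1
  have h1 : 2 * q * ‖s‖ * (N:ℝ)^(-s.re) / s.re ≤ 4 * √X := by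
    have e1 : (N:ℝ)^(-s.re) ≤ 1 / √X := (hrp N hN1).trans
      (one_div_le_one_div_of_le (Real.sqrt_pos.2 (by linarith)) (Real.sqrt_le_sqrt hNle))
    rw [div_le_iff₀ (by linarith)]
    have : 2 * q * ‖s‖ * (N:ℝ)^(-s.re) ≤ 2 * X * (1/√X) := by
      rw [hX, mul_assoc 2]; exact mul_le_mul_of_nonneg_left e1 (by positivity)
    have e2 : 2 * X * (1/√X) = 2 * √X := by
      rw [mul_one_div, mul_div_assoc, Real.div_sqrt]
    nlinarith [Real.sqrt_nonneg X]
  have h2 : √(N:ℝ) ≤ 2 * √X := by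
    have : √(N:ℝ) ≤ √(4 * X) := Real.sqrt_le_sqrt (by linarith)
    rwa [Real.sqrt_mul (by norm_num), show √(4:ℝ) = 2 by rw [show (4:ℝ) = 2^2 by norm_num]; simp] at this
  have := norm_sub_norm_le (DirichletCharacter.LFunction χ s) (∑ n ∈ Finset.Icc 1 N, χ (n : ZMod q) * (n:ℂ)^(-s))
  linarith

end

section
open Complex Real Finset

/-- zero-free case: Borel–Caratheodory for the logarithm. -/
lemma logDeriv_bound_of_ne_zero {f : ℂ → ℂ} (hf : Differentiable ℂ f) {r r2 M m Λ : ℝ}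
    (hr : 0 < r) (hr2 : r < r2) (hm : 0 < m) (hΛ : 0 < Λ)
    (hM : ∀ z ∈ Metric.ball (0:ℂ) r2, ‖f z‖ ≤ M) (h0 : m ≤ ‖f 0‖)
    (hMm : M ≤ m * Real.exp Λ) (hz : ∀ z ∈ Metric.ball (0:ℂ) r2, f z ≠ 0) {z : ℂ} (hzr : ‖z‖ ≤ r) :
    ‖deriv f z / f z‖ ≤ (8 * r2 / (r2 - r)^2) * Λ := by
  have hr20 : 0 < r2 := hr.trans hr2
  have hd : DifferentiableOn ℂ (fun z => deriv f z / f z) (Metric.ball 0 r2) := by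
    intro w hw
    exact ((hf.deriv w).differentiableWithinAt).div (hf w).differentiableWithinAt (hz w hw)
  obtain ⟨g, hg0, hg⟩ := hd.isExactOn_ball.with_val_at 0 0
  have hmem0 : (0:ℂ) ∈ Metric.ball (0:ℂ) r2 := by simpa using hr20
  have hexp : ∀ w ∈ Metric.ball (0:ℂ) r2, f w = f 0 * Complex.exp (g w) := by
    intro w hw
    have hder : ∀ w ∈ Metric.ball (0:ℂ) r2, HasDerivAt (fun w => f w * Complex.exp (- g w)) 0 w := by
      intro w hw
      have h1 := (hf w).hasDerivAt.mul ((hg w hw).fun_neg.cexp)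
      have := hz w hw
      refine h1.congr_deriv ?_
      field_simp
      ring
    have hc := (convex_ball (0:ℂ) r2).is_const_of_fderivWithin_eq_zero (𝕜 := ℂ)
      (f := fun w => f w * Complex.exp (- g w))
      (fun w hw => (hder w hw).differentiableAt.differentiableWithinAt)
      (fun w hw => by
        rw [fderivWithin_of_isOpen Metric.isOpen_ball hw]
        ext
        simp [(hder w hw).deriv]) hw hmem0
    simp only [hg0, neg_zero, Complex.exp_zero, mul_one] at hc
    rw [← hc, mul_assoc, ← Complex.exp_add]; simp
  have hre : ∀ w ∈ Metric.ball (0:ℂ) r2, (g w).re ≤ Λ := by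
    intro w hw
    have h1 := hM w hw
    rw [hexp w hw, norm_mul, Complex.norm_exp] at h1
    have h2 : m * Real.exp (g w).re ≤ m * Real.exp Λ :=
      (mul_le_mul_of_nonneg_right h0 (Real.exp_pos _).le).trans (h1.trans hMm)
    exact Real.exp_le_exp.1 (le_of_mul_le_mul_left h2 hm)
  have hgd : DifferentiableOn ℂ g (Metric.ball 0 r2) := fun w hw => (hg w hw).differentiableAt.differentiableWithinAt
  set δ := (r2 - r)/2 with hδ
  have hδ0 : 0 < δ := by rw [hδ]; linarith
  have hbound : ∀ w : ℂ, ‖w‖ ≤ r + δ → ‖g w‖ ≤ 2 * Λ * r2 / δ := by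
    intro w hw
    have hw2 : ‖w‖ < r2 := by linarith
    have := Complex.borelCaratheodory_zero hΛ hgd hre hr20 (by simpa using hw2) hg0
    refine this.trans ?_
    apply div_le_div₀ (by positivity) _ hδ0 (by linarith)
    exact mul_le_mul_of_nonneg_left hw2.le (by positivity)
  have hsub : Metric.closedBall z δ ⊆ Metric.ball 0 r2 := by
    intro w hw
    have h1 : ‖w - z‖ ≤ δ := by simpa [dist_eq_norm] using hw
    have h2 := norm_le_norm_add_norm_sub' w z
    simp; linarith
  have hcd := Complex.norm_deriv_le_of_forall_mem_sphere_norm_le (f := g) (c := z) hδ0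
    ((hgd.mono hsub).diffContOnCl_ball subset_rfl) (C := 2 * Λ * r2 / δ) (by
      intro w hw
      apply hbound
      have h1 : ‖w - z‖ = δ := by simpa [dist_eq_norm] using hw
      have h2 := norm_le_norm_add_norm_sub' w z
      linarith)
  have hzb : z ∈ Metric.ball (0:ℂ) r2 := by simp; linarith
  rw [(hg z hzb).deriv] at hcd
  refine hcd.trans (le_of_eq ?_)
  rw [hδ]; field_simp [(by linarith : r2 - r ≠ 0)]; ring

lemma blaschke_norm {R : ℝ} {ρ z : ℂ} (hz : ‖z‖ = R) :
    ‖(R:ℂ)^2 - (starRingEnd ℂ) ρ * z‖ = R * ‖z - ρ‖ := by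
  have h1 : (R:ℂ)^2 = z * (starRingEnd ℂ) z := by
    rw [Complex.mul_conj, Complex.normSq_eq_norm_sq, hz]; push_cast; ring
  rw [h1, show z * (starRingEnd ℂ) z - (starRingEnd ℂ) ρ * z = z * (starRingEnd ℂ) (z - ρ) by
    rw [map_sub]; ring, norm_mul, hz, Complex.norm_conj]

lemma blaschke_div {R r r2 : ℝ} (hr : 0 < r) (hr2 : r < r2) (hR : r2 < R)
    {f : ℂ → ℂ} (hf : Differentiable ℂ f) {M m : ℝ} (hm : 0 < m)
    (hM : ∀ z : ℂ, ‖z‖ = R → ‖f z‖ ≤ M) (h0 : m ≤ ‖f 0‖) {ρ : ℂ} (hρ : ‖ρ‖ ≤ r2) (hfρ : f ρ = 0) :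
    ∃ h : ℂ → ℂ, Differentiable ℂ h ∧ (∀ z : ℂ, ‖z‖ = R → ‖h z‖ ≤ M) ∧ m * (R / r2) ≤ ‖h 0‖ ∧
      (∀ z : ℂ, ‖z‖ ≤ r2 → h z = 0 → f z = 0) ∧
      (∀ z : ℂ, ‖z‖ ≤ r → f z ≠ 0 → deriv f z / f z = deriv h z / h z + (z - ρ)⁻¹ +
        (starRingEnd ℂ) ρ / ((R:ℂ)^2 - (starRingEnd ℂ) ρ * z)) := by
  have hr20 : 0 < r2 := hr.trans hr2
  have hR0 : 0 < R := hr20.trans hR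
  have hRC : (R:ℂ) ≠ 0 := by exact_mod_cast hR0.ne'
  have hds : Differentiable ℂ (dslope f ρ) := by
    rw [← differentiableOn_univ, Complex.differentiableOn_dslope Filter.univ_mem]
    exact hf.differentiableOn
  have hfd : ∀ z, f z = (z - ρ) * dslope f ρ z := by
    intro z
    have := sub_smul_dslope f ρ z
    rw [hfρ, sub_zero, smul_eq_mul] at this
    exact this.symm
  have hlin : ∀ z : ℂ, ‖z‖ ≤ r2 → (R:ℂ)^2 - (starRingEnd ℂ) ρ * z ≠ 0 := by
    intro z hz h
    have h1 : ‖(starRingEnd ℂ) ρ * z‖ = R^2 := by rw [← sub_eq_zero.1 h]; simp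
    rw [norm_mul, Complex.norm_conj] at h1
    have : ‖ρ‖ * ‖z‖ ≤ r2 * r2 := mul_le_mul hρ hz (norm_nonneg _) hr20.le
    nlinarith
  refine ⟨fun z => dslope f ρ z * (((R:ℂ)^2 - (starRingEnd ℂ) ρ * z) / R), ?_, ?_, ?_, ?_, ?_⟩
  · exact hds.mul (by fun_prop)
  · intro z hz
    refine le_trans (le_of_eq ?_) (hM z hz)
    rw [hfd z, norm_mul, norm_div, blaschke_norm hz, norm_mul]
    simp only [Complex.norm_real, Real.norm_eq_abs, abs_of_pos hR0]
    field_simp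
  · have hf0 := hfd 0
    have hρ0 : ρ ≠ 0 := by
      rintro rfl
      rw [hfρ, norm_zero] at h0; linarith
    have : ‖dslope f ρ 0‖ = ‖f 0‖ / ‖ρ‖ := by
      rw [hf0, norm_mul, zero_sub, norm_neg]; field_simp
    rw [norm_mul, this]
    simp only [mul_zero, sub_zero]
    have e : ‖(R:ℂ)^2 / R‖ = R := by rw [pow_two, mul_div_assoc, div_self hRC]; simp [abs_of_pos hR0]
    rw [e]
    have : m / r2 ≤ ‖f 0‖ / ‖ρ‖ := div_le_div₀ (norm_nonneg _) h0 (norm_pos_iff.2 hρ0) hρ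
    calc m * (R/r2) = m / r2 * R := by ring
      _ ≤ _ := mul_le_mul_of_nonneg_right this hR0.le
  · intro z hz h
    have h1 : dslope f ρ z = 0 := by
      rcases mul_eq_zero.1 h with h | h
      · exact h
      · exact absurd h (div_ne_zero (hlin z hz) hRC)
    rw [hfd z, h1, mul_zero]
  · intro z hz hfz
    have hl := hlin z (by linarith)
    have hne : z - ρ ≠ 0 := fun h => hfz (by rw [hfd z, h, zero_mul])
    have hdne : dslope f ρ z ≠ 0 := fun h => hfz (by rw [hfd z, h, mul_zero])
    have hf' : deriv f z = dslope f ρ z + (z - ρ) * deriv (dslope f ρ) z := by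
      have : f = fun z => (z - ρ) * dslope f ρ z := funext hfd
      have h2 : HasDerivAt (fun z => (z - ρ) * dslope f ρ z) (1 * dslope f ρ z + (z - ρ) * deriv (dslope f ρ) z) z :=
        ((hasDerivAt_id z).sub_const ρ).mul (hds z).hasDerivAt
      rw [one_mul] at h2
      conv_lhs => rw [this]
      exact h2.deriv
    have hh' : deriv (fun z => dslope f ρ z * (((R:ℂ)^2 - (starRingEnd ℂ) ρ * z) / R)) z =
        deriv (dslope f ρ) z * (((R:ℂ)^2 - (starRingEnd ℂ) ρ * z) / R) + dslope f ρ z * (-(starRingEnd ℂ) ρ / R) := by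
      have h3 : HasDerivAt (fun z => (((R:ℂ)^2 - (starRingEnd ℂ) ρ * z) / R)) (-(starRingEnd ℂ) ρ / R) z := by
        have := (((hasDerivAt_id z).const_mul ((starRingEnd ℂ) ρ)).const_sub ((R:ℂ)^2)).div_const (R:ℂ)
        simpa using this
      exact ((hds z).hasDerivAt.mul h3).deriv
    beta_reduce
    rw [hf', hh', hfd z]
    generalize (R:ℂ)^2 - (starRingEnd ℂ) ρ * z = w at *
    field_simp
    ring

lemma local_logDeriv {R r r2 b : ℝ} (hr : 0 < r) (hr2 : r < r2) (hR : r2 < R) (n : ℕ) :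
    ∀ (f : ℂ → ℂ) (_ : Differentiable ℂ f) (M m : ℝ) (_ : 0 < m)
      (_ : ∀ z : ℂ, ‖z‖ = R → ‖f z‖ ≤ M) (_ : m ≤ ‖f 0‖)
      (_ : M ≤ m * (R / r2)^n) (_ : ∀ z : ℂ, ‖z‖ ≤ r2 → f z = 0 → z.re ≤ -b)
      (z : ℂ) (_ : ‖z‖ ≤ r) (_ : -b < z.re),
      -((8 * r2 / (r2 - r)^2 * Real.log (R/r2) + r2 / (R^2 - r2 * r)) * (n+1)) ≤ (deriv f z / f z).re ∧
      ‖deriv f z / f z‖ ≤ ((8 * r2 / (r2 - r)^2 * Real.log (R/r2) + r2 / (R^2 - r2 * r)) * (n+1))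
        + n / (z.re + b) := by
  have hr20 : 0 < r2 := hr.trans hr2
  have hR0 : 0 < R := hr20.trans hR
  have hlog : 0 < Real.log (R/r2) := Real.log_pos (by rw [lt_div_iff₀ hr20]; linarith)
  have hden : 0 < R^2 - r2 * r := by nlinarith
  set c0 := 8 * r2 / (r2 - r)^2 * Real.log (R/r2) with hc0
  set c1 := r2 / (R^2 - r2 * r) with hc1
  have hc00 : 0 < c0 := by
    have : 0 < r2 - r := by linarith
    positivity
  have hc10 : 0 < c1 := by positivity
  have hmax : ∀ (f : ℂ → ℂ) (_ : Differentiable ℂ f) (M : ℝ) (_ : ∀ z : ℂ, ‖z‖ = R → ‖f z‖ ≤ M) (z : ℂ),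
      ‖z‖ ≤ R → ‖f z‖ ≤ M := by
    intro f hf M hM z hz
    refine Complex.norm_le_of_forall_mem_frontier_norm_le (U := Metric.ball 0 R) Metric.isBounded_ball
      hf.diffContOnCl ?_ ?_
    · intro w hw
      rw [frontier_ball _ hR0.ne'] at hw
      exact hM w (by simpa using hw)
    · rw [closure_ball _ hR0.ne']; simpa using hz
  have hnz : ∀ (n : ℕ) (f : ℂ → ℂ) (_ : Differentiable ℂ f) (M m : ℝ) (_ : 0 < m)
      (_ : ∀ z : ℂ, ‖z‖ = R → ‖f z‖ ≤ M) (_ : m ≤ ‖f 0‖)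
      (_ : M ≤ m * (R / r2)^n) (_ : ∀ z : ℂ, ‖z‖ ≤ r2 → f z ≠ 0) (z : ℂ) (_ : ‖z‖ ≤ r),
      ‖deriv f z / f z‖ ≤ c0 * (n+1) := by
    intro n f hf M m hm hM h0 hMm hz z hzr
    have := logDeriv_bound_of_ne_zero hf (Λ := Real.log (R/r2) * (n+1)) hr hr2 hm (by positivity)
      (M := M) (fun w hw => hmax f hf M hM w (by
        have : ‖w‖ < r2 := by simpa using hw
        linarith)) h0 (by
        refine hMm.trans (mul_le_mul_of_nonneg_left ?_ hm.le)
        rw [Real.exp_mul, Real.exp_log (by positivity)]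
        rw [show ((n:ℝ)+1) = ((n+1:ℕ):ℝ) by push_cast; ring, Real.rpow_natCast]
        exact pow_le_pow_right₀ (by rw [le_div_iff₀ hr20]; linarith) (by omega)) (fun w hw => hz w (by
          have : ‖w‖ < r2 := by simpa using hw
          linarith)) hzr
    rw [hc0]; linarith
  induction n with
  | zero =>
    intro f hf M m hm hM h0 hMm hz z hzr hzb
    have hno : ∀ z : ℂ, ‖z‖ ≤ r2 → f z ≠ 0 := by
      intro ρ hρ hfρ
      obtain ⟨h, hd, hhM, hh0, -, -⟩ := blaschke_div hr hr2 hR hf hm hM h0 hρ hfρ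
      have h1 := hmax h hd M hhM 0 (by simpa using hR0.le)
      have h2 : m * 1 < m * (R/r2) := mul_lt_mul_of_pos_left (by rw [lt_div_iff₀ hr20]; linarith) hm
      simp at hMm
      linarith
    have := hnz 0 f hf M m hm hM h0 hMm hno z hzr
    have h2 := Complex.abs_re_le_norm (deriv f z / f z)
    have h3 := (abs_le.1 h2).1
    have e : (c0 + c1) * (((0:ℕ):ℝ) + 1) = c0 * (((0:ℕ):ℝ) + 1) + c1 := by push_cast; ring
    rw [e]
    constructor
    · linarith
    · simp only [Nat.cast_zero, zero_div, add_zero] at *; linarith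
  | succ n ih =>
    intro f hf M m hm hM h0 hMm hz z hzr hzb
    by_cases hno : ∀ z : ℂ, ‖z‖ ≤ r2 → f z ≠ 0
    · have := hnz (n+1) f hf M m hm hM h0 hMm hno z hzr
      have h2 := Complex.abs_re_le_norm (deriv f z / f z)
      have h3 := (abs_le.1 h2).1
      have e : (c0 + c1) * (((n+1:ℕ):ℝ) + 1) = c0 * (((n+1:ℕ):ℝ) + 1) + c1 * (((n+1:ℕ):ℝ) + 1) := by ring
      have h4 : 0 ≤ c1 * (((n+1:ℕ):ℝ) + 1) := by positivity
      have h5 : 0 ≤ ((n+1:ℕ):ℝ) / (z.re + b) := div_nonneg (by positivity) (by linarith)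
      rw [e]
      constructor <;> linarith
    · push Not at hno
      obtain ⟨ρ, hρ, hfρ⟩ := hno
      obtain ⟨h, hd, hhM, hh0, hhz, hhl⟩ := blaschke_div hr hr2 hR hf hm hM h0 hρ hfρ
      have hρb := hz ρ hρ hfρ
      have hfz : f z ≠ 0 := fun h => by
        have := hz z (by linarith) h
        linarith
      obtain ⟨ih1, ih2⟩ := ih h hd M (m * (R/r2)) (by positivity) hhM hh0
        (hMm.trans (le_of_eq (by rw [pow_succ]; ring))) (fun w hw hw0 => hz w hw (hhz w hw hw0)) z hzr hzb
      have hl := hhl z hzr hfz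
      have hsub : 0 < (z - ρ).re := by simp; linarith
      have h1 : 0 ≤ ((z - ρ)⁻¹).re := by
        rw [Complex.inv_re]; exact div_nonneg hsub.le (Complex.normSq_nonneg _)
      have h2 : ‖(z-ρ)⁻¹‖ ≤ 1 / (z.re + b) := by
        rw [norm_inv, ← one_div]
        apply one_div_le_one_div_of_le (by linarith)
        refine le_trans ?_ ((le_abs_self _).trans (Complex.abs_re_le_norm _))
        simp; linarith
      set E := (starRingEnd ℂ) ρ / ((R:ℂ)^2 - (starRingEnd ℂ) ρ * z) with hE
      have h3 : ‖E‖ ≤ c1 := by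
        rw [hE, norm_div, Complex.norm_conj, hc1]
        apply div_le_div₀ hr20.le hρ hden
        have e1 : ‖(R:ℂ)^2‖ = R^2 := by simp
        have e2 : ‖(starRingEnd ℂ) ρ * z‖ ≤ r2 * r := by
          rw [norm_mul, Complex.norm_conj]
          exact mul_le_mul hρ hzr (norm_nonneg _) hr20.le
        have := norm_sub_norm_le ((R:ℂ)^2) ((starRingEnd ℂ) ρ * z)
        linarith
      have h4 := (abs_le.1 (Complex.abs_re_le_norm E)).1
      rw [hl]
      have e : (c0 + c1) * (((n+1:ℕ):ℝ) + 1) = (c0+c1) * ((n:ℝ) + 1) + c0 + c1 := by push_cast; ring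
      have e3 : ((n+1:ℕ):ℝ) / (z.re + b) = n / (z.re + b) + 1 / (z.re+b) := by push_cast; ring
      rw [e, e3]
      constructor
      · simp only [Complex.add_re]; linarith
      · have n1 := norm_add_le (deriv h z / h z + (z-ρ)⁻¹) (E)
        have n2 := norm_add_le (deriv h z / h z) ((z-ρ)⁻¹)
        linarith

-- Application to L-functions

lemma LSeries_norm_le_of {f : ℕ → ℂ} {g : ℕ → ℝ} (hfg : ∀ n, ‖f n‖ ≤ g n)
    (hg : Summable fun n : ℕ => g n * (n:ℝ)^(-(3/2):ℝ)) {s : ℂ} (hs : 3/2 ≤ s.re) :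
    ‖LSeries f s‖ ≤ ∑' n : ℕ, g n * (n:ℝ)^(-(3/2):ℝ) := by
  apply tsum_of_norm_bounded hg.hasSum
  intro n
  have hg0 : 0 ≤ g n := (norm_nonneg _).trans (hfg n)
  rcases eq_or_ne n 0 with rfl | hn
  · simp only [LSeries.term_zero, norm_zero]
    positivity
  rw [LSeries.term_of_ne_zero hn, norm_div, Complex.norm_natCast_cpow_of_pos (by omega),
    div_eq_mul_inv, ← Real.rpow_neg (by positivity)]
  apply mul_le_mul (hfg n) _ (by positivity) hg0
  apply Real.rpow_le_rpow_of_exponent_le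
  · exact_mod_cast Nat.one_le_iff_ne_zero.2 hn
  · linarith

noncomputable def Z32 : ℝ := ∑' n : ℕ, 1 * (n:ℝ)^(-(3/2):ℝ)
noncomputable def V32 : ℝ := ∑' n : ℕ, ArithmeticFunction.vonMangoldt n * (n:ℝ)^(-(3/2):ℝ)

lemma V32_summable : Summable fun n : ℕ => ArithmeticFunction.vonMangoldt n * (n:ℝ)^(-(3/2):ℝ) := by
  have h := (ArithmeticFunction.LSeriesSummable_vonMangoldt (s := 3/2) (by norm_num)).norm
  refine h.congr fun n => ?_
  rcases eq_or_ne n 0 with rfl | hn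
  · simp
  · rw [LSeries.term_of_ne_zero hn, norm_div, Complex.norm_natCast_cpow_of_pos (by omega), Complex.norm_real,
      Real.norm_of_nonneg ArithmeticFunction.vonMangoldt_nonneg, div_eq_mul_inv, ← Real.rpow_neg (by positivity)]
    norm_num

lemma Z32_summable : Summable fun n : ℕ => (1:ℝ) * (n:ℝ)^(-(3/2):ℝ) := by
  simp only [one_mul]
  exact Real.summable_nat_rpow.2 (by norm_num)

lemma one_le_Z32 : 1 ≤ Z32 := by
  have := Z32_summable.le_tsum 1 (fun n _ => by positivity)
  simpa [Z32] using this

lemma V32_nonneg : 0 ≤ V32 := tsum_nonneg fun n => mul_nonneg ArithmeticFunction.vonMangoldt_nonneg (by positivity)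

lemma L_lower {q : ℕ} [NeZero q] (χ : DirichletCharacter ℂ q) {s : ℂ} (hs : 3/2 ≤ s.re) :
    1 / Z32 ≤ ‖DirichletCharacter.LFunction χ s‖ := by
  have h1 := DirichletCharacter.LSeries.mul_mu_eq_one χ (s := s) (by linarith)
  rw [← DirichletCharacter.LFunction_eq_LSeries χ (by linarith)] at h1
  have h2 := congrArg norm h1
  rw [norm_mul, norm_one] at h2
  have h3 := LSeries_norm_le_of (f := ((fun n : ℕ => χ (n : ZMod q)) * fun n : ℕ => ((ArithmeticFunction.moebius n : ℤ) : ℂ)))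
    (g := fun _ => 1) (by
    intro n
    simp only [Pi.mul_apply, norm_mul]
    have a1 := χ.norm_le_one (n : ZMod q)
    have a2 : ‖((ArithmeticFunction.moebius n : ℤ) : ℂ)‖ ≤ 1 := by
      rw [Complex.norm_intCast]
      exact_mod_cast ArithmeticFunction.abs_moebius_le_one
    exact mul_le_one₀ a1 (norm_nonneg _) a2) Z32_summable hs
  rw [div_le_iff₀ (by linarith [one_le_Z32])]
  calc (1:ℝ) = _ := h2.symm
    _ ≤ _ := mul_le_mul_of_nonneg_left h3 (norm_nonneg _)

lemma LSeries_vM {q : ℕ} [NeZero q] (χ : DirichletCharacter ℂ q) {s : ℂ} (hs : 1 < s.re) :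
    -(deriv (DirichletCharacter.LFunction χ) s / DirichletCharacter.LFunction χ s) =
    LSeries ((fun n : ℕ => χ (n : ZMod q)) * fun n : ℕ => (ArithmeticFunction.vonMangoldt n : ℂ)) s := by
  rw [DirichletCharacter.LSeries_twist_vonMangoldt_eq χ hs, DirichletCharacter.LFunction_eq_LSeries χ hs,
    DirichletCharacter.deriv_LFunction_eq_deriv_LSeries χ hs, neg_div]

lemma LD_right {q : ℕ} [NeZero q] (χ : DirichletCharacter ℂ q) {s : ℂ} (hs : 3/2 ≤ s.re) :
    ‖deriv (DirichletCharacter.LFunction χ) s / DirichletCharacter.LFunction χ s‖ ≤ V32 := by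
  rw [← norm_neg, LSeries_vM χ (by linarith)]
  refine LSeries_norm_le_of (fun n => ?_) V32_summable hs
  simp only [Pi.mul_apply, norm_mul, Complex.norm_real, Real.norm_of_nonneg ArithmeticFunction.vonMangoldt_nonneg]
  exact mul_le_of_le_one_left ArithmeticFunction.vonMangoldt_nonneg (χ.norm_le_one _)

lemma L_zero_re {q : ℕ} [NeZero q] {χ : DirichletCharacter ℂ q} (hχ : χ ≠ 1) (hRH : dirichletRH χ)
    {s : ℂ} (hs : 0 < s.re) (h : DirichletCharacter.LFunction χ s = 0) : s.re = 1/2 := by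
  rcases lt_or_ge s.re 1 with h1 | h1
  · exact hRH s hs h1 h
  · exact absurd h (DirichletCharacter.LFunction_ne_zero_of_one_le_re χ (.inl hχ) h1)

lemma L_ne_zero {q : ℕ} [NeZero q] {χ : DirichletCharacter ℂ q} (hχ : χ ≠ 1) (hRH : dirichletRH χ)
    {s : ℂ} (hs : 1/2 < s.re) : DirichletCharacter.LFunction χ s ≠ 0 := fun h => by
  have := L_zero_re hχ hRH (by linarith) h
  linarith

set_option maxHeartbeats 1000000 in
theorem LD_bound : ∃ A : ℝ, 0 < A ∧ ∀ (q : ℕ) [NeZero q] (χ : DirichletCharacter ℂ q), χ ≠ 1 → dirichletRH χ →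
    ∀ s : ℂ, 1/2 < s.re →
    -(A * Real.log (q * (|s.im| + 3))) ≤
      (deriv (DirichletCharacter.LFunction χ) s / DirichletCharacter.LFunction χ s).re ∧
    ‖deriv (DirichletCharacter.LFunction χ) s / DirichletCharacter.LFunction χ s‖ ≤
      A * Real.log (q * (|s.im| + 3)) * (1 + 1 / (s.re - 1/2)) := by
  set c : ℝ := (8 * (6/5) / ((6/5:ℝ) - 1)^2 * Real.log ((29/20)/(6/5)) + (6/5) / ((29/20)^2 - (6/5) * 1)) with hc
  set lam : ℝ := Real.log ((29/20)/(6/5)) with hlam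
  have hlam0 : 0 < lam := Real.log_pos (by norm_num)
  have hc0 : 0 < c := by rw [hc]; positivity
  set D : ℝ := (Real.log (41 * Z32) + 1) / lam + 2 with hD
  have hZ := one_le_Z32
  have hlZ : 0 < Real.log (41 * Z32) := Real.log_pos (by linarith)
  have hD0 : 0 < D := by positivity
  refine ⟨(c + 1) * D + V32 + 1, by have := V32_nonneg; positivity, ?_⟩
  intro q _ χ hχ hRH s hs
  have hq : (1:ℝ) ≤ q := by exact_mod_cast NeZero.pos q
  set X : ℝ := q * (|s.im| + 3) with hX
  have hX3 : 3 ≤ X := by nlinarith [abs_nonneg s.im]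
  have hlX : 1 ≤ Real.log X := by
    rw [Real.le_log_iff_exp_le (by linarith)]
    linarith [Real.exp_one_lt_d9]
  have hA : ∀ B : ℝ, B ≤ ((c+1) * D + V32 + 1) → B * Real.log X ≤ ((c+1) * D + V32 + 1) * Real.log X := fun B hB =>
    mul_le_mul_of_nonneg_right hB (by linarith)
  have hV := V32_nonneg
  have hfrac : 0 < 1 / (s.re - 1/2) := by
    apply one_div_pos.2; linarith
  rcases le_or_gt (3/2) s.re with h32 | h32
  · have h1 := LD_right χ h32
    have h2 := (abs_le.1 (Complex.abs_re_le_norm (deriv (DirichletCharacter.LFunction χ) s / DirichletCharacter.LFunction χ s))).1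
    have h3 : V32 ≤ ((c+1) * D + V32 + 1) * Real.log X := by
      have : 0 < (c+1) * D := by positivity
      nlinarith
    refine ⟨by linarith, h1.trans (h3.trans ?_)⟩
    have : 0 ≤ ((c+1) * D + V32 + 1) * Real.log X := hV.trans h3
    nlinarith
  · set w : ℂ := ⟨3/2, s.im⟩ with hw
    set f : ℂ → ℂ := fun z => DirichletCharacter.LFunction χ (z + w) with hf
    set n : ℕ := ⌈(Real.log (41 * Z32) + Real.log X) / lam⌉₊ with hn
    have hfd : Differentiable ℂ f := (DirichletCharacter.differentiable_LFunction hχ).comp (by fun_prop)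
    have hz : ‖s - w‖ ≤ 1 ∧ (s - w).re = s.re - 3/2 := by
      have : s - w = ((s.re - 3/2 : ℝ) : ℂ) := by apply Complex.ext <;> simp [hw]
      rw [this]; simp only [Complex.norm_real, Complex.ofReal_re, and_true, Real.norm_eq_abs, abs_le]
      constructor <;> linarith
    have key := local_logDeriv (R := 29/20) (r := 1) (r2 := 6/5) (b := 1) (by norm_num) (by norm_num) (by norm_num) n
      f hfd (41 * X) (1 / Z32) (by positivity) (by
        intro z hz
        have hre : |z.re| ≤ 29/20 := hz ▸ Complex.abs_re_le_norm z
        have hre2 : (1:ℝ)/20 ≤ (z + w).re := by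
          simp [hw]; linarith [(abs_le.1 hre).1]
        have h1 := L_bound_lin hχ (s := z + w) (by linarith)
        have h2 : ‖z + w‖ ≤ |s.im| + 3 := by
          have a1 := norm_add_le z w
          have a2 := Complex.norm_le_abs_re_add_abs_im w
          simp only [hw] at a2
          rw [abs_of_pos (by norm_num : (0:ℝ) < 3/2)] at a2
          linarith
        have h3 : 2 * q * ‖z + w‖ / (z + w).re ≤ 40 * X := by
          rw [div_le_iff₀ (by linarith)]
          have : q * ‖z + w‖ ≤ X := mul_le_mul_of_nonneg_left h2 (by linarith)
          nlinarith
        show ‖DirichletCharacter.LFunction χ (z + w)‖ ≤ _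
        linarith)
      (by
        show _ ≤ ‖DirichletCharacter.LFunction χ (0 + w)‖
        exact L_lower χ (by simp [hw]))
      (by
        rw [one_div, inv_mul_eq_div, le_div_iff₀ (by linarith)]
        have h1 : (Real.log (41 * Z32) + Real.log X) / lam ≤ n := Nat.le_ceil _
        rw [div_le_iff₀ hlam0] at h1
        rw [← Real.log_mul (by linarith) (by linarith)] at h1
        have h2 := (Real.log_le_iff_le_exp (by positivity)).1 h1
        rw [mul_comm (n:ℝ), Real.exp_mul, hlam, Real.exp_log (by norm_num), Real.rpow_natCast] at h2
        linarith)
      (by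
        intro z hz hz0
        have hre : |z.re| ≤ 6/5 := (Complex.abs_re_le_norm z).trans hz
        have hh := L_zero_re hχ hRH (s := z + w) (by
          simp [hw]; linarith [(abs_le.1 hre).1]) hz0
        simp [hw] at hh
        linarith)
      (s - w) hz.1 (by rw [hz.2]; linarith)
    have hfz : f (s - w) = DirichletCharacter.LFunction χ s := by simp [hf]
    have hfz' : deriv f (s - w) = deriv (DirichletCharacter.LFunction χ) s := by
      rw [hf, deriv_comp_add_const]; simp
    rw [hfz, hfz', ← hc, hz.2] at key
    have hnle : (n:ℝ) + 1 ≤ D * Real.log X := by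
      have h1 : (n:ℝ) < (Real.log (41 * Z32) + Real.log X) / lam + 1 := Nat.ceil_lt_add_one (by positivity)
      have h2 : (Real.log (41 * Z32) + Real.log X) / lam ≤ (Real.log (41 * Z32) + 1) / lam * Real.log X := by
        rw [div_mul_eq_mul_div]
        apply div_le_div_of_nonneg_right _ hlam0.le
        nlinarith
      rw [hD, add_mul]; linarith
    have hcn : c * (n+1) ≤ c * D * Real.log X := by
      rw [mul_assoc]; exact mul_le_mul_of_nonneg_left hnle hc0.le
    have hsub : s.re - 3/2 + 1 = s.re - 1/2 := by ring
    rw [hsub] at key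
    have hDl : 0 ≤ D * Real.log X := by positivity
    constructor
    · refine le_trans ?_ key.1
      have : c * D * Real.log X ≤ _ := hA (c * D) (by linarith [add_mul c 1 D, one_mul D])
      linarith
    · refine key.2.trans ?_
      have h1 : (n:ℝ) / (s.re - 1/2) ≤ D * Real.log X * (1 / (s.re - 1/2)) := by
        rw [div_eq_mul_one_div]
        exact mul_le_mul_of_nonneg_right (by linarith) hfrac.le
      have h2 := hA (c * D) (by linarith [add_mul c 1 D, one_mul D])
      have h3 := hA D (by linarith [mul_pos hc0 hD0, add_mul c 1 D, one_mul D])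
      have h4 := mul_le_mul_of_nonneg_right h3 hfrac.le
      rw [mul_add, mul_one]
      linarith

end

section
open Complex Real Finset

lemma integrable_w58 : MeasureTheory.Integrable (fun τ : ℝ => (1 + τ^2)^(-(5/8):ℝ)) := by
  have := integrable_rpow_neg_one_add_norm_sq (E := ℝ) (μ := MeasureTheory.volume) (r := 5/4) (by simp; norm_num)
  refine this.congr (Filter.Eventually.of_forall fun τ => ?_)
  simp only [Real.norm_eq_abs, sq_abs]; norm_num

lemma norm_sq_xy (x τ : ℝ) : ‖(x + τ * I : ℂ)‖^2 = x^2 + τ^2 := by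
  rw [Complex.sq_norm, Complex.normSq_add_mul_I]

/-- pointwise decay bound on the line -/
lemma norm_rpow_le_w58 {x1 x τ : ℝ} (h1 : 0 < x1) (hx : x1 ≤ x) :
    ‖(x + τ * I : ℂ)‖^(-(3/2):ℝ) ≤ (min 1 x1)^(-(5/4):ℝ) * (1 + τ^2)^(-(5/8):ℝ) * x^(-(1/4):ℝ) := by
  set n := ‖(x + τ * I : ℂ)‖ with hn
  have hsq : n^2 = x^2 + τ^2 := norm_sq_xy x τ
  have hx0 : 0 < x := by linarith
  have hn0 : 0 ≤ n := norm_nonneg _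
  have hnx : x ≤ n := by nlinarith [sq_nonneg τ]
  have hnp : 0 < n := by linarith
  have hm : 0 < min 1 x1 := by positivity
  have hm1 : min 1 x1 ≤ 1 := min_le_left _ _
  have hm2 : min 1 x1 ≤ x := (min_le_right _ _).trans hx
  have e : n^(-(3/2):ℝ) = n^(-(5/4):ℝ) * n^(-(1/4):ℝ) := by
    rw [← Real.rpow_add hnp]; norm_num
  rw [e]
  apply mul_le_mul _ _ (by positivity) (by positivity)
  · have h2 : (min 1 x1)^2 * (1 + τ^2) ≤ n^2 := by
      rw [hsq]
      have : (min 1 x1)^2 ≤ x^2 := by nlinarith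
      have : (min 1 x1)^2 ≤ 1 := by nlinarith
      nlinarith [sq_nonneg τ]
    have h3 : n^(-(5/4):ℝ) = (n^2)^(-(5/8):ℝ) := by
      rw [← Real.rpow_natCast, ← Real.rpow_mul hn0]; norm_num
    have h4 : (min 1 x1)^(-(5/4):ℝ) * (1 + τ^2)^(-(5/8):ℝ) = ((min 1 x1)^2 * (1 + τ^2))^(-(5/8):ℝ) := by
      rw [Real.mul_rpow (by positivity) (by positivity), ← Real.rpow_natCast (min 1 x1), ← Real.rpow_mul hm.le]; norm_num
    rw [h3, h4]
    exact Real.rpow_le_rpow_of_nonpos (by positivity) h2 (by norm_num)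
  · exact Real.rpow_le_rpow_of_nonpos hx0 hnx (by norm_num)

lemma line_cont {F : ℂ → ℂ} {x0 x : ℝ} (hF : DifferentiableOn ℂ F {z | x0 < z.re}) (hx : x0 < x) :
    Continuous fun τ : ℝ => F (x + τ * I) := by
  rw [← continuousOn_univ]
  refine hF.continuousOn.comp (t := {z : ℂ | x0 < z.re}) (by fun_prop) ?_
  intro τ _; simpa using hx

lemma line_integrable {F : ℂ → ℂ} {x0 x K : ℝ} (hF : DifferentiableOn ℂ F {z | x0 < z.re}) (hx : x0 < x) (hx0 : 0 < x)
    (hK : ∀ τ : ℝ, ‖F (x + τ * I)‖ ≤ K * ‖(x + τ * I : ℂ)‖^(-(3/2):ℝ)) (hK0 : 0 ≤ K) :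
    MeasureTheory.Integrable (fun τ : ℝ => F (x + τ * I)) := by
  refine MeasureTheory.Integrable.mono' (integrable_w58.const_mul (K * (min 1 x)^(-(5/4):ℝ) * x^(-(1/4):ℝ)))
    (line_cont hF hx).aestronglyMeasurable (Filter.Eventually.of_forall fun τ => ?_)
  refine (hK τ).trans ((mul_le_mul_of_nonneg_left (norm_rpow_le_w58 hx0 le_rfl) hK0).trans (le_of_eq ?_))
  ring

lemma L0a {F : ℂ → ℂ} {x0 x1 x2 K : ℝ} (hF : DifferentiableOn ℂ F {z | x0 < z.re}) (h01 : x0 < x1)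
    (h1 : 0 < x1) (h12 : x1 ≤ x2) (hK0 : 0 ≤ K)
    (hK : ∀ z : ℂ, x1 ≤ z.re → z.re ≤ x2 → ‖F z‖ ≤ K * ‖z‖^(-(3/2):ℝ)) :
    ∫ τ : ℝ, F (x1 + τ * I) = ∫ τ : ℝ, F (x2 + τ * I) := by
  have i1 := line_integrable hF h01 h1 (fun τ => hK _ (by simp) (by simpa using h12)) hK0
  have i2 := line_integrable hF (h01.trans_le h12) (h1.trans_le h12) (fun τ => hK _ (by simpa using h12) (by simp)) hK0
  have t1 := MeasureTheory.intervalIntegral_tendsto_integral i1 Filter.tendsto_neg_atTop_atBot Filter.tendsto_id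
  have t2 := MeasureTheory.intervalIntegral_tendsto_integral i2 Filter.tendsto_neg_atTop_atBot Filter.tendsto_id
  have hhor : ∀ T : ℝ, 0 < T → ∀ y : ℝ, |y| = T → ‖∫ x in x1..x2, F (x + y * I)‖ ≤ K * T^(-(3/2):ℝ) * (x2 - x1) := by
    intro T hT y hy
    have := intervalIntegral.norm_integral_le_of_norm_le_const (a := x1) (b := x2) (f := fun x : ℝ => F (x + y * I))
      (C := K * T^(-(3/2):ℝ)) (by
        intro x hx
        rw [Set.uIoc_of_le h12] at hx
        refine (hK _ (by simpa using hx.1.le) (by simpa using hx.2)).trans ?_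
        apply mul_le_mul_of_nonneg_left _ hK0
        apply Real.rpow_le_rpow_of_nonpos hT _ (by norm_num)
        have := Complex.abs_im_le_norm (x + y * I)
        simpa [hy] using this)
    rwa [abs_of_nonneg (by linarith)] at this
  have hrect : ∀ T : ℝ, ‖(∫ τ in (-T)..T, F (x2 + τ * I)) - ∫ τ in (-T)..T, F (x1 + τ * I)‖ =
      ‖(∫ x in x1..x2, F (x + T * I)) - ∫ x in x1..x2, F (x + (-T : ℝ) * I)‖ := by
    intro T
    have h := Complex.integral_boundary_rect_eq_zero_of_differentiableOn F (x1 + (-T : ℝ) * I) (x2 + T * I) (hF.mono (by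
      intro z hz
      rw [Complex.mem_reProdIm] at hz
      have := hz.1
      simp at this
      rw [Set.uIcc_of_le h12] at this
      exact h01.trans_le this.1))
    simp only [Complex.add_re, Complex.add_im, Complex.ofReal_re, Complex.ofReal_im, Complex.mul_re, Complex.mul_im,
      Complex.I_re, Complex.I_im, mul_zero, mul_one, sub_zero, zero_add, add_zero, smul_eq_mul] at h
    have e : (∫ x in x1..x2, F (x + T * I)) - ∫ x in x1..x2, F (x + (-T : ℝ) * I) =
      I * ((∫ τ in (-T)..T, F (x2 + τ * I)) - ∫ τ in (-T)..T, F (x1 + τ * I)) := by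
      linear_combination -h
    rw [e, norm_mul, Complex.norm_I, one_mul]
  have hz : Filter.Tendsto (fun T : ℝ => (∫ τ in (-T)..T, F (x2 + τ * I)) - ∫ τ in (-T)..T, F (x1 + τ * I)) Filter.atTop (nhds 0) := by
    rw [tendsto_zero_iff_norm_tendsto_zero]
    have hlim : Filter.Tendsto (fun T : ℝ => 2 * (K * T^(-(3/2):ℝ) * (x2 - x1))) Filter.atTop (nhds 0) := by
      have := ((tendsto_rpow_neg_atTop (show (0:ℝ) < 3/2 by norm_num)).const_mul K).mul_const (x2 - x1) |>.const_mul 2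
      simpa using this
    refine tendsto_of_tendsto_of_tendsto_of_le_of_le' tendsto_const_nhds hlim (Filter.Eventually.of_forall fun _ => norm_nonneg _) ?_
    filter_upwards [Filter.eventually_gt_atTop 0] with T hT
    rw [hrect T]
    refine (norm_sub_le _ _).trans ?_
    have a := hhor T hT T (abs_of_pos hT)
    have b := hhor T hT (-T) (by rw [abs_neg, abs_of_pos hT])
    linarith
  have := tendsto_nhds_unique hz (t2.sub t1)
  exact (sub_eq_zero.1 this.symm).symm

lemma L0b {F : ℂ → ℂ} {x0 x1 K : ℝ} (hF : DifferentiableOn ℂ F {z | x0 < z.re}) (h01 : x0 < x1)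
    (h1 : 0 < x1) (hK0 : 0 ≤ K)
    (hK : ∀ z : ℂ, x1 ≤ z.re → ‖F z‖ ≤ K * ‖z‖^(-(3/2):ℝ)) :
    ∫ τ : ℝ, F (x1 + τ * I) = 0 := by
  set W := ∫ τ : ℝ, (1 + τ^2)^(-(5/8):ℝ) with hW
  have hb : ∀ x : ℝ, x1 ≤ x → ‖∫ τ : ℝ, F (x1 + τ * I)‖ ≤ K * (min 1 x1)^(-(5/4):ℝ) * W * x^(-(1/4):ℝ) := by
    intro x hx
    rw [L0a hF h01 h1 hx hK0 (fun z hz _ => hK z hz)]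
    have : K * (min 1 x1)^(-(5/4):ℝ) * W * x^(-(1/4):ℝ) =
        ∫ τ : ℝ, (K * (min 1 x1)^(-(5/4):ℝ) * x^(-(1/4):ℝ)) * (1 + τ^2)^(-(5/8):ℝ) := by
      rw [MeasureTheory.integral_const_mul, hW]; ring
    rw [this]
    apply MeasureTheory.norm_integral_le_of_norm_le (integrable_w58.const_mul _)
    refine Filter.Eventually.of_forall fun τ => ?_
    refine (hK _ (by simpa using hx)).trans ((mul_le_mul_of_nonneg_left (norm_rpow_le_w58 h1 hx) hK0).trans (le_of_eq ?_))
    ring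
  have hlim : Filter.Tendsto (fun x : ℝ => K * (min 1 x1)^(-(5/4):ℝ) * W * x^(-(1/4):ℝ)) Filter.atTop (nhds 0) := by
    simpa using (tendsto_rpow_neg_atTop (show (0:ℝ) < 1/4 by norm_num)).const_mul (K * (min 1 x1)^(-(5/4):ℝ) * W)
  have := ge_of_tendsto hlim ((Filter.eventually_ge_atTop x1).mono hb)
  exact norm_le_zero_iff.1 this

/-- Poisson kernel integral -/
lemma poisson_kernel {b : ℝ} (hb : 0 < b) :
    MeasureTheory.Integrable (fun τ : ℝ => b / (b^2 + τ^2)) ∧ ∫ τ : ℝ, b / (b^2 + τ^2) = π := by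
  have e : ∀ τ : ℝ, b / (b^2 + τ^2) = b⁻¹ * (1 + (b⁻¹ * τ)^2)⁻¹ := by
    intro τ; field_simp
  simp_rw [e]
  constructor
  · exact ((integrable_inv_one_add_sq).comp_mul_left' (inv_ne_zero hb.ne')).const_mul _
  · rw [MeasureTheory.integral_const_mul, MeasureTheory.Measure.integral_comp_mul_left (fun x : ℝ => (1 + x^2)⁻¹) b⁻¹,
      integral_univ_inv_one_add_sq]
    simp [abs_of_pos hb]
    field_simp

end

section
open Complex Real Finset

lemma norm_le_of_shift {z w : ℂ} {d b : ℝ} (hd : ‖z - w‖ ≤ d) (hb : 0 < b) (hw : b ≤ ‖w‖) :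
    ‖z‖ ≤ (1 + d / b) * ‖w‖ := by
  have h1 := norm_le_norm_add_norm_sub' z w
  have h0 : 0 ≤ d := (norm_nonneg _).trans hd
  have h2 : d ≤ d / b * ‖w‖ := by
    rw [div_mul_eq_mul_div, le_div_iff₀ hb]; nlinarith
  linarith

lemma decay_patch {G : ℂ → ℂ} {x0 ε K δ : ℝ} (hG : DifferentiableOn ℂ G {z | x0 < z.re}) (h0 : x0 < ε)
    (hε : 0 < ε) (a : ℂ) {S : Set ℂ} (hS : IsClosed S) (hSε : ∀ z ∈ S, ε ≤ z.re)
    (h : ∀ z ∈ S, δ ≤ ‖z - a‖ → ‖G z‖ ≤ K * ‖z‖^(-(3/2):ℝ)) :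
    ∃ K', 0 ≤ K' ∧ ∀ z ∈ S, ‖G z‖ ≤ K' * ‖z‖^(-(3/2):ℝ) := by
  have hcomp : IsCompact (Metric.closedBall a δ ∩ S) := (isCompact_closedBall a δ).inter_right hS
  have hne : ∀ z ∈ S, 0 < ‖z‖ := by
    intro z hz
    have := hSε z hz
    exact lt_of_lt_of_le (by linarith) ((le_abs_self _).trans (Complex.abs_re_le_norm z))
  have hcont : ContinuousOn (fun z => ‖G z‖ * ‖z‖^(3/2:ℝ)) (Metric.closedBall a δ ∩ S) := by
    apply ContinuousOn.mul
    · exact (hG.continuousOn.mono (fun z hz => h0.trans_le (hSε z hz.2))).norm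
    · exact (continuous_norm.continuousOn).rpow_const (fun z hz => Or.inl (hne z hz.2).ne')
  obtain ⟨M, hM⟩ := hcomp.bddAbove_image hcont
  refine ⟨max (max K M) 0, le_max_right _ _, fun z hz => ?_⟩
  have hz0 := hne z hz
  by_cases hd : δ ≤ ‖z - a‖
  · exact (h z hz hd).trans (mul_le_mul_of_nonneg_right ((le_max_left _ _).trans (le_max_left _ _)) (by positivity))
  · have h1 : ‖G z‖ * ‖z‖^(3/2:ℝ) ≤ M := hM ⟨z, ⟨by simpa [dist_eq_norm] using (not_le.1 hd).le, hz⟩, rfl⟩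
    have h2 : ‖G z‖ = ‖G z‖ * ‖z‖^(3/2:ℝ) * ‖z‖^(-(3/2):ℝ) := by
      rw [mul_assoc, ← Real.rpow_add hz0]; norm_num
    rw [h2]
    exact mul_le_mul_of_nonneg_right (h1.trans ((le_max_right _ _).trans (le_max_left _ _))) (by positivity)

lemma rpow_half_mul {x : ℝ} (hx : 0 < x) : x^(1/2:ℝ) * (x^2)⁻¹ = x^(-(3/2):ℝ) := by
  rw [← Real.rpow_natCast x 2, ← Real.rpow_neg hx.le, ← Real.rpow_add hx]; norm_num

/-- quotient bound: numerator `≤ K |z|^{1/2}`, two denominators comparable with `z`. -/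
lemma decay_quot {N u v z : ℂ} {K c1 c2 : ℝ} (hN : ‖N‖ ≤ K * ‖z‖^(1/2:ℝ)) (hK : 0 ≤ K) (hz : 0 < ‖z‖)
    (hc1 : 0 < c1) (hc2 : 0 < c2)
    (hu : ‖z‖ ≤ c1 * ‖u‖) (hv : ‖z‖ ≤ c2 * ‖v‖) : ‖N / (u * v)‖ ≤ (K * (c1 * c2)) * ‖z‖^(-(3/2):ℝ) := by
  rw [norm_div, norm_mul]
  have hu0 : 0 < ‖u‖ := by
    by_contra h
    have : ‖u‖ = 0 := le_antisymm (not_lt.1 h) (norm_nonneg _)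
    rw [this] at hu; linarith
  have hv0 : 0 < ‖v‖ := by
    by_contra h
    have : ‖v‖ = 0 := le_antisymm (not_lt.1 h) (norm_nonneg _)
    rw [this] at hv; linarith
  rw [← rpow_half_mul hz, div_le_iff₀ (by positivity)]
  have h1 : ‖z‖^2 ≤ (c1 * c2) * (‖u‖ * ‖v‖) := by
    calc ‖z‖^2 = ‖z‖ * ‖z‖ := by ring
      _ ≤ (c1 * ‖u‖) * (c2 * ‖v‖) := mul_le_mul hu hv hz.le (by positivity)
      _ = _ := by ring
  have h2 : 1 ≤ (‖z‖^2)⁻¹ * ((c1 * c2) * (‖u‖ * ‖v‖)) := by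
    rw [inv_mul_eq_div, le_div_iff₀ (by positivity)]; linarith
  calc ‖N‖ ≤ K * ‖z‖^(1/2:ℝ) * 1 := by linarith
    _ ≤ K * ‖z‖^(1/2:ℝ) * ((‖z‖^2)⁻¹ * ((c1 * c2) * (‖u‖ * ‖v‖))) := by gcongr
    _ = _ := by ring

lemma const_le_half {ε : ℝ} (hε : 0 < ε) {z : ℂ} (hz : ε ≤ z.re) (c : ℂ) :
    ‖c‖ ≤ (‖c‖ * ε^(-(1/2):ℝ)) * ‖z‖^(1/2:ℝ) := by
  have h1 : ε^(1/2:ℝ) ≤ ‖z‖^(1/2:ℝ) := Real.rpow_le_rpow hε.le (hz.trans ((le_abs_self _).trans (Complex.abs_re_le_norm z))) (by norm_num)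
  have h2 : ε^(-(1/2):ℝ) * ε^(1/2:ℝ) = 1 := by rw [← Real.rpow_add hε]; norm_num
  calc ‖c‖ = ‖c‖ * (ε^(-(1/2):ℝ) * ε^(1/2:ℝ)) := by rw [h2, mul_one]
    _ ≤ ‖c‖ * (ε^(-(1/2):ℝ) * ‖z‖^(1/2:ℝ)) := by gcongr
    _ = _ := by ring

lemma dslope_diff {H : ℂ → ℂ} (hH : DifferentiableOn ℂ H {z | 0 < z.re}) {a : ℝ} (ha : 0 < a) :
    DifferentiableOn ℂ (dslope H a) {z | 0 < z.re} := by
  refine (Complex.differentiableOn_dslope ?_).2 hH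
  exact (isOpen_lt continuous_const Complex.continuous_re).mem_nhds (by simpa using ha)

theorem poisson_half {H : ℂ → ℂ} (hH : DifferentiableOn ℂ H {z | 0 < z.re}) {ε a K : ℝ} (hε : 0 < ε) (ha : ε < a)
    (hK0 : 0 ≤ K) (hK : ∀ z : ℂ, ε ≤ z.re → ‖H z‖ ≤ K * ‖z‖^(1/2:ℝ)) :
    MeasureTheory.Integrable (fun τ : ℝ => H (ε + τ * I) * ((a - ε) / ((a-ε)^2 + τ^2) : ℝ)) ∧
    ∫ τ : ℝ, H (ε + τ * I) * ((a - ε) / ((a-ε)^2 + τ^2) : ℝ) = π * H a := by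
  set b := a - ε with hb
  have hb0 : 0 < b := by linarith
  have ha0 : 0 < a := by linarith
  set x0 := max 0 (2 * ε - a) with hx0
  have hx0ε : x0 < ε := max_lt hε (by linarith)
  set F : ℂ → ℂ := fun z => dslope H a z * (b / (z + a - 2 * ε)) with hF
  have hne : ∀ z : ℂ, x0 < z.re → z + a - 2 * ε ≠ 0 := by
    intro z hz h
    have h1 := congrArg Complex.re h
    simp at h1
    have := (le_max_right 0 (2 * ε - a)).trans_lt hz
    linarith
  have hFd : DifferentiableOn ℂ F {z | x0 < z.re} := by
    apply DifferentiableOn.mul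
    · exact (dslope_diff hH ha0).mono (fun z hz => by
        have h : x0 < z.re := hz
        show 0 < z.re
        exact (le_max_left _ _).trans_lt h)
    · intro z hz
      apply DifferentiableAt.differentiableWithinAt
      have := hne z hz
      fun_prop (disch := assumption)
  have hFe : ∀ z : ℂ, z ≠ a → F z = ((H z - H a) * b) / ((z - a) * (z + a - 2 * ε)) := by
    intro z hz
    simp only [hF]
    rw [dslope_of_ne _ hz, slope_def_field]
    rw [div_mul_div_comm]
  obtain ⟨K', hK'0, hK'⟩ := decay_patch (G := F) (S := {z : ℂ | ε ≤ z.re}) (δ := b/2)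
    (K := ((K + ‖H a‖ * ε^(-(1/2):ℝ)) * b) * ((1 + a / (b/2)) * (1 + (a + 2 * ε) / b))) hFd hx0ε hε a
    (isClosed_le continuous_const Complex.continuous_re) (fun z hz => hz) (by
      intro z hz hd
      have hz : ε ≤ z.re := hz
      have hza : z ≠ a := by rintro rfl; simp at hd; linarith
      rw [hFe z hza]
      refine decay_quot ?_ (by positivity) ?_ (by positivity) (by positivity) ?_ ?_
      · rw [norm_mul]
        have h1 := norm_sub_le (H z) (H a)
        have h2 := hK z hz
        have h3 := const_le_half hε hz (H a)
        have e : ‖(b:ℂ)‖ = b := by simp [abs_of_pos hb0]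
        rw [e]
        calc ‖H z - H a‖ * b ≤ ((K + ‖H a‖ * ε^(-(1/2):ℝ)) * ‖z‖^(1/2:ℝ)) * b :=
              mul_le_mul_of_nonneg_right (by linarith) hb0.le
          _ = _ := by ring
      · exact lt_of_lt_of_le (by linarith) ((le_abs_self _).trans (Complex.abs_re_le_norm z))
      · apply norm_le_of_shift _ (by linarith) hd
        simp [abs_of_pos ha0]
      · apply norm_le_of_shift _ hb0
        · refine le_trans ?_ ((le_abs_self _).trans (Complex.abs_re_le_norm _))
          simp; linarith
        · rw [show z - (z + a - 2 * ε) = ((-a + 2 * ε : ℝ) : ℂ) by push_cast; ring, Complex.norm_real]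
          rw [Real.norm_eq_abs, abs_le]; constructor <;> linarith)
  have h_int0 := L0b hFd hx0ε hε hK'0 hK'
  have hi := line_integrable hFd hx0ε hε (fun τ => hK' _ (by simp)) hK'0
  have hval : ∀ τ : ℝ, H (ε + τ * I) * ((b / (b^2 + τ^2) : ℝ) : ℂ) = H a * ((b / (b^2 + τ^2) : ℝ) : ℂ) - F (ε + τ * I) := by
    intro τ
    have hne : (ε + τ * I : ℂ) ≠ a := by
      intro h
      have := congrArg Complex.re h
      simp at this; linarith
    rw [hFe _ hne]
    have h1 : ((ε + τ * I : ℂ) - a) * (ε + τ * I + a - 2 * ε) = -((b:ℂ)^2 + (τ:ℂ)^2) := by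
      rw [hb]; push_cast
      linear_combination (τ:ℂ)^2 * Complex.I_sq
    rw [h1]
    have h2 : ((b:ℂ)^2 + (τ:ℂ)^2) ≠ 0 := by
      have : 0 < b^2 + τ^2 := by positivity
      exact_mod_cast this.ne'
    push_cast
    field_simp
    ring
  obtain ⟨pi1, pi2⟩ := poisson_kernel hb0
  have pi1' : MeasureTheory.Integrable (fun τ : ℝ => H a * ((b / (b^2 + τ^2) : ℝ) : ℂ)) := (pi1.ofReal).const_mul _
  simp_rw [hval]
  refine ⟨pi1'.sub hi, ?_⟩
  have pi3 : ∫ τ : ℝ, ((b / (b^2 + τ^2) : ℝ) : ℂ) = ((∫ τ : ℝ, b / (b^2 + τ^2) : ℝ) : ℂ) := integral_ofReal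
  rw [MeasureTheory.integral_sub pi1' hi, h_int0, sub_zero, MeasureTheory.integral_const_mul, pi3, pi2]
  ring

end

section
open Complex Real Finset

lemma pos_norm_of_re {ε : ℝ} (hε : 0 < ε) {z : ℂ} (hz : ε ≤ z.re) : 0 < ‖z‖ :=
  lt_of_lt_of_le hε (hz.trans ((le_abs_self _).trans (Complex.abs_re_le_norm z)))

theorem residue2 {F : ℂ → ℂ} (hF : DifferentiableOn ℂ F {z | 0 < z.re}) {ε a c K : ℝ} (hε : 0 < ε) (ha : ε < a)
    (hc : a < c) (hK0 : 0 ≤ K) (hK : ∀ z : ℂ, ε ≤ z.re → z.re ≤ c → ‖F z‖ ≤ K * ‖z‖^(1/2:ℝ)) (hFa : F a = 0) :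
    MeasureTheory.Integrable (fun τ : ℝ => F (ε + τ * I) / (ε + τ * I - a)^2) ∧
    ∫ τ : ℝ, F (c + τ * I) / (c + τ * I - a)^2 =
      (∫ τ : ℝ, F (ε + τ * I) / (ε + τ * I - a)^2) + 2 * π * deriv F a := by
  set b := a - ε with hb
  have hb0 : 0 < b := by linarith
  have ha0 : 0 < a := by linarith
  set x0 := max 0 (2 * ε - a) with hx0
  have hx0ε : x0 < ε := max_lt hε (by linarith)
  set D := deriv F a with hD
  set G : ℂ → ℂ := fun z => dslope (dslope F a) a z + D / (z - a + 2 * b) with hG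
  have hne : ∀ z : ℂ, x0 < z.re → z - a + 2 * b ≠ 0 := by
    intro z hz h
    have h1 := congrArg Complex.re h
    simp [hb] at h1
    have := (le_max_right 0 (2 * ε - a)).trans_lt hz
    linarith
  have hGd : DifferentiableOn ℂ G {z | x0 < z.re} := by
    apply DifferentiableOn.add
    · exact (dslope_diff (dslope_diff hF ha0) ha0).mono (fun z hz => by
        have h : x0 < z.re := hz
        show 0 < z.re
        exact (le_max_left _ _).trans_lt h)
    · intro z hz
      apply DifferentiableAt.differentiableWithinAt
      have := hne z hz
      fun_prop (disch := assumption)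
  have hGe : ∀ z : ℂ, z ≠ a → x0 < z.re → G z = F z / ((z - a) * (z - a)) - (D * (2 * b)) / ((z - a) * (z - a + 2 * b)) := by
    intro z hz hz0
    simp only [hG]
    rw [dslope_of_ne _ hz, slope_def_field, dslope_of_ne _ hz, slope_def_field, dslope_same, hFa]
    have h1 := hne z hz0
    have h2 : z - a ≠ 0 := sub_ne_zero.2 hz
    rw [← hD]
    field_simp
    ring
  have hzn : ∀ z : ℂ, ε ≤ z.re → 0 < ‖z‖ := fun z hz => pos_norm_of_re hε hz
  have hD2 : ∀ z : ℂ, ε ≤ z.re → ∀ δ > 0, δ ≤ ‖z - a‖ →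
      ‖(D * (2 * b)) / ((z - a) * (z - a + 2 * b))‖ ≤ (‖D * (2 * b)‖ * ε^(-(1/2):ℝ)) * ((1 + a / δ) * (1 + (a + 2 * ε) / b)) * ‖z‖^(-(3/2):ℝ) := by
    intro z hz δ hδ hd
    refine decay_quot (const_le_half hε hz _) (by positivity) (hzn z hz) (by positivity) (by positivity) ?_ ?_
    · apply norm_le_of_shift _ hδ hd
      simp [abs_of_pos ha0]
    · apply norm_le_of_shift _ hb0
      · refine le_trans ?_ ((le_abs_self _).trans (Complex.abs_re_le_norm _))
        simp [hb]; linarith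
      · rw [show z - (z - a + 2 * b) = ((-a + 2 * ε : ℝ) : ℂ) by rw [hb]; push_cast; ring, Complex.norm_real]
        rw [Real.norm_eq_abs, abs_le]; constructor <;> linarith
  have hF2 : ∀ z : ℂ, ε ≤ z.re → z.re ≤ c → ∀ δ > 0, δ ≤ ‖z - a‖ →
      ‖F z / ((z - a) * (z - a))‖ ≤ K * ((1 + a / δ) * (1 + a / δ)) * ‖z‖^(-(3/2):ℝ) := by
    intro z hz hzc δ hδ hd
    refine decay_quot (hK z hz hzc) hK0 (hzn z hz) (by positivity) (by positivity) ?_ ?_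
    · apply norm_le_of_shift _ hδ hd
      simp [abs_of_pos ha0]
    · apply norm_le_of_shift _ hδ hd
      simp [abs_of_pos ha0]
  obtain ⟨K', hK'0, hK'⟩ := decay_patch (G := G) (S := {z : ℂ | ε ≤ z.re ∧ z.re ≤ c}) (δ := b/2)
    (K := K * ((1 + a / (b/2)) * (1 + a / (b/2))) + (‖D * (2 * b)‖ * ε^(-(1/2):ℝ)) * ((1 + a / (b/2)) * (1 + (a + 2 * ε) / b))) hGd hx0ε hε a
    ((isClosed_le continuous_const Complex.continuous_re).inter (isClosed_le Complex.continuous_re continuous_const)) (fun z hz => hz.1) (by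
      intro z hz hd
      have hza : z ≠ a := by rintro rfl; simp at hd; linarith
      rw [hGe z hza (hx0ε.trans_le hz.1)]
      refine (norm_sub_le _ _).trans ?_
      rw [add_mul]
      exact add_le_add (hF2 z hz.1 hz.2 _ (by linarith) hd) (hD2 z hz.1 _ (by linarith) hd))
  have h_int0 := L0a hGd hx0ε hε (by linarith : ε ≤ c) hK'0 (fun z h1 h2 => hK' z ⟨h1, h2⟩)
  have hi1 := line_integrable hGd hx0ε hε (fun τ => hK' _ ⟨by simp, by simp; linarith⟩) hK'0
  have hi2 := line_integrable hGd (by linarith : x0 < c) (by linarith) (fun τ => hK' _ ⟨by simp; linarith, by simp⟩) hK'0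
  set Cr : ℂ → ℂ := fun z => (D * (2 * b)) / ((z - a) * (z - a + 2 * b)) with hCr
  have hCrd : DifferentiableOn ℂ Cr {z | a < z.re} := by
    intro z hz
    apply DifferentiableAt.differentiableWithinAt
    have hz : a < z.re := hz
    have h1 : (z - a) * (z - a + 2 * b) ≠ 0 := by
      apply mul_ne_zero
      · intro h
        have := congrArg Complex.re h
        simp at this; linarith
      · exact hne z (by linarith)
    simp only [hCr]
    fun_prop (disch := assumption)
  have hca : ∀ z : ℂ, c ≤ z.re → c - a ≤ ‖z - a‖ := by
    intro z hz
    refine le_trans ?_ ((le_abs_self _).trans (Complex.abs_re_le_norm _))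
    simp; linarith
  have hCr0 : ∫ τ : ℝ, Cr (c + τ * I) = 0 :=
    L0b hCrd hc (by linarith) (by have := sub_pos.2 hc; positivity) (fun z hz => hD2 z (by linarith) (c - a) (by linarith) (hca z hz))
  have hCrI : MeasureTheory.Integrable fun τ : ℝ => Cr (c + τ * I) :=
    line_integrable hCrd hc (by linarith) (fun τ => hD2 _ (by simp; linarith) (c - a) (by linarith) (hca _ (by simp))) (by have := sub_pos.2 hc; positivity)
  obtain ⟨pi1, pi2⟩ := poisson_kernel hb0
  have hCrε : ∀ τ : ℝ, Cr (ε + τ * I) = -(2 * D) * ((b / (b^2 + τ^2) : ℝ) : ℂ) := by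
    intro τ
    simp only [hCr]
    have h1 : ((ε + τ * I : ℂ) - a) * (ε + τ * I - a + 2 * b) = -((b:ℂ)^2 + (τ:ℂ)^2) := by
      rw [hb]; push_cast
      linear_combination (τ:ℂ)^2 * Complex.I_sq
    rw [h1]
    have h2 : ((b:ℂ)^2 + (τ:ℂ)^2) ≠ 0 := by
      have : 0 < b^2 + τ^2 := by positivity
      exact_mod_cast this.ne'
    push_cast
    field_simp
  have pi3 : ∫ τ : ℝ, ((b / (b^2 + τ^2) : ℝ) : ℂ) = ((∫ τ : ℝ, b / (b^2 + τ^2) : ℝ) : ℂ) := integral_ofReal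
  have hCrεI : MeasureTheory.Integrable fun τ : ℝ => Cr (ε + τ * I) := by
    simp_rw [hCrε]; exact (pi1.ofReal).const_mul _
  have hCrε0 : ∫ τ : ℝ, Cr (ε + τ * I) = -(2 * D) * π := by
    simp_rw [hCrε]; rw [MeasureTheory.integral_const_mul, pi3, pi2]
  have e1 : ∀ τ : ℝ, F (ε + τ * I) / (ε + τ * I - a)^2 = G (ε + τ * I) + Cr (ε + τ * I) := by
    intro τ
    rw [hGe _ (by intro h; have := congrArg Complex.re h; simp at this; linarith) (by simpa using hx0ε)]
    simp only [hCr]; ring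
  have e2 : ∀ τ : ℝ, F (c + τ * I) / (c + τ * I - a)^2 = G (c + τ * I) + Cr (c + τ * I) := by
    intro τ
    rw [hGe _ (by intro h; have := congrArg Complex.re h; simp at this; linarith) (by simp; linarith)]
    simp only [hCr]; ring
  simp_rw [e1, e2]
  refine ⟨hi1.add hCrεI, ?_⟩
  rw [MeasureTheory.integral_add hi1 hCrεI, MeasureTheory.integral_add hi2 hCrI, hCr0, hCrε0, h_int0]
  ring

end

section
open Complex Real Finset

noncomputable def E2 (Δ : ℝ) (w : ℂ) : ℂ := (2 / Δ) * (Complex.exp (w * Δ) - Complex.exp (w * (Δ / 2)))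

lemma E2_diff (Δ : ℝ) : Differentiable ℂ (E2 Δ) := by unfold E2; fun_prop

lemma E2_norm {Δ : ℝ} (hΔ : 0 < Δ) {w : ℂ} (hw : w.re ≤ 0) : ‖E2 Δ w‖ ≤ (4 / Δ) * Real.exp (w.re * Δ / 2) := by
  unfold E2
  rw [norm_mul]
  have h1 : ‖(2 / Δ : ℂ)‖ = 2 / Δ := by
    rw [show (2 / Δ : ℂ) = ((2 / Δ : ℝ) : ℂ) by push_cast; rfl, Complex.norm_real, Real.norm_eq_abs, abs_of_pos (by positivity)]
  have h2 : ‖Complex.exp (w * Δ) - Complex.exp (w * (Δ / 2))‖ ≤ 2 * Real.exp (w.re * Δ / 2) := by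
    refine (norm_sub_le _ _).trans ?_
    rw [Complex.norm_exp, Complex.norm_exp]
    have e1 : (w * (Δ:ℂ)).re = w.re * Δ := by simp
    have e2 : (w * ((Δ:ℂ) / 2)).re = w.re * Δ / 2 := by
      rw [show (w * ((Δ:ℂ) / 2)) = w * ((Δ / 2 : ℝ) : ℂ) by push_cast; ring]; simp; ring
    rw [e1, e2]
    have : Real.exp (w.re * Δ) ≤ Real.exp (w.re * Δ / 2) := by
      apply Real.exp_le_exp.2; nlinarith
    linarith
  rw [h1]
  calc (2 / Δ) * _ ≤ (2 / Δ) * (2 * Real.exp (w.re * Δ / 2)) := by gcongr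
    _ = _ := by ring

lemma E2_conj (Δ : ℝ) (w : ℂ) : (starRingEnd ℂ) (E2 Δ w) = E2 Δ ((starRingEnd ℂ) w) := by
  unfold E2
  have h2 : (starRingEnd ℂ) 2 = 2 := Complex.conj_ofNat 2
  simp [← Complex.exp_conj, h2]

theorem poisson_re {H : ℂ → ℂ} (hH : DifferentiableOn ℂ H {z | 0 < z.re}) {ε a K : ℝ} (hε : 0 < ε) (ha : ε < a)
    (hK0 : 0 ≤ K) (hK : ∀ z : ℂ, ε ≤ z.re → ‖H z‖ ≤ K * ‖z‖^(1/2:ℝ)) :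
    MeasureTheory.Integrable (fun τ : ℝ => (H (ε + τ * I)).re * ((a - ε) / ((a-ε)^2 + τ^2))) ∧
    ∫ τ : ℝ, (H (ε + τ * I)).re * ((a - ε) / ((a-ε)^2 + τ^2)) = π * (H a).re := by
  obtain ⟨p1, p2⟩ := poisson_half hH hε ha hK0 hK
  have e : ∀ τ : ℝ, (H (ε + τ * I)).re * ((a - ε) / ((a-ε)^2 + τ^2)) = RCLike.re (H (ε + τ * I) * ((a - ε) / ((a-ε)^2 + τ^2) : ℝ)) :=
    fun τ => (Complex.re_mul_ofReal _ _).symm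
  simp_rw [e]
  refine ⟨p1.re, ?_⟩
  rw [integral_re p1, p2]
  exact Complex.re_ofReal_mul _ _

theorem conj_bound {f H : ℂ → ℂ} (hf : DifferentiableOn ℂ f {z | 0 < z.re}) (hH : DifferentiableOn ℂ H {z | 0 < z.re})
    {ε a K Δ : ℝ} (hε : 0 < ε) (ha : ε < a) (hΔ : 0 < Δ)
    (hK0 : 0 ≤ K) (hKf : ∀ z : ℂ, ε ≤ z.re → ‖f z‖ ≤ K * ‖z‖^(1/2:ℝ))
    (hKH : ∀ z : ℂ, ε ≤ z.re → ‖H z‖ ≤ K * ‖z‖^(1/2:ℝ))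
    (hfH : ∀ z : ℂ, ε ≤ z.re → |(f z).re| ≤ (H z).re) :
    ‖∫ τ : ℝ, (f (ε + τ * I) * E2 Δ (ε + τ * I - a)) / (ε + τ * I - a)^2‖ ≤
      8 * π / (Δ * (a - ε)) * Real.exp (-((a - ε) * Δ / 2)) * (H a).re := by
  set b := a - ε with hb
  have hb0 : 0 < b := by linarith
  have ha0 : 0 < a := by linarith
  set x0 := max 0 (2 * ε - a) with hx0
  have hx0ε : x0 < ε := max_lt hε (by linarith)
  have hzn : ∀ z : ℂ, ε ≤ z.re → 0 < ‖z‖ := fun z hz => pos_norm_of_re hε hz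
  set F : ℂ → ℂ := fun z => (f z * E2 Δ (-(z + a - 2 * ε))) / ((z + a - 2 * ε) * (z + a - 2 * ε)) with hF
  have hne : ∀ z : ℂ, x0 < z.re → z + a - 2 * ε ≠ 0 := by
    intro z hz h
    have h1 := congrArg Complex.re h
    simp at h1
    have := (le_max_right 0 (2 * ε - a)).trans_lt hz
    linarith
  have hFd : DifferentiableOn ℂ F {z | x0 < z.re} := by
    apply DifferentiableOn.div
    · apply DifferentiableOn.mul
      · exact hf.mono (fun z hz => by
          have h : x0 < z.re := hz
          show 0 < z.re
          exact (le_max_left _ _).trans_lt h)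
      · exact ((E2_diff Δ).comp (by fun_prop)).differentiableOn
    · fun_prop
    · intro z hz
      exact mul_ne_zero (hne z hz) (hne z hz)
  have hFb : ∀ z : ℂ, ε ≤ z.re → ‖F z‖ ≤ (K * (4 / Δ)) * ((1 + (a + 2 * ε) / b) * (1 + (a + 2 * ε) / b)) * ‖z‖^(-(3/2):ℝ) := by
    intro z hz
    have key : ‖z‖ ≤ (1 + (a + 2 * ε) / b) * ‖z + a - 2 * ε‖ := by
      apply norm_le_of_shift _ hb0
      · refine le_trans ?_ ((le_abs_self _).trans (Complex.abs_re_le_norm _))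
        simp; linarith
      · rw [show z - (z + a - 2 * ε) = ((-a + 2 * ε : ℝ) : ℂ) by push_cast; ring, Complex.norm_real]
        rw [Real.norm_eq_abs, abs_le]; constructor <;> linarith
    refine decay_quot ?_ (by positivity) (hzn z hz) (by positivity) (by positivity) key key
    rw [norm_mul]
    have hre : (-(z + a - 2 * ε)).re ≤ 0 := by simp; linarith
    have h1 := E2_norm hΔ hre
    have h2 : Real.exp ((-(z + a - 2 * ε)).re * Δ / 2) ≤ 1 := by
      apply Real.exp_le_one_iff.2; nlinarith
    have h3 : ‖E2 Δ (-(z + a - 2 * ε))‖ ≤ 4 / Δ := h1.trans (mul_le_of_le_one_right (by positivity) h2)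
    calc ‖f z‖ * ‖E2 Δ (-(z + a - 2 * ε))‖ ≤ (K * ‖z‖^(1/2:ℝ)) * (4 / Δ) :=
          mul_le_mul (hKf z hz) h3 (norm_nonneg _) (by positivity)
      _ = _ := by ring
  have h_int0 := L0b hFd hx0ε hε (by positivity) hFb
  have hFi := line_integrable hFd hx0ε hε (fun τ => hFb _ (by simp)) (by positivity)
  set Kk : ℝ → ℂ := fun τ => E2 Δ (ε + τ * I - a) / (ε + τ * I - a)^2 with hKk
  have hKc : ∀ τ : ℝ, F (ε + τ * I) = f (ε + τ * I) * (starRingEnd ℂ) (Kk τ) := by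
    intro τ
    simp only [hF, hKk]
    rw [map_div₀, E2_conj]
    have : (starRingEnd ℂ) (ε + τ * I - a) = -(ε + τ * I + a - 2 * ε) := by
      simp; ring
    rw [map_pow, this]
    rw [mul_div_assoc]; congr 2; ring
  have hKf' : MeasureTheory.Integrable (fun τ : ℝ => (starRingEnd ℂ) (f (ε + τ * I)) * Kk τ) := by
    have := hFi.norm
    have hc : MeasureTheory.Integrable (fun τ : ℝ => (starRingEnd ℂ) (F (ε + τ * I))) := by
      refine hFi.norm.mono' (by
        exact (Complex.continuous_conj.comp (line_cont hFd hx0ε)).aestronglyMeasurable) (Filter.Eventually.of_forall fun τ => by simp)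
    refine hc.congr (Filter.Eventually.of_forall fun τ => ?_)
    simp only [hKc, map_mul, Complex.conj_conj]
  have h0 : ∫ τ : ℝ, (starRingEnd ℂ) (f (ε + τ * I)) * Kk τ = 0 := by
    have : ∀ τ : ℝ, (starRingEnd ℂ) (f (ε + τ * I)) * Kk τ = (starRingEnd ℂ) (F (ε + τ * I)) := by
      intro τ; simp only [hKc, map_mul, Complex.conj_conj]
    simp_rw [this]
    rw [integral_conj, h_int0, map_zero]
  have hzne : ∀ τ : ℝ, (ε + τ * I - a : ℂ) ≠ 0 := by
    intro τ h; have := congrArg Complex.re h; simp at this; linarith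
  have hKkc : Continuous Kk := by
    simp only [hKk]
    refine Continuous.div ((E2_diff Δ).continuous.comp (by fun_prop)) (by fun_prop) (fun τ => pow_ne_zero _ (hzne τ))
  have hKfi : MeasureTheory.Integrable (fun τ : ℝ => f (ε + τ * I) * Kk τ) := by
    refine hKf'.norm.mono' ((line_cont hf hε).mul hKkc).aestronglyMeasurable (Filter.Eventually.of_forall fun τ => by simp)
  have hsum : ∫ τ : ℝ, f (ε + τ * I) * Kk τ = ∫ τ : ℝ, (2 * (f (ε + τ * I)).re : ℂ) * Kk τ := by
    rw [← add_zero (∫ τ : ℝ, f (ε + τ * I) * Kk τ), ← h0, ← MeasureTheory.integral_add hKfi hKf']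
    refine MeasureTheory.integral_congr_ae (Filter.Eventually.of_forall fun τ => ?_)
    simp only
    rw [← add_mul, Complex.add_conj]; push_cast; rfl
  have e0 : ∀ τ : ℝ, (f (ε + τ * I) * E2 Δ (ε + τ * I - a)) / (ε + τ * I - a)^2 = f (ε + τ * I) * Kk τ := by
    intro τ; simp only [hKk, mul_div_assoc]
  simp_rw [e0]
  rw [hsum]
  obtain ⟨p4, p3⟩ := poisson_re hH hε ha hK0 hKH
  rw [← hb] at p3 p4
  have hpt : ∀ τ : ℝ, ‖(2 * (f (ε + τ * I)).re : ℂ) * Kk τ‖ ≤ 8 / (Δ * b) * Real.exp (-(b * Δ / 2)) * ((H (ε + τ * I)).re * (b / (b^2 + τ^2))) := by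
    intro τ
    rw [norm_mul, norm_mul, Complex.norm_real, Real.norm_eq_abs]
    have h1 := hfH (ε + τ * I) (by simp)
    have hre : ((ε + τ * I - a : ℂ)).re = -b := by simp [hb]
    have h2 := E2_norm hΔ (w := ε + τ * I - a) (by rw [hre]; linarith)
    rw [hre] at h2
    have h3 : ‖Kk τ‖ ≤ (4 / Δ) * Real.exp (-b * Δ / 2) / (b^2 + τ^2) := by
      simp only [hKk]
      rw [norm_div, norm_pow]
      have : ‖(ε + τ * I - a : ℂ)‖^2 = b^2 + τ^2 := by
        rw [show (ε + τ * I - a : ℂ) = ((-b : ℝ) : ℂ) + τ * I by rw [hb]; push_cast; ring, norm_sq_xy]; ring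
      rw [this]
      gcongr
    have h4 : ‖(2:ℂ)‖ = 2 := by simp
    rw [h4]
    calc 2 * |(f (ε + τ * I)).re| * ‖Kk τ‖ ≤ 2 * (H (ε + τ * I)).re * ((4 / Δ) * Real.exp (-b * Δ / 2) / (b^2 + τ^2)) := by
          apply mul_le_mul _ h3 (norm_nonneg _)
          · have := (abs_nonneg _).trans h1
            positivity
          · linarith
      _ = _ := by
          rw [show -b * Δ / 2 = -(b * Δ / 2) by ring]
          field_simp
          ring
  refine (MeasureTheory.norm_integral_le_of_norm_le (p4.const_mul _) (Filter.Eventually.of_forall hpt)).trans (le_of_eq ?_)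
  rw [MeasureTheory.integral_const_mul, p3]
  ring

end

section
open Complex Real Finset

lemma perron_bd {x c : ℝ} (hx : x ≤ 0) (hc : 0 < c) (z : ℂ) (hz : c ≤ z.re) :
    ‖Complex.exp (x * z) / (z * z)‖ ≤ (‖(1:ℂ)‖ * c^(-(1/2):ℝ)) * (1 * 1) * ‖z‖^(-(3/2):ℝ) := by
  refine decay_quot ?_ (by positivity) (pos_norm_of_re hc hz) (by norm_num) (by norm_num) (by simp) (by simp)
  refine le_trans ?_ (const_le_half hc hz 1)
  rw [Complex.norm_exp]; simp
  nlinarith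

lemma perron_diff (x : ℝ) : DifferentiableOn ℂ (fun z : ℂ => Complex.exp (x * z) / (z * z)) {z | 0 < z.re} := by
  intro z hz
  apply DifferentiableAt.differentiableWithinAt
  have : z ≠ 0 := by rintro rfl; simp at hz
  fun_prop (disch := simp [this])

lemma perron_nonpos {x c : ℝ} (hx : x ≤ 0) (hc : 0 < c) :
    MeasureTheory.Integrable (fun τ : ℝ => Complex.exp (x * (c + τ * I)) / (c + τ * I)^2) ∧
    ∫ τ : ℝ, Complex.exp (x * (c + τ * I)) / (c + τ * I)^2 = 0 := by
  simp_rw [sq]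
  exact ⟨line_integrable (perron_diff x) hc hc (fun τ => perron_bd hx hc _ (by simp)) (by positivity),
    L0b (perron_diff x) hc hc (by positivity) (perron_bd hx hc)⟩

lemma perron_integrable (x : ℝ) {c : ℝ} (hc : 0 < c) :
    MeasureTheory.Integrable (fun τ : ℝ => Complex.exp (x * (c + τ * I)) / (c + τ * I)^2) := by
  have h := (perron_nonpos (le_refl (0:ℝ)) hc).1.norm.const_mul (Real.exp (x * c))
  refine h.mono' ?_ (Filter.Eventually.of_forall fun τ => ?_)
  · refine (Continuous.div (by fun_prop) (by fun_prop) fun τ => ?_).aestronglyMeasurable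
    apply pow_ne_zero
    intro h; have := congrArg Complex.re h; simp at this; linarith
  · rw [norm_div, norm_div, Complex.norm_exp, Complex.norm_exp]; simp
    exact le_of_eq (by ring)

theorem perron2 (x : ℝ) {c : ℝ} (hc : 0 < c) :
    ∫ τ : ℝ, Complex.exp (x * (c + τ * I)) / (c + τ * I)^2 = ((2 * π * max x 0 : ℝ) : ℂ) := by
  rcases le_or_gt x 0 with hx | hx
  · rw [(perron_nonpos hx hc).2, max_eq_right hx]; simp
  rw [max_eq_left hx.le]
  set F : ℂ → ℂ := fun z => Complex.exp (x * (z - 1)) - 1 with hF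
  have hFd : Differentiable ℂ F := by simp only [hF]; fun_prop
  have hder : deriv F ((1:ℝ):ℂ) = x := by
    have h1 : HasDerivAt (fun z : ℂ => (x:ℂ) * (z - 1)) x ((1:ℝ):ℂ) := by
      simpa using ((hasDerivAt_id ((1:ℝ):ℂ)).sub_const 1).const_mul (x:ℂ)
    have := (h1.cexp.sub_const 1).deriv
    simp only [hF]
    rw [this]; simp
  have hhalf : (0:ℝ) < 1/2 := by norm_num
  obtain ⟨r1, r2⟩ := residue2 (F := F) hFd.differentiableOn (ε := 1/2) (a := 1) (c := 1 + c)
    (K := (Real.exp (x * c) + 1) * (1/2:ℝ)^(-(1/2):ℝ)) hhalf (by norm_num) (by linarith) (by positivity) (by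
      intro z hz hzc
      have h1 : ‖F z‖ ≤ Real.exp (x * c) + 1 := by
        simp only [hF]
        refine (norm_sub_le _ _).trans ?_
        rw [Complex.norm_exp]; simp
        nlinarith
      refine h1.trans ?_
      have := const_le_half hhalf hz ((Real.exp (x * c) + 1 : ℝ) : ℂ)
      rwa [Complex.norm_real, Real.norm_eq_abs, abs_of_pos (by positivity)] at this) (by simp [hF])
  rw [hder] at r2
  have hl : ∀ τ : ℝ, F (((1 + c : ℝ) : ℂ) + τ * I) / (((1 + c : ℝ) : ℂ) + τ * I - ((1:ℝ):ℂ))^2 =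
      Complex.exp (x * (c + τ * I)) / (c + τ * I)^2 - Complex.exp ((0:ℝ) * (c + τ * I)) / (c + τ * I)^2 := by
    intro τ
    simp only [hF]
    rw [← sub_div, show ((1 + c : ℝ) : ℂ) + τ * I - ((1:ℝ):ℂ) = c + τ * I by push_cast; ring,
      show ((1 + c : ℝ) : ℂ) + τ * I - 1 = c + τ * I by push_cast; ring]
    simp
  have hr : ∀ τ : ℝ, F (((1 / 2 : ℝ) : ℂ) + τ * I) / (((1 / 2 : ℝ) : ℂ) + τ * I - ((1:ℝ):ℂ))^2 =
      (starRingEnd ℂ) (Complex.exp ((-x : ℝ) * ((1 / 2 : ℝ) + τ * I)) / ((1 / 2 : ℝ) + τ * I)^2 - Complex.exp ((0:ℝ) * ((1 / 2 : ℝ) + τ * I)) / ((1 / 2 : ℝ) + τ * I)^2) := by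
    intro τ
    simp only [hF]
    rw [← sub_div, map_div₀, map_sub, ← Complex.exp_conj, map_pow]
    have e : (starRingEnd ℂ) (((1 / 2 : ℝ):ℂ) + τ * I) = -(((1 / 2 : ℝ) : ℂ) + τ * I - ((1:ℝ):ℂ)) := by
      rw [map_add, map_mul, Complex.conj_ofReal, Complex.conj_ofReal, Complex.conj_I]; push_cast; ring
    rw [map_mul, e, Complex.conj_ofReal, neg_sq]
    congr 2
    · congr 1; push_cast; ring
    · simp
  simp_rw [hl, hr] at r2
  rw [integral_conj, MeasureTheory.integral_sub (perron_integrable x hc) (perron_integrable 0 hc),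
    MeasureTheory.integral_sub (perron_integrable _ hhalf) (perron_integrable 0 hhalf),
    (perron_nonpos le_rfl hc).2, (perron_nonpos (by linarith : -x ≤ 0) hhalf).2, (perron_nonpos le_rfl hhalf).2] at r2
  rw [sub_zero] at r2
  rw [r2]; simp

end

section
open Complex Real Finset

noncomputable def A0 : ℝ := Classical.choose LD_bound
lemma A0_pos : 0 < A0 := (Classical.choose_spec LD_bound).1

noncomputable def fL {q : ℕ} [NeZero q] (χ : DirichletCharacter ℂ q) (t : ℝ) (z : ℂ) : ℂ :=
  -(deriv (DirichletCharacter.LFunction χ) (1/2 + z + t * I) / DirichletCharacter.LFunction χ (1/2 + z + t * I))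

noncomputable def BL (q : ℕ) (t : ℝ) (z : ℂ) : ℂ :=
  A0 * (Real.log q + Real.log 2 + Complex.log (z + 3 + t * I))

lemma fL_diff {q : ℕ} [NeZero q] {χ : DirichletCharacter ℂ q} (hχ : χ ≠ 1) (hRH : dirichletRH χ) (t : ℝ) :
    DifferentiableOn ℂ (fL χ t) {z | 0 < z.re} := by
  intro z hz
  have hz : 0 < z.re := hz
  apply DifferentiableAt.differentiableWithinAt
  have hd := DirichletCharacter.differentiable_LFunction hχ
  have hne : DirichletCharacter.LFunction χ (1/2 + z + t * I) ≠ 0 := by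
    apply L_ne_zero hχ hRH
    simp; linarith
  unfold fL
  have hd' : Differentiable ℂ (deriv (DirichletCharacter.LFunction χ)) := hd.deriv
  have h1 : DifferentiableAt ℂ (fun z : ℂ => (1/2 + z + t * I)) z := by fun_prop
  exact ((hd'.differentiableAt.comp z h1).div (hd.differentiableAt.comp z h1) hne).neg

lemma BL_diff (q : ℕ) (t : ℝ) : DifferentiableOn ℂ (BL q t) {z | 0 < z.re} := by
  intro z hz
  have hz : 0 < z.re := hz
  apply DifferentiableAt.differentiableWithinAt
  unfold BL
  have : (z + 3 + t * I) ∈ Complex.slitPlane := by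
    left; simp; linarith
  fun_prop (disch := assumption)

lemma BL_re (q : ℕ) (t : ℝ) (z : ℂ) : (BL q t z).re = A0 * (Real.log q + Real.log 2 + Real.log ‖z + 3 + t * I‖) := by
  unfold BL
  rw [Complex.re_ofReal_mul]
  simp [Complex.log_re]

lemma norm_z3 {z : ℂ} (hz : 0 ≤ z.re) (t : ℝ) : 3 ≤ ‖z + 3 + t * I‖ ∧ |z.im + t| + 3 ≤ 2 * ‖z + 3 + t * I‖ := by
  have h1 : 3 ≤ ‖z + 3 + t * I‖ := by
    refine le_trans ?_ ((le_abs_self _).trans (Complex.abs_re_le_norm _)); simp; linarith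
  have h2 : |z.im + t| ≤ ‖z + 3 + t * I‖ := by
    refine le_trans (le_of_eq ?_) (Complex.abs_im_le_norm _); simp
  exact ⟨h1, by linarith⟩

lemma logq_nonneg (q : ℕ) [NeZero q] : 0 ≤ Real.log q :=
  Real.log_nonneg (by exact_mod_cast Nat.one_le_iff_ne_zero.2 (NeZero.ne q))

lemma BL_re_ge (q : ℕ) [NeZero q] (t : ℝ) {z : ℂ} (hz : 0 ≤ z.re) :
    A0 * Real.log (q * (|z.im + t| + 3)) ≤ (BL q t z).re := by
  rw [BL_re]
  obtain ⟨h1, h2⟩ := norm_z3 hz t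
  have hq : (0:ℝ) < q := by exact_mod_cast Nat.pos_of_ne_zero (NeZero.ne q)
  apply mul_le_mul_of_nonneg_left _ A0_pos.le
  rw [add_assoc, ← Real.log_mul (by norm_num) (by linarith), ← Real.log_mul hq.ne' (by nlinarith)]
  apply Real.log_le_log (by positivity)
  gcongr

lemma BL_re_nonneg (q : ℕ) [NeZero q] (t : ℝ) {z : ℂ} (hz : 0 ≤ z.re) : 0 ≤ (BL q t z).re := by
  refine le_trans ?_ (BL_re_ge q t hz)
  apply mul_nonneg A0_pos.le
  apply Real.log_nonneg
  have hq : (1:ℝ) ≤ q := by exact_mod_cast Nat.one_le_iff_ne_zero.2 (NeZero.ne q)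
  nlinarith [abs_nonneg (z.im + t)]

lemma fL_spec {q : ℕ} [NeZero q] {χ : DirichletCharacter ℂ q} (hχ : χ ≠ 1) (hRH : dirichletRH χ) (t : ℝ) {z : ℂ}
    (hz : 0 < z.re) : (fL χ t z).re ≤ A0 * Real.log (q * (|z.im + t| + 3)) ∧
      ‖fL χ t z‖ ≤ A0 * Real.log (q * (|z.im + t| + 3)) * (1 + 1 / z.re) := by
  obtain ⟨h1, h2⟩ := (Classical.choose_spec LD_bound).2 q χ hχ hRH (1/2 + z + t * I) (by simp; linarith)
  have e1 : (1/2 + z + t * I : ℂ).im = z.im + t := by simp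
  have e2 : (1/2 + z + t * I : ℂ).re - 1/2 = z.re := by simp
  rw [e1] at h1 h2
  rw [e2] at h2
  unfold fL
  rw [Complex.neg_re, norm_neg]
  exact ⟨by unfold A0; linarith, h2⟩

lemma fL_re_le {q : ℕ} [NeZero q] {χ : DirichletCharacter ℂ q} (hχ : χ ≠ 1) (hRH : dirichletRH χ) (t : ℝ) {z : ℂ}
    (hz : 0 < z.re) : (fL χ t z).re ≤ (BL q t z).re := (fL_spec hχ hRH t hz).1.trans (BL_re_ge q t hz.le)

lemma log_le_two_sqrt {x : ℝ} (hx : 0 < x) : Real.log x ≤ 2 * x^(1/2:ℝ) := by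
  have := Real.log_le_rpow_div hx.le (by norm_num : (0:ℝ) < 1/2)
  linarith

lemma growth {q : ℕ} [NeZero q] {χ : DirichletCharacter ℂ q} (hχ : χ ≠ 1) (hRH : dirichletRH χ) (t : ℝ) {ε : ℝ} (hε : 0 < ε) :
    ∃ K, 0 ≤ K ∧ (∀ z : ℂ, ε ≤ z.re → ‖fL χ t z‖ ≤ K * ‖z‖^(1/2:ℝ)) ∧ (∀ z : ℂ, ε ≤ z.re → ‖BL q t z‖ ≤ K * ‖z‖^(1/2:ℝ)) := by
  have hq : (1:ℝ) ≤ q := by exact_mod_cast Nat.one_le_iff_ne_zero.2 (NeZero.ne q)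
  have hA := A0_pos
  set M := q * ((|t| + 3) / ε + 1) with hM
  have hM0 : 0 < M := by positivity
  have key : ∀ z : ℂ, ε ≤ z.re → ∀ u : ℝ, 0 < u → u ≤ q * (‖z‖ + |t| + 3) → Real.log u ≤ 2 * M^(1/2:ℝ) * ‖z‖^(1/2:ℝ) := by
    intro z hz u hu0 hu
    have hn := pos_norm_of_re hε hz
    have hn2 : ε ≤ ‖z‖ := hz.trans ((le_abs_self _).trans (Complex.abs_re_le_norm z))
    have h1 : u ≤ M * ‖z‖ := by
      refine hu.trans ?_
      rw [hM, mul_assoc]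
      apply mul_le_mul_of_nonneg_left _ (by linarith)
      rw [add_mul, one_mul]
      have : |t| + 3 ≤ (|t| + 3) / ε * ‖z‖ := by
        rw [div_mul_eq_mul_div, le_div_iff₀ hε]; gcongr
      linarith
    refine (Real.log_le_log hu0 h1).trans ((log_le_two_sqrt (by positivity)).trans ?_)
    rw [Real.mul_rpow hM0.le hn.le]; exact le_of_eq (by ring)
  refine ⟨max (A0 * (2 * M^(1/2:ℝ)) * (1 + 1 / ε)) (A0 * (‖(Real.log q : ℂ) + Real.log 2‖ * ε^(-(1/2):ℝ) + (2 * M^(1/2:ℝ) + π * ε^(-(1/2):ℝ)))), le_max_of_le_left (by positivity), ?_, ?_⟩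
  · intro z hz
    have hz0 : 0 < z.re := by linarith
    refine ((fL_spec hχ hRH t hz0).2.trans ?_).trans (mul_le_mul_of_nonneg_right (le_max_left _ _) (by positivity))
    have h1 := key z hz (q * (|z.im + t| + 3)) (by positivity) (by
      have := abs_add_le z.im t
      have := Complex.abs_im_le_norm z
      gcongr; linarith)
    have h2 : 1 / z.re ≤ 1 / ε := by gcongr
    have h3 : 0 ≤ 2 * M^(1/2:ℝ) * ‖z‖^(1/2:ℝ) := by positivity
    calc A0 * Real.log (q * (|z.im + t| + 3)) * (1 + 1 / z.re) ≤ A0 * (2 * M^(1/2:ℝ) * ‖z‖^(1/2:ℝ)) * (1 + 1 / ε) := by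
          apply mul_le_mul _ (by linarith) (by positivity) (by positivity)
          exact mul_le_mul_of_nonneg_left h1 hA.le
      _ = _ := by ring
  · intro z hz
    have hz0 : 0 < z.re := by linarith
    refine le_trans ?_ (mul_le_mul_of_nonneg_right (le_max_right _ _) (by positivity))
    unfold BL
    rw [norm_mul, Complex.norm_real, Real.norm_eq_abs, abs_of_pos hA, mul_assoc]
    apply mul_le_mul_of_nonneg_left _ hA.le
    refine (norm_add_le _ _).trans ?_
    have h1 := const_le_half hε hz ((Real.log q : ℂ) + Real.log 2)
    have h3 := (norm_z3 hz0.le t).1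
    have h2 := key z hz ‖z + 3 + t * I‖ (by linarith) (by
      have h4 := norm_add₃_le (a := z) (b := 3) (c := t * I)
      have : ‖(t * I : ℂ)‖ = |t| := by simp
      rw [this] at h4
      simp at h4
      nlinarith [norm_nonneg z, abs_nonneg t])
    have h5 : ‖Complex.log (z + 3 + t * I)‖ ≤ Real.log ‖z + 3 + t * I‖ + π := by
      refine (Complex.norm_le_abs_re_add_abs_im _).trans ?_
      rw [Complex.log_re, Complex.log_im, abs_of_nonneg (Real.log_nonneg (by linarith))]
      linarith [Complex.abs_arg_le_pi (z + 3 + t * I)]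
    have h6 := const_le_half hε hz (π : ℂ)
    have h7 : ‖(π:ℂ)‖ = π := by rw [Complex.norm_real, Real.norm_eq_abs, abs_of_pos Real.pi_pos]
    rw [h7] at h6
    rw [add_mul, add_mul]
    linarith

end

section
open Complex Real Finset

noncomputable def kap (Δ : ℝ) (n : ℕ) : ℝ := (2 / Δ) * (max (Δ - Real.log n) 0 - max (Δ / 2 - Real.log n) 0)

lemma kap_nonneg {Δ : ℝ} (hΔ : 0 < Δ) (n : ℕ) : 0 ≤ kap Δ n := by
  unfold kap
  have : max (Δ / 2 - Real.log n) 0 ≤ max (Δ - Real.log n) 0 := max_le_max (by linarith) le_rfl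
  have : 0 < 2 / Δ := by positivity
  nlinarith

lemma kap_le_one {Δ : ℝ} (hΔ : 0 < Δ) (n : ℕ) : kap Δ n ≤ 1 := by
  unfold kap
  have : max (Δ - Real.log n) 0 ≤ max (Δ / 2 - Real.log n) 0 + Δ / 2 := by
    apply max_le
    · linarith [le_max_left (Δ / 2 - Real.log n) 0]
    · linarith [le_max_right (Δ / 2 - Real.log n) 0]
  rw [div_mul_eq_mul_div, div_le_one hΔ]; linarith

lemma kap_zero {Δ : ℝ} (hΔ : 0 < Δ) {n : ℕ} (hn : Real.exp Δ ≤ n) : kap Δ n = 0 := by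
  have : Δ ≤ Real.log n := (Real.le_log_iff_exp_le ((Real.exp_pos _).trans_le hn)).2 hn
  unfold kap
  rw [max_eq_right (by linarith), max_eq_right (by linarith)]; simp

noncomputable def RL {q : ℕ} (χ : DirichletCharacter ℂ q) (Δ t a : ℝ) : ℂ :=
  ∑ n ∈ Finset.Icc 1 ⌊Real.exp Δ⌋₊, ((ArithmeticFunction.vonMangoldt n : ℝ) : ℂ) * χ n * (kap Δ n : ℂ) * (n : ℂ)^(-(1/2 + a + t * I) : ℂ)

lemma E2_int {Δ : ℝ} : MeasureTheory.Integrable (fun τ : ℝ => E2 Δ (1 + τ * I) / (1 + τ * I)^2) := by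
  have h1 := perron_integrable Δ (c := 1) one_pos
  have h2 := perron_integrable (Δ/2) (c := 1) one_pos
  refine ((h1.sub h2).const_mul (2 / Δ : ℂ)).congr (Filter.Eventually.of_forall fun τ => ?_)
  simp only [E2, Pi.sub_apply]
  push_cast
  rw [← sub_div, mul_div_assoc]
  congr 4 <;> ring_nf

lemma term_int {Δ : ℝ} {n : ℕ} (_ : n ≠ 0) :
    MeasureTheory.Integrable (fun τ : ℝ => Complex.exp (-(Real.log n) * (1 + τ * I)) * (E2 Δ (1 + τ * I) / (1 + τ * I)^2)) ∧
    ∫ τ : ℝ, Complex.exp (-(Real.log n) * (1 + τ * I)) * (E2 Δ (1 + τ * I) / (1 + τ * I)^2) = ((2 * π * kap Δ n : ℝ) : ℂ) := by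
  have h1 := perron_integrable (Δ - Real.log n) (c := 1) one_pos
  have h2 := perron_integrable (Δ/2 - Real.log n) (c := 1) one_pos
  have e : ∀ τ : ℝ, Complex.exp (-(Real.log n) * (1 + τ * I)) * (E2 Δ (1 + τ * I) / (1 + τ * I)^2) =
     (2 / Δ : ℂ) * (Complex.exp ((Δ - Real.log n : ℝ) * ((1:ℝ) + τ * I)) / ((1:ℝ) + τ * I)^2 -
      Complex.exp ((Δ / 2 - Real.log n : ℝ) * ((1:ℝ) + τ * I)) / ((1:ℝ) + τ * I)^2) := by
    intro τ
    rw [show ((Δ - Real.log n : ℝ) * ((1:ℝ) + τ * I) : ℂ) = -(Real.log n) * (1 + τ * I) + (1 + τ * I) * Δ by push_cast; ring,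
      show ((Δ / 2 - Real.log n : ℝ) * ((1:ℝ) + τ * I) : ℂ) = -(Real.log n) * (1 + τ * I) + (1 + τ * I) * (Δ / 2) by push_cast; ring,
      Complex.exp_add, Complex.exp_add]
    unfold E2
    push_cast
    ring
  simp_rw [e]
  refine ⟨(h1.sub h2).const_mul _, ?_⟩
  rw [MeasureTheory.integral_const_mul, MeasureTheory.integral_sub h1 h2, perron2 _ one_pos, perron2 _ one_pos]
  unfold kap; push_cast; ring

theorem series_int {q : ℕ} [NeZero q] (χ : DirichletCharacter ℂ q) {Δ : ℝ} (hΔ : 0 < Δ) (t : ℝ) {a : ℝ} (ha : 0 < a) :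
    ∫ τ : ℝ, (fL χ t ((a + 1 : ℝ) + τ * I) * E2 Δ ((a + 1 : ℝ) + τ * I - a)) / ((a + 1 : ℝ) + τ * I - a)^2 = 2 * π * RL χ Δ t a := by
  set cn : ℕ → ℂ := fun n => ((ArithmeticFunction.vonMangoldt n : ℝ) : ℂ) * χ n * (n : ℂ)^(-(1/2 + a + t * I) : ℂ) with hcn
  set Φ : ℝ → ℂ := fun τ => E2 Δ (1 + τ * I) / (1 + τ * I)^2 with hΦ
  set Fn : ℕ → ℝ → ℂ := fun n τ => cn n * (Complex.exp (-(Real.log n) * (1 + τ * I)) * Φ τ) with hFn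
  have hcn0 : cn 0 = 0 := by simp [hcn]
  have hFi : ∀ n, MeasureTheory.Integrable (Fn n) := by
    intro n
    rcases eq_or_ne n 0 with rfl | hn
    · simp only [hFn, hcn0, zero_mul]; exact MeasureTheory.integrable_zero _ _ _
    · exact (term_int hn).1.const_mul _
  have hFnorm : ∀ n (τ : ℝ), ‖Fn n τ‖ ≤ (ArithmeticFunction.vonMangoldt n * (n:ℝ)^(-(3/2):ℝ)) * ‖Φ τ‖ := by
    intro n τ
    rcases eq_or_ne n 0 with rfl | hn
    · simp [hFn, hcn0]
    have hn0 : (0:ℝ) < n := by exact_mod_cast Nat.pos_of_ne_zero hn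
    have hn1 : (1:ℝ) ≤ n := by exact_mod_cast Nat.one_le_iff_ne_zero.2 hn
    simp only [hFn, hcn, norm_mul]
    rw [Complex.norm_exp, Complex.norm_natCast_cpow_of_pos (Nat.pos_of_ne_zero hn), Complex.norm_real,
      Real.norm_of_nonneg ArithmeticFunction.vonMangoldt_nonneg]
    have e1 : (-((Real.log n : ℝ):ℂ) * (1 + τ * I)).re = -Real.log n := by
      rw [← Complex.ofReal_neg, Complex.re_ofReal_mul]; simp
    have e2 : (-(1/2 + a + t * I) : ℂ).re = -(1/2 + a) := by simp
    rw [e1, e2, Real.exp_neg, Real.exp_log hn0, ← Real.rpow_neg_one]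
    have h3 : (n:ℝ)^(-(1/2 + a)) * (n:ℝ)^(-1:ℝ) ≤ (n:ℝ)^(-(3/2):ℝ) := by
      rw [← Real.rpow_add hn0]; apply Real.rpow_le_rpow_of_exponent_le hn1; linarith
    have h4 := χ.norm_le_one (n : ZMod q)
    have h5 := ArithmeticFunction.vonMangoldt_nonneg (n := n)
    calc ArithmeticFunction.vonMangoldt n * ‖χ n‖ * (n:ℝ)^(-(1/2 + a)) * ((n:ℝ)^(-1:ℝ) * ‖Φ τ‖)
        = (ArithmeticFunction.vonMangoldt n * ‖χ n‖) * ((n:ℝ)^(-(1/2 + a)) * (n:ℝ)^(-1:ℝ)) * ‖Φ τ‖ := by ring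
      _ ≤ (ArithmeticFunction.vonMangoldt n * 1) * ((n:ℝ)^(-(3/2):ℝ)) * ‖Φ τ‖ := by gcongr
      _ = _ := by ring
  have hsum : Summable fun n => ∫ τ : ℝ, ‖Fn n τ‖ := by
    refine Summable.of_nonneg_of_le (fun n => MeasureTheory.integral_nonneg fun _ => norm_nonneg _) (fun n => ?_) (V32_summable.mul_right (∫ τ : ℝ, ‖Φ τ‖))
    rw [← MeasureTheory.integral_const_mul]
    exact MeasureTheory.integral_mono (hFi n).norm (E2_int.norm.const_mul _) (hFnorm n)
  have hS := MeasureTheory.hasSum_integral_of_summable_integral_norm hFi hsum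
  have hval : ∀ n, ∫ τ : ℝ, Fn n τ = cn n * (2 * π * kap Δ n) := by
    intro n
    rcases eq_or_ne n 0 with rfl | hn
    · simp [hFn, hcn0]
    · simp only [hFn]
      rw [MeasureTheory.integral_const_mul, (term_int hn).2]; push_cast; ring
  simp_rw [hval] at hS
  have hpt : ∀ τ : ℝ, (fL χ t ((a + 1 : ℝ) + τ * I) * E2 Δ ((a + 1 : ℝ) + τ * I - a)) / ((a + 1 : ℝ) + τ * I - a)^2 = ∑' n, Fn n τ := by
    intro τ
    rw [show (((a + 1 : ℝ) : ℂ) + τ * I - a) = 1 + τ * I by push_cast; ring, mul_div_assoc]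
    unfold fL
    rw [LSeries_vM χ (by simp; linarith), LSeries, ← tsum_mul_right]
    refine tsum_congr fun n => ?_
    rcases eq_or_ne n 0 with rfl | hn
    · simp [hFn, hcn0]
    have hnC : (n:ℂ) ≠ 0 := by exact_mod_cast hn
    rw [LSeries.term_of_ne_zero hn]
    simp only [hFn, hcn, Pi.mul_apply, hΦ]
    have : ((n:ℂ)^(1/2 + (((a + 1 : ℝ):ℂ) + τ * I) + t * I))⁻¹ = (n : ℂ)^(-(1/2 + a + t * I) : ℂ) * Complex.exp (-(Real.log n) * (1 + τ * I)) := by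
      rw [← Complex.cpow_neg, Complex.cpow_def_of_ne_zero hnC, Complex.cpow_def_of_ne_zero hnC, ← Complex.exp_add, ← Complex.natCast_log]
      congr 1; push_cast; ring
    rw [div_eq_mul_inv, this]
    ring
  simp_rw [hpt]
  rw [← hS.tsum_eq, tsum_eq_sum (s := Finset.Icc 1 ⌊Real.exp Δ⌋₊)]
  · unfold RL
    rw [Finset.mul_sum]
    refine Finset.sum_congr rfl fun n _ => ?_
    simp only [hcn]; ring
  · intro n hn
    rcases eq_or_ne n 0 with rfl | hn0
    · simp [hcn0]
    · rw [kap_zero hΔ]; simp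
      by_contra h
      apply hn
      rw [Finset.mem_Icc]
      exact ⟨Nat.one_le_iff_ne_zero.2 hn0, Nat.le_floor (not_le.1 h).le⟩

theorem approx {q : ℕ} [NeZero q] {χ : DirichletCharacter ℂ q} (hχ : χ ≠ 1) (hRH : dirichletRH χ) (t : ℝ)
    {ε a Δ : ℝ} (hε : 0 < ε) (ha : ε < a) (hΔ : 0 < Δ) :
    ‖fL χ t a - RL χ Δ t a‖ ≤ 4 / (Δ * (a - ε)) * Real.exp (-((a - ε) * Δ / 2)) * (2 * (BL q t a).re - (fL χ t a).re) := by
  have ha0 : 0 < a := by linarith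
  obtain ⟨K, hK0, hKf, hKB⟩ := growth hχ hRH t hε
  have hfd := fL_diff hχ hRH t
  have hBd := BL_diff q t
  have hcb := conj_bound (f := fL χ t) (H := fun z => 2 * BL q t z - fL χ t z) (K := 3 * K) hfd
    ((hBd.const_mul 2).sub hfd) hε ha hΔ (by linarith)
    (fun z hz => (hKf z hz).trans (by
      have : 0 ≤ ‖z‖^(1/2:ℝ) := by positivity
      nlinarith [mul_nonneg hK0 this]))
    (fun z hz => by
      refine (norm_sub_le _ _).trans ?_
      rw [norm_mul]
      have h2 : ‖(2:ℂ)‖ = 2 := by simp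
      rw [h2]
      linarith [hKf z hz, hKB z hz])
    (fun z hz => by
      have hz0 : 0 < z.re := by linarith
      have h1 := fL_re_le hχ hRH t hz0
      have h2 := BL_re_nonneg q t hz0.le
      have e : (2 * BL q t z - fL χ t z).re = 2 * (BL q t z).re - (fL χ t z).re := by simp
      rw [e, abs_le]; constructor <;> linarith)
  have e : (2 * BL q t a - fL χ t a).re = 2 * (BL q t a).re - (fL χ t a).re := by simp
  rw [e] at hcb
  set F : ℂ → ℂ := fun z => fL χ t z * E2 Δ (z - a) with hF
  have hE : Differentiable ℂ fun z : ℂ => E2 Δ (z - a) := (E2_diff Δ).comp (by fun_prop)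
  have hFd : DifferentiableOn ℂ F {z | 0 < z.re} := hfd.mul hE.differentiableOn
  have hEb : ∀ z : ℂ, z.re ≤ a + 1 → ‖E2 Δ (z - a)‖ ≤ 2 / Δ * (Real.exp Δ + Real.exp Δ) := by
    intro z hz
    unfold E2
    rw [norm_mul]
    have h1 : ‖(2 / Δ : ℂ)‖ = 2 / Δ := by
      rw [show (2 / Δ : ℂ) = ((2 / Δ : ℝ) : ℂ) by push_cast; rfl, Complex.norm_real, Real.norm_eq_abs, abs_of_pos (by positivity)]
    rw [h1]
    apply mul_le_mul_of_nonneg_left _ (by positivity)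
    refine (norm_sub_le _ _).trans (add_le_add ?_ ?_)
    · rw [Complex.norm_exp]
      apply Real.exp_le_exp.2
      simp; nlinarith
    · rw [Complex.norm_exp]
      apply Real.exp_le_exp.2
      rw [show ((z - a) * ((Δ:ℂ) / 2)) = (z - a) * ((Δ / 2 : ℝ) : ℂ) by push_cast; ring]; simp; nlinarith
  obtain ⟨_, r2⟩ := residue2 (F := F) hFd (c := a + 1) (K := K * (2 / Δ * (Real.exp Δ + Real.exp Δ))) hε ha (by linarith) (by positivity) (by
      intro z hz hzc
      simp only [hF]
      rw [norm_mul]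
      calc ‖fL χ t z‖ * ‖E2 Δ (z - a)‖ ≤ (K * ‖z‖^(1/2:ℝ)) * (2 / Δ * (Real.exp Δ + Real.exp Δ)) :=
            mul_le_mul (hKf z hz) (hEb z hzc) (norm_nonneg _) (by positivity)
        _ = _ := by ring) (by simp [hF, E2])
  have hder : deriv F a = fL χ t a := by
    have h1 : DifferentiableAt ℂ (fL χ t) a := hfd.differentiableAt
      ((isOpen_lt continuous_const Complex.continuous_re).mem_nhds (by simpa using ha0))
    have h2 : HasDerivAt (fun z : ℂ => E2 Δ (z - a)) 1 a := by
      unfold E2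
      have g1 : HasDerivAt (fun z : ℂ => (z - a) * (Δ:ℂ)) (1 * (Δ:ℂ)) a := ((hasDerivAt_id (a:ℂ)).sub_const _).mul_const _
      have g2 : HasDerivAt (fun z : ℂ => (z - a) * ((Δ:ℂ)/2)) (1 * ((Δ:ℂ)/2)) a := ((hasDerivAt_id (a:ℂ)).sub_const _).mul_const _
      have := (g1.cexp.sub g2.cexp).const_mul (2 / Δ : ℂ)
      refine HasDerivAt.congr_deriv this ?_
      have hΔ0 : (Δ:ℂ) ≠ 0 := by exact_mod_cast hΔ.ne'
      rw [sub_self, zero_mul, zero_mul, Complex.exp_zero]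
      field_simp
      ring
    have := (h1.hasDerivAt.mul h2).deriv
    simp only [hF]
    rw [show (fun z => fL χ t z * E2 Δ (z - a)) = (fL χ t * fun z => E2 Δ (z - a)) from rfl, this]
    simp [E2]
  rw [hder] at r2
  have hs := series_int χ hΔ t ha0
  simp only [hF] at r2
  rw [hs] at r2
  have hpi := Real.pi_pos
  have e3 : (2 * π : ℂ) * (fL χ t a - RL χ Δ t a) = -∫ τ : ℝ, (fL χ t (ε + τ * I) * E2 Δ (ε + τ * I - a)) / (ε + τ * I - a)^2 := by
    rw [mul_sub, r2]; ring
  have e4 : 2 * π * ‖fL χ t a - RL χ Δ t a‖ = ‖∫ τ : ℝ, (fL χ t (ε + τ * I) * E2 Δ (ε + τ * I - a)) / (ε + τ * I - a)^2‖ := by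
    rw [← norm_neg (∫ τ : ℝ, _), ← e3, norm_mul]
    congr 1
    rw [show (2 * π : ℂ) = ((2 * π : ℝ) : ℂ) by push_cast; rfl, Complex.norm_real, Real.norm_eq_abs, abs_of_pos (by positivity)]
  have e5 : 2 * π * ‖fL χ t a - RL χ Δ t a‖ ≤ 2 * π * (4 / (Δ * (a - ε)) * Real.exp (-((a - ε) * Δ / 2)) * (2 * (BL q t a).re - (fL χ t a).re)) := by
    rw [e4]; refine hcb.trans (le_of_eq (by ring))
  exact le_of_mul_le_mul_left e5 (by positivity)

end

section
open Complex Real Finset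

theorem harnack {g : ℂ → ℂ} (hg : DifferentiableOn ℂ g {z | 0 < z.re}) {ε a a' K : ℝ} (hε : 0 < ε) (ha : ε < a) (haa : a ≤ a')
    (hK0 : 0 ≤ K) (hK : ∀ z : ℂ, ε ≤ z.re → ‖g z‖ ≤ K * ‖z‖^(1/2:ℝ)) (hg0 : ∀ z : ℂ, ε ≤ z.re → 0 ≤ (g z).re) :
    (g a').re / (a' - ε) ≤ (g a).re / (a - ε) := by
  obtain ⟨i1, p1⟩ := poisson_re hg hε ha hK0 hK
  obtain ⟨i2, p2⟩ := poisson_re hg hε (ha.trans_le haa) hK0 hK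
  have hb : 0 < a - ε := by linarith
  have hb' : 0 < a' - ε := by linarith
  have e1 : π * ((g a).re / (a - ε)) = ∫ τ : ℝ, (a - ε)⁻¹ * ((g (ε + τ * I)).re * ((a - ε) / ((a-ε)^2 + τ^2))) := by
    rw [MeasureTheory.integral_const_mul, p1]; ring
  have e2 : π * ((g a').re / (a' - ε)) = ∫ τ : ℝ, (a' - ε)⁻¹ * ((g (ε + τ * I)).re * ((a' - ε) / ((a'-ε)^2 + τ^2))) := by
    rw [MeasureTheory.integral_const_mul, p2]; ring
  have : π * ((g a').re / (a' - ε)) ≤ π * ((g a).re / (a - ε)) := by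
    rw [e1, e2]
    refine MeasureTheory.integral_mono (i2.const_mul _) (i1.const_mul _) fun τ => ?_
    have h0 := hg0 (ε + τ * I) (by simp)
    have f1 : (a - ε)⁻¹ * ((g (ε + τ * I)).re * ((a - ε) / ((a-ε)^2 + τ^2))) = (g (ε + τ * I)).re / ((a-ε)^2 + τ^2) := by
      field_simp
    have f2 : (a' - ε)⁻¹ * ((g (ε + τ * I)).re * ((a' - ε) / ((a'-ε)^2 + τ^2))) = (g (ε + τ * I)).re / ((a'-ε)^2 + τ^2) := by
      field_simp
    simp only
    rw [f1, f2]
    have : 0 < (a-ε)^2 + τ^2 := by positivity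
    gcongr
  exact le_of_mul_le_mul_left this Real.pi_pos

lemma mvt_ge {f f' : ℝ → ℝ} {x y C : ℝ} (hxy : x ≤ y) (hf : ∀ a ∈ Set.Icc x y, HasDerivAt f (f' a) a)
    (hC : ∀ a ∈ Set.Icc x y, C ≤ f' a) : C * (y - x) ≤ f y - f x := by
  refine (convex_Icc x y).mul_sub_le_image_sub_of_le_deriv (fun a ha => (hf a ha).continuousAt.continuousWithinAt)
    (fun a ha => (hf a (interior_subset ha)).differentiableAt.differentiableWithinAt) (fun a ha => ?_) x ⟨le_rfl, hxy⟩ y ⟨hxy, le_rfl⟩ hxy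
  rw [(hf a (interior_subset ha)).deriv]; exact hC a (interior_subset ha)

lemma L_upper {q : ℕ} [NeZero q] (χ : DirichletCharacter ℂ q) {s : ℂ} (hs : 3/2 ≤ s.re) :
    ‖DirichletCharacter.LFunction χ s‖ ≤ Z32 := by
  rw [DirichletCharacter.LFunction_eq_LSeries χ (by linarith)]
  exact LSeries_norm_le_of (g := fun _ => 1) (fun n => χ.norm_le_one _) Z32_summable hs

noncomputable def uL {q : ℕ} [NeZero q] (χ : DirichletCharacter ℂ q) (t a : ℝ) : ℝ :=
  Real.log ‖DirichletCharacter.LFunction χ (1/2 + a + t * I)‖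

lemma uL_deriv {q : ℕ} [NeZero q] {χ : DirichletCharacter ℂ q} (hχ : χ ≠ 1) (hRH : dirichletRH χ) (t : ℝ) {a : ℝ} (ha : 0 < a) :
    HasDerivAt (uL χ t) (-(fL χ t a).re) a := by
  set L := DirichletCharacter.LFunction χ with hL
  set s0 : ℂ := 1/2 + a + t * I with hs0
  have hne : ∀ x : ℝ, 0 < x → L (1/2 + x + t * I) ≠ 0 := fun x hx => L_ne_zero hχ hRH (by simp; linarith)
  have hd := DirichletCharacter.differentiable_LFunction hχ
  have h1 : HasDerivAt (fun z : ℂ => L (1/2 + z + t * I)) (deriv L s0) (a : ℂ) := by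
    have h2 : HasDerivAt (fun z : ℂ => (1/2 + z + t * I : ℂ)) 1 (a:ℂ) := ((hasDerivAt_id (a:ℂ)).const_add _).add_const _
    have h3 : HasDerivAt L (deriv L s0) s0 := (hd s0).hasDerivAt
    have h5 := h3.comp (a:ℂ) h2
    rw [mul_one] at h5
    exact h5
  have h4 : HasDerivAt (fun z : ℂ => Complex.log (L (1/2 + z + t * I) / L s0)) (deriv L s0 / L s0) (a : ℂ) := by
    have h5 := (h1.div_const (L s0)).clog (by rw [div_self (hne a ha)]; exact Complex.one_mem_slitPlane)
    rw [div_self (hne a ha), div_one] at h5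
    exact h5
  have h6 := (h4.real_of_complex).const_add (Real.log ‖L s0‖)
  have h7 : (deriv L s0 / L s0).re = -(fL χ t a).re := by
    unfold fL; simp [hL, hs0]
  rw [h7] at h6
  refine h6.congr_of_eventuallyEq ?_
  filter_upwards [lt_mem_nhds ha] with x hx
  rw [Complex.log_re, norm_div, Real.log_div (norm_ne_zero_iff.2 (hne x hx)) (norm_ne_zero_iff.2 (hne a ha))]
  unfold uL; ring

noncomputable def DL {q : ℕ} (χ : DirichletCharacter ℂ q) (Δ t a : ℝ) : ℂ :=
  ∑ n ∈ Finset.Icc 1 ⌊Real.exp Δ⌋₊, ((ArithmeticFunction.vonMangoldt n / Real.log n * kap Δ n : ℝ) : ℂ) * χ n * (n : ℂ)^(-(1/2 + a + t * I) : ℂ)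

lemma DL_deriv {q : ℕ} (χ : DirichletCharacter ℂ q) (Δ t a : ℝ) :
    HasDerivAt (fun a => (DL χ Δ t a).re) (-(RL χ Δ t a).re) a := by
  have h : HasDerivAt (fun z : ℂ => ∑ n ∈ Finset.Icc 1 ⌊Real.exp Δ⌋₊, ((ArithmeticFunction.vonMangoldt n / Real.log n * kap Δ n : ℝ) : ℂ) * χ n * (n : ℂ)^(-(1/2 + z + t * I) : ℂ))
      (-(RL χ Δ t a)) (a:ℂ) := by
    unfold RL
    rw [← Finset.sum_neg_distrib]
    apply HasDerivAt.fun_sum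
    intro n hn
    have hn1 : 1 ≤ n := (Finset.mem_Icc.1 hn).1
    have h2 : HasDerivAt (fun z : ℂ => (-(1/2 + z + t * I) : ℂ)) (-1) (a:ℂ) :=
      (((hasDerivAt_id (a:ℂ)).const_add _).add_const _).neg
    have h3 := (h2.const_cpow (c := (n:ℂ)) (Or.inl (by exact_mod_cast (by omega : n ≠ 0)))).const_mul
      (((ArithmeticFunction.vonMangoldt n / Real.log n * kap Δ n : ℝ) : ℂ) * χ n)
    refine h3.congr_deriv ?_
    rw [← Complex.natCast_log]
    rcases eq_or_lt_of_le hn1 with rfl | hn2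
    · simp
    · have : (Real.log n : ℂ) ≠ 0 := by
        exact_mod_cast (Real.log_pos (by exact_mod_cast hn2)).ne'
      rw [Complex.ofReal_mul, Complex.ofReal_div]
      field_simp
  exact (h.real_of_complex).congr_deriv (by simp)

lemma vM_div_log_le (n : ℕ) : 0 ≤ ArithmeticFunction.vonMangoldt n / Real.log n ∧ ArithmeticFunction.vonMangoldt n / Real.log n ≤ 1 := by
  have h0 : 0 ≤ Real.log n := Real.log_natCast_nonneg n
  exact ⟨div_nonneg ArithmeticFunction.vonMangoldt_nonneg h0, div_le_one_of_le₀ ArithmeticFunction.vonMangoldt_le_log h0⟩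

lemma DL_bound {q : ℕ} (χ : DirichletCharacter ℂ q) {Δ : ℝ} (hΔ : 0 < Δ) (t : ℝ) {a : ℝ} (ha : 1 ≤ a) : ‖DL χ Δ t a‖ ≤ Z32 := by
  unfold DL
  refine (norm_sum_le _ _).trans ?_
  refine le_trans (Finset.sum_le_sum fun n hn => ?_) (Z32_summable.sum_le_tsum (Finset.Icc 1 ⌊Real.exp Δ⌋₊) (fun n _ => by positivity))
  have hn1 : 1 ≤ n := (Finset.mem_Icc.1 hn).1
  rw [norm_mul, norm_mul, Complex.norm_natCast_cpow_of_pos (by omega), Complex.norm_real, Real.norm_eq_abs]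
  have h1 := vM_div_log_le n
  have h2 := kap_nonneg hΔ n
  have h3 := kap_le_one hΔ n
  have h4 : ArithmeticFunction.vonMangoldt n / Real.log n * kap Δ n ≤ 1 := mul_le_one₀ h1.2 h2 h3
  rw [abs_of_nonneg (mul_nonneg h1.1 h2)]
  have e2 : (-(1/2 + a + t * I) : ℂ).re = -(1/2 + a) := by simp
  rw [e2]
  have h5 : (n:ℝ)^(-(1/2 + a)) ≤ (n:ℝ)^(-(3/2):ℝ) := Real.rpow_le_rpow_of_exponent_le (by exact_mod_cast hn1) (by linarith)
  have h6 := χ.norm_le_one (n : ZMod q)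
  have h7 := mul_le_one₀ h4 (norm_nonneg _) h6
  exact mul_le_mul h7 h5 (by positivity) (by norm_num)

theorem claimA0 {q : ℕ} [NeZero q] {χ : DirichletCharacter ℂ q} (hχ : χ ≠ 1) (hRH : dirichletRH χ) (t : ℝ)
    {a0 Δ : ℝ} (ha0 : 0 < a0) (ha0' : a0 ≤ 1/2) (hΔ : 1 ≤ Δ) :
    uL χ t a0 ≤ (DL χ Δ t (a0 + 8 / Δ)).re + (Real.log Z32 + Z32) +
      10 / Δ * (A0 * (Real.log q + Real.log 2 + Real.log (13 + |t|))) := by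
  have hΔ0 : 0 < Δ := by linarith
  set a1 := a0 + 8 / Δ with ha1
  set ε := a1 / 4 with hε
  set B0 := A0 * (Real.log q + Real.log 2 + Real.log (13 + |t|)) with hB0
  have h8 : 0 < 8 / Δ := by positivity
  have h8' : 8 / Δ ≤ 8 := by rw [div_le_iff₀ hΔ0]; linarith
  have ha10 : 0 < a1 := by linarith
  have hε0 : 0 < ε := by linarith
  have hB : ∀ a : ℝ, 0 < a → a ≤ 10 → (BL q t a).re ≤ B0 := by
    intro a h0 h10
    rw [BL_re]
    apply mul_le_mul_of_nonneg_left _ A0_pos.le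
    have h3 := (norm_z3 (z := a) (by simpa using h0.le) t).1
    have h4 : ‖(a + 3 + t * I : ℂ)‖ ≤ 13 + |t| := by
      refine (norm_add_le _ _).trans ?_
      have e1 : ‖(a + 3 : ℂ)‖ = a + 3 := by
        rw [show (a + 3 : ℂ) = ((a + 3 : ℝ) : ℂ) by push_cast; rfl, Complex.norm_real, Real.norm_eq_abs, abs_of_pos (by linarith)]
      rw [e1]; simp; linarith
    linarith [Real.log_le_log (by linarith) h4]
  have hB0' : 0 ≤ B0 := (BL_re_nonneg q t (z := a1) (by simpa using ha10.le)).trans (hB a1 ha10 (by linarith))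
  obtain ⟨K, hK0, hKf, hKB⟩ := growth hχ hRH t hε0
  set g : ℂ → ℂ := fun z => BL q t z - fL χ t z with hg
  have hgd : DifferentiableOn ℂ g {z | 0 < z.re} := (BL_diff q t).sub (fL_diff hχ hRH t)
  have hgK : ∀ z : ℂ, ε ≤ z.re → ‖g z‖ ≤ (2 * K) * ‖z‖^(1/2:ℝ) := fun z hz => by
    refine (norm_sub_le _ _).trans ?_
    linarith [hKf z hz, hKB z hz]
  have hgre : ∀ z : ℂ, (g z).re = (BL q t z).re - (fL χ t z).re := fun z => by simp [hg]
  have hg0 : ∀ z : ℂ, 0 < z.re → 0 ≤ (g z).re := fun z hz => by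
    rw [hgre]; linarith [fL_re_le hχ hRH t hz]
  have hH : ∀ a a' : ℝ, ε < a → a ≤ a' → (g a').re / (a' - ε) ≤ (g a).re / (a - ε) := fun a a' h1 h2 =>
    harnack hgd hε0 h1 h2 (by linarith) hgK (fun z hz => hg0 z (by linarith))
  set G1 := (g a1).re with hG1
  have hG10 : 0 ≤ G1 := hg0 _ (by simpa using ha10)
  -- step 1
  have s1 : uL χ t a0 ≤ uL χ t (a1 - 4 / Δ) + B0 * (4 / Δ) := by
    have e : a1 - 4 / Δ - a0 = 4 / Δ := by rw [ha1]; ring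
    have := mvt_ge (f := uL χ t) (f' := fun a => -(fL χ t a).re) (x := a0) (y := a1 - 4 / Δ) (C := -B0) (by
      have : 0 < 4 / Δ := by positivity
      linarith) (fun a ha => uL_deriv hχ hRH t (by linarith [ha.1])) (fun a ha => by
      have h0 : 0 < a := by linarith [ha.1]
      have h1 : a ≤ 10 := by
        have : 0 < 4 / Δ := by positivity
        linarith [ha.2]
      have h2 := fL_re_le hχ hRH t (z := a) (by simpa using h0)
      linarith [hB a h0 h1])
    rw [e] at this
    linarith
  have s2 : uL χ t (a1 - 4 / Δ) ≤ uL χ t a1 + B0 * (4 / Δ) - G1 / 3 * (4 / Δ) := by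
    have h4 : 0 < 4 / Δ := by positivity
    have h48 : 4 / Δ = (8 / Δ) / 2 := by ring
    have := mvt_ge (f := uL χ t) (f' := fun a => -(fL χ t a).re) (x := a1 - 4 / Δ) (y := a1) (C := G1 / 3 - B0) (by
      linarith) (fun a ha => uL_deriv hχ hRH t (by linarith [ha.1])) (fun a ha => by
      have hal : a1 / 2 ≤ a := by linarith [ha.1]
      have h0 : 0 < a := by linarith
      have h1 := hB a h0 (by linarith [ha.2])
      have h2 := hH a a1 (by linarith) ha.2
      have h3 := hgre a
      have h5 : G1 / 3 ≤ (g a).re := by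
        rw [div_le_div_iff₀ (by linarith) (by linarith)] at h2
        have h6 : G1 * (a - ε) ≥ G1 * (a1 / 4) := mul_le_mul_of_nonneg_left (by linarith) hG10
        have h7 : (g a).re * (a1 - ε) = (g a).re * 3 * (a1 / 4) := by rw [hε]; ring
        have h8 : G1 * (a1 / 4) ≤ (g a).re * 3 * (a1 / 4) := by linarith
        have := le_of_mul_le_mul_right h8 (by linarith)
        linarith
      linarith)
    have e : a1 - (a1 - 4 / Δ) = 4 / Δ := by ring
    rw [e] at this
    linarith
  -- step 3
  set c := 4 / Δ * ((G1 + B0) / (a1 - ε)) with hc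
  have hb1 : 6 / Δ ≤ a1 - ε := by
    have : 6 / Δ = 3/4 * (8 / Δ) := by ring
    linarith
  have h6 : 0 < 6 / Δ := by positivity
  have hb10 : 0 < a1 - ε := by linarith
  have hc0 : 0 ≤ c := by positivity
  have s3 : uL χ t a1 - (DL χ Δ t a1).re - c * (2 / Δ) * Real.exp (-((a1 - ε) * Δ / 2)) ≤
      uL χ t 10 - (DL χ Δ t 10).re - c * (2 / Δ) * Real.exp (-((10 - ε) * Δ / 2)) := by
    have := mvt_ge (f := fun a => uL χ t a - (DL χ Δ t a).re - c * (2 / Δ) * Real.exp (-((a - ε) * Δ / 2)))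
      (f' := fun a => -(fL χ t a).re - -(RL χ Δ t a).re - c * (2 / Δ) * (Real.exp (-((a - ε) * Δ / 2)) * (-(1 * Δ / 2))))
      (x := a1) (y := 10) (C := 0) (by linarith) (fun a ha => by
        have hd : HasDerivAt (fun a : ℝ => -((a - ε) * Δ / 2)) (-(1 * Δ / 2)) a :=
          ((((hasDerivAt_id a).sub_const ε).mul_const Δ).div_const 2).neg
        exact ((uL_deriv hχ hRH t (by linarith [ha.1])).sub (DL_deriv χ Δ t a)).sub ((hd.exp).const_mul _)) (fun a ha => by
        have h0 : 0 < a := by linarith [ha.1]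
        have haε : ε < a := by linarith [ha.1]
        have happ := approx hχ hRH t hε0 haε hΔ0
        have hre := (Complex.abs_re_le_norm (fL χ t a - RL χ Δ t a)).trans happ
        have hre2 := (le_abs_self _).trans hre
        rw [Complex.sub_re] at hre2
        have hb := hB a h0 ha.2
        have hh := hH a1 a (by linarith) ha.1
        have hbn : 0 ≤ (BL q t a).re := BL_re_nonneg q t (by simpa using h0.le)
        have key : 4 / (Δ * (a - ε)) * Real.exp (-((a - ε) * Δ / 2)) * (2 * (BL q t a).re - (fL χ t a).re) ≤ c * Real.exp (-((a - ε) * Δ / 2)) := by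
          have e1 : 2 * (BL q t a).re - (fL χ t a).re = (g a).re + (BL q t a).re := by rw [hgre]; ring
          rw [e1]
          have e2 : 4 / (Δ * (a - ε)) * Real.exp (-((a - ε) * Δ / 2)) * ((g a).re + (BL q t a).re) =
            4 / Δ * ((g a).re / (a - ε) + (BL q t a).re / (a - ε)) * Real.exp (-((a - ε) * Δ / 2)) := by
            have : a - ε ≠ 0 := by linarith
            field_simp
          rw [e2]
          have e3 : (BL q t a).re / (a - ε) ≤ B0 / (a1 - ε) := by
            apply div_le_div₀ hB0' hb hb10 (by linarith [ha.1])
          have e4 : (g a).re / (a - ε) + (BL q t a).re / (a - ε) ≤ (G1 + B0) / (a1 - ε) := by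
            rw [add_div]; linarith
          rw [hc]
          gcongr
        have e5 : c * (2 / Δ) * (Real.exp (-((a - ε) * Δ / 2)) * (-(1 * Δ / 2))) = - (c * Real.exp (-((a - ε) * Δ / 2))) := by
          field_simp
        rw [e5]
        linarith)
    simp only [zero_mul] at this
    linarith
  have s4 : c * (2 / Δ) * Real.exp (-((a1 - ε) * Δ / 2)) ≤ (G1 + B0) * (4 / (3 * Δ)) := by
    have h1 : Real.exp (-((a1 - ε) * Δ / 2)) ≤ 1 := by
      apply Real.exp_le_one_iff.2
      have : 0 < (a1 - ε) * Δ := by positivity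
      linarith
    have h2 : c ≤ 4 / Δ * ((G1 + B0) / (6 / Δ)) := by rw [hc]; gcongr
    have h3 : 4 / Δ * ((G1 + B0) / (6 / Δ)) = (G1 + B0) * (2/3) := by field_simp; ring
    have h4 : (G1 + B0) * (2/3) * (2 / Δ) = (G1 + B0) * (4 / (3 * Δ)) := by field_simp; ring
    have h5 : c * (2 / Δ) ≤ (G1 + B0) * (4 / (3 * Δ)) := by
      rw [← h4]; rw [h3] at h2; gcongr
    refine le_trans (mul_le_of_le_one_right (by positivity) h1) h5
  have s5 : uL χ t 10 ≤ Real.log Z32 := by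
    unfold uL
    apply Real.log_le_log
    · apply norm_pos_iff.2
      apply L_ne_zero hχ hRH; norm_num
    · apply L_upper; norm_num
  have s6 := DL_bound χ hΔ0 t (a := 10) (by norm_num)
  have s7 := (abs_le.1 ((Complex.abs_re_le_norm _).trans s6)).1
  have s8 : 0 ≤ c * (2 / Δ) * Real.exp (-((10 - ε) * Δ / 2)) := by positivity
  have e9 : G1 / 3 * (4 / Δ) = G1 * (4 / (3 * Δ)) := by field_simp
  have e10 : 10 / Δ * B0 = B0 * (4 / Δ) + B0 * (4 / Δ) + B0 * (4 / (3 * Δ)) + B0 * (2 / (3 * Δ)) := by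
    field_simp; ring
  have e11 : 0 ≤ B0 * (2 / (3 * Δ)) := by positivity
  rw [e10]
  linarith

end

section
open Complex Real Finset

/-- coefficientwise majorant -/
def Maj {R : Type*} [NormedCommRing R] (f : MonoidAlgebra R ℕ) (F : MonoidAlgebra ℝ ℕ) : Prop :=
  ∀ n, ‖f.coeff n‖ ≤ F.coeff n

lemma coeff_mul_big {R : Type*} [CommSemiring R] (f g : MonoidAlgebra R ℕ) (S T : Finset ℕ)
    (hS : f.coeff.support ⊆ S) (hT : g.coeff.support ⊆ T) (n : ℕ) :
    (f * g).coeff n = ∑ a ∈ S, ∑ b ∈ T, if a * b = n then f.coeff a * g.coeff b else 0 := by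
  rw [MonoidAlgebra.coeff_mul, Finsupp.sum]
  rw [Finset.sum_subset hS]
  · refine Finset.sum_congr rfl fun a _ => ?_
    rw [Finsupp.sum, Finset.sum_subset hT]
    intro b _ hb
    simp [Finsupp.notMem_support_iff.1 hb]
  · intro a _ ha
    simp [Finsupp.notMem_support_iff.1 ha, Finsupp.sum]

section maj
variable {R : Type*} [NormedCommRing R]

lemma Maj.nonneg {f : MonoidAlgebra R ℕ} {F : MonoidAlgebra ℝ ℕ} (h : Maj f F) (n : ℕ) :
    0 ≤ F.coeff n := (norm_nonneg _).trans (h n)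

lemma maj_self {F : MonoidAlgebra ℝ ℕ} (h : ∀ n, 0 ≤ F.coeff n) : Maj F F := fun n => by
  rw [Real.norm_of_nonneg (h n)]

lemma Maj.self {f : MonoidAlgebra R ℕ} {F : MonoidAlgebra ℝ ℕ} (h : Maj f F) : Maj F F :=
  maj_self h.nonneg

lemma Maj.trans {f : MonoidAlgebra R ℕ} {F G : MonoidAlgebra ℝ ℕ} (h : Maj f F) (h' : Maj F G) :
    Maj f G := fun n => (h n).trans ((le_abs_self _).trans (h' n))

lemma Maj.zero : Maj (0 : MonoidAlgebra R ℕ) 0 := fun n => by simp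

lemma Maj.add {f g : MonoidAlgebra R ℕ} {F G : MonoidAlgebra ℝ ℕ} (h : Maj f F) (h' : Maj g G) :
    Maj (f + g) (F + G) := fun n => by
  simp only [MonoidAlgebra.coeff_add, Finsupp.add_apply]
  exact (norm_add_le _ _).trans (add_le_add (h n) (h' n))

lemma Maj.sum {ι : Type*} (s : Finset ι) {f : ι → MonoidAlgebra R ℕ} {F : ι → MonoidAlgebra ℝ ℕ}
    (h : ∀ i ∈ s, Maj (f i) (F i)) : Maj (∑ i ∈ s, f i) (∑ i ∈ s, F i) := fun n => by
  simp only [MonoidAlgebra.coeff_sum, Finsupp.finsetSum_apply]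
  exact (norm_sum_le _ _).trans (Finset.sum_le_sum fun i hi => h i hi n)

lemma Maj.mul {f g : MonoidAlgebra R ℕ} {F G : MonoidAlgebra ℝ ℕ} (h : Maj f F) (h' : Maj g G) :
    Maj (f * g) (F * G) := fun n => by
  classical
  rw [coeff_mul_big f g (f.coeff.support ∪ F.coeff.support) (g.coeff.support ∪ G.coeff.support)
    subset_union_left subset_union_left, coeff_mul_big F G (f.coeff.support ∪ F.coeff.support)
    (g.coeff.support ∪ G.coeff.support) subset_union_right subset_union_right]
  refine (norm_sum_le _ _).trans (Finset.sum_le_sum fun a _ => ?_)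
  refine (norm_sum_le _ _).trans (Finset.sum_le_sum fun b _ => ?_)
  split_ifs
  · exact (norm_mul_le _ _).trans (mul_le_mul (h a) (h' b) (norm_nonneg _) (h.nonneg a))
  · simp

lemma Maj.one [NormOneClass R] : Maj (1 : MonoidAlgebra R ℕ) 1 := fun n => by
  rw [MonoidAlgebra.one_def, MonoidAlgebra.one_def, MonoidAlgebra.coeff_single,
    MonoidAlgebra.coeff_single]
  by_cases hn : 1 = n
  · subst hn; simp
  · simp [Finsupp.single_apply, hn]

lemma Maj.pow [NormOneClass R] {f : MonoidAlgebra R ℕ} {F : MonoidAlgebra ℝ ℕ} (h : Maj f F)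
    (r : ℕ) : Maj (f ^ r) (F ^ r) := by
  induction r with
  | zero => simpa using Maj.one
  | succ r ih => rw [pow_succ, pow_succ]; exact ih.mul h

lemma Maj.prod [NormOneClass R] {ι : Type*} (s : Finset ι) {f : ι → MonoidAlgebra R ℕ}
    {F : ι → MonoidAlgebra ℝ ℕ}
    (h : ∀ i ∈ s, Maj (f i) (F i)) : Maj (∏ i ∈ s, f i) (∏ i ∈ s, F i) := by
  classical
  induction s using Finset.induction_on with
  | empty => simpa using Maj.one
  | insert a s ha ih =>
    rw [Finset.prod_insert ha, Finset.prod_insert ha]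
    exact (h a (mem_insert_self _ _)).mul (ih fun i hi => h i (mem_insert_of_mem hi))

lemma Maj.smul {f : MonoidAlgebra R ℕ} {F : MonoidAlgebra ℝ ℕ} (h : Maj f F) (c : R) (d : ℝ)
    (hcd : ‖c‖ ≤ d) : Maj (c • f) (d • F) := fun n => by
  rw [MonoidAlgebra.coeff_smul_apply, MonoidAlgebra.coeff_smul_apply]
  exact (norm_mul_le _ _).trans (mul_le_mul hcd (h n) (norm_nonneg _) ((norm_nonneg _).trans hcd))

lemma Maj.single (m : ℕ) (c : R) (d : ℝ) (h : ‖c‖ ≤ d) :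
    Maj (MonoidAlgebra.single m c) (MonoidAlgebra.single m d) := fun n => by
  rw [MonoidAlgebra.coeff_single, MonoidAlgebra.coeff_single]
  by_cases hn : m = n
  · subst hn; simpa using h
  · simp [Finsupp.single_apply, hn]

end maj

/-- truncated exponential -/
noncomputable def TT {𝕜 : Type*} [Field 𝕜] (R : ℕ) (g : MonoidAlgebra 𝕜 ℕ) : MonoidAlgebra 𝕜 ℕ :=
  ∑ r ∈ Finset.range (R + 1), ((r.factorial : 𝕜)⁻¹) • g ^ r

lemma Maj.TT {f : MonoidAlgebra ℂ ℕ} {F : MonoidAlgebra ℝ ℕ} (h : Maj f F) (R : ℕ) :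
    Maj (TT R f) (TT R F) := by
  refine Maj.sum _ fun r _ => (h.pow r).smul _ _ ?_
  simp

lemma Maj.TTr {f : MonoidAlgebra ℝ ℕ} {F : MonoidAlgebra ℝ ℕ} (h : Maj f F) (R : ℕ) :
    Maj (_root_.TT R f) (_root_.TT R F) := by
  refine Maj.sum _ fun r _ => (h.pow r).smul _ _ ?_
  simp

lemma TT_mono {F : MonoidAlgebra ℝ ℕ} (h : Maj F F) {R R' : ℕ} (hR : R ≤ R') :
    Maj (TT R F) (TT R' F) := fun n => by
  rw [Real.norm_of_nonneg ((h.TTr R).nonneg n)]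
  unfold TT
  rw [MonoidAlgebra.coeff_sum, MonoidAlgebra.coeff_sum, Finsupp.finsetSum_apply,
    Finsupp.finsetSum_apply]
  refine Finset.sum_le_sum_of_subset_of_nonneg (Finset.range_subset_range.2 (by omega)) ?_
  intro r _ _
  rw [MonoidAlgebra.coeff_smul_apply]
  exact mul_nonneg (by positivity) ((h.pow r).nonneg n)

lemma TT_add {F G : MonoidAlgebra ℝ ℕ} (hF : Maj F F) (hG : Maj G G) (R : ℕ) :
    Maj (TT R (F + G)) (TT R F * TT R G) := fun n => by
  rw [Real.norm_of_nonneg (((hF.add hG).TTr R).nonneg n)]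
  set c : ℕ × ℕ → MonoidAlgebra ℝ ℕ := fun ab =>
    (((ab.1.factorial : ℝ)⁻¹) • F ^ ab.1) * (((ab.2.factorial : ℝ)⁻¹) • G ^ ab.2) with hc
  have hcn : ∀ ab, 0 ≤ (c ab).coeff n := fun ab =>
    (((hF.pow ab.1).smul ((ab.1.factorial : ℝ)⁻¹) ((ab.1.factorial : ℝ)⁻¹) (by simp)).mul
      ((hG.pow ab.2).smul ((ab.2.factorial : ℝ)⁻¹) ((ab.2.factorial : ℝ)⁻¹) (by simp))).nonneg n
  have e1 : TT R (F + G) = ∑ r ∈ Finset.range (R + 1), ∑ ab ∈ Finset.HasAntidiagonal.antidiagonal r, c ab := by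
    unfold TT
    refine Finset.sum_congr rfl fun r _ => ?_
    rw [(Commute.all F G).add_pow', Finset.smul_sum]
    refine Finset.sum_congr rfl fun ab hab => ?_
    rw [Finset.HasAntidiagonal.mem_antidiagonal] at hab
    simp only [hc]
    rw [smul_mul_smul_comm, ← Nat.cast_smul_eq_nsmul ℝ, smul_smul]
    congr 1
    rw [← hab, Nat.choose_symm_add, Nat.add_choose, Nat.cast_div (Nat.factorial_mul_factorial_dvd_factorial_add _ _)
      (by positivity)]
    push_cast
    field_simp
  have e2 : TT R F * TT R G = ∑ ab ∈ Finset.range (R + 1) ×ˢ Finset.range (R + 1), c ab := by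
    unfold TT
    rw [Finset.sum_mul_sum, Finset.sum_product]
  have e3 : ∑ r ∈ Finset.range (R + 1), ∑ ab ∈ Finset.HasAntidiagonal.antidiagonal r, c ab
      = ∑ ab ∈ (Finset.range (R + 1) ×ˢ Finset.range (R + 1)).filter (fun ab => ab.1 + ab.2 ≤ R),
        c ab := by
    rw [← Finset.sum_fiberwise_of_maps_to (t := Finset.range (R + 1)) (g := fun ab : ℕ × ℕ => ab.1 + ab.2)]
    · refine Finset.sum_congr rfl fun r hr => Finset.sum_congr ?_ fun _ _ => rfl
      ext ⟨a, b⟩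
      simp only [Finset.HasAntidiagonal.mem_antidiagonal, Finset.mem_filter, Finset.mem_product,
        Finset.mem_range] at *
      omega
    · intro ab hab
      simp only [Finset.mem_filter, Finset.mem_range] at *
      omega
  rw [e1, e2, e3, MonoidAlgebra.coeff_sum, MonoidAlgebra.coeff_sum, Finsupp.finsetSum_apply,
    Finsupp.finsetSum_apply]
  exact Finset.sum_le_sum_of_subset_of_nonneg (Finset.filter_subset _ _) fun ab _ _ => hcn ab

lemma TT_zero (R : ℕ) : TT R (0 : MonoidAlgebra ℝ ℕ) = 1 := by
  unfold TT
  rw [Finset.sum_range_succ']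
  simp

lemma TT_sum {ι : Type*} (s : Finset ι) (F : ι → MonoidAlgebra ℝ ℕ)
    (hF : ∀ i ∈ s, Maj (F i) (F i)) (R : ℕ) :
    Maj (TT R (∑ i ∈ s, F i)) (∏ i ∈ s, TT R (F i)) := by
  classical
  induction s using Finset.induction_on with
  | empty => simp only [Finset.sum_empty, Finset.prod_empty, TT_zero]; exact Maj.one
  | insert a s ha ih =>
    rw [Finset.sum_insert ha, Finset.prod_insert ha]
    have h1 := hF a (mem_insert_self _ _)
    have h2 : ∀ i ∈ s, Maj (F i) (F i) := fun i hi => hF i (mem_insert_of_mem hi)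
    exact (TT_add h1 (Maj.sum s h2) R).trans ((h1.TTr R).mul (ih h2))

/-- the squared ℓ² norm of the coefficients -/
noncomputable def N2 {R : Type*} [NormedCommRing R] (f : MonoidAlgebra R ℕ) : ℝ :=
  ∑ n ∈ f.coeff.support, ‖f.coeff n‖ ^ 2

lemma N2_big {R : Type*} [NormedCommRing R] (f : MonoidAlgebra R ℕ) (S : Finset ℕ)
    (hS : f.coeff.support ⊆ S) : N2 f = ∑ n ∈ S, ‖f.coeff n‖ ^ 2 := by
  unfold N2
  refine Finset.sum_subset hS fun n _ hn => ?_
  simp [Finsupp.notMem_support_iff.1 hn]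

lemma N2_nonneg {R : Type*} [NormedCommRing R] (f : MonoidAlgebra R ℕ) : 0 ≤ N2 f :=
  Finset.sum_nonneg fun _ _ => by positivity

lemma Maj.N2 {R : Type*} [NormedCommRing R] {f : MonoidAlgebra R ℕ} {F : MonoidAlgebra ℝ ℕ}
    (h : Maj f F) : N2 f ≤ N2 F := by
  classical
  rw [N2_big f (f.coeff.support ∪ F.coeff.support) subset_union_left,
    N2_big F (f.coeff.support ∪ F.coeff.support) subset_union_right]
  refine Finset.sum_le_sum fun n _ => ?_
  have := h n
  rw [Real.norm_of_nonneg (h.nonneg n)]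
  gcongr

lemma N2_smul (c : ℝ) (F : MonoidAlgebra ℝ ℕ) : N2 (c • F) = c ^ 2 * N2 F := by
  rw [N2_big (c • F) F.coeff.support (by
    intro n hn
    rw [Finsupp.mem_support_iff] at *
    intro h0
    apply hn
    rw [MonoidAlgebra.coeff_smul_apply, h0, smul_zero])]
  unfold N2
  rw [Finset.mul_sum]
  refine Finset.sum_congr rfl fun n _ => ?_
  rw [MonoidAlgebra.coeff_smul_apply, smul_eq_mul, norm_mul, mul_pow, Real.norm_eq_abs, sq_abs]

lemma N2_mul (F G : MonoidAlgebra ℝ ℕ)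
    (hinj : ∀ a ∈ F.coeff.support, ∀ a' ∈ F.coeff.support, ∀ b ∈ G.coeff.support,
      ∀ b' ∈ G.coeff.support, a * b = a' * b' → a = a' ∧ b = b') :
    N2 (F * G) ≤ N2 F * N2 G := by
  classical
  set P := F.coeff.support ×ˢ G.coeff.support with hP
  set v : ℕ × ℕ → ℝ := fun ab => F.coeff ab.1 * G.coeff ab.2 with hv
  have hco : ∀ n, (F * G).coeff n = ∑ ab ∈ P.filter (fun ab => ab.1 * ab.2 = n), v ab := by
    intro n
    rw [coeff_mul_big F G _ _ (Finset.Subset.refl _) (Finset.Subset.refl _), Finset.sum_filter,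
      hP, Finset.sum_product]
  have hsq : ∀ n, ‖(F * G).coeff n‖ ^ 2
      = ∑ ab ∈ P.filter (fun ab => ab.1 * ab.2 = n), v ab ^ 2 := by
    intro n
    rw [hco, Real.norm_eq_abs, sq_abs]
    have hcard : (P.filter (fun ab => ab.1 * ab.2 = n)).card ≤ 1 := by
      rw [Finset.card_le_one]
      rintro ⟨a, b⟩ h1 ⟨a', b'⟩ h2
      simp only [hP, Finset.mem_filter, Finset.mem_product] at h1 h2
      obtain ⟨r1, r2⟩ := hinj a h1.1.1 a' h2.1.1 b h1.1.2 b' h2.1.2 (h1.2.trans h2.2.symm)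
      rw [r1, r2]
    rcases Finset.card_le_one_iff_subset_singleton.1 hcard with ⟨x, hx⟩
    rcases Finset.subset_singleton_iff.1 hx with h | h <;> rw [h] <;> simp
  have hsub : (F * G).coeff.support ⊆ P.image (fun ab => ab.1 * ab.2) := by
    intro n hn
    rw [Finsupp.mem_support_iff, hco] at hn
    obtain ⟨ab, hab, _⟩ := Finset.exists_ne_zero_of_sum_ne_zero hn
    rw [Finset.mem_filter] at hab
    exact Finset.mem_image.2 ⟨ab, hab⟩
  rw [N2_big _ _ hsub, Finset.sum_congr rfl fun n _ => hsq n,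
    Finset.sum_fiberwise_of_maps_to (fun ab hab => Finset.mem_image_of_mem _ hab), hP,
    Finset.sum_product]
  unfold N2
  rw [Finset.sum_mul_sum]
  refine le_of_eq (Finset.sum_congr rfl fun a _ => Finset.sum_congr rfl fun b _ => ?_)
  simp only [hv, Real.norm_eq_abs, sq_abs, mul_pow]

end

section
open Complex Real Finset

lemma fact_bound (a b : ℕ) :
    (((a + 2 * b).factorial : ℝ)) ≤ 4 ^ (a + 2 * b) * ((a.factorial : ℝ) * b.factorial) ^ 2 := by
  have h1 : (a + 2 * b).factorial = (a + 2 * b).choose (2 * b) * a.factorial * (2 * b).factorial :=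
    (Nat.add_choose_mul_factorial_mul_factorial a (2 * b)).symm
  have h2 : (2 * b).factorial = (b + b).choose b * b.factorial * b.factorial := by
    rw [two_mul]; exact (Nat.add_choose_mul_factorial_mul_factorial b b).symm
  have h3 : (a + 2 * b).choose (2 * b) ≤ 2 ^ (a + 2 * b) := Nat.choose_le_two_pow _ _
  have h4 : (b + b).choose b ≤ 2 ^ (a + 2 * b) :=
    (Nat.choose_le_two_pow _ _).trans (Nat.pow_le_pow_right (by norm_num) (by omega))
  have h5 : 1 ≤ a.factorial := Nat.factorial_pos a
  have h6 : (a + 2 * b).factorial ≤ 4 ^ (a + 2 * b) * (a.factorial * b.factorial) ^ 2 := by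
    rw [h1, h2]
    calc (a + 2 * b).choose (2 * b) * a.factorial * ((b + b).choose b * b.factorial * b.factorial)
        ≤ 2 ^ (a + 2 * b) * a.factorial * (2 ^ (a + 2 * b) * b.factorial * b.factorial) := by
          gcongr
      _ = 4 ^ (a + 2 * b) * (a.factorial * b.factorial ^ 2) := by
          rw [show (4:ℕ) = 2 * 2 by norm_num, mul_pow]; ring
      _ ≤ 4 ^ (a + 2 * b) * (a.factorial * b.factorial) ^ 2 := by
          rw [mul_pow]
          gcongr
          nlinarith
  exact_mod_cast h6

lemma TT_pair (p : ℕ) (x y : ℝ) (R : ℕ) :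
    TT R (MonoidAlgebra.single p x) * TT R (MonoidAlgebra.single (p ^ 2) y)
      = ∑ b ∈ Finset.range (R + 1), ∑ a ∈ Finset.range (R + 1),
        MonoidAlgebra.single (p ^ (a + 2 * b))
          (x ^ a * y ^ b / ((a.factorial : ℝ) * b.factorial)) := by
  unfold TT
  rw [Finset.sum_mul_sum, Finset.sum_comm]
  refine Finset.sum_congr rfl fun b _ => Finset.sum_congr rfl fun a _ => ?_
  rw [MonoidAlgebra.single_pow, MonoidAlgebra.single_pow, MonoidAlgebra.smul_single,
    MonoidAlgebra.smul_single, MonoidAlgebra.single_mul_single, ← pow_mul, ← pow_add]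
  congr 1
  simp only [smul_eq_mul]
  field_simp

lemma TT_pair_coeff (p : ℕ) (hp : p.Prime) (x y : ℝ) (R j : ℕ) :
    (TT R (MonoidAlgebra.single p x) * TT R (MonoidAlgebra.single (p ^ 2) y)).coeff (p ^ j)
      = ∑ b ∈ (Finset.range (R + 1)).filter (fun b => 2 * b ≤ j ∧ j - 2 * b ≤ R),
          (x ^ (j - 2 * b) * y ^ b / (((j - 2 * b).factorial : ℝ) * b.factorial)) := by
  rw [TT_pair, MonoidAlgebra.coeff_sum, Finsupp.finsetSum_apply, Finset.sum_filter]
  refine Finset.sum_congr rfl fun b _ => ?_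
  rw [MonoidAlgebra.coeff_sum, Finsupp.finsetSum_apply]
  have hinj : ∀ a, (p ^ (a + 2 * b) = p ^ j) ↔ a + 2 * b = j := fun a =>
    (Nat.pow_right_injective hp.two_le).eq_iff
  simp only [MonoidAlgebra.coeff_single, Finsupp.single_apply, hinj]
  split_ifs with h
  · rw [Finset.sum_eq_single (j - 2 * b)]
    · rw [if_pos (by omega)]
    · intro a _ ha
      rw [if_neg (by omega)]
    · intro ha
      rw [Finset.mem_range] at ha
      omega
  · refine Finset.sum_eq_zero fun a ha => ?_
    rw [Finset.mem_range] at ha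
    rw [if_neg (by omega)]

lemma TT_pair_supp (p : ℕ) (x y : ℝ) (R : ℕ) :
    (TT R (MonoidAlgebra.single p x) * TT R (MonoidAlgebra.single (p ^ 2) y)).coeff.support
      ⊆ (Finset.range (3 * R + 1)).image (fun j => p ^ j) := by
  classical
  intro n hn
  rw [Finsupp.mem_support_iff, TT_pair, MonoidAlgebra.coeff_sum, Finsupp.finsetSum_apply] at hn
  obtain ⟨b, hb, h1⟩ := Finset.exists_ne_zero_of_sum_ne_zero hn
  rw [MonoidAlgebra.coeff_sum, Finsupp.finsetSum_apply] at h1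
  obtain ⟨a, ha, h2⟩ := Finset.exists_ne_zero_of_sum_ne_zero h1
  rw [MonoidAlgebra.coeff_single, Finsupp.single_apply] at h2
  rw [Finset.mem_range] at ha hb
  refine Finset.mem_image.2 ⟨a + 2 * b, Finset.mem_range.2 (by omega), ?_⟩
  by_contra hne
  rw [if_neg hne] at h2
  exact h2 rfl

lemma sq_succ_le (j : ℕ) : ((j : ℝ) + 1) ^ 2 ≤ 4 ^ j := by
  have h : (j : ℝ) + 1 ≤ 2 ^ j := by
    have : j + 1 ≤ 2 ^ j := Nat.lt_two_pow_self
    exact_mod_cast this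
  calc ((j : ℝ) + 1) ^ 2 ≤ (2 ^ j) ^ 2 := by gcongr
    _ = 4 ^ j := by rw [← pow_mul, mul_comm, pow_mul]; norm_num

lemma TT_pair_bd (p : ℕ) (hp : p.Prime) (x y X : ℝ) (hx : 0 ≤ x) (hy : 0 ≤ y) (hx2 : x ^ 2 ≤ X)
    (hyX : y ≤ X) (R j : ℕ) :
    ((TT R (MonoidAlgebra.single p x) * TT R (MonoidAlgebra.single (p ^ 2) y)).coeff (p ^ j)) ^ 2
      ≤ (16 * X) ^ j / j.factorial := by
  have hX : 0 ≤ X := hy.trans hyX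
  rw [TT_pair_coeff p hp]
  set M := Real.sqrt (X ^ j * 4 ^ j / j.factorial) with hM
  have hterm : ∀ b ∈ (Finset.range (R + 1)).filter (fun b => 2 * b ≤ j ∧ j - 2 * b ≤ R),
      (x ^ (j - 2 * b) * y ^ b / (((j - 2 * b).factorial : ℝ) * b.factorial)) ≤ M := by
    intro b hb
    obtain ⟨a, rfl⟩ : ∃ a, j = a + 2 * b := ⟨j - 2 * b, by
      have := (Finset.mem_filter.1 hb).2; omega⟩
    rw [Nat.add_sub_cancel]
    apply Real.le_sqrt_of_sq_le
    rw [div_pow, mul_pow, ← pow_mul, mul_comm a 2, pow_mul, ← pow_mul y, mul_comm b 2, pow_mul y]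
    have hf := fact_bound a b
    rw [div_le_div_iff₀ (by positivity) (by positivity)]
    have h2 : (x ^ 2) ^ a * (y ^ 2) ^ b ≤ X ^ (a + 2 * b) := by
      rw [pow_add, pow_mul]
      gcongr
    calc (x ^ 2) ^ a * (y ^ 2) ^ b * ((a + 2 * b).factorial : ℝ)
        ≤ X ^ (a + 2 * b) * (4 ^ (a + 2 * b) * ((a.factorial : ℝ) * b.factorial) ^ 2) := by gcongr
      _ = _ := by ring
  have hcard : (((Finset.range (R + 1)).filter (fun b => 2 * b ≤ j ∧ j - 2 * b ≤ R)).card : ℝ)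
      ≤ j + 1 := by
    have : ((Finset.range (R + 1)).filter (fun b => 2 * b ≤ j ∧ j - 2 * b ≤ R)).card
        ≤ (Finset.range (j + 1)).card := Finset.card_le_card fun b hb => by
      have := (Finset.mem_filter.1 hb).2
      rw [Finset.mem_range]; omega
    rw [Finset.card_range] at this
    exact_mod_cast this
  have hsum := Finset.sum_le_card_nsmul _ _ M hterm
  rw [nsmul_eq_mul] at hsum
  have hM0 : 0 ≤ M := Real.sqrt_nonneg _
  have hs0 : 0 ≤ ∑ b ∈ (Finset.range (R + 1)).filter (fun b => 2 * b ≤ j ∧ j - 2 * b ≤ R),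
          (x ^ (j - 2 * b) * y ^ b / (((j - 2 * b).factorial : ℝ) * b.factorial)) :=
    Finset.sum_nonneg fun b _ => by positivity
  calc _ ≤ (((j : ℝ) + 1) * M) ^ 2 := by
        gcongr
        exact hsum.trans (by gcongr)
    _ = ((j : ℝ) + 1) ^ 2 * (X ^ j * 4 ^ j / j.factorial) := by
        rw [mul_pow, hM, Real.sq_sqrt (by positivity)]
    _ ≤ 4 ^ j * (X ^ j * 4 ^ j / j.factorial) := by gcongr; exact sq_succ_le j
    _ = _ := by
        rw [mul_pow, show (16:ℝ) = 4 * 4 by norm_num, mul_pow]; ring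

lemma TT_pair_N2 (p : ℕ) (hp : p.Prime) (x y : ℝ) (R : ℕ) :
    N2 (TT R (MonoidAlgebra.single p x) * TT R (MonoidAlgebra.single (p ^ 2) y))
      = ∑ j ∈ Finset.range (3 * R + 1),
      ((TT R (MonoidAlgebra.single p x) * TT R (MonoidAlgebra.single (p ^ 2) y)).coeff (p ^ j)) ^ 2
      := by
  classical
  rw [N2_big _ _ (TT_pair_supp p x y R), Finset.sum_image (fun a _ b _ h =>
    Nat.pow_right_injective hp.two_le h)]
  simp only [Real.norm_eq_abs, sq_abs]

lemma local_N2_a (p : ℕ) (hp : p.Prime) (x y X : ℝ) (hx : 0 ≤ x) (hy : 0 ≤ y) (hx2 : x ^ 2 ≤ X)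
    (hyX : y ≤ X) (R : ℕ) :
    N2 (TT R (MonoidAlgebra.single p x) * TT R (MonoidAlgebra.single (p ^ 2) y))
      ≤ Real.exp (16 * X) := by
  have hX : 0 ≤ X := hy.trans hyX
  rw [TT_pair_N2 p hp]
  exact (Finset.sum_le_sum fun j _ => TT_pair_bd p hp x y X hx hy hx2 hyX R j).trans
    (Real.sum_le_exp_of_nonneg (by positivity) _)

lemma local_N2_b (p : ℕ) (hp : p.Prime) (x y X : ℝ) (hx : 0 ≤ x) (hy : 0 ≤ y) (hx2 : x ^ 2 ≤ X)
    (hyX : y ≤ X) (R : ℕ) :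
    N2 (TT R (MonoidAlgebra.single p x) * TT R (MonoidAlgebra.single (p ^ 2) y))
      ≤ Real.exp (x ^ 2 + (16 * X) ^ 2 * Real.exp (16 * X)) := by
  have hX : 0 ≤ X := hy.trans hyX
  rw [TT_pair_N2 p hp]
  have h1 : ∀ j, j = 0 ∨ j = 1 → ((TT R (MonoidAlgebra.single p x) *
      TT R (MonoidAlgebra.single (p ^ 2) y)).coeff (p ^ j)) ^ 2 ≤ x ^ (2 * j) := by
    intro j hj
    rw [TT_pair_coeff p hp, mul_comm 2 j, pow_mul]
    have hsub : ((Finset.range (R + 1)).filter (fun b => 2 * b ≤ j ∧ j - 2 * b ≤ R)) ⊆ {0} := by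
      intro b hb
      have := (Finset.mem_filter.1 hb).2
      rw [Finset.mem_singleton]; omega
    rcases Finset.subset_singleton_iff.1 hsub with h | h
    · rw [h]; simp; positivity
    · rw [h]
      rcases hj with rfl | rfl <;> simp
  set e : ℕ → ℝ := fun j => ((TT R (MonoidAlgebra.single p x) *
      TT R (MonoidAlgebra.single (p ^ 2) y)).coeff (p ^ j)) ^ 2 with he
  have hle : ∑ j ∈ Finset.range (3 * R + 1), e j ≤ ∑ j ∈ Finset.range (3 * R + 1 + 2), e j :=
    Finset.sum_le_sum_of_subset_of_nonneg (Finset.range_subset_range.2 (by omega))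
      fun j _ _ => sq_nonneg _
  refine hle.trans ?_
  rw [Finset.sum_range_succ', Finset.sum_range_succ']
  have h0 : e 0 ≤ 1 := (h1 0 (Or.inl rfl)).trans (by simp)
  have h1' : e (0 + 1) ≤ x ^ 2 := (h1 1 (Or.inr rfl)).trans (by simp)
  have h2 : ∑ j ∈ Finset.range (3 * R + 1), e (j + 1 + 1) ≤ (16 * X) ^ 2 * Real.exp (16 * X) := by
    have h3 : ∀ j, e (j + 1 + 1) ≤ (16 * X) ^ 2 * ((16 * X) ^ j / j.factorial) := by
      intro j
      refine (TT_pair_bd p hp x y X hx hy hx2 hyX R (j + 1 + 1)).trans ?_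
      rw [← mul_div_assoc, ← pow_add, show 2 + j = j + 1 + 1 by ring]
      gcongr
      omega
    refine (Finset.sum_le_sum fun j _ => h3 j).trans ?_
    rw [← Finset.mul_sum]
    gcongr
    exact Real.sum_le_exp_of_nonneg (by positivity) _
  have := Real.add_one_le_exp (x ^ 2 + (16 * X) ^ 2 * Real.exp (16 * X))
  linarith

lemma N2_one : N2 (1 : MonoidAlgebra ℝ ℕ) ≤ 1 := by
  classical
  rw [N2_big 1 {1} (by
    rw [MonoidAlgebra.one_def, MonoidAlgebra.coeff_single]
    exact Finsupp.support_single_subset)]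
  simp [MonoidAlgebra.coeff_one_one]

lemma N2_primes (S : Finset ℕ) (hS : ∀ p ∈ S, p.Prime) (F : ℕ → MonoidAlgebra ℝ ℕ)
    (hF : ∀ p ∈ S, ∀ n, (F p).coeff n ≠ 0 → ∃ j, n = p ^ j) :
    N2 (∏ p ∈ S, F p) ≤ ∏ p ∈ S, N2 (F p) ∧
    ∀ n, (∏ p ∈ S, F p).coeff n ≠ 0 → n ≠ 0 ∧ ∀ p, p.Prime → p ∣ n → p ∈ S := by
  classical
  induction S using Finset.induction_on with
  | empty =>
    simp only [Finset.prod_empty]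
    refine ⟨N2_one, fun n hn => ?_⟩
    rw [MonoidAlgebra.one_def, MonoidAlgebra.coeff_single, Finsupp.single_apply] at hn
    have : 1 = n := by by_contra h; exact hn (if_neg h)
    subst this
    refine ⟨one_ne_zero, fun p hp h => ?_⟩
    exact absurd (Nat.dvd_one.1 h) hp.one_lt.ne'
  | insert p S hp ih =>
    obtain ⟨ih1, ih2⟩ := ih (fun p' h => hS p' (mem_insert_of_mem h))
      (fun p' h => hF p' (mem_insert_of_mem h))
    have hpp := hS p (mem_insert_self _ _)
    have hFp := hF p (mem_insert_self _ _)
    rw [Finset.prod_insert hp, Finset.prod_insert hp]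
    refine ⟨(N2_mul _ _ ?_).trans (mul_le_mul_of_nonneg_left ih1 (N2_nonneg _)), ?_⟩
    · intro a ha a' ha' b hb b' hb' hab
      obtain ⟨j, rfl⟩ := hFp a (Finsupp.mem_support_iff.1 ha)
      obtain ⟨j', rfl⟩ := hFp a' (Finsupp.mem_support_iff.1 ha')
      obtain ⟨hb0, hb1⟩ := ih2 b (Finsupp.mem_support_iff.1 hb)
      obtain ⟨hb0', hb1'⟩ := ih2 b' (Finsupp.mem_support_iff.1 hb')
      have hnb : ¬ p ∣ b := fun h => hp (hb1 p hpp h)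
      have hnb' : ¬ p ∣ b' := fun h => hp (hb1' p hpp h)
      have hj : j = j' := by
        have h1 := congrArg (fun n => n.factorization p) hab
        simp only [Nat.factorization_mul (pow_ne_zero _ hpp.ne_zero) hb0,
          Nat.factorization_mul (pow_ne_zero _ hpp.ne_zero) hb0', Finsupp.add_apply,
          Nat.factorization_eq_zero_of_not_dvd hnb, Nat.factorization_eq_zero_of_not_dvd hnb',
          hpp.factorization_pow, Finsupp.single_eq_same, add_zero] at h1
        exact h1
      subst hj
      exact ⟨rfl, Nat.eq_of_mul_eq_mul_left (pow_pos hpp.pos _) hab⟩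
    · intro n hn
      rw [coeff_mul_big _ _ _ _ (Finset.Subset.refl _) (Finset.Subset.refl _)] at hn
      obtain ⟨a, ha, hn⟩ := Finset.exists_ne_zero_of_sum_ne_zero hn
      obtain ⟨b, hb, hn⟩ := Finset.exists_ne_zero_of_sum_ne_zero hn
      have hab : a * b = n := by by_contra h; exact hn (if_neg h)
      obtain ⟨j, rfl⟩ := hFp a (Finsupp.mem_support_iff.1 ha)
      obtain ⟨hb0, hb1⟩ := ih2 b (Finsupp.mem_support_iff.1 hb)
      subst hab
      refine ⟨mul_ne_zero (pow_ne_zero _ hpp.ne_zero) hb0, fun p' hp' hd => ?_⟩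
      rcases (Nat.Prime.dvd_mul hp').1 hd with h | h
      · have := (Nat.prime_dvd_prime_iff_eq hp' hpp).1 (hp'.dvd_of_dvd_pow h)
        subst this; exact mem_insert_self _ _
      · exact mem_insert_of_mem (hb1 p' hp' h)

lemma N2_global (S : Finset ℕ) (hS : ∀ p ∈ S, p.Prime) (x y B : ℕ → ℝ) (hx : ∀ p ∈ S, 0 ≤ x p)
    (hy : ∀ p ∈ S, 0 ≤ y p) (R : ℕ)
    (hB : ∀ p ∈ S, N2 (TT R (MonoidAlgebra.single p (x p)) *
      TT R (MonoidAlgebra.single (p ^ 2) (y p))) ≤ Real.exp (B p)) :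
    N2 (∏ p ∈ S, TT R (MonoidAlgebra.single p (x p) + MonoidAlgebra.single (p ^ 2) (y p)))
      ≤ Real.exp (∑ p ∈ S, B p) := by
  have h1 : Maj (∏ p ∈ S, TT R (MonoidAlgebra.single p (x p) + MonoidAlgebra.single (p ^ 2) (y p)))
      (∏ p ∈ S, TT R (MonoidAlgebra.single p (x p)) *
      TT R (MonoidAlgebra.single (p ^ 2) (y p))) := by
    refine Maj.prod _ fun p hp => TT_add (Maj.single _ _ _ ?_) (Maj.single _ _ _ ?_) R
    · rw [Real.norm_of_nonneg (hx p hp)]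
    · rw [Real.norm_of_nonneg (hy p hp)]
  refine h1.N2.trans ((N2_primes S hS (fun p => TT R (MonoidAlgebra.single p (x p)) *
      TT R (MonoidAlgebra.single (p ^ 2) (y p))) ?_).1.trans ?_)
  · intro p hp n hn
    have := TT_pair_supp p (x p) (y p) R (Finsupp.mem_support_iff.2 hn)
    obtain ⟨j, _, hj⟩ := Finset.mem_image.1 this
    exact ⟨j, hj.symm⟩
  · rw [Real.exp_sum]
    exact Finset.prod_le_prod (fun p _ => N2_nonneg _) hB

end

section
open Complex Real Finset

/-- support in `[1,X]` -/
def Sup {R : Type*} [Semiring R] (f : MonoidAlgebra R ℕ) (X : ℝ) : Prop :=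
  ∀ n, f.coeff n ≠ 0 → 1 ≤ n ∧ (n : ℝ) ≤ X

section sup
variable {R : Type*} [CommRing R] {f g : MonoidAlgebra R ℕ} {X Y : ℝ}

lemma Sup.mono (h : Sup f X) (hXY : X ≤ Y) : Sup f Y := fun n hn =>
  ⟨(h n hn).1, (h n hn).2.trans hXY⟩

lemma Sup.mul (h : Sup f X) (h' : Sup g Y) : Sup (f * g) (X * Y) := fun n hn => by
  rw [coeff_mul_big _ _ _ _ (Finset.Subset.refl _) (Finset.Subset.refl _)] at hn
  obtain ⟨a, ha, hn⟩ := Finset.exists_ne_zero_of_sum_ne_zero hn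
  obtain ⟨b, hb, hn⟩ := Finset.exists_ne_zero_of_sum_ne_zero hn
  have hab : a * b = n := by by_contra h; exact hn (if_neg h)
  obtain ⟨ha1, ha2⟩ := h a (Finsupp.mem_support_iff.1 ha)
  obtain ⟨hb1, hb2⟩ := h' b (Finsupp.mem_support_iff.1 hb)
  subst hab
  refine ⟨Nat.mul_pos ha1 hb1, ?_⟩
  push_cast
  exact mul_le_mul ha2 hb2 (by positivity) ((Nat.cast_nonneg a).trans ha2)

lemma Sup.single {m : ℕ} (hm : 1 ≤ m) (hX : (m : ℝ) ≤ X) (c : R) :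
    Sup (MonoidAlgebra.single m c) X := fun n hn => by
  rw [MonoidAlgebra.coeff_single, Finsupp.single_apply] at hn
  have : m = n := by by_contra h; exact hn (if_neg h)
  subst this
  exact ⟨hm, hX⟩

lemma Sup.one : Sup (1 : MonoidAlgebra R ℕ) 1 := by
  rw [MonoidAlgebra.one_def]; exact Sup.single le_rfl (by simp) _

lemma Sup.pow (h : Sup f X) (r : ℕ) : Sup (f ^ r) (X ^ r) := by
  induction r with
  | zero => simpa using Sup.one
  | succ r ih => rw [pow_succ, pow_succ]; exact ih.mul h

lemma Sup.smul (h : Sup f X) (c : R) : Sup (c • f) X := fun n hn => by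
  refine h n fun h0 => hn ?_
  rw [MonoidAlgebra.coeff_smul_apply, h0, smul_zero]

lemma Sup.sum {ι : Type*} (s : Finset ι) {f : ι → MonoidAlgebra R ℕ}
    (h : ∀ i ∈ s, Sup (f i) X) : Sup (∑ i ∈ s, f i) X := fun n hn => by
  rw [MonoidAlgebra.coeff_sum, Finsupp.finsetSum_apply] at hn
  obtain ⟨i, hi, hn⟩ := Finset.exists_ne_zero_of_sum_ne_zero hn
  exact h i hi n hn

lemma Sup.add (h : Sup f X) (h' : Sup g X) : Sup (f + g) X := fun n hn => by
  rw [MonoidAlgebra.coeff_add, Finsupp.add_apply] at hn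
  by_cases h0 : f.coeff n = 0
  · exact h' n fun h1 => hn (by rw [h0, h1, add_zero])
  · exact h n h0

lemma Sup.prod {ι : Type*} (s : Finset ι) {f : ι → MonoidAlgebra R ℕ} {X : ι → ℝ}
    (h : ∀ i ∈ s, Sup (f i) (X i)) : Sup (∏ i ∈ s, f i) (∏ i ∈ s, X i) := by
  classical
  induction s using Finset.induction_on with
  | empty => simpa using Sup.one
  | insert a s ha ih =>
    rw [Finset.prod_insert ha, Finset.prod_insert ha]
    exact (h a (mem_insert_self _ _)).mul (ih fun i hi => h i (mem_insert_of_mem hi))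

end sup

lemma Sup.TT {𝕜 : Type*} [Field 𝕜] {f : MonoidAlgebra 𝕜 ℕ} {X : ℝ} (h : Sup f X) (hX : 1 ≤ X)
    (R : ℕ) : Sup (TT R f) (X ^ R) := by
  refine Sup.sum _ fun r hr => ((h.pow r).smul _).mono ?_
  rw [Finset.mem_range] at hr
  exact pow_le_pow_right₀ hX (by omega)

/-- evaluation at a character -/
noncomputable def ev {q : ℕ} (χ : DirichletCharacter ℂ q) : MonoidAlgebra ℂ ℕ →ₐ[ℂ] ℂ :=
  MonoidAlgebra.lift ℂ ℂ ℕ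
    ((χ.toMonoidHom : ZMod q →* ℂ).comp ((Nat.castRingHom (ZMod q)) : ℕ →* ZMod q))

lemma ev_single {q : ℕ} (χ : DirichletCharacter ℂ q) (n : ℕ) (c : ℂ) :
    ev χ (MonoidAlgebra.single n c) = c * χ n := by
  unfold ev
  rw [MonoidAlgebra.lift_single]
  rfl

lemma ev_apply {q : ℕ} (χ : DirichletCharacter ℂ q) (f : MonoidAlgebra ℂ ℕ) :
    ev χ f = ∑ n ∈ f.coeff.support, f.coeff n * χ n := by
  unfold ev
  rw [MonoidAlgebra.lift_apply]
  rfl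

lemma ev_TT {q : ℕ} (χ : DirichletCharacter ℂ q) (f : MonoidAlgebra ℂ ℕ) (R : ℕ) :
    ev χ (TT R f) = ∑ r ∈ Finset.range (R + 1), (ev χ f) ^ r / r.factorial := by
  unfold TT
  rw [map_sum]
  refine Finset.sum_congr rfl fun r _ => ?_
  rw [map_smul, map_pow, smul_eq_mul, div_eq_inv_mul]

lemma orth_aux {q : ℕ} [NeZero q] (n m : ℕ) (hn : n < q) (hm : m < q) :
    ∑ χ : DirichletCharacter ℂ q, χ n * (starRingEnd ℂ) (χ m)
      = if n = m ∧ IsUnit (m : ZMod q) then (q.totient : ℂ) else 0 := by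
  by_cases hu : IsUnit (m : ZMod q)
  · have h1 : ∀ χ : DirichletCharacter ℂ q, χ n * (starRingEnd ℂ) (χ m)
        = χ ((m : ZMod q)⁻¹) * χ n := by
      intro χ
      rw [mul_comm, starRingEnd_apply, MulChar.star_apply', MulChar.inv_apply]
      obtain ⟨u, hu⟩ := hu
      rw [← hu, Ring.inverse_unit, ZMod.inv_coe_unit]
    rw [Finset.sum_congr rfl fun χ _ => h1 χ, DirichletCharacter.sum_char_inv_mul_char_eq ℂ hu]
    have h2 : (m : ZMod q) = n ↔ n = m := by
      rw [ZMod.natCast_eq_natCast_iff, Nat.ModEq, Nat.mod_eq_of_lt hn, Nat.mod_eq_of_lt hm,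
        eq_comm]
    simp only [h2, hu, and_true]
  · rw [if_neg (fun h => hu h.2)]
    refine Finset.sum_eq_zero fun χ _ => ?_
    rw [χ.map_nonunit hu]; simp

lemma orth {q : ℕ} [NeZero q] (f : MonoidAlgebra ℂ ℕ) {X : ℝ} (hf : Sup f X) (hX : X < q) :
    ∑ χ : DirichletCharacter ℂ q, ‖ev χ f‖ ^ 2 ≤ q.totient * N2 f := by
  have hlt : ∀ n ∈ f.coeff.support, n < q := fun n hn => by
    have := (hf n (Finsupp.mem_support_iff.1 hn)).2.trans_lt hX
    exact_mod_cast this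
  have h1 : ((∑ χ : DirichletCharacter ℂ q, ‖ev χ f‖ ^ 2 : ℝ) : ℂ)
      = ∑ n ∈ f.coeff.support, ∑ m ∈ f.coeff.support, f.coeff n * (starRingEnd ℂ) (f.coeff m) *
        ∑ χ : DirichletCharacter ℂ q, χ n * (starRingEnd ℂ) (χ m) := by
    rw [Complex.ofReal_sum]
    have : ∀ χ : DirichletCharacter ℂ q, ((‖ev χ f‖ ^ 2 : ℝ) : ℂ) =
        ∑ n ∈ f.coeff.support, ∑ m ∈ f.coeff.support, f.coeff n * (starRingEnd ℂ) (f.coeff m) *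
        (χ n * (starRingEnd ℂ) (χ m)) := by
      intro χ
      rw [Complex.ofReal_pow, ← Complex.mul_conj', ev_apply, map_sum, Finset.sum_mul_sum]
      refine Finset.sum_congr rfl fun n _ => Finset.sum_congr rfl fun m _ => ?_
      rw [map_mul]; ring
    rw [Finset.sum_congr rfl fun χ _ => this χ, Finset.sum_comm]
    refine Finset.sum_congr rfl fun n _ => ?_
    rw [Finset.sum_comm]
    refine Finset.sum_congr rfl fun m _ => ?_
    rw [Finset.mul_sum]
  have h2 : (∑ χ : DirichletCharacter ℂ q, ‖ev χ f‖ ^ 2 : ℝ)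
      = ∑ n ∈ f.coeff.support, (if IsUnit (n : ZMod q) then (q.totient : ℝ) * ‖f.coeff n‖ ^ 2
        else 0) := by
    apply Complex.ofReal_injective
    rw [h1, Complex.ofReal_sum]
    refine Finset.sum_congr rfl fun n hn => ?_
    rw [Finset.sum_eq_single n]
    · rw [orth_aux n n (hlt n hn) (hlt n hn), Complex.mul_conj']
      split_ifs with h1 h2 h2 <;> simp_all [mul_comm]
    · intro m hm hmn
      rw [orth_aux n m (hlt n hn) (hlt m hm), if_neg (fun h => hmn h.1.symm), mul_zero]
    · intro h; exact absurd hn h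
  rw [h2]
  unfold N2
  rw [Finset.mul_sum]
  refine Finset.sum_le_sum fun n _ => ?_
  split_ifs
  · exact le_rfl
  · positivity

end

section
open Complex Real Finset

lemma exp_le_T (m : ℕ) (w : ℂ) (hw : ‖w‖ ≤ 8 ^ m / 2) :
    ‖Complex.exp w‖ ≤ Real.exp ((1 / 2) ^ m) *
      ‖∑ r ∈ Finset.range (10 * 8 ^ m + 1), w ^ r / r.factorial‖ := by
  set n := 10 * 8 ^ m + 1 with hn
  have hnR : (n : ℝ) = 10 * 8 ^ m + 1 := by rw [hn]; push_cast; ring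
  have h8 : (1 : ℝ) ≤ 8 ^ m := one_le_pow₀ (by norm_num)
  have hwn : ‖w‖ ≤ n / 20 := by rw [hnR]; linarith
  have hb := Complex.exp_bound' (x := w) (n := n) (by
    rw [div_le_iff₀ (by positivity)]
    push_cast
    rw [hnR]; linarith)
  have hf : (‖w‖ ^ n / n.factorial) ≤ (Real.exp 1 / 20) ^ n := by
    have h1 := Real.pow_div_factorial_le_exp (n : ℝ) (by positivity) n
    calc ‖w‖ ^ n / n.factorial ≤ ((n : ℝ) / 20) ^ n / n.factorial := by gcongr
      _ = (1 / 20) ^ n * ((n : ℝ) ^ n / n.factorial) := by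
          rw [div_pow, div_pow, one_pow]; field_simp
      _ ≤ (1 / 20) ^ n * Real.exp n := by gcongr
      _ = (Real.exp 1 / 20) ^ n := by
          rw [← Real.exp_one_pow, ← mul_pow]; congr 1; ring
  have he : 1 ≤ ‖Complex.exp w‖ * Real.exp 1 ^ n := by
    rw [Complex.norm_exp, Real.exp_one_pow, ← Real.exp_add]
    apply Real.one_le_exp
    have := Complex.abs_re_le_norm w
    have := abs_le.1 this
    have : (0 : ℝ) ≤ n := by positivity
    linarith
  have herr : ‖w‖ ^ n / n.factorial * 2 ≤ 2 * (1 / 2) ^ n * ‖Complex.exp w‖ := by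
    calc ‖w‖ ^ n / n.factorial * 2 ≤ (Real.exp 1 / 20) ^ n * 2 := by gcongr
      _ ≤ (Real.exp 1 / 20) ^ n * 2 * (‖Complex.exp w‖ * Real.exp 1 ^ n) :=
          le_mul_of_one_le_right (by positivity) he
      _ = 2 * (Real.exp 1 / 20 * Real.exp 1) ^ n * ‖Complex.exp w‖ := by rw [mul_pow]; ring
      _ ≤ 2 * (1 / 2) ^ n * ‖Complex.exp w‖ := by
          gcongr
          have := Real.exp_one_lt_d9
          have := Real.exp_pos 1
          nlinarith
  set x : ℝ := 2 * (1 / 2) ^ n with hx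
  have hxm : 2 * x ≤ (1 / 2) ^ m := by
    have : (1 / 2 : ℝ) ^ n ≤ (1 / 2) ^ (m + 2) := by
      apply pow_le_pow_of_le_one (by norm_num) (by norm_num)
      have : m < 8 ^ m := Nat.lt_pow_self (by norm_num)
      omega
    rw [pow_add (1 / 2 : ℝ) m 2] at this
    rw [hx]; linarith
  have hx1 : x ≤ 1 / 2 := by
    have : (1 / 2 : ℝ) ^ m ≤ 1 := pow_le_one₀ (by norm_num) (by norm_num)
    linarith
  have hx0 : 0 ≤ x := by positivity
  set T := ∑ r ∈ Finset.range n, w ^ r / (r.factorial : ℂ) with hT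
  have h1 : ‖Complex.exp w‖ ≤ ‖T‖ + x * ‖Complex.exp w‖ := by
    have := norm_add_le T (Complex.exp w - T)
    rw [add_sub_cancel] at this
    linarith
  have h2 : 1 + 2 * x ≤ Real.exp ((1 / 2) ^ m) := by
    have := Real.add_one_le_exp ((1 / 2 : ℝ) ^ m)
    linarith
  have h3 : ‖Complex.exp w‖ ≤ (1 + 2 * x) * ‖T‖ := by
    have h0 := norm_nonneg (Complex.exp w)
    have h4 : ‖Complex.exp w‖ * (1 - x) ≤ ‖T‖ := by linarith
    have h5 : 1 ≤ (1 + 2 * x) * (1 - x) := by nlinarith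
    calc ‖Complex.exp w‖ ≤ ‖Complex.exp w‖ * ((1 + 2 * x) * (1 - x)) :=
          le_mul_of_one_le_right h0 h5
      _ = (1 + 2 * x) * (‖Complex.exp w‖ * (1 - x)) := by ring
      _ ≤ _ := by gcongr
  exact h3.trans (mul_le_mul_of_nonneg_right h2 (norm_nonneg _))

lemma prod_exp_half (l m1 : ℕ) : ∏ m ∈ Finset.Ico l m1, Real.exp ((1 / 2) ^ m) ≤ Real.exp 2 := by
  rw [← Real.exp_sum]
  apply Real.exp_le_exp.2
  calc ∑ m ∈ Finset.Ico l m1, (1 / 2 : ℝ) ^ m ≤ ∑ m ∈ Finset.range m1, (1 / 2 : ℝ) ^ m := by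
        refine Finset.sum_le_sum_of_subset_of_nonneg (fun m hm => ?_) fun _ _ _ => by positivity
        rw [Finset.mem_range]; exact (Finset.mem_Ico.1 hm).2
    _ ≤ 2 := by
        rw [geom_sum_eq (by norm_num), div_le_iff_of_neg (by norm_num)]
        have : (0:ℝ) ≤ (1 / 2) ^ m1 := by positivity
        linarith

/-- the truncated exponential value -/
noncomputable def Tv (m : ℕ) (w : ℂ) : ℂ :=
  ∑ r ∈ Finset.range (10 * 8 ^ m + 1), w ^ r / r.factorial

lemma good_prod (l m1 : ℕ) (z : ℕ → ℂ) (hz : ∀ m ∈ Finset.Ico l m1, ‖z m‖ ≤ 8 ^ m) :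
    Real.exp ((∑ m ∈ Finset.Ico l m1, z m).re)
      ≤ Real.exp 4 * ∏ m ∈ Finset.Ico l m1, ‖Tv m (1 / 2 * z m)‖ ^ 2 := by
  have h1 : Real.exp ((∑ m ∈ Finset.Ico l m1, z m).re)
      = (∏ m ∈ Finset.Ico l m1, ‖Complex.exp (1 / 2 * z m)‖) ^ 2 := by
    rw [Complex.re_sum, ← Finset.prod_pow, Real.exp_sum]
    refine Finset.prod_congr rfl fun m _ => ?_
    rw [Complex.norm_exp, ← Real.exp_nat_mul]
    congr 1
    have : (1 / 2 * z m).re = 1 / 2 * (z m).re := by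
      rw [show (1 / 2 : ℂ) = ((1 / 2 : ℝ) : ℂ) by push_cast; rfl, Complex.re_ofReal_mul]
    rw [this]; push_cast; ring
  have h2 : ∏ m ∈ Finset.Ico l m1, ‖Complex.exp (1 / 2 * z m)‖
      ≤ ∏ m ∈ Finset.Ico l m1, (Real.exp ((1 / 2) ^ m) * ‖Tv m (1 / 2 * z m)‖) := by
    refine Finset.prod_le_prod (fun _ _ => norm_nonneg _) fun m hm => exp_le_T m _ ?_
    rw [norm_mul]
    have := hz m hm
    norm_num
    linarith
  rw [Finset.prod_mul_distrib] at h2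
  rw [h1, Finset.prod_pow, show Real.exp 4 = Real.exp 2 ^ 2 by
    rw [← Real.exp_nat_mul]; norm_num, ← mul_pow]
  have h3 := prod_exp_half l m1
  have h0 : 0 ≤ ∏ m ∈ Finset.Ico l m1, ‖Complex.exp (1 / 2 * z m)‖ :=
    Finset.prod_nonneg fun _ _ => norm_nonneg _
  have h4 : 0 ≤ ∏ m ∈ Finset.Ico l m1, ‖Tv m (1 / 2 * z m)‖ :=
    Finset.prod_nonneg fun _ _ => norm_nonneg _
  apply pow_le_pow_left₀ h0
  exact h2.trans (mul_le_mul_of_nonneg_right h3 h4)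

/-- pointwise decomposition -/
lemma pointwise (m0 m1 : ℕ) (hm : m0 ≤ m1) (K K' V : ℝ) (z : ℕ → ℕ → ℂ) (nn : ℕ → ℕ)
    (hV : ∀ l, m0 ≤ l → l ≤ m1 →
      V ≤ Real.exp (K + K' * 16 ^ l + (∑ m ∈ Finset.Ico l m1, z l m).re)) :
    V ≤ Real.exp (K + 4) * (Real.exp (K' * 16 ^ m0) *
        ∏ m ∈ Finset.Ico m0 m1, ‖Tv m (1 / 2 * z m0 m)‖ ^ 2
      + ∑ m ∈ Finset.Ico m0 m1, ∑ l ∈ Finset.Icc m0 m, Real.exp (K' * 16 ^ (m + 1)) *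
        ((8 ^ m : ℝ) ^ (2 * nn m))⁻¹ * (‖z l m‖ ^ (2 * nn m) *
          ∏ m' ∈ Finset.Ico (m + 1) m1, ‖Tv m' (1 / 2 * z (m + 1) m')‖ ^ 2)) := by
  classical
  have key : ∀ l, m0 ≤ l → l ≤ m1 → (∀ m ∈ Finset.Ico l m1, ‖z l m‖ ≤ 8 ^ m) →
      V ≤ Real.exp (K + 4) * (Real.exp (K' * 16 ^ l) *
        ∏ m ∈ Finset.Ico l m1, ‖Tv m (1 / 2 * z l m)‖ ^ 2) := by
    intro l h1 h2 h3
    refine (hV l h1 h2).trans ?_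
    rw [Real.exp_add, Real.exp_add, Real.exp_add]
    have := good_prod l m1 (z l) h3
    calc _ ≤ Real.exp K * Real.exp (K' * 16 ^ l) * (Real.exp 4 *
          ∏ m ∈ Finset.Ico l m1, ‖Tv m (1 / 2 * z l m)‖ ^ 2) := by gcongr
      _ = _ := by ring
  set bad : Finset ℕ := (Finset.Ico m0 m1).filter (fun m => ∃ l ∈ Finset.Icc m0 m, 8 ^ m < ‖z l m‖)
    with hbad
  have hnn : 0 ≤ ∑ m ∈ Finset.Ico m0 m1, ∑ l ∈ Finset.Icc m0 m, Real.exp (K' * 16 ^ (m + 1)) *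
        ((8 ^ m : ℝ) ^ (2 * nn m))⁻¹ * (‖z l m‖ ^ (2 * nn m) *
          ∏ m' ∈ Finset.Ico (m + 1) m1, ‖Tv m' (1 / 2 * z (m + 1) m')‖ ^ 2) := by
    positivity
  have hnn0 : 0 ≤ Real.exp (K' * 16 ^ m0) *
        ∏ m ∈ Finset.Ico m0 m1, ‖Tv m (1 / 2 * z m0 m)‖ ^ 2 := by positivity
  rcases bad.eq_empty_or_nonempty with he | hne
  · refine (key m0 le_rfl hm ?_).trans ?_
    · intro m hm'
      by_contra hc
      push Not at hc
      have : m ∈ bad := Finset.mem_filter.2 ⟨hm', m0, Finset.mem_Icc.2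
        ⟨le_rfl, (Finset.mem_Ico.1 hm').1⟩, hc⟩
      rw [he] at this
      simp at this
    · gcongr
      linarith
  · set m := bad.max' hne with hmdef
    have hmb : m ∈ bad := bad.max'_mem hne
    obtain ⟨hmI, l, hl, hlz⟩ := Finset.mem_filter.1 hmb
    have hmI' := Finset.mem_Ico.1 hmI
    refine (key (m + 1) (by omega) (by omega) ?_).trans ?_
    · intro m' hm'
      by_contra hc
      push Not at hc
      rw [Finset.mem_Ico] at hm'
      have : m' ∈ bad := Finset.mem_filter.2 ⟨Finset.mem_Ico.2 ⟨by omega, by omega⟩, m + 1,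
        Finset.mem_Icc.2 ⟨by omega, by omega⟩, hc⟩
      have := bad.le_max' m' this
      omega
    · gcongr
      refine le_trans ?_ (le_add_of_nonneg_left hnn0)
      refine le_trans ?_ (Finset.single_le_sum (f := fun m => ∑ l ∈ Finset.Icc m0 m,
        Real.exp (K' * 16 ^ (m + 1)) *
        ((8 ^ m : ℝ) ^ (2 * nn m))⁻¹ * (‖z l m‖ ^ (2 * nn m) *
          ∏ m' ∈ Finset.Ico (m + 1) m1, ‖Tv m' (1 / 2 * z (m + 1) m')‖ ^ 2))
          (fun _ _ => by positivity) hmI)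
      refine le_trans ?_ (Finset.single_le_sum (f := fun l =>
        Real.exp (K' * 16 ^ (m + 1)) *
        ((8 ^ m : ℝ) ^ (2 * nn m))⁻¹ * (‖z l m‖ ^ (2 * nn m) *
          ∏ m' ∈ Finset.Ico (m + 1) m1, ‖Tv m' (1 / 2 * z (m + 1) m')‖ ^ 2))
          (fun _ _ => by positivity) hl)
      rw [mul_assoc]
      gcongr
      rw [← mul_assoc]
      refine le_mul_of_one_le_left (by positivity) ?_
      rw [inv_mul_eq_div, one_le_div (by positivity)]
      gcongr

end

section
open Complex Real Finset

/-- primes in `(N (m+1), N m]` -/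
def chunk (N : ℕ → ℕ) (m : ℕ) : Finset ℕ := (Finset.Ioc (N (m + 1)) (N m)).filter Nat.Prime

/-- prime part of a Dirichlet polynomial -/
noncomputable def PP {R : Type*} [Semiring R] (C : ℕ → R) (S : Finset ℕ) : MonoidAlgebra R ℕ :=
  ∑ p ∈ S, (MonoidAlgebra.single p (C p) + MonoidAlgebra.single (p ^ 2) (C (p ^ 2)))

/-- real majorant version -/
noncomputable def FF (x y : ℕ → ℝ) (S : Finset ℕ) : MonoidAlgebra ℝ ℕ :=
  ∑ p ∈ S, (MonoidAlgebra.single p (x p) + MonoidAlgebra.single (p ^ 2) (y p))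

lemma PP_maj (C : ℕ → ℂ) (x y : ℕ → ℝ) (S : Finset ℕ) (hx : ∀ p ∈ S, ‖C p‖ ≤ x p)
    (hy : ∀ p ∈ S, ‖C (p ^ 2)‖ ≤ y p) : Maj (PP C S) (FF x y S) :=
  Maj.sum _ fun p hp => (Maj.single _ _ _ (hx p hp)).add (Maj.single _ _ _ (hy p hp))

lemma PP_ev {q : ℕ} (χ : DirichletCharacter ℂ q) (C : ℕ → ℂ) (S : Finset ℕ) :
    ev χ (PP C S) = ∑ p ∈ S, (C p * χ p + C (p ^ 2) * χ (p ^ 2 : ℕ)) := by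
  unfold PP
  rw [map_sum]
  exact Finset.sum_congr rfl fun p _ => by rw [map_add, ev_single, ev_single]

lemma FF_smul (x y : ℕ → ℝ) (S : Finset ℕ) (s : ℝ) :
    s • FF x y S = FF (fun p => s * x p) (fun p => s * y p) S := by
  unfold FF
  rw [Finset.smul_sum]
  exact Finset.sum_congr rfl fun p _ => by
    rw [smul_add, MonoidAlgebra.smul_single', MonoidAlgebra.smul_single']

lemma FF_TT (x y : ℕ → ℝ) (S : Finset ℕ) (hx : ∀ p ∈ S, 0 ≤ x p) (hy : ∀ p ∈ S, 0 ≤ y p)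
    {R R' : ℕ} (hR : R ≤ R') :
    Maj (TT R (FF x y S)) (∏ p ∈ S, TT R' (MonoidAlgebra.single p (x p) +
      MonoidAlgebra.single (p ^ 2) (y p))) := by
  have h : ∀ p ∈ S, Maj (MonoidAlgebra.single p (x p) + MonoidAlgebra.single (p ^ 2) (y p))
      (MonoidAlgebra.single p (x p) + MonoidAlgebra.single (p ^ 2) (y p)) := fun p hp =>
    (Maj.single _ _ _ (by rw [Real.norm_of_nonneg (hx p hp)])).add
      (Maj.single _ _ _ (by rw [Real.norm_of_nonneg (hy p hp)]))
  exact (TT_sum S _ h R).trans (Maj.prod S fun p hp => TT_mono (h p hp) hR)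

lemma pow_le_TT {F : MonoidAlgebra ℝ ℕ} (hF : Maj F F) {s : ℝ} (hs : 0 < s) (n : ℕ) :
    Maj (F ^ n) (((n.factorial : ℝ) / s ^ n) • TT n (s • F)) := fun k => by
  rw [Real.norm_of_nonneg ((hF.pow n).nonneg k)]
  have hsF : Maj (s • F) (s • F) := hF.smul s s (by rw [Real.norm_of_nonneg hs.le])
  have h1 : F ^ n = ((n.factorial : ℝ) / s ^ n) • (((n.factorial : ℝ)⁻¹) • (s • F) ^ n) := by
    rw [smul_pow, smul_smul, smul_smul]
    have : (n.factorial : ℝ) / s ^ n * (((n.factorial : ℝ)⁻¹) * s ^ n) = 1 := by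
      have := Nat.factorial_pos n
      field_simp
    rw [← mul_assoc] at this
    rw [this, one_smul]
  conv_lhs => rw [h1]
  rw [MonoidAlgebra.coeff_smul_apply, MonoidAlgebra.coeff_smul_apply, smul_eq_mul, smul_eq_mul]
  have key : (((n.factorial : ℝ)⁻¹) • (s • F) ^ n).coeff k ≤ (TT n (s • F)).coeff k := by
    unfold TT
    rw [MonoidAlgebra.coeff_sum, Finsupp.finsetSum_apply]
    refine Finset.single_le_sum (f := fun r => ((((r.factorial : ℝ)⁻¹) • (s • F) ^ r).coeff k))
      (fun r _ => ?_) (Finset.mem_range.2 (Nat.lt_succ_self n))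
    rw [MonoidAlgebra.coeff_smul_apply]
    exact mul_nonneg (by positivity) ((hsF.pow r).nonneg k)
  rw [MonoidAlgebra.coeff_smul_apply, smul_eq_mul] at key
  exact mul_le_mul_of_nonneg_left key (by positivity)

lemma prod_chunks {M : Type*} [CommMonoid M] (N : ℕ → ℕ) (hN : Antitone N) (f : ℕ → M) (l m1 : ℕ)
    (h : l ≤ m1) : ∏ m ∈ Finset.Ico l m1, ∏ p ∈ chunk N m, f p
      = ∏ p ∈ (Finset.Ioc (N m1) (N l)).filter Nat.Prime, f p := by
  induction m1, h using Nat.le_induction with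
  | base => simp
  | succ m hm ih =>
    rw [Finset.prod_Ico_succ_top hm, ih, chunk, ← Finset.prod_union]
    · congr 1
      ext p
      have h1 := hN hm
      have h2 := hN (Nat.le_succ m)
      simp only [Finset.mem_union, Finset.mem_filter, Finset.mem_Ioc, Nat.succ_eq_add_one] at *
      by_cases hp : p.Prime <;> simp only [hp, and_true, and_false, or_self]
      omega
    · rw [Finset.disjoint_left]
      intro p h1 h2
      simp only [Finset.mem_filter, Finset.mem_Ioc] at h1 h2
      omega

lemma sum_chunks {M : Type*} [AddCommMonoid M] (N : ℕ → ℕ) (hN : Antitone N) (f : ℕ → M)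
    (l m1 : ℕ) (h : l ≤ m1) : ∑ m ∈ Finset.Ico l m1, ∑ p ∈ chunk N m, f p
      = ∑ p ∈ (Finset.Ioc (N m1) (N l)).filter Nat.Prime, f p :=
  prod_chunks (M := Multiplicative M) N hN f l m1 h

lemma sum_inv_sq_le (S : Finset ℕ) (hS : ∀ p ∈ S, p.Prime) : ∑ p ∈ S, 1 / (p : ℝ) ^ 2 ≤ 2 := by
  classical
  obtain ⟨M, hM⟩ : ∃ M, ∀ p ∈ S, p < M := ⟨S.sup id + 1, fun p hp =>
    Nat.lt_succ_of_le (Finset.le_sup (f := id) hp)⟩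
  have h := sum_Ioo_inv_sq_le (α := ℝ) 0 M
  simp only [Nat.cast_zero, zero_add, div_one] at h
  refine le_trans ?_ h
  simp only [one_div]
  refine Finset.sum_le_sum_of_subset_of_nonneg (fun p hp => ?_) fun _ _ _ => by positivity
  rw [Finset.mem_Ioo]
  exact ⟨(hS p hp).pos, hM p hp⟩

lemma PP_sup (C : ℕ → ℂ) (S : Finset ℕ) (hS : ∀ p ∈ S, p.Prime) {X : ℝ} (hX : ∀ p ∈ S, (p : ℝ) ≤ X) :
    Sup (PP C S) (X ^ 2) := by
  refine Sup.sum _ fun p hp => ?_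
  have h1 := hS p hp
  have h2 := hX p hp
  have h3 : (1 : ℝ) ≤ p := by exact_mod_cast h1.one_le
  refine (Sup.single h1.one_le ?_ _).add (Sup.single (Nat.one_le_pow _ _ h1.pos) ?_ _)
  · nlinarith
  · push_cast; gcongr

lemma sum_half_Ico (l m1 : ℕ) : ∑ m ∈ Finset.Ico l m1, (1 / 2 : ℝ) ^ m ≤ 2 * (1 / 2) ^ l := by
  rcases le_or_gt l m1 with h | h
  · rw [Finset.sum_Ico_eq_sum_range]
    have h2 : ∑ i ∈ Finset.range (m1 - l), (1 / 2 : ℝ) ^ (l + i)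
        = (1 / 2) ^ l * ∑ i ∈ Finset.range (m1 - l), (1 / 2 : ℝ) ^ i := by
      rw [Finset.mul_sum]
      exact Finset.sum_congr rfl fun i _ => by rw [pow_add]
    rw [h2, mul_comm]
    gcongr
    rw [geom_sum_eq (by norm_num), div_le_iff_of_neg (by norm_num)]
    have : (0:ℝ) ≤ (1 / 2) ^ (m1 - l) := by positivity
    linarith
  · rw [Finset.Ico_eq_empty (by omega)]; simp

lemma avg_bound (H : ℝ) (hH : 0 ≤ H) (q : ℕ) [NeZero q] (hq : 2 ≤ q) (N : ℕ → ℕ) (hN : Antitone N)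
    (hNe : ∀ m, (N m : ℝ) ≤ Real.exp (Real.log q / 16 ^ m)) (m m1 n : ℕ) (hm : m + 1 ≤ m1)
    (C1 C2 : ℕ → ℂ) (xb : ℕ → ℝ)
    (h1 : ∀ p : ℕ, p.Prime → ‖C1 p‖ ≤ H / Real.sqrt p)
    (h1' : ∀ p : ℕ, p.Prime → ‖C1 (p ^ 2)‖ ≤ H / p)
    (h2 : ∀ p : ℕ, p.Prime → ‖C2 p‖ ≤ xb p)
    (hxb : ∀ p : ℕ, p.Prime → xb p ≤ H / Real.sqrt p)
    (h2' : ∀ p : ℕ, p.Prime → ‖C2 (p ^ 2)‖ ≤ H / p)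
    (hlen : 2 * (n : ℝ) / 16 ^ m + 20 / 2 ^ m < 1) :
    ∑ χ : DirichletCharacter ℂ q, ‖ev χ (PP C1 (chunk N m))‖ ^ (2 * n) *
      ∏ m' ∈ Finset.Ico (m + 1) m1, ‖Tv m' (1 / 2 * ev χ (PP C2 (chunk N m')))‖ ^ 2
    ≤ q.totient * (((n.factorial : ℝ) / Real.sqrt (n + 1) ^ n) ^ 2 *
      Real.exp (16 * (H ^ 2 + H) * (n + 1) * ∑ p ∈ chunk N m, 1 / (p : ℝ)
        + (1 / 4 * ∑ p ∈ (Finset.Ioc (N m1) (N (m + 1))).filter Nat.Prime, xb p ^ 2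
        + 2 * ((16 * (H ^ 2 + H)) ^ 2 * Real.exp (16 * (H ^ 2 + H)))))) := by
  classical
  set A := H ^ 2 + H with hA
  have hA0 : 0 ≤ A := by positivity
  set s := Real.sqrt (n + 1) with hs
  have hs2 : s ^ 2 = n + 1 := Real.sq_sqrt (by positivity)
  have hs1 : 1 ≤ s := Real.one_le_sqrt.2 (by simp)
  set R := 10 * 8 ^ m1 + n with hR
  set S1 := chunk N m with hS1
  set S2 := (Finset.Ioc (N m1) (N (m + 1))).filter Nat.Prime with hS2
  have hS1p : ∀ p ∈ S1, p.Prime := fun p hp => (Finset.mem_filter.1 hp).2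
  have hS2p : ∀ p ∈ S2, p.Prime := fun p hp => (Finset.mem_filter.1 hp).2
  have hdisj : Disjoint S1 S2 := by
    rw [Finset.disjoint_left]
    intro p hp1 hp2
    simp only [hS1, hS2, chunk, Finset.mem_filter, Finset.mem_Ioc] at hp1 hp2
    omega
  set W : MonoidAlgebra ℂ ℕ := PP C1 S1 ^ n *
    ∏ m' ∈ Finset.Ico (m + 1) m1, TT (10 * 8 ^ m') ((1 / 2 : ℂ) • PP C2 (chunk N m')) with hW
  have hev : ∀ χ : DirichletCharacter ℂ q, ‖ev χ (PP C1 S1)‖ ^ (2 * n) *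
      ∏ m' ∈ Finset.Ico (m + 1) m1, ‖Tv m' (1 / 2 * ev χ (PP C2 (chunk N m')))‖ ^ 2
      = ‖ev χ W‖ ^ 2 := by
    intro χ
    rw [hW, map_mul, map_pow, map_prod, norm_mul, mul_pow, norm_pow, ← pow_mul, mul_comm n 2,
      norm_prod, Finset.prod_pow]
    congr 2
    refine Finset.prod_congr rfl fun m' _ => ?_
    rw [ev_TT, map_smul, smul_eq_mul, Tv]
  -- majorant
  set x : ℕ → ℝ := fun p => if p ∈ S1 then s * (H / Real.sqrt p) else 1 / 2 * xb p with hx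
  set y : ℕ → ℝ := fun p => if p ∈ S1 then s * (H / p) else 1 / 2 * (H / p) with hy
  have hxb0 : ∀ p : ℕ, p.Prime → 0 ≤ xb p := fun p hp => (norm_nonneg _).trans (h2 p hp)
  have hM : Maj W (((n.factorial : ℝ) / s ^ n) • ∏ p ∈ S1 ∪ S2,
      TT R (MonoidAlgebra.single p (x p) + MonoidAlgebra.single (p ^ 2) (y p))) := by
    rw [Finset.prod_union hdisj, ← smul_mul_assoc]
    refine Maj.mul ?_ ?_
    · have e1 : Maj (PP C1 S1) (FF (fun p => H / Real.sqrt p) (fun p => H / p) S1) :=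
        PP_maj _ _ _ _ (fun p hp => h1 p (hS1p p hp)) (fun p hp => h1' p (hS1p p hp))
      have e2 := (e1.pow n).trans (pow_le_TT e1.self (s := s) (by positivity) n)
      refine e2.trans (Maj.smul ?_ _ _ (by rw [Real.norm_of_nonneg (by positivity)]))
      rw [FF_smul]
      refine (FF_TT _ _ S1 (fun p _ => by positivity) (fun p _ => by positivity)
        (show n ≤ R by omega)).trans ?_
      have : ∏ p ∈ S1, TT R (MonoidAlgebra.single p (s * (H / Real.sqrt p)) +
          MonoidAlgebra.single (p ^ 2) (s * (H / p))) = ∏ p ∈ S1,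
          TT R (MonoidAlgebra.single p (x p) + MonoidAlgebra.single (p ^ 2) (y p)) := by
        refine Finset.prod_congr rfl fun p hp => ?_
        simp only [hx, hy, if_pos hp]
      rw [← this]
      refine Maj.prod _ fun p _ => (Maj.add (Maj.single _ _ _ ?_) (Maj.single _ _ _ ?_)).TTr R <;>
      rw [Real.norm_of_nonneg (by positivity)]
    · have e0 : ∏ p ∈ S2,
          TT R (MonoidAlgebra.single p (x p) + MonoidAlgebra.single (p ^ 2) (y p))
          = ∏ m' ∈ Finset.Ico (m + 1) m1, ∏ p ∈ chunk N m', TT R (MonoidAlgebra.single p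
            (1 / 2 * xb p) + MonoidAlgebra.single (p ^ 2) (1 / 2 * (H / p))) := by
        rw [prod_chunks N hN _ _ _ hm]
        refine Finset.prod_congr rfl fun p hp => ?_
        have := Finset.disjoint_right.1 hdisj hp
        simp only [hx, hy, if_neg this]
      rw [e0]
      refine Maj.prod _ fun m' hm' => ?_
      have hcp : ∀ p ∈ chunk N m', p.Prime := fun p hp => (Finset.mem_filter.1 hp).2
      have e1 : Maj (PP C2 (chunk N m')) (FF xb (fun p => H / p) (chunk N m')) :=
        PP_maj _ _ _ _ (fun p hp => h2 p (hcp p hp)) (fun p hp => h2' p (hcp p hp))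
      have e2 := (e1.smul (1 / 2 : ℂ) (1 / 2) (by simp)).TT (10 * 8 ^ m')
      rw [FF_smul] at e2
      refine e2.trans (FF_TT _ _ _ (fun p hp => ?_) (fun p hp => by positivity) ?_)
      · have := hxb0 p (hcp p hp); positivity
      · have h8 : 8 ^ m' ≤ 8 ^ m1 := Nat.pow_le_pow_right (by norm_num)
          (Finset.mem_Ico.1 hm').2.le
        omega
  -- N2
  have hN2 : N2 W ≤ ((n.factorial : ℝ) / s ^ n) ^ 2 *
      Real.exp (16 * A * (n + 1) * ∑ p ∈ S1, 1 / (p : ℝ)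
        + (1 / 4 * ∑ p ∈ S2, xb p ^ 2 + 2 * ((16 * A) ^ 2 * Real.exp (16 * A)))) := by
    refine hM.N2.trans ?_
    rw [N2_smul]
    gcongr
    set B : ℕ → ℝ := fun p => if p ∈ S1 then 16 * (A * (n + 1) / p) else
      (1 / 2 * xb p) ^ 2 + (16 * (A / p)) ^ 2 * Real.exp (16 * (A / p)) with hB
    have hglob := N2_global (S1 ∪ S2) (fun p hp => by
      rcases Finset.mem_union.1 hp with h | h
      · exact hS1p p h
      · exact hS2p p h) x y B ?_ ?_ R ?_
    · refine hglob.trans (Real.exp_le_exp.2 ?_)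
      rw [Finset.sum_union hdisj]
      refine add_le_add ?_ ?_
      · rw [Finset.mul_sum]
        refine Finset.sum_le_sum fun p hp => ?_
        simp only [hB, if_pos hp]
        apply le_of_eq; ring
      · have hle : ∀ p ∈ S2, B p ≤ 1 / 4 * xb p ^ 2 + (16 * A) ^ 2 * Real.exp (16 * A) *
            (1 / (p : ℝ) ^ 2) := by
          intro p hp
          have hp1 : (1 : ℝ) ≤ p := by exact_mod_cast (hS2p p hp).one_le
          simp only [hB, if_neg (Finset.disjoint_right.1 hdisj hp)]
          have : Real.exp (16 * (A / p)) ≤ Real.exp (16 * A) := by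
            apply Real.exp_le_exp.2
            gcongr
            exact div_le_self hA0 hp1
          have e3 : (16 * (A / p)) ^ 2 * Real.exp (16 * (A / p)) ≤
              (16 * (A / p)) ^ 2 * Real.exp (16 * A) := by gcongr
          have e4 : (16 * (A / p)) ^ 2 * Real.exp (16 * A)
            = (16 * A) ^ 2 * Real.exp (16 * A) * (1 / (p : ℝ) ^ 2) := by
            field_simp
          rw [← e4]
          nlinarith
        refine (Finset.sum_le_sum hle).trans ?_
        rw [Finset.sum_add_distrib, ← Finset.mul_sum, ← Finset.mul_sum, mul_comm (2:ℝ)]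
        gcongr
        exact sum_inv_sq_le S2 hS2p
    · intro p hp
      simp only [hx]
      split_ifs with h
      · positivity
      · rcases Finset.mem_union.1 hp with h' | h'
        · exact absurd h' h
        · have := hxb0 p (hS2p p h'); positivity
    · intro p hp
      simp only [hy]
      split_ifs <;> positivity
    · intro p hp
      simp only [hx, hy, hB]
      split_ifs with h
      · have hpp := hS1p p h
        have hp0 : (0 : ℝ) < p := by exact_mod_cast hpp.pos
        refine local_N2_a p hpp _ _ (A * (n + 1) / p) (by positivity) (by positivity) ?_ ?_ R
        · rw [mul_pow, div_pow, hs2, Real.sq_sqrt hp0.le, ← mul_div_assoc]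
          refine div_le_div_of_nonneg_right ?_ hp0.le
          rw [mul_comm]
          refine mul_le_mul_of_nonneg_right ?_ (by positivity)
          rw [hA]; linarith
        · rw [← mul_div_assoc]
          refine div_le_div_of_nonneg_right ?_ hp0.le
          have t1 : s ≤ n + 1 := by nlinarith
          have t2 : H ≤ A := by rw [hA]; nlinarith
          rw [mul_comm]
          exact mul_le_mul t2 t1 (by positivity) (by positivity)
      · have hpp : p.Prime := by
          rcases Finset.mem_union.1 hp with h' | h'
          · exact absurd h' h
          · exact hS2p p h'
        have hp0 : (0 : ℝ) < p := by exact_mod_cast hpp.pos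
        have hx0 := hxb0 p hpp
        refine local_N2_b p hpp _ _ (A / p) (by positivity) (by positivity) ?_ ?_ R
        · have : xb p ^ 2 ≤ H ^ 2 / p := by
            calc xb p ^ 2 ≤ (H / Real.sqrt p) ^ 2 := by gcongr; exact hxb p hpp
              _ = H ^ 2 / p := by rw [div_pow, Real.sq_sqrt hp0.le]
          have h3 : H ^ 2 / p ≤ A / p := by gcongr; rw [hA]; linarith
          nlinarith
        · have h3 : H / p ≤ A / p := by gcongr; rw [hA]; nlinarith
          have : 0 ≤ H / p := by positivity
          linarith
  -- support
  have hq0 : (0 : ℝ) < q := by positivity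
  have hQ : 0 < Real.log q := Real.log_pos (by exact_mod_cast hq)
  set Q := Real.log q with hQd
  have hch : ∀ k, ∀ p ∈ chunk N k, (p : ℝ) ≤ Real.exp (Q / 16 ^ k) := fun k p hp => by
    refine le_trans ?_ (hNe k)
    have := (Finset.mem_Ioc.1 (Finset.mem_filter.1 hp).1).2
    exact_mod_cast this
  have hSup : Sup W ((Real.exp (Q / 16 ^ m) ^ 2) ^ n *
      ∏ m' ∈ Finset.Ico (m + 1) m1, (Real.exp (Q / 16 ^ m') ^ 2) ^ (10 * 8 ^ m')) := by
    refine ((PP_sup C1 S1 hS1p (hch m)).pow n).mul (Sup.prod _ fun m' _ => ?_)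
    refine Sup.TT ((PP_sup C2 _ (fun p hp => (Finset.mem_filter.1 hp).2) (hch m')).smul _) ?_ _
    exact one_le_pow₀ (Real.one_le_exp (by positivity))
  have hlt : (Real.exp (Q / 16 ^ m) ^ 2) ^ n *
      ∏ m' ∈ Finset.Ico (m + 1) m1, (Real.exp (Q / 16 ^ m') ^ 2) ^ (10 * 8 ^ m') < q := by
    have e1 : ∀ k j : ℕ, (Real.exp (Q / 16 ^ k) ^ 2) ^ j = Real.exp (Q * (2 * j / 16 ^ k)) := by
      intro k j
      rw [← pow_mul, ← Real.exp_nat_mul]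
      congr 1; push_cast; ring
    simp only [e1]
    rw [← Real.exp_sum, ← Real.exp_add, ← Finset.mul_sum, ← mul_add]
    have e2 : ∑ i ∈ Finset.Ico (m + 1) m1, 2 * ((10 * 8 ^ i : ℕ) : ℝ) / 16 ^ i ≤ 20 / 2 ^ m := by
      have : ∀ i ∈ Finset.Ico (m + 1) m1, 2 * ((10 * 8 ^ i : ℕ) : ℝ) / 16 ^ i
          = 20 * (1 / 2) ^ i := by
        intro i _
        push_cast
        rw [show (16 : ℝ) = 8 * 2 by norm_num, mul_pow, one_div, inv_pow]
        field_simp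
        norm_num
      rw [Finset.sum_congr rfl this, ← Finset.mul_sum]
      have := sum_half_Ico (m + 1) m1
      have e : (20 : ℝ) / 2 ^ m = 20 * (2 * (1 / 2) ^ (m + 1)) := by
        rw [pow_succ, one_div, inv_pow]; field_simp
      rw [e]
      linarith
    calc _ ≤ Real.exp (Q * (2 * n / 16 ^ m + 20 / 2 ^ m)) := by gcongr
      _ < Real.exp Q := by
          apply Real.exp_lt_exp.2
          nlinarith
      _ = q := Real.exp_log hq0
  rw [Finset.sum_congr rfl fun χ _ => hev χ]
  refine (orth W hSup hlt).trans ?_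
  gcongr

end

section
open Complex Real Finset

lemma bad_coef (K' G : ℝ) (m n : ℕ) (hn : n = 2 * 16 ^ (m - 1)) (hm1 : 1 ≤ m)
    (hG : 0 ≤ G) (hm : 128 * K' + 2 * G + 2 ≤ m) :
    (m + 1 : ℝ) * (Real.exp (K' * 16 ^ (m + 1)) * ((8 ^ m : ℝ) ^ (2 * n))⁻¹ *
      (((n.factorial : ℝ) / Real.sqrt (n + 1) ^ n) ^ 2 * Real.exp (G * (n + 1)))) ≤ (1 / 2) ^ m := by
  obtain ⟨j, rfl⟩ : ∃ j, m = j + 1 := ⟨m - 1, by omega⟩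
  simp only [Nat.add_sub_cancel] at hn
  have hnR : (n : ℝ) = 2 * 16 ^ j := by rw [hn]; push_cast; ring
  have h16 : ((j : ℝ) + 1) ≤ 16 ^ j := by
    have := one_add_mul_le_pow (a := (15 : ℝ)) (by norm_num) j
    norm_num at this
    nlinarith [(Nat.cast_nonneg j : (0 : ℝ) ≤ j)]
  have hn1 : (1 : ℝ) ≤ n := by rw [hnR]; have : (0 : ℝ) ≤ j := Nat.cast_nonneg j; linarith
  set M : ℝ := ((j + 1 : ℕ) : ℝ) with hM
  have hMj : M = j + 1 := by rw [hM]; push_cast; ring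
  have hM0 : 0 ≤ M := by positivity
  have e1 : ((8 ^ (j + 1) : ℝ) ^ (2 * n)) = (4 ^ (j + 1)) ^ n * (16 ^ (j + 1)) ^ n := by
    rw [pow_mul (8 ^ (j + 1) : ℝ), ← mul_pow, ← mul_pow, ← pow_mul (8 : ℝ), mul_comm (j + 1) 2,
      pow_mul (8 : ℝ)]; norm_num
  have f1 : ((n.factorial : ℝ) / Real.sqrt (n + 1) ^ n) ^ 2 ≤ (16 ^ (j + 1)) ^ n := by
    have a1 : (n.factorial : ℝ) ≤ (n : ℝ) ^ n := by exact_mod_cast Nat.factorial_le_pow n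
    have a2 : (Real.sqrt (n + 1) ^ n) ^ 2 = ((n : ℝ) + 1) ^ n := by
      rw [← pow_mul, mul_comm, pow_mul, Real.sq_sqrt (by positivity)]
    rw [div_pow, a2, div_le_iff₀ (by positivity)]
    calc (n.factorial : ℝ) ^ 2 ≤ ((n : ℝ) ^ n) ^ 2 := by gcongr
      _ = (n : ℝ) ^ n * (n : ℝ) ^ n := by ring
      _ ≤ (16 ^ (j + 1)) ^ n * ((n : ℝ) + 1) ^ n := by
          gcongr
          · rw [hnR, pow_succ]; nlinarith [pow_pos (show (0:ℝ) < 16 by norm_num) j]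
          · linarith
  have f2 : ((4 ^ (j + 1) : ℝ) ^ n)⁻¹ ≤ Real.exp (-(M * n)) := by
    rw [Real.exp_neg]
    gcongr
    rw [mul_comm, Real.exp_nat_mul, hM, ← mul_one (((j + 1 : ℕ) : ℝ)), Real.exp_nat_mul]
    gcongr
    have := Real.exp_one_lt_d9
    linarith
  have f3 : Real.exp (K' * 16 ^ (j + 1 + 1)) * ((8 ^ (j + 1) : ℝ) ^ (2 * n))⁻¹ *
      (((n.factorial : ℝ) / Real.sqrt (n + 1) ^ n) ^ 2 * Real.exp (G * (n + 1)))
      ≤ Real.exp (-(2 * n)) := by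
    calc _ ≤ Real.exp (K' * 16 ^ (j + 1 + 1)) * ((8 ^ (j + 1) : ℝ) ^ (2 * n))⁻¹ *
      ((16 ^ (j + 1)) ^ n * Real.exp (G * (n + 1))) := by gcongr
      _ = Real.exp (K' * 16 ^ (j + 1 + 1)) * ((4 ^ (j + 1) : ℝ) ^ n)⁻¹ * Real.exp (G * (n + 1)) := by
          rw [e1]; field_simp
      _ ≤ Real.exp (K' * 16 ^ (j + 1 + 1)) * Real.exp (-(M * n)) * Real.exp (G * (n + 1)) := by
          gcongr
      _ = Real.exp (128 * K' * n - M * n + G * (n + 1)) := by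
          rw [← Real.exp_add, ← Real.exp_add, hnR]; congr 1; rw [pow_succ, pow_succ]; ring
      _ ≤ _ := by
          apply Real.exp_le_exp.2
          nlinarith
  calc _ ≤ (M + 1) * Real.exp (-(2 * n)) := by gcongr
    _ ≤ (M + 1) * Real.exp (-(2 * M)) := by
        gcongr; rw [hnR, hMj]; linarith
    _ = (M + 1) * Real.exp (-M) * Real.exp (-M) := by rw [mul_assoc, ← Real.exp_add]; ring_nf
    _ ≤ 1 * Real.exp (-M) := by
        gcongr
        rw [Real.exp_neg, mul_inv_le_iff₀ (Real.exp_pos _), one_mul]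
        exact Real.add_one_le_exp M
    _ = (Real.exp 1)⁻¹ ^ (j + 1) := by
        rw [one_mul, hM, Real.exp_neg, ← mul_one (((j + 1 : ℕ) : ℝ)), Real.exp_nat_mul, inv_pow]
    _ ≤ _ := by
        gcongr
        rw [one_div]
        gcongr
        have := Real.add_one_le_exp (1 : ℝ)
        linarith

theorem core (H K K' D : ℝ) (hH : 0 ≤ H) (hD : 0 ≤ D) :
    ∃ m0 : ℕ, 7 ≤ m0 ∧ ∃ Cc : ℝ, 0 < Cc ∧ ∀ (q : ℕ) [NeZero q], 2 ≤ q → ∀ m1 : ℕ, m0 ≤ m1 →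
      ∀ N : ℕ → ℕ, Antitone N → (∀ m, (N m : ℝ) ≤ Real.exp (Real.log q / 16 ^ m)) →
      ∀ (C : ℕ → ℕ → ℂ) (xb : ℕ → ℝ),
      (∀ l, ∀ p : ℕ, p.Prime → ‖C l p‖ ≤ xb p) →
      (∀ p : ℕ, p.Prime → xb p ≤ H / Real.sqrt p) →
      (∀ l, ∀ p : ℕ, p.Prime → ‖C l (p ^ 2)‖ ≤ H / p) →
      (∀ m, m < m1 → ∑ p ∈ chunk N m, 1 / (p : ℝ) ≤ D) →
      ∀ (X : Finset (DirichletCharacter ℂ q)) (V : DirichletCharacter ℂ q → ℝ),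
      (∀ χ ∈ X, ∀ l, m0 ≤ l → l ≤ m1 → V χ ≤ Real.exp (K + K' * 16 ^ l +
        (∑ m ∈ Finset.Ico l m1, ev χ (PP (C l) (chunk N m))).re)) →
      ∑ χ ∈ X, V χ ≤ Cc * q.totient *
        Real.exp (1 / 4 * ∑ p ∈ (Finset.Ioc 0 (N m0)).filter Nat.Prime, xb p ^ 2) := by
  set A := 16 * (H ^ 2 + H) with hA
  have hA0 : 0 ≤ A := by positivity
  set G := A * D with hG
  have hG0 : 0 ≤ G := by positivity
  obtain ⟨m0', hm0'⟩ := exists_nat_ge (128 * K' + 2 * G + 2)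
  set m0 := m0' + 7 with hm0
  set MM := Real.exp (2 * (A ^ 2 * Real.exp A)) with hMM
  refine ⟨m0, by omega, Real.exp (K + 4) * (MM * (Real.exp (K' * 16 ^ m0) * Real.exp G + 2)),
    by positivity, ?_⟩
  intro q _ hq m1 hm1 N hN hNe C xb hCx hxb hC2 hchunk X V hV
  set E := Real.exp (1 / 4 * ∑ p ∈ (Finset.Ioc 0 (N m0)).filter Nat.Prime, xb p ^ 2) with hE
  have hC1 : ∀ l, ∀ p : ℕ, p.Prime → ‖C l p‖ ≤ H / Real.sqrt p :=
    fun l p hp => (hCx l p hp).trans (hxb p hp)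
  set nn : ℕ → ℕ := fun m => 2 * 16 ^ (m - 1) with hnn
  set z : DirichletCharacter ℂ q → ℕ → ℕ → ℂ := fun χ l m => ev χ (PP (C l) (chunk N m)) with hz
  -- averaged bound
  have avg : ∀ m n l l' : ℕ, m0 ≤ m + 1 → m + 1 ≤ m1 → 2 * (n : ℝ) / 16 ^ m + 20 / 2 ^ m < 1 →
      ∑ χ : DirichletCharacter ℂ q, ‖z χ l m‖ ^ (2 * n) *
      ∏ m' ∈ Finset.Ico (m + 1) m1, ‖Tv m' (1 / 2 * z χ l' m')‖ ^ 2
      ≤ q.totient * (((n.factorial : ℝ) / Real.sqrt (n + 1) ^ n) ^ 2 *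
        Real.exp (G * (n + 1))) * (MM * E) := by
    intro m n l l' h1 h2 h3
    refine (avg_bound H hH q hq N hN hNe m m1 n h2 (C l) (C l') xb (hC1 l) (hC2 l) (hCx l') hxb
      (hC2 l') h3).trans ?_
    rw [mul_assoc (q.totient : ℝ)]
    refine mul_le_mul_of_nonneg_left ?_ (by positivity)
    rw [mul_assoc (((n.factorial : ℝ) / Real.sqrt (n + 1) ^ n) ^ 2)]
    refine mul_le_mul_of_nonneg_left ?_ (by positivity)
    rw [hMM, hE, ← Real.exp_add, ← Real.exp_add]
    apply Real.exp_le_exp.2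
    have t1 : A * (n + 1) * ∑ p ∈ chunk N m, 1 / (p : ℝ) ≤ A * (n + 1) * D :=
      mul_le_mul_of_nonneg_left (hchunk m (by omega)) (by positivity)
    have t2 : ∑ p ∈ (Finset.Ioc (N m1) (N (m + 1))).filter Nat.Prime, xb p ^ 2
        ≤ ∑ p ∈ (Finset.Ioc 0 (N m0)).filter Nat.Prime, xb p ^ 2 := by
      refine Finset.sum_le_sum_of_subset_of_nonneg ?_ (fun _ _ _ => sq_nonneg _)
      apply Finset.filter_subset_filter
      exact Finset.Ioc_subset_Ioc (Nat.zero_le _) (hN h1)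
    have t3 : A * (n + 1) * D = G * (n + 1) := by rw [hG]; ring
    linarith
  have good : ∑ χ : DirichletCharacter ℂ q, ∏ m ∈ Finset.Ico m0 m1, ‖Tv m (1 / 2 * z χ m0 m)‖ ^ 2
      ≤ q.totient * Real.exp G * (MM * E) := by
    have := avg (m0 - 1) 0 m0 m0 (by omega) (by omega) (by
      have : (m0 - 1) = m0' + 6 := by omega
      rw [this]
      have h2 : (1 : ℝ) ≤ 2 ^ m0' := one_le_pow₀ (by norm_num)
      rw [pow_add 2]
      norm_num
      rw [div_lt_one (by positivity)]
      linarith)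
    have hh : m0 - 1 + 1 = m0 := by omega
    simpa [hh] using this
  have bad : ∀ m ∈ Finset.Ico m0 m1, ∀ l ∈ Finset.Icc m0 m,
      ∑ χ : DirichletCharacter ℂ q, Real.exp (K' * 16 ^ (m + 1)) *
        ((8 ^ m : ℝ) ^ (2 * nn m))⁻¹ * (‖z χ l m‖ ^ (2 * nn m) *
          ∏ m' ∈ Finset.Ico (m + 1) m1, ‖Tv m' (1 / 2 * z χ (m + 1) m')‖ ^ 2)
      ≤ (1 / 2) ^ m / (m + 1) * (q.totient * (MM * E)) := by
    intro m hm l hl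
    have hm' := Finset.mem_Ico.1 hm
    rw [← Finset.mul_sum]
    have := avg m (nn m) l (m + 1) (by omega) (by omega) (by
      obtain ⟨j, hj⟩ : ∃ j, m = j + 6 := ⟨m - 6, by omega⟩
      have e : nn m = 2 * 16 ^ (j + 5) := by simp only [hnn, hj]; congr 1
      rw [e, hj]
      have h2 : (1 : ℝ) ≤ 2 ^ j := one_le_pow₀ (by norm_num)
      have e1 : 2 * ((2 * 16 ^ (j + 5) : ℕ) : ℝ) / 16 ^ (j + 6) = 1 / 4 := by
        push_cast
        rw [pow_succ 16 (j + 5)]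
        field_simp
        norm_num
      have e2 : (20 : ℝ) / 2 ^ (j + 6) ≤ 20 / 64 := by
        rw [pow_add]
        gcongr
        linarith
      rw [e1]
      linarith)
    refine (mul_le_mul_of_nonneg_left this (by positivity)).trans ?_
    have bc := bad_coef K' G m (nn m) rfl (by omega) hG0 (by
      have : (m0' : ℝ) ≤ m := by exact_mod_cast (by omega : m0' ≤ m)
      linarith)
    have bc' : Real.exp (K' * 16 ^ (m + 1)) * ((8 ^ m : ℝ) ^ (2 * nn m))⁻¹ *
      ((((nn m).factorial : ℝ) / Real.sqrt (nn m + 1) ^ (nn m)) ^ 2 * Real.exp (G * (nn m + 1)))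
      ≤ (1 / 2) ^ m / (m + 1) := by
      rw [le_div_iff₀ (by positivity), mul_comm]; exact bc
    have hnn0 : 0 ≤ (q.totient : ℝ) * (MM * E) := by positivity
    calc _ = (Real.exp (K' * 16 ^ (m + 1)) * ((8 ^ m : ℝ) ^ (2 * nn m))⁻¹ *
      ((((nn m).factorial : ℝ) / Real.sqrt (nn m + 1) ^ (nn m)) ^ 2 * Real.exp (G * (nn m + 1))))
        * (q.totient * (MM * E)) := by ring
      _ ≤ _ := mul_le_mul_of_nonneg_right bc' hnn0
  calc ∑ χ ∈ X, V χ ≤ ∑ χ ∈ X, Real.exp (K + 4) * (Real.exp (K' * 16 ^ m0) *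
        ∏ m ∈ Finset.Ico m0 m1, ‖Tv m (1 / 2 * z χ m0 m)‖ ^ 2
      + ∑ m ∈ Finset.Ico m0 m1, ∑ l ∈ Finset.Icc m0 m, Real.exp (K' * 16 ^ (m + 1)) *
        ((8 ^ m : ℝ) ^ (2 * nn m))⁻¹ * (‖z χ l m‖ ^ (2 * nn m) *
          ∏ m' ∈ Finset.Ico (m + 1) m1, ‖Tv m' (1 / 2 * z χ (m + 1) m')‖ ^ 2)) :=
        Finset.sum_le_sum fun χ hχ => pointwise m0 m1 hm1 K K' (V χ) (z χ) nn (hV χ hχ)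
    _ ≤ ∑ χ : DirichletCharacter ℂ q, Real.exp (K + 4) * (Real.exp (K' * 16 ^ m0) *
        ∏ m ∈ Finset.Ico m0 m1, ‖Tv m (1 / 2 * z χ m0 m)‖ ^ 2
      + ∑ m ∈ Finset.Ico m0 m1, ∑ l ∈ Finset.Icc m0 m, Real.exp (K' * 16 ^ (m + 1)) *
        ((8 ^ m : ℝ) ^ (2 * nn m))⁻¹ * (‖z χ l m‖ ^ (2 * nn m) *
          ∏ m' ∈ Finset.Ico (m + 1) m1, ‖Tv m' (1 / 2 * z χ (m + 1) m')‖ ^ 2)) := by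
        refine Finset.sum_le_sum_of_subset_of_nonneg (Finset.subset_univ _) fun χ _ _ => ?_
        refine mul_nonneg (Real.exp_pos _).le (add_nonneg (mul_nonneg (Real.exp_pos _).le
          (Finset.prod_nonneg fun _ _ => by positivity)) (Finset.sum_nonneg fun _ _ =>
          Finset.sum_nonneg fun _ _ => mul_nonneg (by positivity) (mul_nonneg (by positivity)
          (Finset.prod_nonneg fun _ _ => by positivity))))
    _ = Real.exp (K + 4) * (Real.exp (K' * 16 ^ m0) * ∑ χ : DirichletCharacter ℂ q,
        ∏ m ∈ Finset.Ico m0 m1, ‖Tv m (1 / 2 * z χ m0 m)‖ ^ 2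
      + ∑ m ∈ Finset.Ico m0 m1, ∑ l ∈ Finset.Icc m0 m, ∑ χ : DirichletCharacter ℂ q,
        Real.exp (K' * 16 ^ (m + 1)) *
        ((8 ^ m : ℝ) ^ (2 * nn m))⁻¹ * (‖z χ l m‖ ^ (2 * nn m) *
          ∏ m' ∈ Finset.Ico (m + 1) m1, ‖Tv m' (1 / 2 * z χ (m + 1) m')‖ ^ 2)) := by
        rw [← Finset.mul_sum, Finset.sum_add_distrib, ← Finset.mul_sum]
        congr 2
        rw [Finset.sum_comm]
        refine Finset.sum_congr rfl fun m _ => ?_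
        rw [Finset.sum_comm]
    _ ≤ Real.exp (K + 4) * (Real.exp (K' * 16 ^ m0) * (q.totient * Real.exp G * (MM * E))
      + ∑ m ∈ Finset.Ico m0 m1, ∑ l ∈ Finset.Icc m0 m,
        (1 / 2) ^ m / (m + 1) * (q.totient * (MM * E))) := by
        refine mul_le_mul_of_nonneg_left (add_le_add (mul_le_mul_of_nonneg_left good
          (Real.exp_pos _).le) (Finset.sum_le_sum fun m hm => Finset.sum_le_sum fun l hl =>
          bad m hm l hl)) (Real.exp_pos _).le
    _ ≤ Real.exp (K + 4) * (Real.exp (K' * 16 ^ m0) * (q.totient * Real.exp G * (MM * E))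
      + 2 * (q.totient * (MM * E))) := by
        refine mul_le_mul_of_nonneg_left (add_le_add le_rfl ?_) (Real.exp_pos _).le
        have hnn0 : 0 ≤ (q.totient : ℝ) * (MM * E) := by positivity
        calc _ ≤ ∑ m ∈ Finset.Ico m0 m1, (1 / 2 : ℝ) ^ m * (q.totient * (MM * E)) := by
              refine Finset.sum_le_sum fun m hm => ?_
              rw [Finset.sum_const, nsmul_eq_mul, Nat.card_Icc, ← mul_assoc]
              refine mul_le_mul_of_nonneg_right ?_ hnn0
              have : ((m + 1 - m0 : ℕ) : ℝ) ≤ m + 1 := by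
                exact_mod_cast Nat.sub_le _ _
              rw [← mul_div_assoc, div_le_iff₀ (by positivity), mul_comm]
              gcongr
          _ = (∑ m ∈ Finset.Ico m0 m1, (1 / 2 : ℝ) ^ m) * (q.totient * (MM * E)) := by
              rw [Finset.sum_mul]
          _ ≤ _ := by
              refine mul_le_mul_of_nonneg_right ((sum_half_Ico m0 m1).trans ?_) hnn0
              have : (1 / 2 : ℝ) ^ m0 ≤ 1 := pow_le_one₀ (by norm_num) (by norm_num)
              linarith
    _ = _ := by ring

end

section
open Complex Real Finset

lemma mertens_up (N : ℕ) (hN : 1 ≤ N) :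
    ∑ p ∈ (Finset.Ioc 0 N).filter Nat.Prime, Real.log p / p ≤ Real.log N + Real.log 4 := by
  have hN0 : (0 : ℝ) < N := by exact_mod_cast hN
  have hdvd : ∏ p ∈ (Finset.Ioc 0 N).filter Nat.Prime, p ^ (N / p) ∣ N.factorial := by
    refine Finset.prod_dvd_of_isRelPrime ?_ ?_
    · intro a ha b hb hab
      have ha' := (Finset.mem_filter.1 ha).2
      have hb' := (Finset.mem_filter.1 hb).2
      rw [Function.onFun, ← Nat.coprime_iff_isRelPrime]
      exact Nat.Coprime.pow _ _ ((Nat.coprime_primes ha' hb').2 hab)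
    · intro p hp
      have hpp := (Finset.mem_filter.1 hp).2
      have hpN := (Finset.mem_Ioc.1 (Finset.mem_filter.1 hp).1).2
      rw [Nat.Prime.pow_dvd_factorial_iff hpp (Nat.lt_succ_self _)]
      refine le_trans (le_of_eq (by rw [pow_one])) (Finset.single_le_sum (f := fun i => N / p ^ i)
        (fun _ _ => Nat.zero_le _) (Finset.mem_Ico.2 ⟨le_rfl, ?_⟩))
      have := Nat.log_pos hpp.one_lt hpN
      omega
  have h1 : ∏ p ∈ (Finset.Ioc 0 N).filter Nat.Prime, p ^ (N / p) ≤ N ^ N :=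
    (Nat.le_of_dvd (Nat.factorial_pos _) hdvd).trans (Nat.factorial_le_pow N)
  have h2 : ∑ p ∈ (Finset.Ioc 0 N).filter Nat.Prime, ((N / p : ℕ) : ℝ) * Real.log p
      ≤ N * Real.log N := by
    have h3 : ∑ p ∈ (Finset.Ioc 0 N).filter Nat.Prime, ((N / p : ℕ) : ℝ) * Real.log p
        = Real.log ((∏ p ∈ (Finset.Ioc 0 N).filter Nat.Prime, p ^ (N / p) : ℕ) : ℝ) := by
      push_cast
      rw [Real.log_prod]
      · exact Finset.sum_congr rfl fun p _ => by rw [Real.log_pow]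
      · intro p hp
        have hpp := (Finset.mem_filter.1 hp).2
        have : (p : ℝ) ≠ 0 := by exact_mod_cast hpp.ne_zero
        positivity
    rw [h3, ← Real.log_pow]
    refine Real.log_le_log ?_ (by exact_mod_cast h1)
    have : 0 < ∏ p ∈ (Finset.Ioc 0 N).filter Nat.Prime, p ^ (N / p) :=
      Finset.prod_pos fun p hp => pow_pos (Finset.mem_filter.1 hp).2.pos _
    exact_mod_cast this
  have h4 : ∑ p ∈ (Finset.Ioc 0 N).filter Nat.Prime, Real.log p ≤ Real.log 4 * N := by
    have := Chebyshev.theta_le_log4_mul_x (x := (N : ℝ)) hN0.le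
    rw [Chebyshev.theta, Nat.floor_natCast] at this
    exact this
  have h5 : N * ∑ p ∈ (Finset.Ioc 0 N).filter Nat.Prime, Real.log p / p
      ≤ ∑ p ∈ (Finset.Ioc 0 N).filter Nat.Prime, ((N / p : ℕ) : ℝ) * Real.log p
        + ∑ p ∈ (Finset.Ioc 0 N).filter Nat.Prime, Real.log p := by
    rw [Finset.mul_sum, ← Finset.sum_add_distrib]
    refine Finset.sum_le_sum fun p hp => ?_
    have hpp := (Finset.mem_filter.1 hp).2
    have hp0 : (0 : ℝ) < p := by exact_mod_cast hpp.pos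
    have hl : 0 ≤ Real.log p := Real.log_natCast_nonneg p
    have : (N : ℝ) / p ≤ ((N / p : ℕ) : ℝ) + 1 := by
      rw [← Nat.floor_div_eq_div (K := ℝ)]
      exact (Nat.lt_floor_add_one _).le
    calc (N : ℝ) * (Real.log p / p) = (N : ℝ) / p * Real.log p := by ring
      _ ≤ (((N / p : ℕ) : ℝ) + 1) * Real.log p := by gcongr
      _ = _ := by ring
  have : N * ∑ p ∈ (Finset.Ioc 0 N).filter Nat.Prime, Real.log p / p
      ≤ N * (Real.log N + Real.log 4) := by linarith
  exact le_of_mul_le_mul_left this hN0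

/-- sum of reciprocals of the primes in a chunk -/
lemma chunk_inv_le (Q : ℝ) (m : ℕ) (hm : 1 ≤ Q / 16 ^ m) :
    ∑ p ∈ chunk (fun m => ⌊Real.exp (Q / 16 ^ m)⌋₊) m, 1 / (p : ℝ) ≤ 48 := by
  set Δ := Q / 16 ^ m with hΔ
  have e : Q / 16 ^ (m + 1) = Δ / 16 := by rw [hΔ, pow_succ]; field_simp
  set N := ⌊Real.exp Δ⌋₊ with hN
  have hN1 : 1 ≤ N := Nat.le_floor (by simpa using Real.one_le_exp (by linarith))
  have h1 : ∀ p ∈ chunk (fun m => ⌊Real.exp (Q / 16 ^ m)⌋₊) m,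
      1 / (p : ℝ) ≤ 16 / Δ * (Real.log p / p) := by
    intro p hp
    have hpp := (Finset.mem_filter.1 hp).2
    have hp0 : (0 : ℝ) < p := by exact_mod_cast hpp.pos
    have h := (Finset.mem_Ioc.1 (Finset.mem_filter.1 hp).1).1
    simp only [e] at h
    have h2 := (Nat.floor_lt (Real.exp_pos _).le).1 h
    have h3 : Δ / 16 ≤ Real.log p := (Real.le_log_iff_exp_le hp0).2 h2.le
    rw [← mul_div_assoc]
    gcongr
    rw [div_mul_eq_mul_div, le_div_iff₀ (by linarith)]
    linarith
  have h2 : ∑ p ∈ chunk (fun m => ⌊Real.exp (Q / 16 ^ m)⌋₊) m, Real.log p / p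
      ≤ ∑ p ∈ (Finset.Ioc 0 N).filter Nat.Prime, Real.log p / p := by
    refine Finset.sum_le_sum_of_subset_of_nonneg ?_ fun p _ _ =>
      div_nonneg (Real.log_natCast_nonneg p) (Nat.cast_nonneg p)
    exact Finset.filter_subset_filter _ (Finset.Ioc_subset_Ioc (Nat.zero_le _) le_rfl)
  have h3 := mertens_up N hN1
  have h4 : Real.log N ≤ Δ := by
    rw [Real.log_le_iff_le_exp (by exact_mod_cast hN1)]
    exact Nat.floor_le (Real.exp_pos _).le
  have h5 : Real.log 4 ≤ 2 := by
    rw [Real.log_le_iff_le_exp (by norm_num)]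
    have := Real.add_one_le_exp (1 : ℝ)
    have : Real.exp 2 = Real.exp 1 * Real.exp 1 := by rw [← Real.exp_add]; norm_num
    nlinarith
  calc _ ≤ ∑ p ∈ chunk (fun m => ⌊Real.exp (Q / 16 ^ m)⌋₊) m, 16 / Δ * (Real.log p / p) :=
        Finset.sum_le_sum h1
    _ = 16 / Δ * ∑ p ∈ chunk (fun m => ⌊Real.exp (Q / 16 ^ m)⌋₊) m, Real.log p / p := by
        rw [Finset.mul_sum]
    _ ≤ 16 / Δ * (3 * Δ) := by
        refine mul_le_mul_of_nonneg_left ?_ (by positivity)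
        linarith
    _ = 48 := by field_simp; norm_num

lemma geo3 {r : ℝ} (h0 : 0 ≤ r) (h1 : r ^ 2 ≤ 1 / 2) (K : ℕ) :
    ∑ k ∈ Finset.Icc 3 K, r ^ k ≤ 4 * r ^ 3 := by
  have hr : r ≤ 3 / 4 := by nlinarith
  have : ∑ k ∈ Finset.Icc 3 K, r ^ k ≤ r ^ 3 * ∑ i ∈ Finset.range K, r ^ i := by
    rw [← Finset.Ico_add_one_right_eq_Icc, Finset.sum_Ico_eq_sum_range, Finset.mul_sum]
    refine le_trans (Finset.sum_le_sum_of_subset_of_nonneg (t := Finset.range K)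
      (Finset.range_subset_range.2 (by omega)) (fun _ _ _ => by positivity)) ?_
    exact Finset.sum_le_sum fun i _ => by rw [pow_add]
  refine this.trans ?_
  rw [mul_comm 4]
  refine mul_le_mul_of_nonneg_left ?_ (by positivity)
  rw [geom_sum_eq (by linarith), div_le_iff_of_neg (by linarith)]
  have : 0 ≤ r ^ K := by positivity
  linarith

lemma DL_split (g : ℕ → ℂ) (N : ℕ) (H : ℝ) (hH : 0 ≤ H) (hg : ∀ n, N < n → g n = 0)
    (hpp : ∀ n, ¬ IsPrimePow n → g n = 0)
    (hb : ∀ p k : ℕ, p.Prime → 3 ≤ k → ‖g (p ^ k)‖ ≤ H * ((p : ℝ) ^ (-(1 / 2) : ℝ)) ^ k) :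
    ‖∑ n ∈ Finset.Icc 1 N, g n - ∑ p ∈ (Finset.Ioc 0 N).filter Nat.Prime, (g p + g (p ^ 2))‖
      ≤ 4 * H * Z32 := by
  set K := ⌊Real.log N / Real.log 2⌋₊ + 2 with hK
  have h1 : ∑ n ∈ Finset.Icc 1 N, g n
      = ∑ k ∈ Finset.Icc 1 K, ∑ p ∈ (Finset.Ioc 0 N).filter Nat.Prime, g (p ^ k) := by
    have a := Chebyshev.sum_PrimePow_eq_sum_sum' g (x := (N : ℝ)) (Nat.cast_nonneg N)
      (N := K) (by omega)
    rw [Nat.floor_natCast] at a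
    have b : ∑ n ∈ Finset.Icc 1 N, g n = ∑ n ∈ Finset.Ioc 0 N with IsPrimePow n, g n := by
      rw [Finset.sum_filter]
      refine Finset.sum_congr (by ext; simp [Nat.succ_le_iff]) fun n _ => ?_
      split_ifs with h
      · rfl
      · exact hpp n h
    rw [b, a]
    refine Finset.sum_congr rfl fun k hk => ?_
    have hk1 := (Finset.mem_Icc.1 hk).1
    refine Finset.sum_subset ?_ ?_
    · refine Finset.filter_subset_filter _ (Finset.Ioc_subset_Ioc le_rfl ?_)
      rcases Nat.eq_zero_or_pos N with h0 | h0
      · rw [h0, Nat.cast_zero, Real.zero_rpow (by positivity)]; simp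
      · refine Nat.floor_le_of_le ?_
        have hN1 : (1 : ℝ) ≤ N := by exact_mod_cast h0
        calc (N : ℝ) ^ ((1 : ℝ) / k) ≤ (N : ℝ) ^ (1 : ℝ) := by
              refine Real.rpow_le_rpow_of_exponent_le hN1 ?_
              rw [div_le_one (by positivity)]
              exact_mod_cast hk1
          _ = N := Real.rpow_one _
    · intro p hp hp'
      apply hg
      have hp1 := Finset.mem_filter.1 hp
      have hp2 := Finset.mem_Ioc.1 hp1.1
      simp only [Finset.mem_filter, Finset.mem_Ioc, not_and] at hp'
      have h3 : ¬ p ≤ ⌊(N : ℝ) ^ ((1 : ℝ) / k)⌋₊ := fun h => hp' ⟨hp2.1, h⟩ hp1.2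
      rw [not_le, Nat.floor_lt (by positivity)] at h3
      have h4 : (N : ℝ) < (p : ℝ) ^ k := by
        calc (N : ℝ) = ((N : ℝ) ^ ((1 : ℝ) / k)) ^ k := by
              rw [← Real.rpow_natCast, ← Real.rpow_mul (by positivity), one_div,
                inv_mul_cancel₀ (by positivity), Real.rpow_one]
          _ < _ := by gcongr
      exact_mod_cast h4
  have h2 : ∑ n ∈ Finset.Icc 1 N, g n - ∑ p ∈ (Finset.Ioc 0 N).filter Nat.Prime, (g p + g (p ^ 2))
      = ∑ p ∈ (Finset.Ioc 0 N).filter Nat.Prime, ∑ k ∈ Finset.Icc 3 K, g (p ^ k) := by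
    rw [h1, Finset.sum_comm, ← Finset.sum_sub_distrib]
    refine Finset.sum_congr rfl fun p _ => ?_
    rw [← Finset.add_sum_Ioc_eq_sum_Icc (by omega : 1 ≤ K)]
    have : Finset.Ioc 1 K = Finset.Icc 2 K := by ext; simp [Nat.succ_le_iff]
    rw [this, ← Finset.add_sum_Ioc_eq_sum_Icc (by omega : 2 ≤ K)]
    have : Finset.Ioc 2 K = Finset.Icc 3 K := by ext; simp [Nat.succ_le_iff]
    rw [this, pow_one]
    ring
  rw [h2]
  refine (norm_sum_le _ _).trans ?_
  calc _ ≤ ∑ p ∈ (Finset.Ioc 0 N).filter Nat.Prime, 4 * H * (1 * (p : ℝ) ^ (-(3 / 2) : ℝ)) := by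
        refine Finset.sum_le_sum fun p hp => ?_
        have hpr := (Finset.mem_filter.1 hp).2
        have hp2 : (2 : ℝ) ≤ p := by exact_mod_cast hpr.two_le
        set r := (p : ℝ) ^ (-(1 / 2) : ℝ) with hr
        have hr2 : r ^ 2 ≤ 1 / 2 := by
          rw [hr, ← Real.rpow_natCast, ← Real.rpow_mul (by positivity)]
          norm_num
          rw [Real.rpow_neg_one]
          rw [one_div]
          exact inv_anti₀ (by norm_num) hp2
        have hr3 : r ^ 3 = (p : ℝ) ^ (-(3 / 2) : ℝ) := by
          rw [hr, ← Real.rpow_natCast, ← Real.rpow_mul (by positivity)]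
          norm_num
        calc _ ≤ ∑ k ∈ Finset.Icc 3 K, ‖g (p ^ k)‖ := norm_sum_le _ _
          _ ≤ ∑ k ∈ Finset.Icc 3 K, H * r ^ k :=
              Finset.sum_le_sum fun k hk => hb p k hpr (Finset.mem_Icc.1 hk).1
          _ = H * ∑ k ∈ Finset.Icc 3 K, r ^ k := by rw [Finset.mul_sum]
          _ ≤ H * (4 * r ^ 3) := by gcongr; exact geo3 (by positivity) hr2 K
          _ = _ := by rw [hr3]; ring
    _ = 4 * H * ∑ p ∈ (Finset.Ioc 0 N).filter Nat.Prime, (1 * (p : ℝ) ^ (-(3 / 2) : ℝ)) := by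
        rw [Finset.mul_sum]
    _ ≤ _ := by
        refine mul_le_mul_of_nonneg_left ?_ (by positivity)
        exact Z32_summable.sum_le_tsum _ (fun n _ => by positivity)

end

section
open Complex Real Finset

/-- level coefficients -/
noncomputable def cL (α t : Fin 4 → ℝ) (a Δ : ℝ) (n : ℕ) : ℂ :=
  ((ArithmeticFunction.vonMangoldt n / Real.log n * kap Δ n : ℝ) : ℂ) *
    ∑ i, (α i : ℂ) * (n : ℂ) ^ (-(1 / 2 + a + t i * I) : ℂ)

/-- bound for prime coefficients -/
noncomputable def xB (α t : Fin 4 → ℝ) (a : ℝ) (n : ℕ) : ℝ :=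
  ‖∑ i, (α i : ℂ) * (n : ℂ) ^ (-(1 / 2 + a + t i * I) : ℂ)‖

lemma xB_le (α t : Fin 4 → ℝ) (hα : ∀ i, 0 ≤ α i) {a : ℝ} (ha : 0 ≤ a) {n : ℕ} (hn : 1 ≤ n) :
    xB α t a n ≤ (∑ i, α i) * (n : ℝ) ^ (-(1 / 2) : ℝ) := by
  unfold xB
  refine (norm_sum_le _ _).trans ?_
  rw [Finset.sum_mul]
  refine Finset.sum_le_sum fun i _ => ?_
  have hn0 : (0 : ℝ) < n := by exact_mod_cast hn
  rw [norm_mul, Complex.norm_real, Real.norm_of_nonneg (hα i)]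
  refine mul_le_mul_of_nonneg_left ?_ (hα i)
  rw [show ((n : ℂ)) = ((n : ℝ) : ℂ) by simp, Complex.norm_cpow_eq_rpow_re_of_pos hn0]
  refine Real.rpow_le_rpow_of_exponent_le (by exact_mod_cast hn) ?_
  simp
  linarith

lemma xB_mono (α t : Fin 4 → ℝ) {a b : ℝ} (hb : 0 ≤ b) {n : ℕ} (hn : 1 ≤ n) :
    xB α t (a + b) n ≤ xB α t a n := by
  unfold xB
  have hn0 : (0 : ℝ) < n := by exact_mod_cast hn
  have hnc : (n : ℂ) ≠ 0 := by exact_mod_cast hn0.ne'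
  have : ∑ i, (α i : ℂ) * (n : ℂ) ^ (-(1 / 2 + (a + b : ℝ) + t i * I) : ℂ)
      = (n : ℂ) ^ (-(b : ℂ)) * ∑ i, (α i : ℂ) * (n : ℂ) ^ (-(1 / 2 + a + t i * I) : ℂ) := by
    rw [Finset.mul_sum]
    refine Finset.sum_congr rfl fun i _ => ?_
    rw [show (-(1 / 2 + (a + b : ℝ) + t i * I) : ℂ) = -(b : ℂ) + -(1 / 2 + a + t i * I) by
      push_cast; ring, Complex.cpow_add _ _ hnc]
    ring
  rw [this, norm_mul]
  refine mul_le_of_le_one_left (norm_nonneg _) ?_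
  rw [show ((n : ℂ)) = ((n : ℝ) : ℂ) by simp, Complex.norm_cpow_eq_rpow_re_of_pos hn0]
  refine Real.rpow_le_one_of_one_le_of_nonpos (by exact_mod_cast hn) ?_
  simpa using hb

lemma cL_le (α t : Fin 4 → ℝ) (a : ℝ) {Δ : ℝ} (hΔ : 0 < Δ) (n : ℕ) :
    ‖cL α t a Δ n‖ ≤ xB α t a n := by
  unfold cL xB
  rw [norm_mul, Complex.norm_real]
  refine mul_le_of_le_one_left (norm_nonneg _) ?_
  obtain ⟨h1, h2⟩ := vM_div_log_le n
  have h3 := kap_nonneg hΔ n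
  have h4 := kap_le_one hΔ n
  rw [Real.norm_of_nonneg (mul_nonneg h1 h3)]
  exact mul_le_one₀ h2 h3 h4

lemma cL_DL {q : ℕ} (χ : DirichletCharacter ℂ q) (α t : Fin 4 → ℝ) (a Δ : ℝ) :
    ∑ i, (α i : ℂ) * DL χ Δ (t i) a = ∑ n ∈ Finset.Icc 1 ⌊Real.exp Δ⌋₊, cL α t a Δ n * χ n := by
  unfold DL cL
  simp only [Finset.mul_sum, Finset.sum_mul]
  rw [Finset.sum_comm]
  refine Finset.sum_congr rfl fun n _ => Finset.sum_congr rfl fun i _ => ?_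
  ring

theorem lemmaB0 (α : Fin 4 → ℝ) (hα : ∀ i, 0 ≤ α i) : ∃ C : ℝ, 0 < C ∧ ∃ q0 : ℕ, 14 ≤ q0 ∧
    ∀ (q : ℕ) [NeZero q], q0 ≤ q → (∀ χ : DirichletCharacter ℂ q, dirichletRH χ) →
    ∀ a : ℝ, 0 < a → a ≤ 1 / 2 → ∀ t : Fin 4 → ℝ, (∀ i, |t i| ≤ (q : ℝ) ^ 2) →
    ∀ X : Finset (DirichletCharacter ℂ q), (∀ χ ∈ X, χ ≠ 1) → ∃ N : ℕ,
    ∑ χ ∈ X, ∏ i, ‖DirichletCharacter.LFunction χ (1 / 2 + a + t i * I)‖ ^ (α i)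
      ≤ C * q.totient *
        Real.exp (1 / 4 * ∑ p ∈ (Finset.Ioc 0 N).filter Nat.Prime, xB α t a p ^ 2) := by
  set H := ∑ i, α i with hHd
  have hH : 0 ≤ H := Finset.sum_nonneg fun i _ => hα i
  have hZ := one_le_Z32
  obtain ⟨m0, hm0, Cc, hCc, hcore⟩ := core H (H * (Real.log Z32 + Z32) + 4 * H * Z32 +
    2 * H * Real.exp 16) (50 * A0 * H) 48 hH (by norm_num)
  refine ⟨Cc, hCc, ⌈Real.exp (16 ^ m0)⌉₊ + 14, by omega, ?_⟩
  intro q _ hq hRH a ha ha' t ht X hX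
  have hq14 : 14 ≤ q := by omega
  have hqR : (14 : ℝ) ≤ q := by exact_mod_cast hq14
  have hq0 : (0 : ℝ) < q := by linarith
  set Q := Real.log q with hQ
  have hQ16 : (16 : ℝ) ^ m0 ≤ Q := by
    rw [hQ, Real.le_log_iff_exp_le hq0]
    refine (Nat.le_ceil _).trans ?_
    exact_mod_cast (by omega : ⌈Real.exp (16 ^ m0)⌉₊ ≤ q)
  have hQ0 : 0 < Q := lt_of_lt_of_le (by positivity) hQ16
  set m1 := Nat.log 16 ⌊Q⌋₊ with hm1
  have hfl : 16 ^ m0 ≤ ⌊Q⌋₊ := Nat.le_floor (by push_cast; exact hQ16)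
  have hfl0 : ⌊Q⌋₊ ≠ 0 := by have : 0 < 16 ^ m0 := by positivity
                             omega
  have hm01 : m0 ≤ m1 := by
    rw [hm1]; exact Nat.le_log_of_pow_le (by norm_num) hfl
  have hD1 : ∀ l, l ≤ m1 → 1 ≤ Q / 16 ^ l := by
    intro l hl
    rw [le_div_iff₀ (by positivity), one_mul]
    have : (16 : ℝ) ^ m1 ≤ Q := by
      refine le_trans ?_ (Nat.floor_le hQ0.le)
      exact_mod_cast Nat.pow_log_le_self 16 hfl0
    exact (pow_le_pow_right₀ (by norm_num) hl).trans this
  have hD2 : Q / 16 ^ m1 ≤ 16 := by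
    rw [div_le_iff₀ (by positivity), ← pow_succ']
    have h1 := Nat.lt_pow_succ_log_self (b := 16) (by norm_num) ⌊Q⌋₊
    have h2 : ((⌊Q⌋₊ + 1 : ℕ) : ℝ) ≤ ((16 ^ (m1 + 1) : ℕ) : ℝ) := by exact_mod_cast h1
    push_cast at h2
    linarith [Nat.lt_floor_add_one Q]
  set N : ℕ → ℕ := fun m => ⌊Real.exp (Q / 16 ^ m)⌋₊ with hN
  have hNanti : Antitone N := by
    intro i j hij
    refine Nat.floor_le_floor ?_
    apply Real.exp_le_exp.2
    gcongr
    norm_num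
  refine ⟨N m0, hcore q (by omega) m1 hm01 N hNanti (fun m => Nat.floor_le (Real.exp_pos _).le)
    (fun l => cL α t (a + 8 / (Q / 16 ^ l)) (Q / 16 ^ l)) (xB α t a) ?_ ?_ ?_ ?_ X _ ?_⟩
  · intro l p hp
    exact (cL_le α t _ (by positivity) p).trans (xB_mono α t (by positivity) hp.one_le)
  · intro p hp
    refine (xB_le α t hα ha.le hp.one_le).trans (le_of_eq ?_)
    rw [Real.rpow_neg (by positivity), ← Real.sqrt_eq_rpow, div_eq_mul_inv]
  · intro l p hp
    refine (cL_le α t _ (by positivity) _).trans ?_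
    refine (xB_le α t hα (by positivity) (Nat.one_le_pow _ _ hp.pos)).trans (le_of_eq ?_)
    push_cast
    have : ((p : ℝ) ^ 2) ^ (-(1 / 2) : ℝ) = (p : ℝ)⁻¹ := by
      rw [← Real.rpow_natCast, ← Real.rpow_mul (by positivity),
        show ((2 : ℕ) : ℝ) * (-(1 / 2)) = -1 by norm_num, Real.rpow_neg_one]
    rw [this, div_eq_mul_inv]
  · intro m hm
    exact chunk_inv_le Q m (hD1 m hm.le)
  · intro χ hχ l hl hl1
    set Δ := Q / 16 ^ l with hΔ
    have hΔ1 := hD1 l hl1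
    have hΔ0 : 0 < Δ := by linarith
    set b := a + 8 / Δ with hb
    have hb0 : 0 ≤ b := by positivity
    have hχ1 := hX χ hχ
    have hL : ∀ i, 0 < ‖DirichletCharacter.LFunction χ (1 / 2 + a + t i * I)‖ := fun i => by
      rw [norm_pos_iff]
      refine L_ne_zero hχ1 (hRH χ) ?_
      simp; linarith
    have e1 : ∏ i, ‖DirichletCharacter.LFunction χ (1 / 2 + a + t i * I)‖ ^ (α i)
        = Real.exp (∑ i, α i * uL χ (t i) a) := by
      rw [Real.exp_sum]
      refine Finset.prod_congr rfl fun i _ => ?_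
      rw [Real.rpow_def_of_pos (hL i), uL, mul_comm]
    rw [e1]
    apply Real.exp_le_exp.2
    have hA0 := A0_pos
    have s1 : ∀ i, uL χ (t i) a ≤ (DL χ Δ (t i) b).re + (Real.log Z32 + Z32) + 50 * A0 * 16 ^ l := by
      intro i
      refine (claimA0 hχ1 (hRH χ) (t i) ha ha' hΔ1).trans ?_
      refine add_le_add le_rfl ?_
      have l2 : Real.log 2 ≤ Q := Real.log_le_log (by norm_num) (by linarith)
      have l3 : Real.log (13 + |t i|) ≤ 3 * Q := by
        have : (3 : ℝ) * Q = Real.log ((q : ℝ) ^ 3) := by rw [Real.log_pow]; rw [hQ]; norm_num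
        rw [this]
        refine Real.log_le_log (by positivity) ?_
        have := ht i
        nlinarith [sq_nonneg ((q : ℝ) - 14)]
      calc 10 / Δ * (A0 * (Q + Real.log 2 + Real.log (13 + |t i|)))
          ≤ 10 / Δ * (A0 * (5 * Q)) := by gcongr; linarith
        _ = 50 * A0 * 16 ^ l := by 
            have : Q = Δ * 16 ^ l := by rw [hΔ]; field_simp
            rw [this, div_mul_eq_mul_div, div_eq_iff hΔ0.ne']; ring
    have s2 : ∑ i, α i * uL χ (t i) a ≤ (∑ i, (α i : ℂ) * DL χ Δ (t i) b).re
        + H * (Real.log Z32 + Z32) + 50 * A0 * H * 16 ^ l := by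
      have : (∑ i, (α i : ℂ) * DL χ Δ (t i) b).re = ∑ i, α i * (DL χ Δ (t i) b).re := by
        rw [Complex.re_sum]
        exact Finset.sum_congr rfl fun i _ => by rw [Complex.re_ofReal_mul]
      rw [this, hHd, Finset.sum_mul, mul_assoc, mul_comm (∑ i, α i), ← mul_assoc, Finset.mul_sum,
        ← Finset.sum_add_distrib, ← Finset.sum_add_distrib]
      refine Finset.sum_le_sum fun i _ => ?_
      have := mul_le_mul_of_nonneg_left (s1 i) (hα i)
      linarith
    set g : ℕ → ℂ := fun n => cL α t b Δ n * χ n with hg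
    have hgn : ∀ n : ℕ, 1 ≤ n → ‖g n‖ ≤ H * (n : ℝ) ^ (-(1 / 2) : ℝ) := by
      intro n hn
      simp only [hg]
      rw [norm_mul]
      refine (mul_le_of_le_one_right (norm_nonneg _) (DirichletCharacter.norm_le_one χ _)).trans ?_
      exact (cL_le α t b hΔ0 n).trans (xB_le α t hα hb0 hn)
    have hgH : ∀ n : ℕ, 1 ≤ n → ‖g n‖ ≤ H := by
      intro n hn
      refine (hgn n hn).trans (mul_le_of_le_one_right hH ?_)
      exact Real.rpow_le_one_of_one_le_of_nonpos (by exact_mod_cast hn) (by norm_num)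
    have s3 := DL_split g (N l) H hH (by
        intro n hn
        have : Real.exp Δ < n := (Nat.floor_lt (Real.exp_pos _).le).1 hn
        simp only [hg, cL]
        rw [kap_zero hΔ0 this.le]
        simp) (by
        intro n hn
        simp only [hg, cL]
        rw [ArithmeticFunction.vonMangoldt_eq_zero_iff.2 hn]
        simp) (by
        intro p k hp hk
        refine (hgn (p ^ k) (Nat.one_le_pow _ _ hp.pos)).trans (le_of_eq ?_)
        push_cast
        rw [← Real.rpow_natCast, ← Real.rpow_natCast, ← Real.rpow_mul (by positivity),
          ← Real.rpow_mul (by positivity), mul_comm (k : ℝ)])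
    have s4 : ∑ p ∈ (Finset.Ioc 0 (N l)).filter Nat.Prime, (g p + g (p ^ 2))
        = ∑ p ∈ (Finset.Ioc 0 (N m1)).filter Nat.Prime, (g p + g (p ^ 2))
          + ∑ m ∈ Finset.Ico l m1, ∑ p ∈ chunk N m, (g p + g (p ^ 2)) := by
      rw [sum_chunks N hNanti _ l m1 hl1, ← Finset.sum_union]
      · congr 1
        ext p
        have := hNanti hl1
        simp only [Finset.mem_union, Finset.mem_filter, Finset.mem_Ioc]
        constructor
        · rintro ⟨⟨h1, h2⟩, h3⟩
          rcases le_or_gt p (N m1) with h | h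
          · exact Or.inl ⟨⟨h1, h⟩, h3⟩
          · exact Or.inr ⟨⟨h, h2⟩, h3⟩
        · rintro (⟨⟨h1, h2⟩, h3⟩ | ⟨⟨h1, h2⟩, h3⟩)
          · exact ⟨⟨h1, h2.trans this⟩, h3⟩
          · exact ⟨⟨by omega, h2⟩, h3⟩
      · rw [Finset.disjoint_left]
        intro p h1 h2
        simp only [Finset.mem_filter, Finset.mem_Ioc] at h1 h2
        omega
    have s5 : ‖∑ p ∈ (Finset.Ioc 0 (N m1)).filter Nat.Prime, (g p + g (p ^ 2))‖
        ≤ 2 * H * Real.exp 16 := by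
      refine (norm_sum_le _ _).trans ?_
      calc _ ≤ ∑ p ∈ (Finset.Ioc 0 (N m1)).filter Nat.Prime, (2 * H) := by
            refine Finset.sum_le_sum fun p hp => (norm_add_le _ _).trans ?_
            have hpp := (Finset.mem_filter.1 hp).2
            have h1 := hgH p hpp.one_le
            have h2 := hgH (p ^ 2) (Nat.one_le_pow _ _ hpp.pos)
            linarith
        _ ≤ ∑ p ∈ Finset.Ioc 0 (N m1), (2 * H) :=
            Finset.sum_le_sum_of_subset_of_nonneg (Finset.filter_subset _ _)
              fun _ _ _ => by positivity
        _ = N m1 * (2 * H) := by simp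
        _ ≤ Real.exp 16 * (2 * H) := by
            refine mul_le_mul_of_nonneg_right ?_ (by positivity)
            exact (Nat.floor_le (Real.exp_pos _).le).trans (Real.exp_le_exp.2 hD2)
        _ = _ := by ring
    have s6 : ∑ m ∈ Finset.Ico l m1, ev χ (PP (cL α t b Δ) (chunk N m))
        = ∑ m ∈ Finset.Ico l m1, ∑ p ∈ chunk N m, (g p + g (p ^ 2)) :=
      Finset.sum_congr rfl fun m _ => PP_ev χ _ _
    rw [s6]
    rw [cL_DL] at s2
    have s7 : ∑ n ∈ Finset.Icc 1 ⌊Real.exp Δ⌋₊, cL α t b Δ n * χ n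
        = (∑ n ∈ Finset.Icc 1 (N l), g n
          - ∑ p ∈ (Finset.Ioc 0 (N l)).filter Nat.Prime, (g p + g (p ^ 2)))
          + ∑ p ∈ (Finset.Ioc 0 (N m1)).filter Nat.Prime, (g p + g (p ^ 2))
          + ∑ m ∈ Finset.Ico l m1, ∑ p ∈ chunk N m, (g p + g (p ^ 2)) := by
      rw [s4]; ring
    rw [s7, Complex.add_re, Complex.add_re] at s2
    have r1 := (Complex.re_le_norm _).trans s3
    have r2 := (Complex.re_le_norm _).trans s5
    linarith

end

section
open Complex Real Finset

lemma cpow_diff {s : ℂ} (hs : 1 ≤ s.re) {n : ℕ} (hn : 1 ≤ n) {x : ℝ} (hx : (n : ℝ) ≤ x) (hx1 : x ≤ n + 1) :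
    ‖(n : ℂ) ^ (-s) - (x : ℂ) ^ (-s)‖ ≤ ‖s‖ * ((n : ℝ) ^ 2)⁻¹ := by
  have hn1 : (1 : ℝ) ≤ n := by exact_mod_cast hn
  have hs0 : s ≠ 0 := by rintro rfl; simp at hs; linarith
  have key := (convex_Icc (n : ℝ) (n + 1)).norm_image_sub_le_of_norm_hasDerivWithin_le
    (f := fun y : ℝ => (y : ℂ) ^ (-s)) (f' := fun y : ℝ => (-s) * (y : ℂ) ^ (-s - 1))
    (C := ‖s‖ * ((n : ℝ) ^ 2)⁻¹) (x := x) (y := n) ?_ ?_ ⟨hx, hx1⟩ ⟨le_rfl, by linarith⟩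
  · refine key.trans ?_
    refine mul_le_of_le_one_right (by positivity) ?_
    rw [Real.norm_eq_abs, abs_le]; constructor <;> linarith
  · intro y hy
    have hy0 : y ≠ 0 := by have := hy.1; linarith
    exact (hasDerivAt_ofReal_cpow_const hy0 (neg_ne_zero.2 hs0)).hasDerivWithinAt
  · intro y hy
    have hy0 : 0 < y := by have := hy.1; linarith
    rw [norm_mul, norm_neg, Complex.norm_cpow_eq_rpow_re_of_pos hy0]
    refine mul_le_mul_of_nonneg_left ?_ (norm_nonneg _)
    have e : (-s - 1).re = -(s.re + 1) := by simp; ring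
    rw [e, Real.rpow_neg hy0.le]
    refine inv_anti₀ (by positivity) ?_
    calc (n : ℝ) ^ 2 ≤ y ^ 2 := by gcongr; exact hy.1
      _ = y ^ (2 : ℝ) := by norm_cast
      _ ≤ _ := Real.rpow_le_rpow_of_exponent_le (by have := hy.1; linarith) (by linarith)

lemma cpow_step {s : ℂ} (hs : 1 ≤ s.re) (hs1 : s ≠ 1) {n : ℕ} (hn : 1 ≤ n) :
    ‖(n : ℂ) ^ (-s) - ((n : ℂ) ^ (1 - s) - ((n + 1 : ℕ) : ℂ) ^ (1 - s)) / (s - 1)‖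
      ≤ ‖s‖ * ((n : ℝ) ^ 2)⁻¹ := by
  have hn1 : (1 : ℝ) ≤ n := by exact_mod_cast hn
  have hs0 : s - 1 ≠ 0 := sub_ne_zero.2 hs1
  have key := (convex_Icc (n : ℝ) (n + 1)).norm_image_sub_le_of_norm_hasDerivWithin_le
    (f := fun y : ℝ => (n : ℂ) ^ (-s) * (y : ℂ) - (y : ℂ) ^ (-s + 1) / (-s + 1))
    (f' := fun y : ℝ => (n : ℂ) ^ (-s) * 1 - (y : ℂ) ^ (-s))
    (C := ‖s‖ * ((n : ℝ) ^ 2)⁻¹) (x := n) (y := n + 1) ?_ ?_ ⟨le_rfl, by linarith⟩ ⟨by linarith, le_rfl⟩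
  · simp only [add_sub_cancel_left, norm_one, mul_one] at key
    refine le_trans (le_of_eq ?_) key
    congr 1
    push_cast
    rw [show -s + 1 = 1 - s by ring]
    have h1 : (1 - s) ≠ 0 := by intro h; apply hs0; linear_combination -h
    have h2 : s - 1 = -(1 - s) := by ring
    rw [h2, div_neg]
    ring
  · intro y hy
    have hy0 : y ≠ 0 := by have := hy.1; linarith
    refine HasDerivAt.hasDerivWithinAt (HasDerivAt.sub ?_ (hasDerivAt_ofReal_cpow_const' hy0 ?_))
    · exact (Complex.ofRealCLM.hasDerivAt (x := y)).const_mul _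
    · intro h; apply hs0; linear_combination -h
  · intro y hy
    simp only [mul_one]
    exact cpow_diff hs hn hy.1 hy.2

lemma sum_inv_sq_Ico (N M : ℕ) (hN : 1 ≤ N) : ∑ n ∈ Finset.Ico N M, ((n : ℝ) ^ 2)⁻¹ ≤ 2 / N := by
  rcases le_or_gt N M with h | h
  · have : ∑ n ∈ Finset.Ico N M, ((n : ℝ) ^ 2)⁻¹ ≤ 2 / N - 2 / M := by
      induction M, h using Nat.le_induction with
      | base => simp
      | succ M hM ih =>
        rw [Finset.sum_Ico_succ_top hM]
        have hM1 : (1 : ℝ) ≤ M := by exact_mod_cast (by omega : 1 ≤ M)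
        have : ((M : ℝ) ^ 2)⁻¹ ≤ 2 / M - 2 / ((M + 1 : ℕ) : ℝ) := by
          push_cast
          rw [div_sub_div _ _ (by positivity) (by positivity), inv_eq_one_div,
            div_le_div_iff₀ (by positivity) (by positivity)]
          nlinarith
        linarith
    have h2 : (0 : ℝ) ≤ 2 / M := by positivity
    linarith
  · rw [Finset.Ico_eq_empty (by omega)]; simp; positivity

lemma partial_zeta {s : ℂ} (hs : 1 ≤ s.re) (hs1 : s ≠ 1) {N M : ℕ} (hN : 1 ≤ N) (hM : N ≤ M) :
    ‖∑ n ∈ Finset.Ico 1 M, (n : ℂ) ^ (-s)‖ ≤ (1 + Real.log N) + 2 * ‖s‖ / N + 2 / ‖s - 1‖ := by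
  have hsum : ∑ n ∈ Finset.Ico 1 M, (n : ℂ) ^ (-s) = ∑ n ∈ Finset.Ico 1 N, (n : ℂ) ^ (-s)
      + ∑ n ∈ Finset.Ico N M, ((n : ℂ) ^ (-s) - ((n : ℂ) ^ (1 - s) - ((n + 1 : ℕ) : ℂ) ^ (1 - s)) / (s - 1))
      + ((N : ℂ) ^ (1 - s) - (M : ℂ) ^ (1 - s)) / (s - 1) := by
    rw [Finset.sum_sub_distrib, ← Finset.sum_div, ← Finset.sum_Ico_consecutive _ hN hM]
    have : ∑ n ∈ Finset.Ico N M, ((n : ℂ) ^ (1 - s) - ((n + 1 : ℕ) : ℂ) ^ (1 - s)) =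
        (N : ℂ) ^ (1 - s) - (M : ℂ) ^ (1 - s) := by
      have := Finset.sum_Ico_sub (fun n : ℕ => (n : ℂ) ^ (1 - s)) hM
      rw [← neg_sub ((M : ℂ) ^ (1 - s)), ← this, ← Finset.sum_neg_distrib]
      simp
    rw [this]; ring
  have hle : ∀ n : ℕ, 1 ≤ n → ‖(n : ℂ) ^ (1 - s)‖ ≤ 1 := by
    intro n hn
    rw [Complex.norm_natCast_cpow_of_pos (by omega)]
    exact Real.rpow_le_one_of_one_le_of_nonpos (by exact_mod_cast hn) (by simp; linarith)
  rw [hsum]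
  refine (norm_add_le _ _).trans (add_le_add ((norm_add_le _ _).trans (add_le_add ?_ ?_)) ?_)
  · refine (norm_sum_le _ _).trans ?_
    calc ∑ n ∈ Finset.Ico 1 N, ‖(n : ℂ) ^ (-s)‖ ≤ ∑ n ∈ Finset.Ico 1 N, (n : ℝ)⁻¹ := by
          refine Finset.sum_le_sum fun n hn => ?_
          rw [Finset.mem_Ico] at hn
          have h1 : (1 : ℝ) ≤ n := by exact_mod_cast hn.1
          rw [Complex.norm_natCast_cpow_of_pos (by omega), ← Real.rpow_neg_one]
          exact Real.rpow_le_rpow_of_exponent_le h1 (by simp; linarith)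
      _ ≤ ∑ n ∈ Finset.Icc 1 N, (n : ℝ)⁻¹ := by
          refine Finset.sum_le_sum_of_subset_of_nonneg ?_ (fun _ _ _ => by positivity)
          intro n hn; simp at hn ⊢; omega
      _ ≤ _ := by
          have := harmonic_le_one_add_log N
          rw [harmonic_eq_sum_Icc] at this
          push_cast at this
          exact this
  · refine (norm_sum_le _ _).trans ?_
    calc _ ≤ ∑ n ∈ Finset.Ico N M, ‖s‖ * ((n : ℝ) ^ 2)⁻¹ := by
          refine Finset.sum_le_sum fun n hn => ?_
          rw [Finset.mem_Ico] at hn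
          exact cpow_step hs hs1 (by omega)
      _ ≤ _ := by
          rw [← Finset.mul_sum]
          have := mul_le_mul_of_nonneg_left (sum_inv_sq_Ico N M hN) (norm_nonneg s)
          refine this.trans (le_of_eq (by ring))
  · rw [norm_div]
    gcongr
    refine (norm_sub_le _ _).trans ?_
    have := hle N hN
    have := hle M (by omega)
    linarith

lemma zeta_le0 {s : ℂ} (hs : 1 < s.re) {N : ℕ} (hN : 1 ≤ N) :
    ‖riemannZeta s‖ ≤ (1 + Real.log N) + 2 * ‖s‖ / N + 2 / ‖s - 1‖ := by
  have hs1 : s ≠ 1 := by rintro rfl; simp at hs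
  have hs0 : s ≠ 0 := by rintro rfl; simp at hs; linarith
  have h1 := (Complex.summable_one_div_nat_cpow.2 hs).hasSum.tendsto_sum_nat
  rw [← zeta_eq_tsum_one_div_nat_cpow hs] at h1
  refine le_of_tendsto h1.norm ?_
  filter_upwards [Filter.eventually_ge_atTop N] with M hM
  refine le_trans (le_of_eq ?_) (partial_zeta hs.le hs1 hN hM)
  congr 1
  rw [Finset.range_eq_Ico, Finset.sum_eq_sum_Ico_succ_bot (by omega)]
  simp only [Nat.cast_zero, Complex.zero_cpow hs0, div_zero, zero_add]
  refine Finset.sum_congr rfl fun n _ => ?_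
  rw [Complex.cpow_neg, one_div]

lemma zeta_le (δ : ℝ) (hδ : 0 < δ) (hδ1 : δ ≤ 1) : ∃ C : ℝ, 0 < C ∧ ∀ l : ℝ, 2 ≤ l → ∀ t : ℝ,
    ‖riemannZeta (1 + 2 / l + t * I)‖ ≤ C * ((1 + l / (1 + l * |t|)) * (1 + |t|) ^ δ) := by
  refine ⟨14 / δ, by positivity, fun l hl t => ?_⟩
  set s : ℂ := 1 + 2 / l + t * I with hs
  have hl0 : 0 < l := by linarith
  have hre : s.re = 1 + 2 / l := by
    have : (2 / l : ℂ) = ((2 / l : ℝ) : ℂ) := by push_cast; rfl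
    rw [hs, this, ← Complex.ofReal_one, ← Complex.ofReal_add]; simp only [Complex.add_re, Complex.add_im, Complex.ofReal_re, Complex.ofReal_im, Complex.re_ofReal_mul, Complex.im_ofReal_mul, Complex.I_re, Complex.I_im]; ring
  have him : s.im = t := by
    have : (2 / l : ℂ) = ((2 / l : ℝ) : ℂ) := by push_cast; rfl
    rw [hs, this, ← Complex.ofReal_one, ← Complex.ofReal_add]; simp only [Complex.add_re, Complex.add_im, Complex.ofReal_re, Complex.ofReal_im, Complex.re_ofReal_mul, Complex.im_ofReal_mul, Complex.I_re, Complex.I_im]; ring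
  have hs1 : 1 < s.re := by rw [hre]; have : 0 < 2 / l := by positivity
                            linarith
  set N := ⌈|t|⌉₊ + 1 with hN
  have ht0 := abs_nonneg t
  have hNt : |t| + 1 ≤ N := by
    rw [hN]; push_cast; have := Nat.le_ceil |t|; linarith
  have hNt2 : (N : ℝ) ≤ |t| + 2 := by
    rw [hN]; push_cast; have := Nat.ceil_lt_add_one ht0; linarith
  have h := zeta_le0 hs1 (N := N) (by omega)
  have h2l : 2 / l ≤ 1 := by rw [div_le_one hl0]; exact hl
  have hsn : ‖s‖ ≤ 2 + |t| := by
    refine (Complex.norm_le_abs_re_add_abs_im s).trans ?_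
    rw [hre, him, abs_of_nonneg (by positivity)]; linarith
  have hs1n : (1 + l * |t|) / l ≤ ‖s - 1‖ + ‖s - 1‖ := by
    have a1 := Complex.abs_re_le_norm (s - 1)
    have a2 := Complex.abs_im_le_norm (s - 1)
    have e1 : (s - 1).re = 2 / l := by simp [hre]
    have e2 : (s - 1).im = t := by simp [him]
    rw [e1, abs_of_nonneg (by positivity)] at a1
    rw [e2] at a2
    have : (1 + l * |t|) / l = 1 / l + |t| := by field_simp
    rw [this]
    have : 1 / l ≤ 2 / l := by gcongr; norm_num
    linarith
  have hA : 1 ≤ (1 + |t|) ^ δ := Real.one_le_rpow (by linarith) hδ.le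
  have hlog : Real.log N ≤ 2 * (1 + |t|) ^ δ / δ := by
    have : Real.log N ≤ (N : ℝ) ^ δ / δ := Real.log_le_rpow_div (by positivity) hδ
    refine this.trans ?_
    gcongr
    calc (N : ℝ) ^ δ ≤ (2 * (1 + |t|)) ^ δ := by gcongr; linarith
      _ = 2 ^ δ * (1 + |t|) ^ δ := Real.mul_rpow (by norm_num) (by positivity)
      _ ≤ 2 ^ (1 : ℝ) * (1 + |t|) ^ δ := by gcongr; norm_num
      _ = _ := by norm_num
  have h2 : 2 * ‖s‖ / N ≤ 4 := by
    rw [div_le_iff₀ (by positivity)]; nlinarith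
  have h3 : 2 / ‖s - 1‖ ≤ 4 * (l / (1 + l * |t|)) := by
    have hpos : 0 < (1 + l * |t|) / l := by positivity
    have : l / (1 + l * |t|) = 1 / ((1 + l * |t|) / l) := by rw [one_div_div]
    rw [this, mul_one_div, div_le_div_iff₀ (by linarith) hpos]
    linarith
  set A := (1 + |t|) ^ δ
  set g := l / (1 + l * |t|)
  have hg : 0 ≤ g := by positivity
  have hδi : 1 ≤ 1 / δ := by rw [le_div_iff₀ hδ]; linarith
  have e : 14 / δ * ((1 + g) * A) = 14 * (1 / δ) * A + 14 * (1 / δ) * (g * A) := by ring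
  rw [e]
  have e2 : 2 * A / δ = 2 * ((1 / δ) * A) := by ring
  have b1 : A ≤ 1 / δ * A := le_mul_of_one_le_left (by positivity) hδi
  have b2 : g ≤ g * A := le_mul_of_one_le_right hg hA
  have b3 : g * A ≤ 1 / δ * (g * A) := le_mul_of_one_le_left (by positivity) hδi
  rw [e2] at hlog
  nlinarith

end

section
open Complex Real Finset

lemma prime_cpow_norm_le {s : ℂ} (hs : 1 < s.re) (p : Nat.Primes) : ‖((p : ℕ) : ℂ) ^ (-s)‖ ≤ ((p : ℕ) : ℝ)⁻¹ := by
  have hp : (1 : ℝ) ≤ ((p : ℕ) : ℝ) := by exact_mod_cast p.2.one_lt.le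
  rw [Complex.norm_natCast_cpow_of_pos p.2.pos, ← Real.rpow_neg_one]
  exact Real.rpow_le_rpow_of_exponent_le hp (by simp; linarith)

lemma prime_sq_summable : Summable (fun p : Nat.Primes => (((p : ℕ) : ℝ) ^ 2)⁻¹) :=
  (Real.summable_nat_pow_inv.2 (by norm_num : 1 < 2)).comp_injective Nat.Primes.coe_nat_injective

lemma prime_cpow_summable {s : ℂ} (hs : 1 < s.re) : Summable (fun p : Nat.Primes => ((p : ℕ) : ℂ) ^ (-s)) := by
  have h := (Complex.summable_one_div_nat_cpow.2 hs).comp_injective Nat.Primes.coe_nat_injective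
  refine h.congr fun p => ?_
  simp [Complex.cpow_neg]

/-- `Re ∑ p^{-s} ≤ log |ζ(s)| + O(1)`. -/
lemma prime_sum_le_log_zeta {s : ℂ} (hs : 1 < s.re) :
    ∑' p : Nat.Primes, (((p : ℕ) : ℂ) ^ (-s)).re ≤
      Real.log ‖riemannZeta s‖ + ∑' p : Nat.Primes, (((p : ℕ) : ℝ) ^ 2)⁻¹ := by
  have hbd : ∀ p : Nat.Primes, ‖-Complex.log (1 - ((p : ℕ) : ℂ) ^ (-s)) - ((p : ℕ) : ℂ) ^ (-s)‖ ≤ (((p : ℕ) : ℝ) ^ 2)⁻¹ := by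
    intro p
    have hp : (2 : ℝ) ≤ ((p : ℕ) : ℝ) := by exact_mod_cast p.2.two_le
    have h1 := prime_cpow_norm_le hs p
    have h2 : (((p : ℕ) : ℝ))⁻¹ ≤ 1 / 2 := by
      rw [inv_eq_one_div]; gcongr
    set z := ((p : ℕ) : ℂ) ^ (-s)
    have h3 := Complex.norm_log_one_add_sub_self_le (z := -z) (by rw [norm_neg]; linarith)
    rw [norm_neg] at h3
    have e : ‖-Complex.log (1 - z) - z‖ = ‖Complex.log (1 + -z) - -z‖ := by
      rw [← norm_neg]; congr 1; ring_nf
    rw [e]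
    refine h3.trans ?_
    have h4 : (1 - ‖z‖)⁻¹ ≤ 2 := by
      rw [inv_le_comm₀ (by linarith) (by norm_num)]; linarith
    calc ‖z‖ ^ 2 * (1 - ‖z‖)⁻¹ / 2 ≤ ‖z‖ ^ 2 * 2 / 2 := by gcongr
      _ = ‖z‖ ^ 2 := by ring
      _ ≤ (((p : ℕ) : ℝ)⁻¹) ^ 2 := by gcongr
      _ = _ := by rw [inv_pow]
  have hS1 : Summable fun p : Nat.Primes => -Complex.log (1 - ((p : ℕ) : ℂ) ^ (-s)) - ((p : ℕ) : ℂ) ^ (-s) :=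
    Summable.of_norm_bounded prime_sq_summable hbd
  have hS2 := prime_cpow_summable hs
  have hS3 : Summable fun p : Nat.Primes => -Complex.log (1 - ((p : ℕ) : ℂ) ^ (-s)) := by
    refine (hS1.add hS2).congr fun p => ?_
    ring
  have hz := riemannZeta_eulerProduct_exp_log hs
  rw [← hz, Complex.norm_exp, Real.log_exp, Complex.re_tsum hS3]
  rw [← Summable.tsum_add (Complex.hasSum_re hS3.hasSum).summable prime_sq_summable]
  refine Summable.tsum_le_tsum (fun p => ?_) (Complex.hasSum_re hS2.hasSum).summable
    ((Complex.hasSum_re hS3.hasSum).summable.add prime_sq_summable)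
  have h := (Complex.abs_re_le_norm _).trans (hbd p)
  rw [Complex.sub_re, abs_le] at h
  linarith [h.1]

lemma xB_sq (α t : Fin 4 → ℝ) (a : ℝ) (n : ℕ) (hn : 0 < n) :
    xB α t a n ^ 2 = ∑ i, ∑ j, α i * α j * ((n : ℂ) ^ (-(1 + 2 * a + (t i - t j : ℝ) * I) : ℂ)).re := by
  unfold xB
  have hn0 : (n : ℂ) ≠ 0 := by exact_mod_cast hn.ne'
  set z := ∑ i, (α i : ℂ) * (n : ℂ) ^ (-(1/2 + a + t i * I) : ℂ) with hz
  have h1 : ((‖z‖ ^ 2 : ℝ) : ℂ) = z * (starRingEnd ℂ) z := by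
    rw [Complex.mul_conj, Complex.normSq_eq_norm_sq]
  have h2 : z * (starRingEnd ℂ) z = ∑ i, ∑ j, ((α i * α j : ℝ) : ℂ) * (n : ℂ) ^ (-(1 + 2 * a + (t i - t j : ℝ) * I) : ℂ) := by
    rw [hz, map_sum, Finset.sum_mul_sum]
    refine Finset.sum_congr rfl fun i _ => Finset.sum_congr rfl fun j _ => ?_
    have hc : (starRingEnd ℂ) ((n : ℂ) ^ (-(1/2 + a + t j * I) : ℂ)) = (n : ℂ) ^ (-(1/2 + a - t j * I) : ℂ) := by
      have := Complex.cpow_conj (n : ℂ) (-(1/2 + a + t j * I) : ℂ) (by rw [Complex.natCast_arg]; exact Real.pi_ne_zero.symm)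
      rw [Complex.conj_natCast] at this
      rw [← this]
      congr 1
      simp only [map_neg, map_add, map_mul, map_div₀, Complex.conj_ofReal, Complex.conj_I, map_one, map_ofNat]
      ring
    rw [map_mul, Complex.conj_ofReal, hc]
    have : (n : ℂ) ^ (-(1 + 2 * a + (t i - t j : ℝ) * I) : ℂ) = (n : ℂ) ^ (-(1/2 + a + t i * I) : ℂ) * (n : ℂ) ^ (-(1/2 + a - t j * I) : ℂ) := by
      rw [← Complex.cpow_add _ _ hn0]
      congr 1
      push_cast
      ring
    rw [this]
    push_cast
    ring
  have h3 := congrArg Complex.re (h1.trans h2)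
  rw [Complex.ofReal_re] at h3
  rw [h3, Complex.re_sum]
  refine Finset.sum_congr rfl fun i _ => ?_
  rw [Complex.re_sum]
  refine Finset.sum_congr rfl fun j _ => ?_
  rw [Complex.re_ofReal_mul]

lemma xB_sum_le (α t : Fin 4 → ℝ) (hα : ∀ i, 0 ≤ α i) (a : ℝ) (ha : 0 < a) (N : ℕ) :
    ∑ p ∈ (Finset.Ioc 0 N).filter Nat.Prime, xB α t a p ^ 2 ≤
      ∑ i, ∑ j, α i * α j * (Real.log ‖riemannZeta (1 + 2 * a + (t i - t j : ℝ) * I)‖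
        + ∑' p : Nat.Primes, (((p : ℕ) : ℝ) ^ 2)⁻¹) := by
  have hre : ∀ x : ℝ, 1 < (1 + 2 * a + x * I : ℂ).re := by
    intro x
    have : (1 + 2 * a + x * I : ℂ).re = 1 + 2 * a := by
      simp
    rw [this]; linarith
  have hS : HasSum (fun p : Nat.Primes => xB α t a p ^ 2) (∑ i, ∑ j, α i * α j *
      ∑' p : Nat.Primes, (((p : ℕ) : ℂ) ^ (-(1 + 2 * a + (t i - t j : ℝ) * I) : ℂ)).re) := by
    have : (fun p : Nat.Primes => xB α t a p ^ 2) = fun p : Nat.Primes => ∑ i, ∑ j, α i * α j *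
      (((p : ℕ) : ℂ) ^ (-(1 + 2 * a + (t i - t j : ℝ) * I) : ℂ)).re := by
      funext p; exact xB_sq α t a p p.2.pos
    rw [this]
    refine hasSum_sum fun i _ => hasSum_sum fun j _ => HasSum.mul_left _ ?_
    exact (Complex.hasSum_re (prime_cpow_summable (hre _)).hasSum).summable.hasSum
  have h1 : ∑ p ∈ (Finset.Ioc 0 N).filter Nat.Prime, xB α t a p ^ 2 ≤ ∑' p : Nat.Primes, xB α t a p ^ 2 := by
    have e : ∑ p ∈ (Finset.Ioc 0 N).filter Nat.Prime, xB α t a p ^ 2 =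
        ∑ p ∈ ((Finset.Ioc 0 N).filter Nat.Prime).subtype Nat.Prime, xB α t a p ^ 2 := by
      rw [Finset.sum_subtype_of_mem (f := fun p : ℕ => xB α t a p ^ 2)]
      intro x hx
      exact (Finset.mem_filter.1 hx).2
    rw [e]
    have hh : ∀ s : Finset Nat.Primes, ∑ p ∈ s, xB α t a p ^ 2 ≤ ∑' p : Nat.Primes, xB α t a p ^ 2 :=
      fun s => hS.summable.sum_le_tsum s (fun p _ => sq_nonneg _)
    exact hh _
  refine h1.trans ?_
  have hS4 : ∑' p : Nat.Primes, xB α t a p ^ 2 = _ := hS.tsum_eq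
  rw [hS4]
  refine Finset.sum_le_sum fun i _ => Finset.sum_le_sum fun j _ => ?_
  exact mul_le_mul_of_nonneg_left (prime_sum_le_log_zeta (hre _)) (mul_nonneg (hα i) (hα j))

/-- the majorant of zeta near the one line -/
noncomputable def mm (l x : ℝ) : ℝ := 1 + l / (1 + l * |x|)
noncomputable def GG (l d x : ℝ) : ℝ := mm l x * (1 + |x|) ^ d

lemma one_le_mm {l : ℝ} (hl : 0 ≤ l) (x : ℝ) : 1 ≤ mm l x := by
  unfold mm; have : 0 ≤ l / (1 + l * |x|) := by positivity
  linarith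
lemma one_le_GG {l d : ℝ} (hl : 0 ≤ l) (hd : 0 ≤ d) (x : ℝ) : 1 ≤ GG l d x := by
  unfold GG
  have := Real.one_le_rpow (x := 1 + |x|) (by linarith [abs_nonneg x]) hd
  nlinarith [one_le_mm hl x]
lemma GG_neg (l d x : ℝ) : GG l d (-x) = GG l d x := by simp [GG, mm]
lemma GG_zero (l d : ℝ) : GG l d 0 = 1 + l := by simp [GG, mm]

lemma lemmaB1 (r : ℝ) (hr : 1 < r) (d : ℝ) (hd : 0 < d) (hd1 : d ≤ 1) : ∃ C : ℝ, 0 < C ∧ ∃ q0 : ℕ, 14 ≤ q0 ∧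
    ∀ (q : ℕ) [NeZero q], q0 ≤ q → (∀ χ : DirichletCharacter ℂ q, dirichletRH χ) →
    ∀ l : ℝ, 2 ≤ l → ∀ t1 t2 t3 u : ℝ, |t1| ≤ (q : ℝ) ^ 2 → |t2| ≤ (q : ℝ) ^ 2 → |t3| ≤ (q : ℝ) ^ 2 → |u| ≤ (q : ℝ) ^ 2 →
    ∀ X : Finset (DirichletCharacter ℂ q), (∀ χ ∈ X, χ ≠ 1) →
    ∑ χ ∈ X, ‖DirichletCharacter.LFunction χ (1/2 + (1/l : ℝ) + t1 * I)‖ * ‖DirichletCharacter.LFunction χ (1/2 + (1/l : ℝ) + t2 * I)‖ *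
      ‖DirichletCharacter.LFunction χ (1/2 + (1/l : ℝ) + t3 * I)‖ * ‖DirichletCharacter.LFunction χ (1/2 + (1/l : ℝ) + u * I)‖ ^ r
    ≤ C * q.totient * l ^ ((3 + r ^ 2) / 4) * ((GG l d (t1 - t2) * GG l d (t1 - t3) * GG l d (t2 - t3)) ^ (1/2 : ℝ) *
      (GG l d (t1 - u) * GG l d (t2 - u) * GG l d (t3 - u)) ^ (r / 2)) := by
  set α : Fin 4 → ℝ := ![1, 1, 1, r] with hα
  have hα0 : ∀ i, 0 ≤ α i := by
    intro i; fin_cases i <;> simp [hα]; linarith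
  obtain ⟨C, hC, q0, hq0, H⟩ := lemmaB0 α hα0
  obtain ⟨D, hD, HD⟩ := zeta_le d hd hd1
  set c0 := ∑' p : Nat.Primes, (((p : ℕ) : ℝ) ^ 2)⁻¹ with hc0
  set K := Real.log D + c0 with hK
  refine ⟨C * (Real.exp (1/4 * ∑ i, ∑ j, α i * α j * K) * 2 ^ ((3 + r ^ 2) / 4)), by positivity, q0, hq0, ?_⟩
  intro q _ hq hRH l hl t1 t2 t3 u h1 h2 h3 h4 X hX
  have hl0 : 0 < l := by linarith
  set t : Fin 4 → ℝ := ![t1, t2, t3, u] with ht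
  have hti : ∀ i, |t i| ≤ (q : ℝ) ^ 2 := by
    intro i; fin_cases i <;> simp [ht, h1, h2, h3, h4]
  obtain ⟨N, HN⟩ := H q hq hRH (1 / l) (by positivity) (by gcongr) t hti X hX
  have hxs := xB_sum_le α t hα0 (1 / l) (by positivity) N
  have hG : ∀ x, 0 < GG l d x := fun x => by linarith [one_le_GG hl0.le hd.le x]
  have hz : ∀ x : ℝ, Real.log ‖riemannZeta (1 + 2 * (1 / l : ℝ) + x * I)‖ + c0 ≤ K + Real.log (GG l d x) := by
    intro x
    have h := HD l hl x
    have e : (1 + 2 * ((1 / l : ℝ) : ℂ) + x * I : ℂ) = 1 + 2 / l + x * I := by push_cast; ring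
    rw [e]
    have hre : 1 < (1 + 2 / l + x * I : ℂ).re := by
      rw [← e]
      have : (1 + 2 * ((1 / l : ℝ) : ℂ) + x * I : ℂ).re = 1 + 2 * (1 / l) := by
        simp
      rw [this]; have : 0 < 1 / l := by positivity
      linarith
    have hne : riemannZeta (1 + 2 / l + x * I) ≠ 0 := riemannZeta_ne_zero_of_one_lt_re hre
    have := Real.log_le_log (norm_pos_iff.2 hne) h
    have e2 : D * ((1 + l / (1 + l * |x|)) * (1 + |x|) ^ d) = D * GG l d x := rfl
    rw [e2, Real.log_mul hD.ne' (hG x).ne'] at this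
    rw [hK]; linarith
  have hsum : ∑ p ∈ (Finset.Ioc 0 N).filter Nat.Prime, xB α t (1 / l) p ^ 2 ≤
      ∑ i, ∑ j, α i * α j * K + ∑ i, ∑ j, α i * α j * Real.log (GG l d (t i - t j)) := by
    refine hxs.trans ?_
    rw [← Finset.sum_add_distrib]
    refine Finset.sum_le_sum fun i _ => ?_
    rw [← Finset.sum_add_distrib]
    refine Finset.sum_le_sum fun j _ => ?_
    rw [← mul_add]
    exact mul_le_mul_of_nonneg_left (hz _) (mul_nonneg (hα0 i) (hα0 j))
  have hlhs : ∀ χ : DirichletCharacter ℂ q, ∏ i, ‖DirichletCharacter.LFunction χ (1/2 + (1/l : ℝ) + t i * I)‖ ^ (α i) =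
    ‖DirichletCharacter.LFunction χ (1/2 + (1/l : ℝ) + t1 * I)‖ * ‖DirichletCharacter.LFunction χ (1/2 + (1/l : ℝ) + t2 * I)‖ *
      ‖DirichletCharacter.LFunction χ (1/2 + (1/l : ℝ) + t3 * I)‖ * ‖DirichletCharacter.LFunction χ (1/2 + (1/l : ℝ) + u * I)‖ ^ r := by
    intro χ
    rw [Fin.prod_univ_four]
    simp [ht, hα]
  rw [Finset.sum_congr rfl (fun χ _ => hlhs χ)] at HN
  refine HN.trans ?_
  have hS2 : ∑ i, ∑ j, α i * α j * Real.log (GG l d (t i - t j)) =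
      (3 + r ^ 2) * Real.log (1 + l) + 2 * (Real.log (GG l d (t1 - t2)) + Real.log (GG l d (t1 - t3)) + Real.log (GG l d (t2 - t3)))
      + 2 * r * (Real.log (GG l d (t1 - u)) + Real.log (GG l d (t2 - u)) + Real.log (GG l d (t3 - u))) := by
    have s : ∀ a b : ℝ, GG l d (a - b) = GG l d (b - a) := fun a b => by rw [← GG_neg, neg_sub]
    simp only [Fin.sum_univ_four, hα, ht]
    simp only [Matrix.cons_val_zero, Matrix.cons_val_one, Matrix.cons_val, sub_self, GG_zero]
    rw [s t2 t1, s t3 t1, s t3 t2, s u t1, s u t2, s u t3]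
    ring
  have hexp : Real.exp (1/4 * ∑ p ∈ (Finset.Ioc 0 N).filter Nat.Prime, xB α t (1 / l) p ^ 2) ≤
      Real.exp (1/4 * ∑ i, ∑ j, α i * α j * K) * ((1 + l) ^ ((3 + r ^ 2) / 4) * 
      ((GG l d (t1 - t2) * GG l d (t1 - t3) * GG l d (t2 - t3)) ^ (1/2 : ℝ) *
      (GG l d (t1 - u) * GG l d (t2 - u) * GG l d (t3 - u)) ^ (r / 2))) := by
    have hpos12 := mul_pos (mul_pos (hG (t1 - t2)) (hG (t1 - t3))) (hG (t2 - t3))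
    have hposu := mul_pos (mul_pos (hG (t1 - u)) (hG (t2 - u))) (hG (t3 - u))
    rw [Real.rpow_def_of_pos hpos12, Real.rpow_def_of_pos hposu, Real.rpow_def_of_pos (by linarith : 0 < 1 + l),
      ← Real.exp_add, ← Real.exp_add, ← Real.exp_add, Real.exp_le_exp,
      Real.log_mul (mul_pos (hG _) (hG _)).ne' (hG _).ne', Real.log_mul (hG _).ne' (hG _).ne',
      Real.log_mul (mul_pos (hG _) (hG _)).ne' (hG _).ne', Real.log_mul (hG _).ne' (hG _).ne']
    rw [hS2] at hsum
    linarith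
  have hl2 : (1 + l) ^ ((3 + r ^ 2) / 4) ≤ 2 ^ ((3 + r ^ 2) / 4) * l ^ ((3 + r ^ 2) / 4) := by
    rw [← Real.mul_rpow (by norm_num) hl0.le]
    exact Real.rpow_le_rpow (by linarith) (by linarith) (by positivity)
  set B := ((GG l d (t1 - t2) * GG l d (t1 - t3) * GG l d (t2 - t3)) ^ (1/2 : ℝ) *
      (GG l d (t1 - u) * GG l d (t2 - u) * GG l d (t3 - u)) ^ (r / 2)) with hB
  have hB0 : 0 ≤ B := by
    rw [hB]
    have := fun x => (hG x).le
    exact mul_nonneg (Real.rpow_nonneg (mul_nonneg (mul_nonneg (this _) (this _)) (this _)) _)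
     (Real.rpow_nonneg (mul_nonneg (mul_nonneg (this _) (this _)) (this _)) _)
  set E := Real.exp (1/4 * ∑ i, ∑ j, α i * α j * K)
  calc _ ≤ C * q.totient * (E * (2 ^ ((3 + r ^ 2) / 4) * l ^ ((3 + r ^ 2) / 4) * B)) := by
        refine mul_le_mul_of_nonneg_left (hexp.trans ?_) (by positivity)
        gcongr
    _ = _ := by ring

end

section
open Complex Real Finset

/-- the weight -/
noncomputable def ww (C l t : ℝ) : ℝ := min (1 / (1 + |t|)) (l ^ C / (1 + |t|) ^ 2)

lemma ww_nonneg {C l : ℝ} (hl : 1 ≤ l) (t : ℝ) : 0 ≤ ww C l t := by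
  unfold ww; exact le_min (by positivity) (by positivity)

lemma ww_le_inv (C l t : ℝ) : ww C l t ≤ 1 / (1 + |t|) := min_le_left _ _

lemma ww_le_one (C l t : ℝ) : ww C l t ≤ 1 := by
  refine (ww_le_inv C l t).trans ?_
  rw [div_le_one (by positivity)]; linarith [abs_nonneg t]

lemma ww_cont (C l : ℝ) : Continuous (ww C l) := by
  unfold ww
  have h : ∀ x : ℝ, 1 + |x| ≠ 0 := fun x => by positivity
  have h2 : ∀ x : ℝ, (1 + |x|) ^ 2 ≠ 0 := fun x => by positivity
  refine Continuous.min ?_ ?_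
  · exact continuous_const.div (by fun_prop) h
  · exact continuous_const.div (by fun_prop) h2

lemma ww_near {C l : ℝ} (hl : 1 ≤ l) {t u : ℝ} (h : |t - u| ≤ 1) : ww C l u ≤ 4 * ww C l t := by
  have h1 : 1 + |t| ≤ 2 * (1 + |u|) := by
    have := abs_sub_abs_le_abs_sub t u
    linarith [abs_nonneg u]
  have hl0 : 0 < l := by linarith
  unfold ww
  rw [mul_min_of_nonneg _ _ (by norm_num)]
  refine min_le_min ?_ ?_
  · rw [mul_one_div, div_le_div_iff₀ (by positivity) (by positivity)]
    linarith [abs_nonneg u]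
  · rw [← mul_div_assoc, div_le_div_iff₀ (by positivity) (by positivity)]
    have h2 : (1 + |t|) ^ 2 ≤ 4 * (1 + |u|) ^ 2 := by
      calc (1 + |t|) ^ 2 ≤ (2 * (1 + |u|)) ^ 2 := by gcongr
        _ = _ := by ring
    have : 0 < l ^ C := by positivity
    nlinarith

lemma ww_pow_le {C l : ℝ} (hl : 1 ≤ l) {κ : ℝ} (h0 : 0 < κ) (h1 : 2 * κ ≤ 1) (t : ℝ) :
    ww C l t * (1 + |t|) ^ κ ≤ l ^ (2 * C * κ) * (1 + |t|) ^ (-(1 + κ)) := by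
  have hl0 : 0 < l := by linarith
  have hT : 0 < 1 + |t| := by positivity
  set T := 1 + |t| with hTd
  have hw : ww C l t ≤ (1 / T) ^ (1 - 2 * κ) * (l ^ C / T ^ 2) ^ (2 * κ) := by
    have hw0 := ww_nonneg (C := C) hl t
    have e : ww C l t = ww C l t ^ (1 - 2 * κ) * ww C l t ^ (2 * κ) := by
      rcases eq_or_lt_of_le hw0 with h | h
      · exfalso
        have : 0 < ww C l t := by unfold ww; exact lt_min (by positivity) (by positivity)
        linarith
      · rw [← Real.rpow_add h]; simp
    rw [e]
    refine mul_le_mul (Real.rpow_le_rpow hw0 (min_le_left _ _) (by linarith))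
      (Real.rpow_le_rpow hw0 (min_le_right _ _) (by linarith)) (by positivity) (by positivity)
  calc ww C l t * T ^ κ ≤ (1 / T) ^ (1 - 2 * κ) * (l ^ C / T ^ 2) ^ (2 * κ) * T ^ κ := by gcongr
    _ = _ := by
      have e1 : (1 / T) ^ (1 - 2 * κ) = T ^ (-(1 - 2 * κ)) := by
        rw [one_div, Real.inv_rpow hT.le, Real.rpow_neg hT.le]
      have e2 : (l ^ C / T ^ 2) ^ (2 * κ) = l ^ (2 * C * κ) * T ^ (-(4 * κ)) := by
        rw [Real.div_rpow (by positivity) (by positivity), ← Real.rpow_mul hl0.le, ← Real.rpow_natCast,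
          ← Real.rpow_mul hT.le, Real.rpow_neg hT.le]
        rw [div_eq_mul_inv]; push_cast
        congr 2
        · ring
        · congr 1; ring
      rw [e1, e2]
      have : T ^ (-(1 + κ)) = T ^ (-(1 - 2 * κ)) * T ^ (-(4 * κ)) * T ^ κ := by
        rw [← Real.rpow_add hT, ← Real.rpow_add hT]; congr 1; ring
      rw [this]; ring

lemma int_pow (s : ℝ) (hs : 1 < s) : MeasureTheory.Integrable (fun x : ℝ => (1 + |x|) ^ (-s)) := by
  have := integrable_one_add_norm (E := ℝ) (μ := MeasureTheory.volume) (r := s) (by simpa using hs)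
  simpa using this

open MeasureTheory in
lemma lint_pow (s : ℝ) (hs : 1 < s) :
    ∫⁻ x : ℝ, ENNReal.ofReal ((1 + |x|) ^ (-s)) = ENNReal.ofReal (∫ x : ℝ, (1 + |x|) ^ (-s)) := by
  rw [ofReal_integral_eq_lintegral_ofReal (int_pow s hs)]
  exact Filter.Eventually.of_forall fun x => by positivity

noncomputable def gg (l x : ℝ) : ℝ := l / (1 + l * |x|)

open MeasureTheory in
lemma lint_gg (s : ℝ) (hs : 1 < s) : ∃ c : ℝ, 0 < c ∧ ∀ l : ℝ, 1 ≤ l → ∀ t : ℝ,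
    ∫⁻ u : ℝ, ENNReal.ofReal (gg l (t - u) ^ s) ≤ ENNReal.ofReal (c * l ^ (s - 1)) := by
  set c := ∫ x : ℝ, (1 + |x|) ^ (-s) with hc
  have hc0 : 0 ≤ c := integral_nonneg fun x => by positivity
  refine ⟨c + 1, by positivity, fun l hl t => ?_⟩
  have hl0 : 0 < l := by linarith
  have e : ∀ u, gg l (t - u) ^ s = l ^ s * (1 + |l * (t - u)|) ^ (-s) := by
    intro u
    unfold gg
    rw [abs_mul, abs_of_pos hl0, Real.div_rpow hl0.le (by positivity), Real.rpow_neg (by positivity), div_eq_mul_inv]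
  have h_int0 : Integrable (fun u : ℝ => l ^ s * (1 + |l * (t - u)|) ^ (-s)) := by
    refine Integrable.const_mul ?_ _
    exact ((int_pow s hs).comp_mul_left' hl0.ne').comp_sub_left t
  rw [lintegral_congr (fun u => by rw [e u])]
  rw [← ofReal_integral_eq_lintegral_ofReal h_int0 (Filter.Eventually.of_forall fun x => by positivity)]
  refine ENNReal.ofReal_le_ofReal ?_
  rw [integral_const_mul, integral_sub_left_eq_self (fun u : ℝ => (1 + |l * u|) ^ (-s)) volume t,
    Measure.integral_comp_mul_left (fun x : ℝ => (1 + |x|) ^ (-s)) l, ← hc, smul_eq_mul, abs_of_pos (by positivity)]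
  have : l ^ s * (l⁻¹ * c) = c * l ^ (s - 1) := by
    rw [Real.rpow_sub_one hl0.ne']; field_simp
  rw [this]
  gcongr
  linarith

open MeasureTheory in
lemma lint_ww (κ : ℝ) (h0 : 0 < κ) (h1 : 2 * κ ≤ 1) : ∃ c : ℝ, 0 < c ∧ ∀ C l : ℝ, 1 ≤ l →
    ∫⁻ u : ℝ, ENNReal.ofReal (ww C l u * (1 + |u|) ^ κ) ≤ ENNReal.ofReal (c * l ^ (2 * C * κ)) := by
  set c := ∫ x : ℝ, (1 + |x|) ^ (-(1 + κ)) with hc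
  have hc0 : 0 ≤ c := integral_nonneg fun x => by positivity
  refine ⟨c + 1, by positivity, fun C l hl => ?_⟩
  have hl0 : 0 < l := by linarith
  calc _ ≤ ∫⁻ u : ℝ, ENNReal.ofReal (l ^ (2 * C * κ)) * ENNReal.ofReal ((1 + |u|) ^ (-(1 + κ))) := by
        refine lintegral_mono fun u => ?_
        rw [← ENNReal.ofReal_mul (by positivity)]
        exact ENNReal.ofReal_le_ofReal (ww_pow_le hl h0 h1 u)
    _ = ENNReal.ofReal (l ^ (2 * C * κ)) * ENNReal.ofReal c := by
        rw [lintegral_const_mul' _ _ ENNReal.ofReal_ne_top, lint_pow _ (by linarith)]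
    _ ≤ _ := by
        rw [← ENNReal.ofReal_mul (by positivity)]
        refine ENNReal.ofReal_le_ofReal ?_
        rw [mul_comm]; gcongr; linarith

end

section
open Complex Real Finset

noncomputable def EE (l δ κ x : ℝ) : ℝ := mm l x ^ (1 + δ) * (1 + |x|) ^ κ

lemma EE_neg (l δ κ x : ℝ) : EE l δ κ (-x) = EE l δ κ x := by simp [EE, mm]
lemma EE_nonneg {l : ℝ} (hl : 0 ≤ l) (δ κ x : ℝ) : 0 ≤ EE l δ κ x := by
  have := one_le_mm hl x
  unfold EE; positivity

lemma mm_cont {l : ℝ} (hl : 0 ≤ l) : Continuous (mm l) := by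
  unfold mm
  exact continuous_const.add (continuous_const.div (by fun_prop) (fun x => by positivity))

lemma EE_cont {l : ℝ} (hl : 0 ≤ l) (δ κ : ℝ) : Continuous (EE l δ κ) := by
  unfold EE
  refine Continuous.mul ?_ ?_
  · exact (mm_cont hl).rpow_const fun x => Or.inl (by have := one_le_mm hl x; positivity)
  · exact Continuous.rpow_const (by fun_prop) fun x => Or.inl (by positivity)

lemma gg_cont {l : ℝ} (hl : 0 ≤ l) : Continuous (gg l) := by
  unfold gg
  exact (continuous_const.div (by fun_prop) (fun x => by positivity))

lemma edge_pt {C l δ κ : ℝ} (hl : 2 ≤ l) (hδ : 0 < δ) (hκ : 0 ≤ κ) (hκ1 : κ ≤ 1) (t u : ℝ) :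
    EE l δ κ (t - u) * ww C l u ≤ 8 * 3 ^ (1 + δ) * (gg l (t - u) ^ (1 + δ) * ww C l t + (1 + |t|) ^ κ * (ww C l u * (1 + |u|) ^ κ)) := by
  have hl0 : 0 < l := by linarith
  have hw := ww_nonneg (C := C) (by linarith : 1 ≤ l) t
  have hwu := ww_nonneg (C := C) (by linarith : 1 ≤ l) u
  have hm1 := one_le_mm hl0.le (t - u)
  have hg0 : 0 ≤ gg l (t - u) := by unfold gg; positivity
  have hmg : mm l (t - u) = 1 + gg l (t - u) := rfl
  rcases le_or_gt |t - u| 1 with h | h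
  · have hg : 2 / 3 ≤ gg l (t - u) := by
      unfold gg
      rw [div_le_div_iff₀ (by norm_num) (by positivity)]
      nlinarith
    have a1 : mm l (t - u) ^ (1 + δ) ≤ 3 ^ (1 + δ) * gg l (t - u) ^ (1 + δ) := by
      rw [← Real.mul_rpow (by norm_num) hg0]
      exact Real.rpow_le_rpow (by linarith) (by linarith) (by linarith)
    have a2 : (1 + |t - u|) ^ κ ≤ 2 := by
      calc (1 + |t - u|) ^ κ ≤ 2 ^ κ := Real.rpow_le_rpow (by positivity) (by linarith) hκ
        _ ≤ 2 ^ (1 : ℝ) := Real.rpow_le_rpow_of_exponent_le (by norm_num) hκ1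
        _ = 2 := by norm_num
    have a3 := ww_near (C := C) (by linarith : 1 ≤ l) h
    calc EE l δ κ (t - u) * ww C l u ≤ (3 ^ (1 + δ) * gg l (t - u) ^ (1 + δ) * 2) * (4 * ww C l t) := by
          unfold EE; gcongr
      _ = 8 * 3 ^ (1 + δ) * (gg l (t - u) ^ (1 + δ) * ww C l t + 0) := by ring
      _ ≤ _ := by gcongr; positivity
  · have hg : gg l (t - u) ≤ 1 := by
      unfold gg
      rw [div_le_one (by positivity)]
      nlinarith
    have a1 : mm l (t - u) ^ (1 + δ) ≤ 3 ^ (1 + δ) :=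
      Real.rpow_le_rpow (by linarith) (by linarith) (by linarith)
    have a2 : (1 + |t - u|) ^ κ ≤ (1 + |t|) ^ κ * (1 + |u|) ^ κ := by
      rw [← Real.mul_rpow (by positivity) (by positivity)]
      refine Real.rpow_le_rpow (by positivity) ?_ hκ
      have := abs_sub t u
      nlinarith [abs_nonneg t, abs_nonneg u]
    calc EE l δ κ (t - u) * ww C l u ≤ (3 ^ (1 + δ) * ((1 + |t|) ^ κ * (1 + |u|) ^ κ)) * ww C l u := by
          unfold EE; gcongr
      _ = 3 ^ (1 + δ) * (0 + (1 + |t|) ^ κ * (ww C l u * (1 + |u|) ^ κ)) := by ring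
      _ ≤ 8 * 3 ^ (1 + δ) * (gg l (t - u) ^ (1 + δ) * ww C l t + (1 + |t|) ^ κ * (ww C l u * (1 + |u|) ^ κ)) := by
          gcongr
          · have : (0:ℝ) < 3 ^ (1 + δ) := by positivity
            linarith
          · positivity

open MeasureTheory

noncomputable def muw (C l : ℝ) : Measure ℝ := volume.withDensity (fun t => ENNReal.ofReal (ww C l t))

instance (C l : ℝ) : SFinite (muw C l) := by unfold muw; infer_instance

lemma lint_muw (C l : ℝ) {f : ℝ → ENNReal} (hf : Measurable f) :
    ∫⁻ t, f t ∂(muw C l) = ∫⁻ t, ENNReal.ofReal (ww C l t) * f t := by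
  unfold muw
  rw [lintegral_withDensity_eq_lintegral_mul _ ((ww_cont C l).measurable.ennreal_ofReal) hf]
  rfl

noncomputable def JJ (C l δ κ t : ℝ) : ENNReal := ∫⁻ u, ENNReal.ofReal (EE l δ κ (t - u)) ∂(muw C l)

lemma JJ_le (δ κ : ℝ) (hδ : 0 < δ) (hκ : 0 < κ) (hκ1 : 2 * κ ≤ 1) : ∃ K : ℝ, 0 < K ∧ ∀ C l : ℝ, 2 ≤ l → ∀ t : ℝ,
    JJ C l δ κ t ≤ ENNReal.ofReal (K * (l ^ δ * ww C l t + (1 + |t|) ^ κ * l ^ (2 * C * κ))) := by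
  obtain ⟨c1, hc1, H1⟩ := lint_gg (1 + δ) (by linarith)
  obtain ⟨c2, hc2, H2⟩ := lint_ww κ hκ hκ1
  refine ⟨8 * 3 ^ (1 + δ) * (c1 + c2), by positivity, fun C l hl t => ?_⟩
  have hl0 : 0 < l := by linarith
  have hl1 : 1 ≤ l := by linarith
  have hw := ww_nonneg (C := C) hl1
  have hg0 : ∀ x, 0 ≤ gg l x := fun x => by unfold gg; positivity
  unfold JJ
  have hEm : Measurable fun u => ENNReal.ofReal (EE l δ κ (t - u)) :=
    ((EE_cont hl0.le δ κ).comp (by fun_prop : Continuous fun u => t - u)).measurable.ennreal_ofReal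
  rw [lint_muw C l hEm]
  calc _ ≤ ∫⁻ u, ENNReal.ofReal (8 * 3 ^ (1 + δ)) * (ENNReal.ofReal (ww C l t) * ENNReal.ofReal (gg l (t - u) ^ (1 + δ)) +
        ENNReal.ofReal ((1 + |t|) ^ κ) * ENNReal.ofReal (ww C l u * (1 + |u|) ^ κ)) := by
        refine lintegral_mono fun u => ?_
        rw [← ENNReal.ofReal_mul (hw u), ← ENNReal.ofReal_mul (hw t), ← ENNReal.ofReal_mul (by positivity),
          ← ENNReal.ofReal_add (mul_nonneg (hw t) (Real.rpow_nonneg (hg0 _) _))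
            (mul_nonneg (by positivity) (mul_nonneg (hw u) (by positivity))), ← ENNReal.ofReal_mul (by positivity)]
        refine ENNReal.ofReal_le_ofReal ?_
        have := edge_pt (C := C) hl hδ hκ.le (by linarith) t u
        rw [mul_comm (ww C l u), mul_comm (ww C l t)]
        exact this
    _ = ENNReal.ofReal (8 * 3 ^ (1 + δ)) * (ENNReal.ofReal (ww C l t) * (∫⁻ u, ENNReal.ofReal (gg l (t - u) ^ (1 + δ))) +
        ENNReal.ofReal ((1 + |t|) ^ κ) * ∫⁻ u, ENNReal.ofReal (ww C l u * (1 + |u|) ^ κ)) := by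
        rw [lintegral_const_mul' _ _ ENNReal.ofReal_ne_top, lintegral_add_left, lintegral_const_mul' _ _ ENNReal.ofReal_ne_top,
          lintegral_const_mul' _ _ ENNReal.ofReal_ne_top]
        refine Measurable.const_mul ?_ _
        refine Measurable.ennreal_ofReal ?_
        exact (((gg_cont hl0.le).comp (by fun_prop : Continuous fun u => t - u)).rpow_const
          fun x => Or.inr (by linarith)).measurable
    _ ≤ ENNReal.ofReal (8 * 3 ^ (1 + δ)) * (ENNReal.ofReal (ww C l t) * ENNReal.ofReal (c1 * l ^ (1 + δ - 1)) +
        ENNReal.ofReal ((1 + |t|) ^ κ) * ENNReal.ofReal (c2 * l ^ (2 * C * κ))) := by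
        gcongr
        · exact H1 l hl1 t
        · exact H2 C l hl1
    _ ≤ _ := by
        rw [← ENNReal.ofReal_mul (hw t), ← ENNReal.ofReal_mul (by positivity),
          ← ENNReal.ofReal_add (mul_nonneg (hw t) (by positivity)) (by positivity), ← ENNReal.ofReal_mul (by positivity)]
        refine ENNReal.ofReal_le_ofReal ?_
        rw [add_sub_cancel_left, mul_assoc (8 * (3:ℝ) ^ (1 + δ)) (c1 + c2)]
        refine mul_le_mul_of_nonneg_left ?_ (by positivity)
        have h1 : 0 ≤ l ^ δ * ww C l t := mul_nonneg (by positivity) (hw t)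
        have h2 : 0 ≤ (1 + |t|) ^ κ * l ^ (2 * C * κ) := by positivity
        nlinarith

lemma JJ3_le (δ C : ℝ) (hδ : 0 < δ) (hC : 0 < C) (κ : ℝ) (hκ : 0 < κ) (hκ1 : κ ≤ 1 / 6) (hκC : 4 * C * κ ≤ δ) :
    ∃ K : ℝ, 0 < K ∧ ∀ l : ℝ, 2 ≤ l →
    ∫⁻ t, JJ C l δ κ t ^ 3 ∂(muw C l) ≤ ENNReal.ofReal (K * l ^ (3 * δ)) := by
  obtain ⟨K, hK, HK⟩ := JJ_le δ κ hδ hκ (by linarith)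
  obtain ⟨c3, hc3, H3⟩ := lint_ww (3 * κ) (by linarith) (by linarith)
  set c2 := ∫ x : ℝ, (1 + |x|) ^ (-2 : ℝ) with hc
  have hc0 : 0 ≤ c2 := integral_nonneg fun x => by positivity
  refine ⟨K ^ 3 * 4 * (c2 + c3), by positivity, fun l hl => ?_⟩
  have hl0 : 0 < l := by linarith
  have hl1 : 1 ≤ l := by linarith
  have hw := ww_nonneg (C := C) hl1
  set b : ℝ → ℝ := fun t => K * (l ^ δ * ww C l t + (1 + |t|) ^ κ * l ^ (2 * C * κ)) with hb
  have hb0 : ∀ t, 0 ≤ b t := fun t => by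
    have := hw t
    simp only [hb]; positivity
  have hbc : Continuous b := by
    have h1 : Continuous fun t : ℝ => (1 + |t|) ^ κ := Continuous.rpow_const (by fun_prop) fun x => Or.inl (by positivity)
    have h2 := ww_cont C l
    simp only [hb]; fun_prop
  calc _ ≤ ∫⁻ t, ENNReal.ofReal (b t ^ 3) ∂(muw C l) := by
        refine lintegral_mono fun t => ?_
        rw [ENNReal.ofReal_pow (hb0 t)]
        exact pow_le_pow_left' (HK C l hl t) 3
    _ = ∫⁻ t, ENNReal.ofReal (ww C l t) * ENNReal.ofReal (b t ^ 3) := 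
        lint_muw C l (hbc.pow 3).measurable.ennreal_ofReal
    _ ≤ ∫⁻ t, ENNReal.ofReal (K ^ 3 * 4) * (ENNReal.ofReal (l ^ (3 * δ)) * ENNReal.ofReal ((1 + |t|) ^ (-2 : ℝ)) +
         ENNReal.ofReal (l ^ (6 * C * κ)) * ENNReal.ofReal (ww C l t * (1 + |t|) ^ (3 * κ))) := by
        refine lintegral_mono fun t => ?_
        have hwt := hw t
        rw [← ENNReal.ofReal_mul (hw t), ← ENNReal.ofReal_mul (by positivity), ← ENNReal.ofReal_mul (by positivity),
          ← ENNReal.ofReal_add (by positivity) (by positivity), ← ENNReal.ofReal_mul (by positivity)]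
        refine ENNReal.ofReal_le_ofReal ?_
        have e1 : l ^ (3 * δ) = (l ^ δ) ^ 3 := by
          rw [← Real.rpow_natCast, ← Real.rpow_mul hl0.le]; congr 1; push_cast; ring
        have e2 : l ^ (6 * C * κ) = (l ^ (2 * C * κ)) ^ 3 := by
          rw [← Real.rpow_natCast, ← Real.rpow_mul hl0.le]; congr 1; push_cast; ring
        have e3 : (1 + |t|) ^ (3 * κ) = ((1 + |t|) ^ κ) ^ 3 := by
          rw [← Real.rpow_natCast, ← Real.rpow_mul (by positivity)]; congr 1; push_cast; ring
        have e4 : (1 + |t|) ^ (-2 : ℝ) = (1 / (1 + |t|)) ^ 2 := by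
          rw [Real.rpow_neg (by positivity), one_div, inv_pow]; norm_cast
        have h4 : ww C l t ^ 4 ≤ (1 + |t|) ^ (-2 : ℝ) := by
          rw [e4]
          calc ww C l t ^ 4 ≤ ww C l t ^ 2 := pow_le_pow_of_le_one hwt (ww_le_one C l t) (by norm_num)
            _ ≤ _ := pow_le_pow_left₀ hwt (ww_le_inv C l t) 2
        rw [e1, e2, e3]
        set L := l ^ δ
        set M := l ^ (2 * C * κ)
        set P := (1 + |t|) ^ κ
        set w := ww C l t
        have hL : 0 ≤ L := by positivity
        have hM : 0 ≤ M := by positivity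
        have hP : 0 ≤ P := by positivity
        have cube : (L * w + P * M) ^ 3 ≤ 4 * ((L * w) ^ 3 + (P * M) ^ 3) := by
          have x0 : 0 ≤ L * w := by positivity
          have y0 : 0 ≤ P * M := by positivity
          nlinarith [mul_nonneg (add_nonneg x0 y0) (sq_nonneg (L * w - P * M))]
        calc w * (b t) ^ 3 = K ^ 3 * (w * (L * w + P * M) ^ 3) := by simp only [hb, L, w, P, M]; ring
          _ ≤ K ^ 3 * (w * (4 * ((L * w) ^ 3 + (P * M) ^ 3))) := by gcongr
          _ = K ^ 3 * 4 * (L ^ 3 * w ^ 4 + M ^ 3 * (w * P ^ 3)) := by ring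
          _ ≤ _ := by gcongr
    _ = ENNReal.ofReal (K ^ 3 * 4) * (ENNReal.ofReal (l ^ (3 * δ)) * ENNReal.ofReal c2 +
         ENNReal.ofReal (l ^ (6 * C * κ)) * ∫⁻ t, ENNReal.ofReal (ww C l t * (1 + |t|) ^ (3 * κ))) := by
        rw [lintegral_const_mul' _ _ ENNReal.ofReal_ne_top, lintegral_add_left, lintegral_const_mul' _ _ ENNReal.ofReal_ne_top,
          lintegral_const_mul' _ _ ENNReal.ofReal_ne_top, lint_pow 2 (by norm_num)]
        refine Measurable.const_mul (Measurable.ennreal_ofReal ?_) _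
        exact (Continuous.rpow_const (by fun_prop) fun x => Or.inl (by positivity)).measurable
    _ ≤ ENNReal.ofReal (K ^ 3 * 4) * (ENNReal.ofReal (l ^ (3 * δ)) * ENNReal.ofReal c2 +
         ENNReal.ofReal (l ^ (6 * C * κ)) * ENNReal.ofReal (c3 * l ^ (2 * C * (3 * κ)))) := by
        gcongr
        exact H3 C l hl1
    _ ≤ _ := by
        rw [← ENNReal.ofReal_mul (by positivity), ← ENNReal.ofReal_mul (by positivity),
          ← ENNReal.ofReal_add (by positivity) (by positivity), ← ENNReal.ofReal_mul (by positivity)]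
        refine ENNReal.ofReal_le_ofReal ?_
        have : l ^ (6 * C * κ) * (c3 * l ^ (2 * C * (3 * κ))) ≤ l ^ (3 * δ) * c3 := by
          have e : l ^ (6 * C * κ) * (c3 * l ^ (2 * C * (3 * κ))) = l ^ (12 * C * κ) * c3 := by
            rw [mul_left_comm, ← Real.rpow_add hl0, mul_comm]; congr 2; ring
          rw [e]
          refine mul_le_mul_of_nonneg_right (Real.rpow_le_rpow_of_exponent_le hl1 (by linarith)) hc3.le
        calc _ ≤ K ^ 3 * 4 * (l ^ (3 * δ) * c2 + l ^ (3 * δ) * c3) := by gcongr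
          _ = _ := by ring

end

section
open Complex Real Finset
open MeasureTheory

lemma nest4 (μ : Measure ℝ) [SFinite μ] (F : ℝ × ℝ × ℝ × ℝ → ENNReal) (hF : Measurable F) :
    ∫⁻ a, ∫⁻ b, ∫⁻ c, ∫⁻ d, F (a, b, c, d) ∂μ ∂μ ∂μ ∂μ = ∫⁻ z, F z ∂(μ.prod (μ.prod (μ.prod μ))) := by
  rw [lintegral_prod _ hF.aemeasurable]
  refine lintegral_congr fun a => ?_
  have h1 : Measurable fun z : ℝ × ℝ × ℝ => F (a, z) := by fun_prop
  rw [lintegral_prod _ h1.aemeasurable]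
  refine lintegral_congr fun b => ?_
  have h2 : Measurable fun z : ℝ × ℝ => F (a, b, z) := by fun_prop
  rw [lintegral_prod _ h2.aemeasurable]

lemma nest4_add (μ : Measure ℝ) [SFinite μ] (F G H K : ℝ × ℝ × ℝ × ℝ → ENNReal) (hF : Measurable F) (hG : Measurable G)
    (hH : Measurable H) (hK : Measurable K) (c : ENNReal) :
    ∫⁻ a₁, ∫⁻ b, ∫⁻ c₁, ∫⁻ d, c * (F (a₁, b, c₁, d) + G (a₁, b, c₁, d) + H (a₁, b, c₁, d) + K (a₁, b, c₁, d)) ∂μ ∂μ ∂μ ∂μ =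
    c * (∫⁻ a, ∫⁻ b, ∫⁻ c, ∫⁻ d, F (a, b, c, d) ∂μ ∂μ ∂μ ∂μ + ∫⁻ a, ∫⁻ b, ∫⁻ c, ∫⁻ d, G (a, b, c, d) ∂μ ∂μ ∂μ ∂μ
     + ∫⁻ a, ∫⁻ b, ∫⁻ c, ∫⁻ d, H (a, b, c, d) ∂μ ∂μ ∂μ ∂μ + ∫⁻ a, ∫⁻ b, ∫⁻ c, ∫⁻ d, K (a, b, c, d) ∂μ ∂μ ∂μ ∂μ) := by
  rw [nest4 μ F hF, nest4 μ G hG, nest4 μ H hH, nest4 μ K hK,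
    nest4 μ (fun z => c * (F z + G z + H z + K z)) (by fun_prop), lintegral_const_mul _ (by fun_prop),
    lintegral_add_left (by fun_prop), lintegral_add_left (by fun_prop), lintegral_add_left hF]

section stars
variable (μ : Measure ℝ) [SFinite μ] (e : ℝ → ENNReal) (he : Measurable e) (hev : ∀ x, e (-x) = e x)

lemma swapF {μ : Measure ℝ} [SFinite μ] {e : ℝ → ENNReal} (he : Measurable e) {F : ℝ → ENNReal} (hF : Measurable F) :
    ∫⁻ t, ∫⁻ s, F s * e (s - t) ∂μ ∂μ = ∫⁻ s, F s * (∫⁻ t, e (s - t) ∂μ) ∂μ := by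
  rw [lintegral_lintegral_swap]
  · refine lintegral_congr fun s => ?_
    rw [lintegral_const_mul _ (by fun_prop)]
  · have : Measurable fun z : ℝ × ℝ => F z.2 * e (z.2 - z.1) := by fun_prop
    exact this.aemeasurable

lemma J_meas {μ : Measure ℝ} [SFinite μ] {e : ℝ → ENNReal} (he : Measurable e) :
    Measurable fun s => ∫⁻ t, e (s - t) ∂μ := by
  have : Measurable fun z : ℝ × ℝ => e (z.1 - z.2) := by fun_prop
  exact this.lintegral_prod_right'

lemma star1 {μ : Measure ℝ} [SFinite μ] {e : ℝ → ENNReal} (he : Measurable e) :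
    ∫⁻ a, ∫⁻ b, ∫⁻ c, ∫⁻ d, e (a - b) * e (a - c) * e (a - d) ∂μ ∂μ ∂μ ∂μ = ∫⁻ a, (∫⁻ t, e (a - t) ∂μ) ^ 3 ∂μ := by
  refine lintegral_congr fun a => ?_
  have hm : Measurable fun t => e (a - t) := by fun_prop
  have : ∀ b c, ∫⁻ d, e (a - b) * e (a - c) * e (a - d) ∂μ = e (a - b) * ((∫⁻ t, e (a - t) ∂μ) * e (a - c)) := by
    intro b c; rw [lintegral_const_mul _ hm]; ring
  simp only [this]
  have h2 : ∀ b, ∫⁻ c, e (a - b) * ((∫⁻ t, e (a - t) ∂μ) * e (a - c)) ∂μ = (∫⁻ t, e (a - t) ∂μ) ^ 2 * e (a - b) := by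
    intro b
    rw [lintegral_const_mul _ (by fun_prop), lintegral_const_mul _ hm]; ring
  simp only [h2]
  rw [lintegral_const_mul _ hm]; ring

lemma star2 {μ : Measure ℝ} [SFinite μ] {e : ℝ → ENNReal} (he : Measurable e) :
    ∫⁻ a, ∫⁻ b, ∫⁻ c, ∫⁻ d, e (b - a) * e (b - c) * e (b - d) ∂μ ∂μ ∂μ ∂μ = ∫⁻ a, (∫⁻ t, e (a - t) ∂μ) ^ 3 ∂μ := by
  have hJ := J_meas (μ := μ) he
  have : ∀ a b, ∫⁻ c, ∫⁻ d, e (b - a) * e (b - c) * e (b - d) ∂μ ∂μ = (∫⁻ t, e (b - t) ∂μ) ^ 2 * e (b - a) := by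
    intro a b
    have hm : Measurable fun t => e (b - t) := by fun_prop
    have h1 : ∀ c, ∫⁻ d, e (b - a) * e (b - c) * e (b - d) ∂μ = e (b - a) * ((∫⁻ t, e (b - t) ∂μ) * e (b - c)) := by
      intro c; rw [lintegral_const_mul _ hm]; ring
    simp only [h1]
    rw [lintegral_const_mul _ (by fun_prop), lintegral_const_mul _ hm]; ring
  simp only [this]
  rw [swapF he (F := fun b => (∫⁻ t, e (b - t) ∂μ) ^ 2) (hJ.pow_const 2)]
  refine lintegral_congr fun s => ?_
  ring

lemma star3 {μ : Measure ℝ} [SFinite μ] {e : ℝ → ENNReal} (he : Measurable e) :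
    ∫⁻ a, ∫⁻ b, ∫⁻ c, ∫⁻ d, e (c - a) * e (c - b) * e (c - d) ∂μ ∂μ ∂μ ∂μ = ∫⁻ a, (∫⁻ t, e (a - t) ∂μ) ^ 3 ∂μ := by
  have hJ := J_meas (μ := μ) he
  have : ∀ a b c, ∫⁻ d, e (c - a) * e (c - b) * e (c - d) ∂μ = (e (c - a) * (∫⁻ t, e (c - t) ∂μ)) * e (c - b) := by
    intro a b c
    rw [lintegral_const_mul _ (by fun_prop)]; ring
  simp only [this]
  have h2 : ∀ a, ∫⁻ b, ∫⁻ c, (e (c - a) * (∫⁻ t, e (c - t) ∂μ)) * e (c - b) ∂μ ∂μ = ∫⁻ c, (∫⁻ t, e (c - t) ∂μ) ^ 2 * e (c - a) ∂μ := by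
    intro a
    rw [swapF he (F := fun c => e (c - a) * (∫⁻ t, e (c - t) ∂μ)) ((by fun_prop : Measurable fun c => e (c - a)).mul hJ)]
    refine lintegral_congr fun s => ?_
    ring
  simp only [h2]
  rw [swapF he (F := fun b => (∫⁻ t, e (b - t) ∂μ) ^ 2) (hJ.pow_const 2)]
  refine lintegral_congr fun s => ?_
  ring

lemma star4 {μ : Measure ℝ} [SFinite μ] {e : ℝ → ENNReal} (he : Measurable e) :
    ∫⁻ a, ∫⁻ b, ∫⁻ c, ∫⁻ d, e (d - a) * e (d - b) * e (d - c) ∂μ ∂μ ∂μ ∂μ = ∫⁻ a, (∫⁻ t, e (a - t) ∂μ) ^ 3 ∂μ := by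
  have hJ := J_meas (μ := μ) he
  have h1 : ∀ a b, ∫⁻ c, ∫⁻ d, e (d - a) * e (d - b) * e (d - c) ∂μ ∂μ = ∫⁻ d, (e (d - a) * (∫⁻ t, e (d - t) ∂μ)) * e (d - b) ∂μ := by
    intro a b
    rw [swapF he (F := fun d => e (d - a) * e (d - b)) (by fun_prop)]
    refine lintegral_congr fun s => ?_
    ring
  simp only [h1]
  have h2 : ∀ a, ∫⁻ b, ∫⁻ c, (e (c - a) * (∫⁻ t, e (c - t) ∂μ)) * e (c - b) ∂μ ∂μ = ∫⁻ c, (∫⁻ t, e (c - t) ∂μ) ^ 2 * e (c - a) ∂μ := by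
    intro a
    rw [swapF he (F := fun c => e (c - a) * (∫⁻ t, e (c - t) ∂μ)) ((by fun_prop : Measurable fun c => e (c - a)).mul hJ)]
    refine lintegral_congr fun s => ?_
    ring
  simp only [h2]
  rw [swapF he (F := fun b => (∫⁻ t, e (b - t) ∂μ) ^ 2) (hJ.pow_const 2)]
  refine lintegral_congr fun s => ?_
  ring
end stars

lemma holder_r {μ : Measure ℝ} {A : ℝ → ENNReal} (hA : Measurable A) {v : ℝ → ℝ} (hv : Measurable v)
    (hv0 : ∀ x, 0 < v x) {r : ℝ} (hr : 1 < r) :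
    (∫⁻ u, A u ∂μ) ^ r ≤ (∫⁻ u, A u ^ r * ENNReal.ofReal (v u ^ (-(r - 1))) ∂μ) * (∫⁻ u, ENNReal.ofReal (v u) ∂μ) ^ (r - 1) := by
  have hr0 : 0 < r := by linarith
  have hpq : r.HolderConjugate (r / (r - 1)) := Real.HolderConjugate.conjExponent hr
  set s := (r - 1) / r with hs
  have h := ENNReal.lintegral_mul_le_Lp_mul_Lq μ hpq (f := fun u => A u * ENNReal.ofReal (v u ^ (-s)))
    (g := fun u => ENNReal.ofReal (v u ^ s))
    (hA.mul (hv.pow_const _).ennreal_ofReal).aemeasurable (hv.pow_const _).ennreal_ofReal.aemeasurable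
  have e1 : ∀ u, ((fun u => A u * ENNReal.ofReal (v u ^ (-s))) * fun u => ENNReal.ofReal (v u ^ s)) u = A u := by
    intro u
    simp only [Pi.mul_apply]
    rw [mul_assoc, ← ENNReal.ofReal_mul (Real.rpow_nonneg (hv0 u).le _), ← Real.rpow_add (hv0 u)]
    simp
  have e2 : ∀ u, (A u * ENNReal.ofReal (v u ^ (-s))) ^ r = A u ^ r * ENNReal.ofReal (v u ^ (-(r - 1))) := by
    intro u
    rw [ENNReal.mul_rpow_of_nonneg _ _ hr0.le, ENNReal.ofReal_rpow_of_nonneg (Real.rpow_nonneg (hv0 u).le _) hr0.le,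
      ← Real.rpow_mul (hv0 u).le]
    congr 3
    rw [hs]; field_simp
  have e3 : ∀ u, (ENNReal.ofReal (v u ^ s)) ^ (r / (r - 1)) = ENNReal.ofReal (v u) := by
    intro u
    have : 0 < r - 1 := by linarith
    rw [ENNReal.ofReal_rpow_of_nonneg (Real.rpow_nonneg (hv0 u).le _) (by positivity), ← Real.rpow_mul (hv0 u).le]
    have : s * (r / (r - 1)) = 1 := by rw [hs]; field_simp
    rw [this, Real.rpow_one]
  simp only [e1, e2, e3] at h
  calc _ ≤ ((∫⁻ u, A u ^ r * ENNReal.ofReal (v u ^ (-(r - 1))) ∂μ) ^ (1 / r) * (∫⁻ u, ENNReal.ofReal (v u) ∂μ) ^ (1 / (r / (r - 1)))) ^ r :=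
        ENNReal.rpow_le_rpow h hr0.le
    _ = _ := by
        rw [ENNReal.mul_rpow_of_nonneg _ _ hr0.le, ← ENNReal.rpow_mul, ← ENNReal.rpow_mul]
        congr 1
        · rw [one_div_mul_cancel hr0.ne', ENNReal.rpow_one]
        · congr 1; rw [one_div_div]; field_simp

lemma amgm_star {x12 x13 x23 x1 x2 x3 δ : ℝ} (h12 : 0 < x12) (h13 : 0 < x13) (h23 : 0 < x23) (h1 : 0 < x1) (h2 : 0 < x2)
    (h3 : 0 < x3) (hδ : 0 < δ) :
    (x12 * x13 * x23) ^ (1 / 2 : ℝ) * (x1 * x2 * x3) ^ (1 / 2 + δ) ≤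
      (x12 * x13 * x1) ^ (1 + δ) + (x12 * x23 * x2) ^ (1 + δ) + (x13 * x23 * x3) ^ (1 + δ) + (x1 * x2 * x3) ^ (1 + δ) := by
  set θ := 1 / (4 * (1 + δ)) with hθ
  have hθ0 : 0 < θ := by positivity
  have hθ1 : θ ≤ 1 / 4 := by rw [hθ]; gcongr; linarith
  have hθ2 : θ * (1 + δ) = 1 / 4 := by rw [hθ]; field_simp
  set S1 := (x12 * x13 * x1) ^ (1 + δ) with hS1
  set S2 := (x12 * x23 * x2) ^ (1 + δ) with hS2
  set S3 := (x13 * x23 * x3) ^ (1 + δ) with hS3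
  set S4 := (x1 * x2 * x3) ^ (1 + δ) with hS4
  have key := Real.geom_mean_le_arith_mean4_weighted (w₁ := θ) (w₂ := θ) (w₃ := θ) (w₄ := 1 - 3 * θ)
    (p₁ := S1) (p₂ := S2) (p₃ := S3) (p₄ := S4)
    hθ0.le hθ0.le hθ0.le (by linarith) (by positivity) (by positivity) (by positivity) (by positivity) (by ring)
  have e : (x12 * x13 * x23) ^ (1 / 2 : ℝ) * (x1 * x2 * x3) ^ (1 / 2 + δ) = S1 ^ θ * S2 ^ θ * S3 ^ θ * S4 ^ (1 - 3 * θ) := by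
    rw [hS1, hS2, hS3, hS4, ← Real.rpow_mul (by positivity), ← Real.rpow_mul (by positivity), ← Real.rpow_mul (by positivity),
      ← Real.rpow_mul (by positivity), mul_comm (1 + δ) θ, hθ2]
    have : (1 + δ) * (1 - 3 * θ) = 1 / 4 + δ := by linarith
    rw [this]
    simp only [Real.mul_rpow (mul_pos h12 h13).le h23.le, Real.mul_rpow h12.le h13.le, Real.mul_rpow (mul_pos h1 h2).le h3.le,
      Real.mul_rpow h1.le h2.le, Real.mul_rpow (mul_pos h12 h13).le h1.le, Real.mul_rpow (mul_pos h12 h23).le h2.le,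
      Real.mul_rpow h12.le h23.le, Real.mul_rpow (mul_pos h13 h23).le h3.le, Real.mul_rpow h13.le h23.le]
    have sq : ∀ x : ℝ, 0 < x → x ^ (1 / 2 : ℝ) = x ^ (1 / 4 : ℝ) * x ^ (1 / 4 : ℝ) := by
      intro x hx; rw [← Real.rpow_add hx]; norm_num
    have sq2 : ∀ x : ℝ, 0 < x → x ^ (1 / 2 + δ : ℝ) = x ^ (1 / 4 : ℝ) * x ^ (1 / 4 + δ : ℝ) := by
      intro x hx; rw [← Real.rpow_add hx]; congr 1; ring
    rw [sq x12 h12, sq x13 h13, sq x23 h23, sq2 x1 h1, sq2 x2 h2, sq2 x3 h3]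
    ring
  rw [e]
  refine key.trans ?_
  have a1 : 0 ≤ S1 := by positivity
  have a2 : 0 ≤ S2 := by positivity
  have a3 : 0 ≤ S3 := by positivity
  have a4 : 0 ≤ S4 := by positivity
  nlinarith

lemma sum_lint_le {ι : Type*} (X : Finset ι) {μ : Measure ℝ} (f : ι → ℝ → ENNReal) :
    ∑ i ∈ X, ∫⁻ t, f i t ∂μ ≤ ∫⁻ t, ∑ i ∈ X, f i t ∂μ := by
  classical
  induction X using Finset.induction_on with
  | empty => simp
  | insert a s ha ih =>
    rw [Finset.sum_insert ha]
    simp only [Finset.sum_insert ha]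
    exact (add_le_add_right ih _).trans (le_lintegral_add _ _)

end

section
open Complex Real Finset
open MeasureTheory

lemma mint (C : ℝ) (hC : 0 < C) : ∃ K : ℝ, 0 < K ∧ ∀ l : ℝ, 2 ≤ l → ∀ t : ℝ,
    ∫⁻ u, ENNReal.ofReal (mm l (t - u) ^ (5 / 4 : ℝ)) ∂(muw C l) ≤ ENNReal.ofReal (K * l ^ (1 / 4 : ℝ)) := by
  set κ := min (1 / (8 * C)) (1 / 2) with hκ
  have hκ0 : 0 < κ := lt_min (by positivity) (by norm_num)
  have hκ1 : κ ≤ 1 / 2 := min_le_right _ _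
  have hκ2 : 2 * C * κ ≤ 1 / 4 := by
    have : κ ≤ 1 / (8 * C) := min_le_left _ _
    rw [le_div_iff₀ (by positivity)] at this
    linarith
  obtain ⟨c1, hc1, H1⟩ := lint_gg (5 / 4) (by norm_num)
  obtain ⟨c2, hc2, H2⟩ := lint_ww κ hκ0 (by linarith)
  refine ⟨4 * (c1 + c2), by positivity, fun l hl t => ?_⟩
  have hl0 : 0 < l := by linarith
  have hl1 : 1 ≤ l := by linarith
  have hw := ww_nonneg (C := C) hl1
  have hg0 : ∀ x, 0 ≤ gg l x := fun x => by unfold gg; positivity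
  have hm : Measurable fun u => ENNReal.ofReal (mm l (t - u) ^ (5 / 4 : ℝ)) := by
    refine Measurable.ennreal_ofReal ?_
    exact (((mm_cont hl0.le).comp (by fun_prop : Continuous fun u => t - u)).rpow_const
          fun x => Or.inr (by norm_num)).measurable
  rw [lint_muw C l hm]
  calc _ ≤ ∫⁻ u, ENNReal.ofReal 4 * (ENNReal.ofReal (gg l (t - u) ^ (5 / 4 : ℝ)) + ENNReal.ofReal (ww C l u * (1 + |u|) ^ κ)) := by
        refine lintegral_mono fun u => ?_
        have hg := hg0 (t - u)
        have hwu := hw u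
        rw [← ENNReal.ofReal_mul (hw u), ← ENNReal.ofReal_add (by positivity) (by positivity), ← ENNReal.ofReal_mul (by positivity)]
        refine ENNReal.ofReal_le_ofReal ?_
        have h1 : mm l (t - u) ^ (5 / 4 : ℝ) ≤ 4 * (1 + gg l (t - u) ^ (5 / 4 : ℝ)) := by
          have hmg : mm l (t - u) = 1 + gg l (t - u) := rfl
          rw [hmg]
          have h2 : (2 : ℝ) ^ (5 / 4 : ℝ) ≤ 4 := by
            calc (2 : ℝ) ^ (5 / 4 : ℝ) ≤ 2 ^ (2 : ℝ) := Real.rpow_le_rpow_of_exponent_le (by norm_num) (by norm_num)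
              _ = 4 := by norm_num
          rcases le_total (gg l (t - u)) 1 with h | h
          · calc (1 + gg l (t - u)) ^ (5 / 4 : ℝ) ≤ 2 ^ (5 / 4 : ℝ) := Real.rpow_le_rpow (by positivity) (by linarith) (by norm_num)
              _ ≤ 4 * (1 + 0) := by linarith
              _ ≤ _ := by gcongr; positivity
          · calc (1 + gg l (t - u)) ^ (5 / 4 : ℝ) ≤ (2 * gg l (t - u)) ^ (5 / 4 : ℝ) := Real.rpow_le_rpow (by positivity) (by linarith) (by norm_num)
              _ = 2 ^ (5 / 4 : ℝ) * gg l (t - u) ^ (5 / 4 : ℝ) := Real.mul_rpow (by norm_num) hg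
              _ ≤ 4 * (0 + gg l (t - u) ^ (5 / 4 : ℝ)) := by rw [zero_add]; gcongr
              _ ≤ _ := by gcongr; norm_num
        have h3 := ww_le_one C l u
        have h4 : 1 ≤ (1 + |u|) ^ κ := Real.one_le_rpow (by linarith [abs_nonneg u]) hκ0.le
        have h5 : 0 ≤ gg l (t - u) ^ (5 / 4 : ℝ) := by positivity
        calc ww C l u * mm l (t - u) ^ (5 / 4 : ℝ) ≤ ww C l u * (4 * (1 + gg l (t - u) ^ (5 / 4 : ℝ))) := by gcongr
          _ = 4 * (ww C l u * gg l (t - u) ^ (5 / 4 : ℝ) + ww C l u * 1) := by ring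
          _ ≤ 4 * (1 * gg l (t - u) ^ (5 / 4 : ℝ) + ww C l u * (1 + |u|) ^ κ) := by gcongr
          _ = _ := by ring
    _ = ENNReal.ofReal 4 * ((∫⁻ u, ENNReal.ofReal (gg l (t - u) ^ (5 / 4 : ℝ))) + ∫⁻ u, ENNReal.ofReal (ww C l u * (1 + |u|) ^ κ)) := by
        rw [lintegral_const_mul' _ _ ENNReal.ofReal_ne_top, lintegral_add_left]
        refine Measurable.ennreal_ofReal ?_
        exact (((gg_cont hl0.le).comp (by fun_prop : Continuous fun u => t - u)).rpow_const
          fun x => Or.inr (by norm_num)).measurable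
    _ ≤ ENNReal.ofReal 4 * (ENNReal.ofReal (c1 * l ^ (5 / 4 - 1 : ℝ)) + ENNReal.ofReal (c2 * l ^ (2 * C * κ))) := by
        gcongr
        · exact H1 l hl1 t
        · exact H2 C l hl1
    _ ≤ _ := by
        rw [← ENNReal.ofReal_add (by positivity) (by positivity), ← ENNReal.ofReal_mul (by positivity)]
        refine ENNReal.ofReal_le_ofReal ?_
        have e : (5 / 4 - 1 : ℝ) = 1 / 4 := by norm_num
        rw [e]
        have h6 : l ^ (2 * C * κ) ≤ l ^ (1 / 4 : ℝ) := Real.rpow_le_rpow_of_exponent_le hl1 hκ2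
        nlinarith

/-- the Hölder weight -/
noncomputable def vv (l t1 t2 t3 u : ℝ) : ℝ :=
  l ^ (-(1 / 4) : ℝ) * (mm l (t1 - u) * mm l (t2 - u) * mm l (t3 - u)) ^ (5 / 12 : ℝ)

lemma vv_pos {l : ℝ} (hl : 0 < l) (t1 t2 t3 u : ℝ) : 0 < vv l t1 t2 t3 u := by
  have h := fun x => one_le_mm hl.le x
  have h1 := h (t1 - u); have h2 := h (t2 - u); have h3 := h (t3 - u)
  unfold vv; positivity

lemma vv_cont {l : ℝ} (hl : 0 < l) (t1 t2 t3 : ℝ) : Continuous (vv l t1 t2 t3) := by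
  unfold vv
  have hc := mm_cont hl.le
  refine Continuous.mul continuous_const (Continuous.rpow_const (by fun_prop) fun x => Or.inr (by norm_num))

lemma vv_int (C : ℝ) (hC : 0 < C) : ∃ K : ℝ, 0 < K ∧ ∀ l : ℝ, 2 ≤ l → ∀ t1 t2 t3 : ℝ,
    ∫⁻ u, ENNReal.ofReal (vv l t1 t2 t3 u) ∂(muw C l) ≤ ENNReal.ofReal K := by
  obtain ⟨K, hK, H⟩ := mint C hC
  refine ⟨3 * K, by positivity, fun l hl t1 t2 t3 => ?_⟩
  have hl0 : 0 < l := by linarith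
  have hm0 := fun x => one_le_mm hl0.le x
  have hm : ∀ t, Measurable fun u => ENNReal.ofReal (mm l (t - u) ^ (5 / 4 : ℝ)) := by
    intro t
    refine Measurable.ennreal_ofReal ?_
    exact (((mm_cont hl0.le).comp (by fun_prop : Continuous fun u => t - u)).rpow_const
          fun x => Or.inr (by norm_num)).measurable
  calc _ ≤ ∫⁻ u, ENNReal.ofReal (l ^ (-(1 / 4) : ℝ)) * (ENNReal.ofReal (mm l (t1 - u) ^ (5 / 4 : ℝ)) +
        ENNReal.ofReal (mm l (t2 - u) ^ (5 / 4 : ℝ)) + ENNReal.ofReal (mm l (t3 - u) ^ (5 / 4 : ℝ))) ∂(muw C l) := by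
        refine lintegral_mono fun u => ?_
        have h1 : 0 < mm l (t1 - u) := by linarith [hm0 (t1 - u)]
        have h2 : 0 < mm l (t2 - u) := by linarith [hm0 (t2 - u)]
        have h3 : 0 < mm l (t3 - u) := by linarith [hm0 (t3 - u)]
        rw [← ENNReal.ofReal_add (by positivity) (by positivity), ← ENNReal.ofReal_add (by positivity) (by positivity),
          ← ENNReal.ofReal_mul (by positivity)]
        refine ENNReal.ofReal_le_ofReal ?_
        unfold vv
        refine mul_le_mul_of_nonneg_left ?_ (by positivity)
        have key := Real.geom_mean_le_arith_mean3_weighted (w₁ := 1 / 3) (w₂ := 1 / 3) (w₃ := 1 / 3)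
          (p₁ := mm l (t1 - u) ^ (5 / 4 : ℝ)) (p₂ := mm l (t2 - u) ^ (5 / 4 : ℝ)) (p₃ := mm l (t3 - u) ^ (5 / 4 : ℝ))
          (by norm_num) (by norm_num) (by norm_num) (by positivity) (by positivity) (by positivity) (by norm_num)
        rw [← Real.rpow_mul h1.le, ← Real.rpow_mul h2.le, ← Real.rpow_mul h3.le] at key
        rw [show (5 / 4 * (1 / 3) : ℝ) = 5 / 12 by norm_num] at key
        rw [Real.mul_rpow (by positivity) h3.le, Real.mul_rpow h1.le h2.le]
        refine key.trans ?_
        have p1 : 0 ≤ mm l (t1 - u) ^ (5 / 4 : ℝ) := by positivity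
        have p2 : 0 ≤ mm l (t2 - u) ^ (5 / 4 : ℝ) := by positivity
        have p3 : 0 ≤ mm l (t3 - u) ^ (5 / 4 : ℝ) := by positivity
        linarith
    _ = ENNReal.ofReal (l ^ (-(1 / 4) : ℝ)) * (∫⁻ u, ENNReal.ofReal (mm l (t1 - u) ^ (5 / 4 : ℝ)) ∂(muw C l) +
        ∫⁻ u, ENNReal.ofReal (mm l (t2 - u) ^ (5 / 4 : ℝ)) ∂(muw C l) + ∫⁻ u, ENNReal.ofReal (mm l (t3 - u) ^ (5 / 4 : ℝ)) ∂(muw C l)) := by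
        rw [lintegral_const_mul' _ _ ENNReal.ofReal_ne_top, lintegral_add_right _ (hm t3), lintegral_add_left (hm t1)]
    _ ≤ ENNReal.ofReal (l ^ (-(1 / 4) : ℝ)) * (ENNReal.ofReal (K * l ^ (1 / 4 : ℝ)) + ENNReal.ofReal (K * l ^ (1 / 4 : ℝ))
         + ENNReal.ofReal (K * l ^ (1 / 4 : ℝ))) := by
        gcongr
        · exact H l hl t1
        · exact H l hl t2
        · exact H l hl t3
    _ ≤ _ := by
        rw [← ENNReal.ofReal_add (by positivity) (by positivity), ← ENNReal.ofReal_add (by positivity) (by positivity),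
          ← ENNReal.ofReal_mul (by positivity)]
        refine ENNReal.ofReal_le_ofReal (le_of_eq ?_)
        have : l ^ (-(1 / 4) : ℝ) * l ^ (1 / 4 : ℝ) = 1 := by rw [← Real.rpow_add hl0]; simp
        linear_combination 3 * K * this

/-- pointwise bound of the integrand by the four stars -/
lemma integrand_le {r l κ : ℝ} (hr : 1 < r) (hl : 2 ≤ l) (hκ : 0 < κ) (t1 t2 t3 u : ℝ) :
    let δ := (r - 1) / 12
    let d := κ / (1 + δ) / r
    (GG l d (t1 - t2) * GG l d (t1 - t3) * GG l d (t2 - t3)) ^ (1/2 : ℝ) *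
      (GG l d (t1 - u) * GG l d (t2 - u) * GG l d (t3 - u)) ^ (r / 2) * vv l t1 t2 t3 u ^ (-(r - 1)) ≤
    l ^ ((r - 1) / 4) * (EE l δ κ (t1 - t2) * EE l δ κ (t1 - t3) * EE l δ κ (t1 - u) +
      EE l δ κ (t2 - t1) * EE l δ κ (t2 - t3) * EE l δ κ (t2 - u) +
      EE l δ κ (t3 - t1) * EE l δ κ (t3 - t2) * EE l δ κ (t3 - u) +
      EE l δ κ (u - t1) * EE l δ κ (u - t2) * EE l δ κ (u - t3)) := by
  intro δ d
  have hl0 : 0 < l := by linarith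
  have hδ : 0 < δ := by simp only [δ]; linarith
  have hm0 := fun x => one_le_mm hl0.le x
  have hm : ∀ x, 0 < mm l x := fun x => by linarith [hm0 x]
  set κ' := κ / (1 + δ) with hκ'
  have hκ'0 : 0 < κ' := by positivity
  have hd : d = κ' / r := rfl
  have hd0 : 0 < d := by rw [hd]; positivity
  have hd1 : d ≤ κ' := by rw [hd]; exact div_le_self hκ'0.le hr.le
  have hT1 : ∀ x : ℝ, 1 ≤ 1 + |x| := fun x => by linarith [abs_nonneg x]
  have hT : ∀ x : ℝ, 0 < 1 + |x| := fun x => by linarith [abs_nonneg x]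
  have hH : ∀ x, 0 < GG l κ' x := fun x => by linarith [one_le_GG hl0.le hκ'0.le x]
  have hG : ∀ x, 0 < GG l d x := fun x => by linarith [one_le_GG hl0.le hd0.le x]
  have hEH : ∀ x, EE l δ κ x = GG l κ' x ^ (1 + δ) := by
    intro x
    unfold EE GG
    rw [Real.mul_rpow (hm x).le (by have := hT x; positivity), ← Real.rpow_mul (hT x).le]
    congr 2
    rw [hκ']; field_simp
  have hGH : ∀ x, GG l d x ≤ GG l κ' x := by
    intro x
    unfold GG
    exact mul_le_mul_of_nonneg_left (Real.rpow_le_rpow_of_exponent_le (hT1 x) hd1) (hm x).le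
  have hedge : ∀ x, GG l d x ^ (r / 2) * (mm l x ^ (5 / 12 : ℝ)) ^ (-(r - 1)) ≤ GG l κ' x ^ (1 / 2 + δ) := by
    intro x
    unfold GG
    have hTx := hT x
    have hmx := hm x
    rw [Real.mul_rpow hmx.le (by positivity), Real.mul_rpow hmx.le (by positivity), ← Real.rpow_mul hmx.le,
      ← Real.rpow_mul hTx.le, ← Real.rpow_mul hTx.le, mul_right_comm, ← Real.rpow_add hmx]
    have e : r / 2 + 5 / 12 * -(r - 1) = 1 / 2 + δ := by simp only [δ]; ring
    rw [e]
    refine mul_le_mul_of_nonneg_left (Real.rpow_le_rpow_of_exponent_le (hT1 x) ?_) (by positivity)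
    have : d * (r / 2) = κ' * (1 / 2) := by rw [hd]; field_simp
    rw [this]
    nlinarith
  have hvv : vv l t1 t2 t3 u ^ (-(r - 1)) = l ^ ((r - 1) / 4) * ((mm l (t1 - u) ^ (5 / 12 : ℝ)) ^ (-(r - 1)) *
      (mm l (t2 - u) ^ (5 / 12 : ℝ)) ^ (-(r - 1)) * (mm l (t3 - u) ^ (5 / 12 : ℝ)) ^ (-(r - 1))) := by
    have m1 := hm (t1 - u); have m2 := hm (t2 - u); have m3 := hm (t3 - u)
    unfold vv
    rw [Real.mul_rpow (by positivity) (by positivity), ← Real.rpow_mul hl0.le, Real.mul_rpow (by positivity) m3.le,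
      Real.mul_rpow m1.le m2.le, Real.mul_rpow (by positivity) (by positivity), Real.mul_rpow (by positivity) (by positivity)]
    congr 2; ring
  have hG1 := hG (t1 - u); have hG2 := hG (t2 - u); have hG3 := hG (t3 - u)
  have hH1 := hH (t1 - u); have hH2 := hH (t2 - u); have hH3 := hH (t3 - u)
  have m1 := hm (t1 - u); have m2 := hm (t2 - u); have m3 := hm (t3 - u)
  have g12 := hG (t1 - t2); have g13 := hG (t1 - t3); have g23 := hG (t2 - t3)
  have h12 := hH (t1 - t2); have h13 := hH (t1 - t3); have h23 := hH (t2 - t3)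
  have hsym : ∀ a b, EE l δ κ (a - b) = EE l δ κ (b - a) := fun a b => by rw [← EE_neg, neg_sub]
  calc _ = l ^ ((r - 1) / 4) * ((GG l d (t1 - t2) * GG l d (t1 - t3) * GG l d (t2 - t3)) ^ (1/2 : ℝ) *
        ((GG l d (t1 - u) ^ (r / 2) * (mm l (t1 - u) ^ (5 / 12 : ℝ)) ^ (-(r - 1))) *
        (GG l d (t2 - u) ^ (r / 2) * (mm l (t2 - u) ^ (5 / 12 : ℝ)) ^ (-(r - 1))) *
        (GG l d (t3 - u) ^ (r / 2) * (mm l (t3 - u) ^ (5 / 12 : ℝ)) ^ (-(r - 1))))) := by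
        rw [hvv, Real.mul_rpow (x := GG l d (t1 - u) * GG l d (t2 - u)) (by positivity) hG3.le, Real.mul_rpow hG1.le hG2.le]
        ring
    _ ≤ l ^ ((r - 1) / 4) * ((GG l κ' (t1 - t2) * GG l κ' (t1 - t3) * GG l κ' (t2 - t3)) ^ (1/2 : ℝ) *
        (GG l κ' (t1 - u) ^ (1 / 2 + δ) * GG l κ' (t2 - u) ^ (1 / 2 + δ) * GG l κ' (t3 - u) ^ (1 / 2 + δ))) := by
        gcongr
        · exact hGH _
        · exact hGH _
        · exact hGH _
        · exact hedge _
        · exact hedge _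
        · exact hedge _
    _ = l ^ ((r - 1) / 4) * ((GG l κ' (t1 - t2) * GG l κ' (t1 - t3) * GG l κ' (t2 - t3)) ^ (1/2 : ℝ) *
        (GG l κ' (t1 - u) * GG l κ' (t2 - u) * GG l κ' (t3 - u)) ^ (1 / 2 + δ)) := by
        rw [Real.mul_rpow (x := GG l κ' (t1 - u) * GG l κ' (t2 - u)) (by positivity) hH3.le, Real.mul_rpow hH1.le hH2.le]
    _ ≤ l ^ ((r - 1) / 4) * _ := mul_le_mul_of_nonneg_left (amgm_star h12 h13 h23 hH1 hH2 hH3 hδ) (by positivity)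
    _ = _ := by
        rw [hsym t2 t1, hsym t3 t1, hsym t3 t2, hsym u t1, hsym u t2, hsym u t3]
        simp only [hEH]
        rw [Real.mul_rpow (by positivity) hH1.le, Real.mul_rpow h12.le h13.le, Real.mul_rpow (by positivity) hH2.le,
          Real.mul_rpow h12.le h23.le, Real.mul_rpow (x := GG l κ' (t1 - t3) * GG l κ' (t2 - t3)) (by positivity) hH3.le,
          Real.mul_rpow h13.le h23.le,
          Real.mul_rpow (x := GG l κ' (t1 - u) * GG l κ' (t2 - u)) (by positivity) hH3.le, Real.mul_rpow hH1.le hH2.le]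

end

section
open Complex Real Finset
open MeasureTheory

theorem momentAbs (r : ℝ) (hr : 1 < r) (C : ℝ) (hC : 0 < C) : ∃ d : ℝ, 0 < d ∧ d ≤ 1 ∧ ∃ K : ℝ, 0 < K ∧
    ∀ l : ℝ, 2 ≤ l → ∀ {ι : Type} (X : Finset ι) (A : ι → ℝ → ENNReal), (∀ i ∈ X, Measurable (A i)) → ∀ B : ℝ, 0 ≤ B →
    (∀ t1 t2 t3 u : ℝ, ∑ i ∈ X, A i t1 * A i t2 * A i t3 * A i u ^ r ≤ ENNReal.ofReal (B *
      ((GG l d (t1 - t2) * GG l d (t1 - t3) * GG l d (t2 - t3)) ^ (1/2 : ℝ) *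
      (GG l d (t1 - u) * GG l d (t2 - u) * GG l d (t3 - u)) ^ (r / 2)))) →
    ∑ i ∈ X, (∫⁻ t, A i t ∂(muw C l)) ^ (3 + r) ≤ ENNReal.ofReal (K * B * l ^ ((r - 1) / 2)) := by
  set δ := (r - 1) / 12 with hδd
  have hδ : 0 < δ := by rw [hδd]; linarith
  set κ := min (δ / (4 * C)) (1 / 6) with hκd
  have hκ : 0 < κ := lt_min (by positivity) (by norm_num)
  have hκ1 : κ ≤ 1 / 6 := min_le_right _ _
  have hκ2 : 4 * C * κ ≤ δ := by
    have : κ ≤ δ / (4 * C) := min_le_left _ _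
    rw [le_div_iff₀ (by positivity)] at this
    linarith
  set d := κ / (1 + δ) / r with hd
  have hr0 : 0 < r := by linarith
  obtain ⟨K1, hK1, H1⟩ := vv_int C hC
  obtain ⟨K3, hK3, H3⟩ := JJ3_le δ C hδ hC κ hκ hκ1 hκ2
  refine ⟨d, by positivity, ?_, K1 ^ (r - 1) * (4 * K3), by positivity, ?_⟩
  · have : κ / (1 + δ) ≤ κ := div_le_self hκ.le (by linarith)
    have : d ≤ κ / (1 + δ) := div_le_self (by positivity) hr.le
    linarith
  intro l hl ι X A hA B hB hAB
  have hl0 : 0 < l := by linarith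
  set μ := muw C l with hμ
  have hvpos := vv_pos hl0
  -- Hölder step
  have step1 : ∀ i ∈ X, (∫⁻ t, A i t ∂μ) ^ (3 + r) ≤ ∫⁻ t1, ∫⁻ t2, ∫⁻ t3, ∫⁻ u, ENNReal.ofReal (K1 ^ (r - 1)) *
      ((A i t1 * A i t2 * A i t3 * A i u ^ r) * ENNReal.ofReal (vv l t1 t2 t3 u ^ (-(r - 1)))) ∂μ ∂μ ∂μ ∂μ := by
    intro i hi
    set J := ∫⁻ t, A i t ∂μ with hJ
    have hR : ∀ t1 t2 t3, J ^ r ≤ ENNReal.ofReal (K1 ^ (r - 1)) * ∫⁻ u, A i u ^ r * ENNReal.ofReal (vv l t1 t2 t3 u ^ (-(r - 1))) ∂μ := by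
      intro t1 t2 t3
      refine (holder_r (hA i hi) (vv_cont hl0 t1 t2 t3).measurable (hvpos t1 t2 t3) hr).trans ?_
      rw [mul_comm]
      refine mul_le_mul_left ?_ _
      rw [← ENNReal.ofReal_rpow_of_pos hK1]
      exact ENNReal.rpow_le_rpow (H1 l hl t1 t2 t3) (by linarith)
    have e : J ^ (3 + r) = J * (J * (J * J ^ r)) := by
      rw [ENNReal.rpow_add_of_nonneg _ _ (by norm_num) hr0.le]
      have : J ^ (3 : ℝ) = J * J * J := by
        rw [show (3 : ℝ) = ((3 : ℕ) : ℝ) by norm_num, ENNReal.rpow_natCast]; ring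
      rw [this]; ring
    rw [e]
    have mulin : ∀ Y : ENNReal, J * Y ≤ ∫⁻ t, A i t * Y ∂μ := fun Y => lintegral_mul_const_le _ _
    refine (mulin _).trans (lintegral_mono fun t1 => ?_)
    refine (mul_le_mul_right (mulin _) _).trans ((lintegral_const_mul_le _ _).trans (lintegral_mono fun t2 => ?_))
    refine (mul_le_mul_right (mul_le_mul_right (mulin _) _) _).trans ?_
    refine (mul_le_mul_right (lintegral_const_mul_le _ _) _).trans ((lintegral_const_mul_le _ _).trans (lintegral_mono fun t3 => ?_))
    dsimp only
    refine (mul_le_mul_right (mul_le_mul_right (mul_le_mul_right (hR t1 t2 t3) _) _) _).trans ?_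
    have e2 : A i t1 * (A i t2 * (A i t3 * (ENNReal.ofReal (K1 ^ (r - 1)) * ∫⁻ u, A i u ^ r * ENNReal.ofReal (vv l t1 t2 t3 u ^ (-(r - 1))) ∂μ)))
      = (ENNReal.ofReal (K1 ^ (r - 1)) * (A i t1 * A i t2 * A i t3)) * ∫⁻ u, A i u ^ r * ENNReal.ofReal (vv l t1 t2 t3 u ^ (-(r - 1))) ∂μ := by ring
    rw [e2]
    refine (lintegral_const_mul_le _ _).trans (lintegral_mono fun u => le_of_eq ?_)
    ring
  have hEm : Measurable fun x => ENNReal.ofReal (EE l δ κ x) := (EE_cont hl0.le δ κ).measurable.ennreal_ofReal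
  set e : ℝ → ENNReal := fun x => ENNReal.ofReal (EE l δ κ x) with he
  have hE0 := EE_nonneg hl0.le δ κ
  calc ∑ i ∈ X, (∫⁻ t, A i t ∂μ) ^ (3 + r)
      ≤ ∑ i ∈ X, ∫⁻ t1, ∫⁻ t2, ∫⁻ t3, ∫⁻ u, ENNReal.ofReal (K1 ^ (r - 1)) *
      ((A i t1 * A i t2 * A i t3 * A i u ^ r) * ENNReal.ofReal (vv l t1 t2 t3 u ^ (-(r - 1)))) ∂μ ∂μ ∂μ ∂μ := Finset.sum_le_sum fun i hi => step1 i hi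
    _ ≤ ∫⁻ t1, ∫⁻ t2, ∫⁻ t3, ∫⁻ u, ∑ i ∈ X, ENNReal.ofReal (K1 ^ (r - 1)) *
      ((A i t1 * A i t2 * A i t3 * A i u ^ r) * ENNReal.ofReal (vv l t1 t2 t3 u ^ (-(r - 1)))) ∂μ ∂μ ∂μ ∂μ := by
        refine (sum_lint_le X _).trans (lintegral_mono fun t1 => ?_)
        refine (sum_lint_le X _).trans (lintegral_mono fun t2 => ?_)
        refine (sum_lint_le X _).trans (lintegral_mono fun t3 => ?_)
        exact sum_lint_le X _
    _ ≤ ∫⁻ t1, ∫⁻ t2, ∫⁻ t3, ∫⁻ u, ENNReal.ofReal (K1 ^ (r - 1) * B * l ^ ((r - 1) / 4)) *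
        (e (t1 - t2) * e (t1 - t3) * e (t1 - u) + e (t2 - t1) * e (t2 - t3) * e (t2 - u) + e (t3 - t1) * e (t3 - t2) * e (t3 - u) +
         e (u - t1) * e (u - t2) * e (u - t3)) ∂μ ∂μ ∂μ ∂μ := by
        refine lintegral_mono fun t1 => lintegral_mono fun t2 => lintegral_mono fun t3 => lintegral_mono fun u => ?_
        dsimp only
        rw [← Finset.mul_sum, ← Finset.sum_mul]
        refine (mul_le_mul_right (mul_le_mul_left (hAB t1 t2 t3 u) _) _).trans ?_
        have hGp : ∀ x, 0 ≤ GG l d x := fun x => by linarith [one_le_GG hl0.le (by positivity : 0 ≤ d) x]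
        have hin := integrand_le hr hl hκ t1 t2 t3 u
        have hv1 := hvpos t1 t2 t3 u
        simp only [he]
        simp only [← ENNReal.ofReal_mul (hE0 _), ← ENNReal.ofReal_mul (mul_nonneg (hE0 _) (hE0 _))]
        have hE3 : ∀ a b c, 0 ≤ EE l δ κ a * EE l δ κ b * EE l δ κ c := fun a b c => mul_nonneg (mul_nonneg (hE0 _) (hE0 _)) (hE0 _)
        rw [← ENNReal.ofReal_add (hE3 _ _ _) (hE3 _ _ _), ← ENNReal.ofReal_add (add_nonneg (hE3 _ _ _) (hE3 _ _ _)) (hE3 _ _ _),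
          ← ENNReal.ofReal_add (add_nonneg (add_nonneg (hE3 _ _ _) (hE3 _ _ _)) (hE3 _ _ _)) (hE3 _ _ _),
          ← ENNReal.ofReal_mul (p := B * _) ?_, ← ENNReal.ofReal_mul (p := K1 ^ (r - 1)) (by positivity),
          ← ENNReal.ofReal_mul (p := K1 ^ (r - 1) * B * l ^ ((r - 1) / 4)) (by positivity)]
        · refine ENNReal.ofReal_le_ofReal ?_
          have := mul_le_mul_of_nonneg_left hin (by positivity : 0 ≤ K1 ^ (r - 1) * B)
          refine le_trans (le_of_eq ?_) (this.trans (le_of_eq ?_))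
          · simp only [hd, hδd]; ring
          · simp only [hδd]; ring
        · have g1 := mul_nonneg (mul_nonneg (hGp (t1 - t2)) (hGp (t1 - t3))) (hGp (t2 - t3))
          have g2 := mul_nonneg (mul_nonneg (hGp (t1 - u)) (hGp (t2 - u))) (hGp (t3 - u))
          positivity
    _ = ENNReal.ofReal (K1 ^ (r - 1) * B * l ^ ((r - 1) / 4)) * (4 * ∫⁻ a, (∫⁻ t, e (a - t) ∂μ) ^ 3 ∂μ) := by
        have := nest4_add μ (fun z => e (z.1 - z.2.1) * e (z.1 - z.2.2.1) * e (z.1 - z.2.2.2))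
          (fun z => e (z.2.1 - z.1) * e (z.2.1 - z.2.2.1) * e (z.2.1 - z.2.2.2))
          (fun z => e (z.2.2.1 - z.1) * e (z.2.2.1 - z.2.1) * e (z.2.2.1 - z.2.2.2))
          (fun z => e (z.2.2.2 - z.1) * e (z.2.2.2 - z.2.1) * e (z.2.2.2 - z.2.2.1))
          (by fun_prop) (by fun_prop) (by fun_prop) (by fun_prop) (ENNReal.ofReal (K1 ^ (r - 1) * B * l ^ ((r - 1) / 4)))
        dsimp only at this
        rw [this, star1 hEm, star2 hEm, star3 hEm, star4 hEm]
        ring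
    _ ≤ ENNReal.ofReal (K1 ^ (r - 1) * B * l ^ ((r - 1) / 4)) * (4 * ENNReal.ofReal (K3 * l ^ (3 * δ))) := by
        gcongr
        exact H3 l hl
    _ ≤ _ := by
        rw [show (4 : ENNReal) = ENNReal.ofReal 4 by simp, ← ENNReal.ofReal_mul (by norm_num), ← ENNReal.ofReal_mul (by positivity)]
        refine ENNReal.ofReal_le_ofReal (le_of_eq ?_)
        have : l ^ ((r - 1) / 2) = l ^ ((r - 1) / 4) * l ^ (3 * δ) := by
          rw [← Real.rpow_add hl0]; congr 1; rw [hδd]; ring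
        rw [this]; ring

end

section
open Complex Real Finset
open MeasureTheory

/-- truncated L-values on the line -/
noncomputable def AL {q : ℕ} [NeZero q] (l : ℝ) (χ : DirichletCharacter ℂ q) : ℝ → ENNReal :=
  Set.indicator (Set.Icc (-(q : ℝ) ^ 2) ((q : ℝ) ^ 2))
    (fun t => ENNReal.ofReal ‖DirichletCharacter.LFunction χ (1/2 + (1/l : ℝ) + t * I)‖)

lemma AL_meas {q : ℕ} [NeZero q] (l : ℝ) {χ : DirichletCharacter ℂ q} (hχ : χ ≠ 1) : Measurable (AL l χ) := by
  refine Measurable.indicator ?_ measurableSet_Icc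
  refine Measurable.ennreal_ofReal (Continuous.measurable ?_)
  have := (DirichletCharacter.differentiable_LFunction hχ).continuous
  fun_prop

theorem momentL (k : ℝ) (hk : 2 < k) (C : ℝ) (hC : 0 < C) : ∃ K : ℝ, 0 < K ∧ ∃ q0 : ℕ, 14 ≤ q0 ∧
    ∀ (q : ℕ) [NeZero q], q0 ≤ q → (∀ χ : DirichletCharacter ℂ q, dirichletRH χ) →
    ∀ l : ℝ, 2 ≤ l → ∀ X : Finset (DirichletCharacter ℂ q), (∀ χ ∈ X, χ ≠ 1) →
    ∑ χ ∈ X, (∫⁻ t, AL l χ t ∂(muw C l)) ^ (2 * k) ≤ ENNReal.ofReal (K * q.totient * l ^ ((k - 1) ^ 2)) := by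
  set r := 2 * k - 3 with hr
  have hr1 : 1 < r := by rw [hr]; linarith
  obtain ⟨d, hd, hd1, K, hK, H⟩ := momentAbs r hr1 C hC
  obtain ⟨D, hD, q0, hq0, HB⟩ := lemmaB1 r hr1 d hd hd1
  refine ⟨K * D, by positivity, q0, hq0, ?_⟩
  intro q _ hq hRH l hl X hX
  have hl0 : 0 < l := by linarith
  have h := H l hl X (AL l) (fun χ hχ => AL_meas l (hX χ hχ)) (D * q.totient * l ^ ((3 + r ^ 2) / 4)) (by positivity) ?_
  · rw [show 3 + r = 2 * k by rw [hr]; ring] at h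
    refine h.trans (ENNReal.ofReal_le_ofReal (le_of_eq ?_))
    have : l ^ ((k - 1) ^ 2) = l ^ ((3 + r ^ 2) / 4) * l ^ ((r - 1) / 2) := by
      rw [← Real.rpow_add hl0]; congr 1; rw [hr]; ring
    rw [this]; ring
  · intro t1 t2 t3 u
    by_cases hin : |t1| ≤ (q : ℝ) ^ 2 ∧ |t2| ≤ (q : ℝ) ^ 2 ∧ |t3| ≤ (q : ℝ) ^ 2 ∧ |u| ≤ (q : ℝ) ^ 2
    · obtain ⟨h1, h2, h3, h4⟩ := hin
      refine le_trans (le_of_eq ?_) (ENNReal.ofReal_le_ofReal (HB q hq hRH l hl t1 t2 t3 u h1 h2 h3 h4 X hX))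
      rw [ENNReal.ofReal_sum_of_nonneg (fun χ _ => by positivity)]
      refine Finset.sum_congr rfl fun χ _ => ?_
      have hA : ∀ t : ℝ, |t| ≤ (q : ℝ) ^ 2 → AL l χ t = ENNReal.ofReal ‖DirichletCharacter.LFunction χ (1/2 + (1/l : ℝ) + t * I)‖ := by
        intro t ht
        exact Set.indicator_of_mem (show t ∈ Set.Icc (-(q : ℝ) ^ 2) ((q : ℝ) ^ 2) from abs_le.1 ht) _
      rw [hA t1 h1, hA t2 h2, hA t3 h3, hA u h4, ENNReal.ofReal_rpow_of_nonneg (norm_nonneg _) (by linarith),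
        ← ENNReal.ofReal_mul (by positivity), ← ENNReal.ofReal_mul (by positivity), ← ENNReal.ofReal_mul (by positivity)]
    · have hz : ∀ χ : DirichletCharacter ℂ q, AL l χ t1 * AL l χ t2 * AL l χ t3 * AL l χ u ^ r = 0 := by
        intro χ
        have hA : ∀ t : ℝ, ¬ |t| ≤ (q : ℝ) ^ 2 → AL l χ t = 0 := by
          intro t ht
          exact Set.indicator_of_notMem (show t ∉ Set.Icc (-(q : ℝ) ^ 2) ((q : ℝ) ^ 2) from fun h => ht (abs_le.2 h)) _
        by_cases h1 : |t1| ≤ (q : ℝ) ^ 2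
        · by_cases h2 : |t2| ≤ (q : ℝ) ^ 2
          · by_cases h3 : |t3| ≤ (q : ℝ) ^ 2
            · rw [hA u (fun h4 => hin ⟨h1, h2, h3, h4⟩), ENNReal.zero_rpow_of_pos (by linarith), mul_zero]
            · rw [hA t3 h3]; simp
          · rw [hA t2 h2]; simp
        · rw [hA t1 h1]; simp
      simp only [hz, Finset.sum_const_zero]
      exact zero_le

end

section
open Complex Real Finset MeasureTheory

lemma hh_mellin {s : ℂ} (hs : 0 < s.re) :
    HasMellin (fun t : ℝ => Set.indicator (Set.Ioc 0 1) (fun _ => (1:ℂ)) t - Set.indicator (Set.Ioc 0 1) (fun t : ℝ => (t:ℂ)^(1:ℂ)) t) s (1 / (s * (s+1))) := by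
  have h1 := hasMellin_one_Ioc hs
  have h2 := hasMellin_cpow_Ioc (1:ℂ) (s := s) (by simp; linarith)
  have h := hasMellin_sub h1.1 h2.1
  rw [h1.2, h2.2] at h
  have a : s ≠ 0 := by rintro rfl; simp at hs
  have b : s + 1 ≠ 0 := by intro h; have := congrArg Complex.re h; simp at this; linarith
  have e : 1 / (s * (s+1)) = 1 / s - 1 / (s + 1) := by field_simp; ring
  rw [e]; exact h

lemma ne_line {c : ℝ} (hc : 0 < c) (τ : ℝ) : (c + τ * I : ℂ) ≠ 0 ∧ (c + τ * I + 1 : ℂ) ≠ 0 := by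
  constructor <;> (intro h; have := congrArg Complex.re h; simp at this; linarith)

lemma inv_ss_norm {c : ℝ} (hc : 0 < c) (τ : ℝ) : ‖1 / ((c + τ * I : ℂ) * (c + τ * I + 1))‖ ≤ 1 / (c ^ 2 + τ ^ 2) := by
  rw [norm_div, norm_one, norm_mul]
  have h1 := norm_sq_xy c τ
  have h2 : ‖(c + τ * I : ℂ)‖ ≤ ‖(c + τ * I + 1 : ℂ)‖ := by
    have := norm_sq_xy (c+1) τ
    rw [show (((c+1:ℝ):ℂ) + τ * I) = c + τ * I + 1 by push_cast; ring] at this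
    refine le_of_sq_le_sq ?_ (norm_nonneg _)
    rw [this, h1]; nlinarith
  have h0 : 0 < ‖(c + τ * I : ℂ)‖ := norm_pos_iff.2 (ne_line hc τ).1
  rw [← h1, sq]
  gcongr

lemma inv_ss_integrable {c : ℝ} (hc : 0 < c) : Integrable (fun τ : ℝ => 1 / ((c + τ * I : ℂ) * (c + τ * I + 1))) := by
  refine ((poisson_kernel hc).1.const_mul (1/c)).mono' ?_ (Filter.Eventually.of_forall fun τ => ?_)
  · refine (Continuous.div (by fun_prop) (by fun_prop) fun τ => ?_).aestronglyMeasurable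
    exact mul_ne_zero (ne_line hc τ).1 (ne_line hc τ).2
  · refine (inv_ss_norm hc τ).trans (le_of_eq ?_)
    field_simp

lemma perron_x {x c : ℝ} (hx : 0 < x) (hc : 0 < c) :
    ∫ τ : ℝ, (x:ℂ)^(-(c + τ * I : ℂ)) * (1 / ((c + τ * I : ℂ) * (c + τ * I + 1))) = ((2 * π * max (1 - x) 0 : ℝ) : ℂ) := by
  set h : ℝ → ℂ := (fun t : ℝ => Set.indicator (Set.Ioc 0 1) (fun _ => (1:ℂ)) t - Set.indicator (Set.Ioc 0 1) (fun t : ℝ => (t:ℂ)^(1:ℂ)) t) with hh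
  have he : ∀ t : ℝ, 0 < t → h t = ((max (1 - t) 0 : ℝ) : ℂ) := by
    intro t ht
    simp only [hh]
    by_cases h1 : t ≤ 1
    · have hm : t ∈ Set.Ioc (0:ℝ) 1 := ⟨ht, h1⟩
      rw [Set.indicator_of_mem hm, Set.indicator_of_mem hm, max_eq_left (by linarith)]; simp
    · rw [Set.indicator_of_notMem (fun h => h1 h.2), Set.indicator_of_notMem (fun h => h1 h.2), max_eq_right (by linarith)]; simp
  have hm : ∀ τ : ℝ, mellin h (c + τ * I) = 1 / ((c + τ * I : ℂ) * (c + τ * I + 1)) := fun τ =>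
    (hh_mellin (s := c + τ * I) (by simpa using hc)).2
  have hcont : ContinuousAt h x := by
    have : ContinuousAt (fun t : ℝ => ((max (1 - t) 0 : ℝ) : ℂ)) x := by fun_prop
    refine this.congr ?_
    filter_upwards [lt_mem_nhds hx] with t ht using (he t ht).symm
  have hv : VerticalIntegrable (mellin h) c := by
    unfold VerticalIntegrable
    simp_rw [hm]
    exact inv_ss_integrable hc
  have := mellinInv_mellin_eq c h hx (hh_mellin (s := c) (by simpa using hc)).1 hv hcont
  rw [he x hx] at this
  unfold mellinInv at this
  simp_rw [hm] at this
  have hp : (0:ℝ) < π := Real.pi_pos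
  rw [show ((2 * π * max (1 - x) 0 : ℝ) : ℂ) = (2 * π : ℝ) * ((max (1 - x) 0 : ℝ) : ℂ) by push_cast; ring, ← this]
  simp only [smul_eq_mul, Complex.real_smul]
  rw [← mul_assoc]
  have : ((2 * π : ℝ) : ℂ) * ((1 / (2 * π) : ℝ) : ℂ) = 1 := by
    rw [← Complex.ofReal_mul, mul_one_div_cancel (by positivity)]; simp
  rw [this, one_mul]

end

section
open Complex Real Finset MeasureTheory

noncomputable def QQ (y y' T : ℝ) (s : ℂ) : ℂ := ((y:ℂ)^(s+1) - (y':ℂ)^(s+1)) / T * (1 / (s * (s+1)))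

lemma cont_cpow_line {X : ℝ} (hX : 0 < X) (c : ℝ) : Continuous (fun τ : ℝ => (X:ℂ)^(c + τ * I + 1 : ℂ)) := by
  refine Continuous.const_cpow (by fun_prop) (Or.inl (by exact_mod_cast hX.ne'))

lemma cont_cpow_neg {n : ℕ} (hn : 1 ≤ n) (c : ℝ) : Continuous (fun τ : ℝ => (n:ℂ)^(-(c + τ * I) : ℂ)) := by
  refine Continuous.const_cpow (by fun_prop) (Or.inl (by exact_mod_cast (by omega)))

lemma norm_cpow_line {X : ℝ} (hX : 0 < X) (c τ : ℝ) : ‖(X:ℂ)^(c + τ * I + 1 : ℂ)‖ = X ^ (c+1) := by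
  rw [Complex.norm_cpow_eq_rpow_re_of_pos hX]; simp

lemma norm_cpow_neg {n : ℕ} (hn : 1 ≤ n) (c τ : ℝ) : ‖(n:ℂ)^(-(c + τ * I) : ℂ)‖ = (n:ℝ) ^ (-c) := by
  rw [Complex.norm_natCast_cpow_of_pos (by omega)]; simp

lemma perron_n_int {n : ℕ} (hn : 1 ≤ n) {X c : ℝ} (hX : 0 < X) (hc : 0 < c) :
    Integrable (fun τ : ℝ => (n:ℂ)^(-(c + τ * I) : ℂ) * ((X:ℂ)^(c + τ * I + 1 : ℂ) * (1 / ((c + τ * I : ℂ) * (c + τ * I + 1))))) := by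
  simp_rw [← mul_assoc]
  refine (inv_ss_integrable hc).bdd_mul (c := (n:ℝ) ^ (-c) * X ^ (c+1)) ?_ (Filter.Eventually.of_forall fun τ => ?_)
  · exact ((cont_cpow_neg hn c).mul (cont_cpow_line hX c)).aestronglyMeasurable
  · rw [norm_mul, norm_cpow_line hX, norm_cpow_neg hn]

lemma perron_n {n : ℕ} (hn : 1 ≤ n) {X c : ℝ} (hX : 0 < X) (hc : 0 < c) :
    ∫ τ : ℝ, (n:ℂ)^(-(c + τ * I) : ℂ) * ((X:ℂ)^(c + τ * I + 1 : ℂ) * (1 / ((c + τ * I : ℂ) * (c + τ * I + 1)))) =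
      ((2 * π * max (X - n) 0 : ℝ) : ℂ) := by
  have hn0 : (0:ℝ) < n := by exact_mod_cast hn
  have h := perron_x (x := n / X) (by positivity) hc
  have hX' : (X:ℂ) ≠ 0 := by exact_mod_cast hX.ne'
  have e : ∀ τ : ℝ, (n:ℂ)^(-(c + τ * I) : ℂ) * ((X:ℂ)^(c + τ * I + 1 : ℂ) * (1 / ((c + τ * I : ℂ) * (c + τ * I + 1)))) =
      X * (((n / X : ℝ) : ℂ)^(-(c + τ * I : ℂ)) * (1 / ((c + τ * I : ℂ) * (c + τ * I + 1)))) := by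
    intro τ
    rw [div_eq_mul_inv (n:ℝ) X, Complex.ofReal_mul, Complex.mul_cpow_ofReal_nonneg hn0.le (by positivity),
      Complex.cpow_add _ _ hX', Complex.cpow_one, Complex.ofReal_inv, Complex.inv_cpow, Complex.cpow_neg (X:ℂ), inv_inv, Complex.ofReal_natCast]
    · ring
    · rw [Complex.arg_ofReal_of_nonneg hX.le]; exact Real.pi_pos.ne
  simp_rw [e]
  rw [MeasureTheory.integral_const_mul, h, ← Complex.ofReal_mul]
  congr 1
  have : max (X - n) 0 = X * max (1 - n / X) 0 := by
    rw [mul_max_of_nonneg _ _ hX.le, mul_zero]; congr 1; field_simp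
  rw [this]; ring

/-- Partial sums -/
noncomputable def PN {q : ℕ} (χ : DirichletCharacter ℂ q) (N : ℕ) (s : ℂ) : ℂ :=
  ∑ n ∈ Finset.Icc 1 N, χ (n : ZMod q) * (n:ℂ)^(-s)

lemma PN_int {q : ℕ} (χ : DirichletCharacter ℂ q) (N : ℕ) {y y' T c : ℝ} (hy : 0 < y) (hy' : 0 < y') (hc : 0 < c) :
    ∫ τ : ℝ, PN χ N (c + τ * I) * QQ y y' T (c + τ * I) =
      2 * π * ∑ n ∈ Finset.Icc 1 N, ((((max (y - n) 0 - max (y' - n) 0) / T : ℝ)) : ℂ) * χ (n : ZMod q) := by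
  have e : ∀ τ : ℝ, PN χ N (c + τ * I) * QQ y y' T (c + τ * I) = ∑ n ∈ Finset.Icc 1 N, (χ (n : ZMod q) / T) *
      ((n:ℂ)^(-(c + τ * I) : ℂ) * ((y:ℂ)^(c + τ * I + 1 : ℂ) * (1 / ((c + τ * I : ℂ) * (c + τ * I + 1)))) -
       (n:ℂ)^(-(c + τ * I) : ℂ) * ((y':ℂ)^(c + τ * I + 1 : ℂ) * (1 / ((c + τ * I : ℂ) * (c + τ * I + 1))))) := by
    intro τ
    unfold PN QQ
    rw [Finset.sum_mul]
    refine Finset.sum_congr rfl fun n _ => ?_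
    ring
  simp_rw [e]
  rw [MeasureTheory.integral_finset_sum, Finset.mul_sum]
  · refine Finset.sum_congr rfl fun n hn => ?_
    have hn1 := (Finset.mem_Icc.1 hn).1
    rw [MeasureTheory.integral_const_mul, MeasureTheory.integral_sub (perron_n_int hn1 hy hc) (perron_n_int hn1 hy' hc),
      perron_n hn1 hy hc, perron_n hn1 hy' hc]
    push_cast; ring
  · intro n hn
    have hn1 := (Finset.mem_Icc.1 hn).1
    exact ((perron_n_int hn1 hy hc).sub (perron_n_int hn1 hy' hc)).const_mul _

lemma PN_bound {q : ℕ} [NeZero q] {χ : DirichletCharacter ℂ q} (hχ : χ ≠ 1) {N : ℕ} (hN : 1 ≤ N)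
    {s : ℂ} (hs : 1/2 ≤ s.re) : ‖PN χ N s‖ ≤ 12 * √(q * ‖s‖) := by
  have hN0 : (1:ℝ) ≤ N := by exact_mod_cast hN
  have hs2 : 1/2 ≤ ‖s‖ := hs.trans ((le_abs_self _).trans (Complex.abs_re_le_norm s))
  have hrp : ∀ n : ℕ, 1 ≤ n → (n:ℝ)^(-s.re) ≤ 1 / √n := by
    intro n hn
    have hn1 : (1:ℝ) ≤ n := by exact_mod_cast hn
    rw [Real.sqrt_eq_rpow, one_div, ← Real.rpow_neg (by linarith)]
    exact Real.rpow_le_rpow_of_exponent_le hn1 (by linarith)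
  have hsum : ‖PN χ N s‖ ≤ 2 * √N := by
    refine (norm_sum_le _ _).trans (le_trans (Finset.sum_le_sum fun n hn => ?_) (sum_inv_sqrt_le N))
    have hn1 := (Finset.mem_Icc.1 hn).1
    rw [norm_mul, Complex.norm_natCast_cpow_of_pos (by omega)]
    refine le_trans (mul_le_of_le_one_left (by positivity) (χ.norm_le_one _)) ?_
    simpa using hrp n hn1
  rcases le_total (N:ℝ) (q * ‖s‖) with h | h
  · refine hsum.trans ?_
    have := Real.sqrt_le_sqrt h
    have h0 := Real.sqrt_nonneg (q * ‖s‖)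
    linarith
  · have h1 := L_tail_le hχ N hN (by linarith : 0 < s.re)
    have h2 := L_bound_sqrt hχ hs
    have h3 : ‖PN χ N s‖ ≤ ‖DirichletCharacter.LFunction χ s‖ + ‖DirichletCharacter.LFunction χ s - PN χ N s‖ := by
      rw [norm_sub_rev]
      have := norm_add_le (DirichletCharacter.LFunction χ s) (PN χ N s - DirichletCharacter.LFunction χ s)
      simpa using this
    have h4 : 2 * q * ‖s‖ * (N:ℝ)^(-s.re) / s.re ≤ 4 * √(q * ‖s‖) := by
      rw [div_le_iff₀ (by linarith)]
      have a := hrp N hN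
      set X := (q:ℝ) * ‖s‖ with hX
      have hX0 : 0 ≤ X := by positivity
      have b : X * (1 / √N) ≤ √X := by
        rw [mul_one_div, div_le_iff₀ (by positivity)]
        calc X = √X * √X := (Real.mul_self_sqrt hX0).symm
          _ ≤ √X * √N := by gcongr
      have c : X * (N:ℝ)^(-s.re) ≤ √X := le_trans (by gcongr) b
      have d := Real.sqrt_nonneg X
      calc 2 * q * ‖s‖ * (N:ℝ)^(-s.re) = 2 * (X * (N:ℝ)^(-s.re)) := by rw [hX]; ring
        _ ≤ 2 * √X := by gcongr
        _ ≤ _ := by nlinarith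
    change ‖DirichletCharacter.LFunction χ s - PN χ N s‖ ≤ _ at h1
    linarith

lemma PN_tendsto {q : ℕ} [NeZero q] {χ : DirichletCharacter ℂ q} (hχ : χ ≠ 1) {s : ℂ} (hs : 0 < s.re) :
    Filter.Tendsto (fun N : ℕ => PN χ N s) Filter.atTop (nhds (DirichletCharacter.LFunction χ s)) := by
  rw [tendsto_iff_norm_sub_tendsto_zero]
  have hlim : Filter.Tendsto (fun N : ℕ => 2 * q * ‖s‖ * (N:ℝ)^(-s.re) / s.re) Filter.atTop (nhds 0) := by
    have := (((tendsto_rpow_neg_atTop hs).comp tendsto_natCast_atTop_atTop).const_mul (2 * q * ‖s‖)).div_const s.re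
    simpa [Function.comp_def] using this
  refine tendsto_of_tendsto_of_tendsto_of_le_of_le' tendsto_const_nhds hlim (Filter.Eventually.of_forall fun _ => norm_nonneg _) ?_
  filter_upwards [Filter.eventually_ge_atTop 1] with N hN
  rw [norm_sub_rev]
  exact L_tail_le hχ N hN hs

lemma QQ_cont {y y' T c : ℝ} (hy : 0 < y) (hy' : 0 < y') (hc : 0 < c) :
    Continuous (fun τ : ℝ => QQ y y' T (c + τ * I)) := by
  unfold QQ
  refine (((cont_cpow_line hy c).sub (cont_cpow_line hy' c)).div_const _).mul
    (Continuous.div (by fun_prop) (by fun_prop) fun τ => ?_)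
  exact mul_ne_zero (ne_line hc τ).1 (ne_line hc τ).2

lemma QQ_bd {y y' T c : ℝ} (hy : 0 < y) (hy' : 0 < y') (hyy : y' ≤ y) (hT : 0 < T) (hc : 0 < c) (τ : ℝ) :
    ‖QQ y y' T (c + τ * I)‖ ≤ 2 * y ^ (c + 1) / T * (1 / (‖(c + τ * I : ℂ)‖ * ‖(c + τ * I + 1 : ℂ)‖)) := by
  unfold QQ
  rw [norm_mul, norm_div, norm_div, norm_one, norm_mul, Complex.norm_real, Real.norm_eq_abs, abs_of_pos hT]
  gcongr
  refine (norm_sub_le _ _).trans ?_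
  rw [norm_cpow_line hy, norm_cpow_line hy', two_mul]
  gcongr

theorem rep_L {q : ℕ} [NeZero q] {χ : DirichletCharacter ℂ q} (hχ : χ ≠ 1) {y y' T c : ℝ} (hy : 0 < y) (hy' : 0 < y')
    (hyy : y' ≤ y) (hT : 0 < T) (hc : 1/2 ≤ c) :
    ∫ τ : ℝ, DirichletCharacter.LFunction χ (c + τ * I) * QQ y y' T (c + τ * I) =
      2 * π * ∑ n ∈ Finset.Icc 1 ⌊y⌋₊, ((((max (y - n) 0 - max (y' - n) 0) / T : ℝ)) : ℂ) * χ (n : ZMod q) := by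
  have hc0 : 0 < c := by linarith
  set R := 2 * (π:ℂ) * ∑ n ∈ Finset.Icc 1 ⌊y⌋₊, ((((max (y - n) 0 - max (y' - n) 0) / T : ℝ)) : ℂ) * χ (n : ZMod q) with hR
  set K : ℝ := 12 * √q * (2 * y ^ (c + 1) / T) with hK
  have hK0 : 0 ≤ K := by positivity
  have hlim : Filter.Tendsto (fun N : ℕ => ∫ τ : ℝ, PN χ N (c + τ * I) * QQ y y' T (c + τ * I)) Filter.atTop
      (nhds (∫ τ : ℝ, DirichletCharacter.LFunction χ (c + τ * I) * QQ y y' T (c + τ * I))) := by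
    refine tendsto_integral_filter_of_dominated_convergence
      (fun τ : ℝ => (K * (min 1 c)^(-(5/4):ℝ) * c^(-(1/4):ℝ)) * (1 + τ^2)^(-(5/8):ℝ)) ?_ ?_ (integrable_w58.const_mul _) ?_
    · refine Filter.Eventually.of_forall fun N => Continuous.aestronglyMeasurable ?_
      refine Continuous.mul ?_ (QQ_cont hy hy' hc0)
      unfold PN
      exact continuous_finset_sum _ fun n hn => continuous_const.mul (cont_cpow_neg (Finset.mem_Icc.1 hn).1 c)
    · filter_upwards [Filter.eventually_ge_atTop 1] with N hN
      refine Filter.Eventually.of_forall fun τ => ?_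
      set s : ℂ := c + τ * I with hs
      have hsre : s.re = c := by simp [hs]
      have hsp : 0 < ‖s‖ := norm_pos_iff.2 (ne_line hc0 τ).1
      have h1 := PN_bound hχ hN (s := s) (by rw [hsre]; exact hc)
      have h2 := QQ_bd hy hy' hyy hT hc0 τ
      rw [← hs] at h2
      have h3 : ‖s‖ ≤ ‖s + 1‖ := by
        have a := norm_sq_xy (c+1) τ
        have b := norm_sq_xy c τ
        rw [show (((c+1:ℝ):ℂ) + τ * I) = s + 1 by rw [hs]; push_cast; ring] at a
        rw [← hs] at b
        refine le_of_sq_le_sq ?_ (norm_nonneg _)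
        rw [a, b]; nlinarith
      have h4 := norm_rpow_le_w58 (τ := τ) hc0 le_rfl
      rw [← hs] at h4
      have h5 : √‖s‖ * (1 / (‖s‖ * ‖s‖)) = ‖s‖ ^ (-(3/2):ℝ) := by
        rw [Real.sqrt_eq_rpow, one_div (‖s‖ * ‖s‖), mul_inv, ← Real.rpow_neg_one ‖s‖, ← Real.rpow_add hsp, ← Real.rpow_add hsp]; norm_num
      rw [norm_mul]
      calc ‖PN χ N s‖ * ‖QQ y y' T s‖ ≤ (12 * √(q * ‖s‖)) * (2 * y ^ (c + 1) / T * (1 / (‖s‖ * ‖s‖))) := by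
            refine mul_le_mul h1 (h2.trans ?_) (norm_nonneg _) (by positivity)
            gcongr
        _ = K * ‖s‖ ^ (-(3/2):ℝ) := by
            rw [← h5, Real.sqrt_mul (Nat.cast_nonneg q), hK]; ring
        _ ≤ K * ((min 1 c)^(-(5/4):ℝ) * (1 + τ^2)^(-(5/8):ℝ) * c^(-(1/4):ℝ)) := by gcongr
        _ = _ := by ring
    · refine Filter.Eventually.of_forall fun τ => (PN_tendsto hχ (by simpa using hc0)).mul_const _
  have hev : (fun N : ℕ => ∫ τ : ℝ, PN χ N (c + τ * I) * QQ y y' T (c + τ * I)) =ᶠ[Filter.atTop] fun _ => R := by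
    filter_upwards [Filter.eventually_ge_atTop ⌊y⌋₊] with N hN
    rw [PN_int χ N hy hy' hc0, hR]
    congr 1
    symm
    refine Finset.sum_subset (Finset.Icc_subset_Icc le_rfl hN) ?_
    intro n hn hn2
    have : ⌊y⌋₊ < n := by
      by_contra h
      exact hn2 (Finset.mem_Icc.2 ⟨(Finset.mem_Icc.1 hn).1, by omega⟩)
    have hyn : y < n := (Nat.floor_lt hy.le).1 this
    rw [max_eq_right (by linarith), max_eq_right (by linarith)]; simp
  exact tendsto_nhds_unique hlim (Filter.Tendsto.congr' hev.symm tendsto_const_nhds)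

end

section
open Complex Real Finset MeasureTheory

lemma cpow_line_diff {y y' c : ℝ} (hy' : 0 < y') (hyy : y' ≤ y) (hc : 0 < c) (τ : ℝ) :
    ‖(y:ℂ)^(c + τ * I + 1 : ℂ) - (y':ℂ)^(c + τ * I + 1 : ℂ)‖ ≤ ‖(c + τ * I + 1 : ℂ)‖ * y ^ c * (y - y') := by
  have h := Convex.norm_image_sub_le_of_norm_hasDerivWithin_le (𝕜 := ℝ) (s := Set.Icc y' y) (x := y') (y := y)
    (f := fun x : ℝ => (x:ℂ)^(c + τ * I + 1 : ℂ)) (f' := fun x : ℝ => (c + τ * I + 1 : ℂ) * (x:ℂ)^(c + τ * I : ℂ))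
    (C := ‖(c + τ * I + 1 : ℂ)‖ * y ^ c) ?_ ?_ (convex_Icc _ _) ⟨le_rfl, hyy⟩ ⟨hyy, le_rfl⟩
  · rwa [Real.norm_eq_abs, abs_of_nonneg (by linarith)] at h
  · intro x hx
    have hx0 : 0 < x := hy'.trans_le hx.1
    have := hasDerivAt_ofReal_cpow_const (x := x) hx0.ne' (r := c + τ * I + 1) (ne_line hc τ).2
    rw [add_sub_cancel_right] at this
    exact this.hasDerivWithinAt
  · intro x hx
    have hx0 : 0 < x := hy'.trans_le hx.1
    rw [norm_mul, Complex.norm_cpow_eq_rpow_re_of_pos hx0]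
    simp only [Complex.add_re, Complex.ofReal_re, Complex.mul_re, Complex.I_re, Complex.I_im, Complex.ofReal_im, mul_zero, mul_one, sub_self, add_zero]
    gcongr
    exact hx.2

lemma QQ_ww {C l y T : ℝ} (hC : 0 < C) (hl : 2 ≤ l) (hly : l = Real.log y) (hy : 0 < y) (hT : T = y / l ^ C) (τ : ℝ) :
    ‖QQ y (y - T) T ((1/2 + 1/l : ℝ) + τ * I)‖ ≤ 12 * Real.exp 1 * √y * ww C l τ := by
  have hl0 : 0 < l := by linarith
  have hlC : 1 < l ^ C := Real.one_lt_rpow (by linarith) hC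
  have hT0 : 0 < T := by rw [hT]; positivity
  have hTy : T < y := by rw [hT]; exact div_lt_self hy hlC
  set c : ℝ := 1/2 + 1/l with hc
  have hc12 : 1/2 ≤ c := by rw [hc]; have : 0 < 1/l := by positivity
                            linarith
  have hc0 : 0 < c := by linarith
  have hyc : y ^ c = Real.exp 1 * √y := by
    rw [hc, Real.rpow_add hy, ← Real.sqrt_eq_rpow, Real.rpow_def_of_pos hy (1/l), ← hly, mul_one_div_cancel hl0.ne']; ring
  have n1 : 1 + |τ| ≤ 3 * ‖(c + τ * I : ℂ)‖ := by
    have a := Complex.abs_re_le_norm (c + τ * I)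
    have b := Complex.abs_im_le_norm (c + τ * I)
    simp at a b
    have := le_abs_self c
    linarith
  have n2 : 1 + |τ| ≤ 2 * ‖(c + τ * I + 1 : ℂ)‖ := by
    have a := Complex.abs_re_le_norm (c + τ * I + 1)
    have b := Complex.abs_im_le_norm (c + τ * I + 1)
    simp at a b
    have := le_abs_self (c+1)
    linarith
  have p1 : 0 < ‖(c + τ * I : ℂ)‖ := norm_pos_iff.2 (ne_line hc0 τ).1
  have p2 : 0 < ‖(c + τ * I + 1 : ℂ)‖ := norm_pos_iff.2 (ne_line hc0 τ).2
  have p3 : 0 < 1 + |τ| := by positivity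
  have e0 : 0 < Real.exp 1 * √y := by positivity
  unfold ww
  rw [mul_min_of_nonneg _ _ (by positivity)]
  refine le_min ?_ ?_
  · unfold QQ
    rw [norm_mul, norm_div, norm_div, norm_one, norm_mul, Complex.norm_real, Real.norm_eq_abs, abs_of_pos hT0]
    have := cpow_line_diff (y := y) (y' := y - T) (by linarith) (by linarith) hc0 τ
    rw [show y - (y - T) = T by ring] at this
    calc _ ≤ ‖(c + τ * I + 1 : ℂ)‖ * y ^ c * T / T * (1 / (‖(c + τ * I : ℂ)‖ * ‖(c + τ * I + 1 : ℂ)‖)) := by gcongr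
      _ = y ^ c * (1 / ‖(c + τ * I : ℂ)‖) := by field_simp
      _ ≤ y ^ c * (3 * (1 / (1 + |τ|))) := by
        gcongr
        rw [mul_one_div, div_le_div_iff₀ p1 p3]; linarith
      _ ≤ _ := by
        rw [hyc]
        have : 0 < Real.exp 1 * √y * (1 / (1 + |τ|)) := by positivity
        nlinarith
  · refine (QQ_bd hy (by linarith) (by linarith) hT0 hc0 τ).trans ?_
    have e1 : 2 * y ^ (c+1) / T = 2 * (Real.exp 1 * √y) * l ^ C := by
      rw [Real.rpow_add hy, Real.rpow_one, hyc, hT]; field_simp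
    rw [e1]
    have : 1 / (‖(c + τ * I : ℂ)‖ * ‖(c + τ * I + 1 : ℂ)‖) ≤ 6 * (1 / (1 + |τ|)^2) := by
      rw [mul_one_div, div_le_div_iff₀ (by positivity) (by positivity)]
      nlinarith
    calc _ ≤ 2 * (Real.exp 1 * √y) * l ^ C * (6 * (1 / (1 + |τ|)^2)) := by gcongr
      _ = _ := by ring

/-- tail bound -/
lemma tail_pt {C l : ℝ} (hl : 2 ≤ l) {q : ℕ} [NeZero q] {χ : DirichletCharacter ℂ q} (hχ : χ ≠ 1) {τ : ℝ}
    (hτ : (q:ℝ)^2 ≤ |τ|) :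
    ww C l τ * ‖DirichletCharacter.LFunction χ ((1/2 + 1/l : ℝ) + τ * I)‖ ≤
      8 * (l ^ C * (q:ℝ) ^ (-(1/4):ℝ)) * (1 + ‖τ‖) ^ (-(9/8):ℝ) := by
  have hq : (1:ℝ) ≤ q := by exact_mod_cast NeZero.pos q
  have hq0 : (0:ℝ) < q := by linarith
  have hl0 : 0 < l := by linarith
  set c : ℝ := 1/2 + 1/l with hc
  have hl2 : 1/l ≤ 1/2 := by gcongr
  have hl3 : 0 < 1/l := by positivity
  have h1 := L_bound_sqrt hχ (s := c + τ * I) (by simp; rw [hc]; linarith)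
  have h2 : ‖(c + τ * I : ℂ)‖ ≤ 1 + |τ| := by
    refine (norm_add_le _ _).trans ?_
    rw [norm_mul, Complex.norm_I, mul_one, Complex.norm_real, Complex.norm_real, Real.norm_eq_abs, Real.norm_eq_abs]
    gcongr
    rw [abs_of_nonneg (by linarith)]; linarith
  rw [Real.norm_eq_abs]
  set M := 1 + |τ| with hM
  have hM0 : 0 < M := by positivity
  have hqM : (q:ℝ)^2 ≤ M := by linarith
  have h3 : ww C l τ ≤ l ^ C / M^2 := min_le_right _ _
  have h4 : M ^ (-(3/8):ℝ) ≤ (q:ℝ) ^ (-(3/4):ℝ) := by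
    calc M ^ (-(3/8):ℝ) ≤ ((q:ℝ)^2) ^ (-(3/8):ℝ) := Real.rpow_le_rpow_of_nonpos (by positivity) hqM (by norm_num)
      _ = _ := by rw [← Real.rpow_natCast, ← Real.rpow_mul hq0.le]; norm_num
  calc ww C l τ * ‖DirichletCharacter.LFunction χ (c + τ * I)‖ ≤ (l ^ C / M^2) * (8 * √(q * M)) := by
        refine mul_le_mul h3 (h1.trans ?_) (norm_nonneg _) (by positivity)
        gcongr
    _ = 8 * l ^ C * (q:ℝ)^(1/2:ℝ) * (M ^ (-(3/8):ℝ) * M ^ (-(9/8):ℝ)) := by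
        rw [Real.sqrt_mul hq0.le, Real.sqrt_eq_rpow, Real.sqrt_eq_rpow, ← Real.rpow_add hM0,
          show l ^ C / M^2 = l ^ C * M ^ (-2:ℝ) by rw [Real.rpow_neg hM0.le]; norm_num; rfl,
          show (-(3/8) + -(9/8) : ℝ) = -2 + 1/2 by norm_num, Real.rpow_add hM0]
        ring
    _ ≤ 8 * l ^ C * (q:ℝ)^(1/2:ℝ) * ((q:ℝ) ^ (-(3/4):ℝ) * M ^ (-(9/8):ℝ)) := by gcongr
    _ = _ := by
        rw [show (-(1/4):ℝ) = 1/2 + -(3/4) by norm_num, Real.rpow_add hq0]; ring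

lemma W98 : ∃ W : ℝ, 0 ≤ W ∧ ∫⁻ t : ℝ, ENNReal.ofReal ((1 + ‖t‖) ^ (-(9/8):ℝ)) = ENNReal.ofReal W := by
  have h := integrable_one_add_norm (E := ℝ) (μ := volume) (r := 9/8) (by simp; norm_num)
  refine ⟨∫ t : ℝ, (1 + ‖t‖) ^ (-(9/8):ℝ), integral_nonneg fun t => by positivity, ?_⟩
  rw [ofReal_integral_eq_lintegral_ofReal h (Filter.Eventually.of_forall fun t => by positivity)]

lemma logpow_le {C l : ℝ} (hC : 0 < C) {q : ℕ} (hq : 1 ≤ q) (hl : 0 ≤ l) (hlq : l ≤ Real.log q) :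
    l ^ C * (q:ℝ) ^ (-(1/4):ℝ) ≤ (4 * C) ^ C := by
  have hq0 : (0:ℝ) < q := by exact_mod_cast hq
  have h := Real.log_le_rpow_div hq0.le (ε := 1/(4*C)) (by positivity)
  have h1 : l ^ C ≤ (4 * C) ^ C * (q:ℝ)^(1/4:ℝ) := by
    calc l ^ C ≤ ((q:ℝ) ^ (1/(4*C)) / (1/(4*C))) ^ C := by gcongr; exact hlq.trans h
      _ = ((4 * C) * (q:ℝ) ^ (1/(4*C))) ^ C := by congr 1; field_simp
      _ = (4 * C) ^ C * (q:ℝ)^(1/4:ℝ) := by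
        rw [Real.mul_rpow (by positivity) (by positivity), ← Real.rpow_mul hq0.le]
        congr 2; field_simp
  calc _ ≤ (4 * C) ^ C * (q:ℝ)^(1/4:ℝ) * (q:ℝ) ^ (-(1/4):ℝ) := by gcongr
    _ = _ := by rw [mul_assoc, ← Real.rpow_add hq0]; norm_num

theorem S_bound (C : ℝ) (hC : 0 < C) : ∃ B : ℝ, 0 ≤ B ∧ ∀ (q : ℕ) [NeZero q] (χ : DirichletCharacter ℂ q), χ ≠ 1 →
    ∀ y : ℝ, 2 ≤ y → y ≤ q → 2 ≤ Real.log y → ∀ T : ℝ, T = y / Real.log y ^ C →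
    ENNReal.ofReal ‖∑ n ∈ Finset.Icc 1 ⌊y⌋₊, ((((max (y - n) 0 - max (y - T - n) 0) / T : ℝ)) : ℂ) * χ (n : ZMod q)‖ ≤
      ENNReal.ofReal (12 * Real.exp 1 * √y) * ((∫⁻ t, AL (Real.log y) χ t ∂(muw C (Real.log y))) + ENNReal.ofReal B) := by
  obtain ⟨W, hW0, hW⟩ := W98
  refine ⟨8 * (4 * C) ^ C * W, by positivity, ?_⟩
  intro q _ χ hχ y hy2 hyq hl T hT
  set l := Real.log y with hly
  have hy : 0 < y := by linarith
  have hl0 : 0 < l := by linarith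
  have hlC : 1 < l ^ C := Real.one_lt_rpow (by linarith) hC
  have hT0 : 0 < T := by rw [hT]; positivity
  have hTy : T < y := by rw [hT]; exact div_lt_self hy hlC
  have hl3 : 0 < 1/l := by positivity
  have hrep := rep_L hχ (y := y) (y' := y - T) (T := T) (c := 1/2 + 1/l) hy (by linarith) (by linarith) hT0 (by linarith)
  set S := ∑ n ∈ Finset.Icc 1 ⌊y⌋₊, ((((max (y - n) 0 - max (y - T - n) 0) / T : ℝ)) : ℂ) * χ (n : ZMod q) with hS
  have hq1 : 1 ≤ q := NeZero.pos q
  have hL := AL_meas l hχ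
  have h1 : ‖S‖ ≤ ‖∫ τ : ℝ, DirichletCharacter.LFunction χ ((1/2 + 1/l : ℝ) + τ * I) * QQ y (y - T) T ((1/2 + 1/l : ℝ) + τ * I)‖ := by
    rw [hrep, norm_mul]
    refine le_mul_of_one_le_left (norm_nonneg _) ?_
    have : (2 * (π:ℂ)) = ((2 * π : ℝ) : ℂ) := by push_cast; rfl
    rw [this, Complex.norm_real, Real.norm_eq_abs, abs_of_pos (by positivity)]
    linarith [Real.pi_gt_three]
  set A := 12 * Real.exp 1 * √y with hA
  have hA0 : 0 ≤ A := by positivity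
  calc ENNReal.ofReal ‖S‖ ≤ ENNReal.ofReal ‖∫ τ : ℝ, DirichletCharacter.LFunction χ ((1/2 + 1/l : ℝ) + τ * I) * QQ y (y - T) T ((1/2 + 1/l : ℝ) + τ * I)‖ :=
        ENNReal.ofReal_le_ofReal h1
    _ ≤ ∫⁻ τ : ℝ, ENNReal.ofReal ‖DirichletCharacter.LFunction χ ((1/2 + 1/l : ℝ) + τ * I) * QQ y (y - T) T ((1/2 + 1/l : ℝ) + τ * I)‖ := by
        simp_rw [ofReal_norm]
        exact enorm_integral_le_lintegral_enorm _
    _ ≤ ∫⁻ τ : ℝ, ENNReal.ofReal A * (ENNReal.ofReal (ww C l τ) * AL l χ τ +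
          ENNReal.ofReal (8 * (4 * C) ^ C) * ENNReal.ofReal ((1 + ‖τ‖) ^ (-(9/8):ℝ))) := by
        refine lintegral_mono fun τ => ?_
        have hw := ww_nonneg (C := C) (l := l) (by linarith) τ
        have hQ := QQ_ww hC hl hly hy hT τ
        have h2 : ‖DirichletCharacter.LFunction χ ((1/2 + 1/l : ℝ) + τ * I) * QQ y (y - T) T ((1/2 + 1/l : ℝ) + τ * I)‖ ≤
            A * (ww C l τ * ‖DirichletCharacter.LFunction χ ((1/2 + 1/l : ℝ) + τ * I)‖) := by
          rw [norm_mul]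
          calc _ ≤ ‖DirichletCharacter.LFunction χ ((1/2 + 1/l : ℝ) + τ * I)‖ * (12 * Real.exp 1 * √y * ww C l τ) := by gcongr
            _ = _ := by rw [hA]; ring
        refine (ENNReal.ofReal_le_ofReal h2).trans ?_
        rw [ENNReal.ofReal_mul hA0]
        gcongr
        by_cases hm : τ ∈ Set.Icc (-(q:ℝ)^2) ((q:ℝ)^2)
        · refine le_trans ?_ le_self_add
          unfold AL
          rw [Set.indicator_of_mem hm, ENNReal.ofReal_mul hw]
          refine le_of_eq ?_
          congr 4
          push_cast; ring
        · refine le_trans ?_ le_add_self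
          rw [← ENNReal.ofReal_mul (by positivity)]
          refine ENNReal.ofReal_le_ofReal ((tail_pt hl hχ ?_).trans ?_)
          · by_contra h
            push Not at h
            have := abs_lt.1 h
            exact hm ⟨this.1.le, this.2.le⟩
          · have := logpow_le hC hq1 hl0.le (Real.log_le_log hy hyq)
            gcongr
    _ = _ := by
        rw [lintegral_const_mul' _ _ ENNReal.ofReal_ne_top, lint_muw C l hL, lintegral_add_left, lintegral_const_mul' _ _ ENNReal.ofReal_ne_top, hW,
          ← ENNReal.ofReal_mul (by positivity)]
        exact ((ww_cont C l).measurable.ennreal_ofReal).mul hL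

end

section
open Complex Real Finset MeasureTheory

lemma prim_ne_one {q : ℕ} [NeZero q] (hq : 2 ≤ q) {χ : DirichletCharacter ℂ q} (h : χ.IsPrimitive) : χ ≠ 1 := by
  rintro rfl
  rw [DirichletCharacter.isPrimitive_def, DirichletCharacter.conductor_one] at h
  omega

lemma card_le_tot {q : ℕ} [NeZero q] (X : Finset (DirichletCharacter ℂ q)) : X.card ≤ q.totient := by
  classical
  have h := DirichletCharacter.card_eq_totient_of_hasEnoughRootsOfUnity ℂ q
  rw [← h, Nat.card_eq_fintype_card]
  exact Finset.card_le_univ X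

/-- the weight as a difference of truncated linear functions -/
lemma f_eq {y T x : ℝ} (hT : 0 < T) :
    (if x ≤ y - T then 1 else if x ≤ y then 1 - (x - y + T) / T else 0) = (max (y - x) 0 - max (y - T - x) 0) / T := by
  split_ifs with h1 h2
  · rw [max_eq_left (by linarith), max_eq_left (by linarith)]; field_simp; ring
  · rw [max_eq_left (by linarith), max_eq_right (by linarith)]; field_simp; ring
  · rw [max_eq_right (by linarith), max_eq_right (by linarith)]; simp

lemma f_abs {y T x : ℝ} (hT : 0 < T) : |(max (y - x) 0 - max (y - T - x) 0) / T| ≤ 1 := by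
  rw [abs_div, abs_of_pos hT, div_le_one hT]
  refine (abs_max_sub_max_le_abs _ _ _).trans ?_
  rw [show y - x - (y - T - x) = T by ring, abs_of_pos hT]

lemma S_trivial {q : ℕ} (χ : DirichletCharacter ℂ q) {y T : ℝ} (hy : 0 ≤ y) (hT : 0 < T) :
    ‖∑ n ∈ Finset.Icc 1 ⌊y⌋₊, ((((max (y - n) 0 - max (y - T - n) 0) / T : ℝ)) : ℂ) * χ (n : ZMod q)‖ ≤ y := by
  calc _ ≤ ∑ n ∈ Finset.Icc 1 ⌊y⌋₊, (1:ℝ) := by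
        refine (norm_sum_le _ _).trans (Finset.sum_le_sum fun n _ => ?_)
        rw [norm_mul, Complex.norm_real, Real.norm_eq_abs]
        exact mul_le_one₀ (f_abs hT) (norm_nonneg _) (χ.norm_le_one _)
    _ ≤ y := by
        simp
        exact Nat.floor_le hy

theorem main_core (k : ℝ) (hk : 2 < k) (C : ℝ) (hC : 0 < C) :
    ∃ C' : ℝ, 0 < C' ∧ ∃ q0 : ℕ, ∀ (q : ℕ) [NeZero q], q0 ≤ q →
      (∀ χ : DirichletCharacter ℂ q, dirichletRH χ) →
      ∀ y : ℝ, 2 ≤ y → y ≤ (q : ℝ) →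
      ∀ T : ℝ, T = y / Real.log y ^ C → ∀ X : Finset (DirichletCharacter ℂ q), (∀ χ ∈ X, χ ≠ 1) →
      ∑ χ ∈ X, ‖∑ n ∈ Finset.Icc 1 ⌊y⌋₊, ((((max (y - n) 0 - max (y - T - n) 0) / T : ℝ)) : ℂ) * χ (n : ZMod q)‖ ^ (2 * k)
      ≤ C' * y ^ k * (Nat.totient q) * Real.log y ^ ((k - 1) ^ 2) := by
  obtain ⟨K, hK, q0, hq0, hmom⟩ := momentL k hk C hC
  obtain ⟨B, hB, hS⟩ := S_bound C hC
  set E : ℝ := (k-1)^2 with hE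
  have hE0 : 0 ≤ E := sq_nonneg _
  have hlog2 : 0 < Real.log 2 := Real.log_pos (by norm_num)
  set C1 : ℝ := (12 * Real.exp 1) ^ (2*k) * (2 ^ (2*k-1) * (K + B ^ (2*k))) with hC1
  set C2 : ℝ := (Real.exp 2) ^ (2*k) / (Real.log 2) ^ E with hC2
  have hC1p : 0 < C1 := by positivity
  have hC2p : 0 < C2 := by positivity
  refine ⟨C1 + C2, by positivity, q0, ?_⟩
  intro q _ hq hRH y hy2 hyq T hT X hX
  have hy : 0 < y := by linarith
  set l := Real.log y with hl
  have hl2 : Real.log 2 ≤ l := Real.log_le_log (by norm_num) hy2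
  have hl0 : 0 < l := by linarith
  have hT0 : 0 < T := by rw [hT]; positivity
  have hcard : (X.card : ℝ) ≤ q.totient := by exact_mod_cast card_le_tot X
  set S : DirichletCharacter ℂ q → ℂ := fun χ => ∑ n ∈ Finset.Icc 1 ⌊y⌋₊, ((((max (y - n) 0 - max (y - T - n) 0) / T : ℝ)) : ℂ) * χ (n : ZMod q) with hSd
  change ∑ χ ∈ X, ‖S χ‖ ^ (2*k) ≤ _
  have hyk : 1 ≤ y ^ k := Real.one_le_rpow (by linarith) (by linarith)
  have hlE : 0 < l ^ E := by positivity
  rcases lt_or_ge l 2 with hsm | hbig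
  · have hye : y ≤ Real.exp 2 := by rw [← Real.exp_log hy]; exact Real.exp_le_exp.2 hsm.le
    have h1 : ∀ χ ∈ X, ‖S χ‖ ^ (2*k) ≤ (Real.exp 2) ^ (2*k) := fun χ _ =>
      Real.rpow_le_rpow (norm_nonneg _) ((S_trivial χ hy.le hT0).trans hye) (by linarith)
    have h2 : ∑ χ ∈ X, ‖S χ‖ ^ (2*k) ≤ X.card * (Real.exp 2) ^ (2*k) := by
      have := Finset.sum_le_card_nsmul X _ _ h1
      simpa using this
    have h3 : (Real.log 2) ^ E ≤ l ^ E := Real.rpow_le_rpow hlog2.le hl2 hE0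
    have h4 : (Real.exp 2) ^ (2*k) ≤ C2 * l ^ E := by
      rw [hC2, div_mul_eq_mul_div, le_div_iff₀ (by positivity)]; gcongr
    calc _ ≤ (X.card:ℝ) * (Real.exp 2) ^ (2*k) := h2
      _ ≤ q.totient * (C2 * l ^ E) := by gcongr
      _ = C2 * 1 * q.totient * l ^ E := by ring
      _ ≤ (C1 + C2) * y ^ k * q.totient * l ^ E := by
        gcongr
        linarith
  · have hm := hmom q hq hRH l hbig X hX
    have hl1 : 1 ≤ l ^ E := Real.one_le_rpow (by linarith) hE0
    have hpt : ∀ χ ∈ X, ENNReal.ofReal (‖S χ‖ ^ (2*k)) ≤ ENNReal.ofReal ((12 * Real.exp 1 * √y) ^ (2*k)) *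
        (ENNReal.ofReal (2 ^ (2*k-1)) * ((∫⁻ t, AL l χ t ∂(muw C l)) ^ (2*k) + ENNReal.ofReal (B ^ (2*k)))) := by
      intro χ hχ
      have h := hS q χ (hX χ hχ) y hy2 hyq hbig T hT
      rw [← ENNReal.ofReal_rpow_of_nonneg (norm_nonneg _) (by linarith),
        ← ENNReal.ofReal_rpow_of_nonneg (p := 2*k) (by positivity : 0 ≤ 12 * Real.exp 1 * √y) (by linarith),
        ← ENNReal.ofReal_rpow_of_nonneg hB (by linarith),
        ← ENNReal.ofReal_rpow_of_pos (by norm_num : (0:ℝ) < 2)]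
      refine (ENNReal.rpow_le_rpow h (by linarith)).trans ?_
      rw [ENNReal.mul_rpow_of_nonneg _ _ (by linarith)]
      refine mul_le_mul_right ?_ _
      have := ENNReal.rpow_add_le_mul_rpow_add_rpow (∫⁻ t, AL l χ t ∂(muw C l)) (ENNReal.ofReal B) (by linarith : 1 ≤ 2*k)
      simpa using this
    have hAk : (12 * Real.exp 1 * √y) ^ (2*k) = (12 * Real.exp 1) ^ (2*k) * y ^ k := by
      rw [Real.mul_rpow (by positivity) (by positivity), Real.sqrt_eq_rpow, ← Real.rpow_mul hy.le]
      congr 2; ring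
    have hsum : ENNReal.ofReal (∑ χ ∈ X, ‖S χ‖ ^ (2*k)) ≤ ENNReal.ofReal ((12 * Real.exp 1 * √y) ^ (2*k) *
        (2 ^ (2*k-1) * (K * q.totient * l ^ E + q.totient * B ^ (2*k)))) := by
      rw [ENNReal.ofReal_sum_of_nonneg (fun _ _ => by positivity)]
      refine (Finset.sum_le_sum hpt).trans ?_
      rw [← Finset.mul_sum, ← Finset.mul_sum, Finset.sum_add_distrib, ENNReal.ofReal_mul (by positivity),
        ENNReal.ofReal_mul (by positivity), ENNReal.ofReal_add (by positivity) (by positivity)]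
      refine mul_le_mul_right (mul_le_mul_right (add_le_add hm ?_) _) _
      rw [Finset.sum_const, nsmul_eq_mul, ENNReal.ofReal_mul (by positivity)]
      refine mul_le_mul_left ?_ _
      rw [ENNReal.ofReal_natCast]
      exact_mod_cast card_le_tot X
    have hfin := (ENNReal.ofReal_le_ofReal_iff (by positivity)).1 hsum
    refine hfin.trans ?_
    rw [hAk]
    have hB2 : 0 ≤ B ^ (2*k) := by positivity
    calc _ ≤ (12 * Real.exp 1) ^ (2*k) * y ^ k * (2 ^ (2*k-1) * (K * q.totient * l ^ E + q.totient * (B ^ (2*k) * l ^ E))) := by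
          gcongr
          exact le_mul_of_one_le_right hB2 hl1
      _ = C1 * y ^ k * q.totient * l ^ E := by rw [hC1]; ring
      _ ≤ _ := by gcongr; linarith

end

open Classical in
theorem stmt15 (k : ℝ) (hk : 2 < k) (C : ℝ) (hC : 0 < C) :
    ∃ C' : ℝ, 0 < C' ∧ ∃ q0 : ℕ, ∀ (q : ℕ) [NeZero q], q0 ≤ q →
      (∀ χ : DirichletCharacter ℂ q, dirichletRH χ) →
      ∀ y : ℝ, 2 ≤ y → y ≤ (q : ℝ) →
      ∀ T : ℝ, T = y / Real.log y ^ C →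
      ∀ f : ℝ → ℝ,
        (∀ x : ℝ, 0 < x →
          f x = if x ≤ y - T then 1 else if x ≤ y then 1 - (x - y + T) / T else 0) →
      ∑ χ ∈ Finset.univ.filter (fun χ : DirichletCharacter ℂ q => χ.IsPrimitive),
        ‖∑ n ∈ Finset.Icc 1 ⌊y⌋₊, (f n : ℂ) * χ n‖ ^ (2 * k)
      ≤ C' * y ^ k * (Nat.totient q) * Real.log y ^ ((k - 1) ^ 2) := by
  obtain ⟨C', hC', q0, h⟩ := main_core k hk C hC
  refine ⟨C', hC', max q0 2, ?_⟩
  intro q _ hq hRH y hy2 hyq T hT f hf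
  have hl0 : 0 < Real.log y := Real.log_pos (by linarith)
  have hT0 : 0 < T := by
    rw [hT]; have : 0 < y := by linarith
    positivity
  have hq2 : 2 ≤ q := (le_max_right _ _).trans hq
  refine le_trans (le_of_eq ?_) (h q ((le_max_left _ _).trans hq) hRH y hy2 hyq T hT
    (Finset.univ.filter (fun χ : DirichletCharacter ℂ q => χ.IsPrimitive))
    (fun χ hχ => prim_ne_one hq2 (Finset.mem_filter.1 hχ).2))
  refine Finset.sum_congr rfl fun χ _ => ?_
  congr 2
  refine Finset.sum_congr rfl fun n hn => ?_
  have hn0 : (0:ℝ) < n := by exact_mod_cast (Finset.mem_Icc.1 hn).1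
  rw [hf n hn0, f_eq hT0]
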